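/- There exists a constant C > 0 such that for every real X ≥ 100 the following holds. For each prime p let a_p := p − #{(x,y) ∈ (ℤ/pℤ)² : y² = x³ − x}. Then | ( #{primes p ≤ X : p ≡ 1 (mod 12) and there exists b ∈ ℤ/pℤ with b³ = a_p in ℤ/pℤ} ) / ( #{primes p ≤ X : p ≡ 1 (mod 12)} ) − 1/3 | ≤ C·X^{−1/3200}. -/

import Mathlib

/-- The trace of Frobenius of the elliptic curve `y² = x³ - x` over `ℤ/pℤ`:
`a_p = p - #{(x,y) : y² = x³ - x}`. -/
noncomputable def apE (p : ℕ) : ℤ :=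
  (p : ℤ) - Nat.card {xy : ZMod p × ZMod p // xy.2 ^ 2 = xy.1 ^ 3 - xy.1}

namespace CubicTrace

open QuadraticAlgebra

/-- The Eisenstein integers `ℤ[ω]`. -/
abbrev E := QuadraticAlgebra ℤ (-1) (-1)

/-- The ring `ℤ[ω][i]` of integers of the twelfth cyclotomic field. -/
abbrev O := QuadraticAlgebra E (-1) 0

/-- A primitive cube root of unity. -/
abbrev om : E := ⟨0, 1⟩

theorem om_cube : om ^ 3 = 1 := by decide

theorem one_add_om_add_sq : 1 + om + om ^ 2 = 0 := by decide

/-- The norm of an Eisenstein integer. -/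
def nE : E →* ℤ := QuadraticAlgebra.norm

theorem nE_def (z : E) : nE z = z.re ^ 2 - z.re * z.im + z.im ^ 2 := by
  simp only [nE, norm_def]; ring

theorem nE_nonneg (z : E) : 0 ≤ nE z := by
  rw [nE_def]; nlinarith [sq_nonneg (2 * z.re - z.im), sq_nonneg z.im]

theorem nE_eq_zero {z : E} : nE z = 0 ↔ z = 0 := by
  refine ⟨fun h => ?_, fun h => by simp [h, nE_def]⟩
  rw [nE_def] at h
  have h1 : z.im ^ 2 = 0 := by nlinarith [sq_nonneg (2 * z.re - z.im), sq_nonneg z.im]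
  have h1 : z.im = 0 := by simpa using h1
  rw [h1] at h
  have h2 : z.re = 0 := by simpa using h
  ext <;> simp [h1, h2]

theorem nE_pos {z : E} (hz : z ≠ 0) : 0 < nE z :=
  lt_of_le_of_ne (nE_nonneg z) fun h => hz (nE_eq_zero.1 h.symm)

theorem nE_intCast (n : ℤ) : nE (n : E) = n ^ 2 := by simp [nE_def]

theorem mul_star_E (z : E) : z * star z = (nE z : E) := by
  rw [← algebraMap_norm_eq_mul_star]; rfl

theorem nE_star (z : E) : nE (star z) = nE z := QuadraticAlgebra.norm_star z

/-- The relative norm from `O` to `E`. -/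
def nO : O →* E := QuadraticAlgebra.norm

theorem nO_def (α : O) : nO α = α.re ^ 2 + α.im ^ 2 := by
  simp only [nO, norm_def]; ring

/-- The absolute norm of `O`. -/
def N : O →* ℤ := nE.comp nO

theorem N_def (α : O) : N α = nE (nO α) := rfl

/-- The average of the squared complex absolute values of `α`. -/
def hs (α : O) : ℤ := nE α.re + nE α.im

/-- The coefficient of `√3` in the squared complex absolute value. -/
def ht (α : O) : ℤ := α.re.im * α.im.re - α.re.re * α.im.im

theorem N_eq (α : O) : N α = hs α ^ 2 - 3 * ht α ^ 2 := by
  simp only [N_def, nO_def, nE_def, hs, ht, pow_two, re_add, im_add, re_mul, im_mul]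
  ring

theorem hs_nonneg (α : O) : 0 ≤ hs α := add_nonneg (nE_nonneg _) (nE_nonneg _)

theorem N_nonneg (α : O) : 0 ≤ N α := nE_nonneg _

theorem sq_eq_three_mul_sq {a b : ℤ} (h : a ^ 2 = 3 * b ^ 2) : a = 0 := by
  by_contra ha
  have hb : b ≠ 0 := by rintro rfl; simp at h; exact ha h
  obtain ⟨c, rfl⟩ : b ∣ a := (Int.pow_dvd_pow_iff two_ne_zero).1 ⟨3, by rw [h]; ring⟩
  have hc : c ^ 2 = 3 := by
    apply mul_left_cancel₀ (pow_ne_zero 2 hb); linarith [mul_pow b c 2]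
  have h1 : c < 2 := by nlinarith
  have h2 : -2 < c := by nlinarith
  interval_cases c <;> omega

theorem hs_eq_zero {α : O} : hs α = 0 ↔ α = 0 := by
  refine ⟨fun h => ?_, fun h => by subst h; simp [hs, nE_def]⟩
  have h1 := nE_nonneg α.re
  have h2 := nE_nonneg α.im
  unfold hs at h
  ext1
  · exact nE_eq_zero.1 (by omega)
  · exact nE_eq_zero.1 (by omega)

theorem N_eq_zero {α : O} : N α = 0 ↔ α = 0 := by
  refine ⟨fun h => ?_, fun h => by subst h; simp [N_def, nO_def, nE_def]⟩
  rw [N_eq] at h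
  exact hs_eq_zero.1 (sq_eq_three_mul_sq (b := ht α) (by linarith))

theorem N_pos {α : O} (hα : α ≠ 0) : 0 < N α :=
  lt_of_le_of_ne (N_nonneg α) fun h => hα (N_eq_zero.1 h.symm)

theorem N_intCast (n : ℤ) : N (n : O) = n ^ 4 := by
  simp [N_def, nO_def, nE_def, pow_two]; ring

instance : IsDomain E where
  mul_left_cancel_of_ne_zero {a} ha b c h := by
    have h1 : nE (a * (b - c)) = 0 := by rw [mul_sub, sub_eq_zero.2 h]; exact nE_eq_zero.2 rfl
    rw [map_mul, mul_eq_zero] at h1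
    exact sub_eq_zero.1 (nE_eq_zero.1 (h1.resolve_left fun h => ha (nE_eq_zero.1 h)))
  mul_right_cancel_of_ne_zero {a} ha b c h := by
    have h1 : nE ((b - c) * a) = 0 := by rw [sub_mul, sub_eq_zero.2 h]; exact nE_eq_zero.2 rfl
    rw [map_mul, mul_eq_zero] at h1
    exact sub_eq_zero.1 (nE_eq_zero.1 (h1.resolve_right fun h => ha (nE_eq_zero.1 h)))

instance : IsDomain O where
  mul_left_cancel_of_ne_zero {a} ha b c h := by
    have h1 : N (a * (b - c)) = 0 := by rw [mul_sub, sub_eq_zero.2 h]; exact N_eq_zero.2 rfl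
    rw [map_mul, mul_eq_zero] at h1
    exact sub_eq_zero.1 (N_eq_zero.1 (h1.resolve_left fun h => ha (N_eq_zero.1 h)))
  mul_right_cancel_of_ne_zero {a} ha b c h := by
    have h1 : N ((b - c) * a) = 0 := by rw [sub_mul, sub_eq_zero.2 h]; exact N_eq_zero.2 rfl
    rw [map_mul, mul_eq_zero] at h1
    exact sub_eq_zero.1 (N_eq_zero.1 (h1.resolve_right fun h => ha (N_eq_zero.1 h)))

/-- A domain with a Euclidean multiplicative norm is a principal ideal ring. -/
theorem isPrincipalIdealRing_of_norm {R : Type*} [CommRing R] [IsDomain R] (ν : R →* ℤ)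
    (h0 : ∀ x, 0 ≤ ν x) (hdiv : ∀ x y : R, y ≠ 0 → ∃ q, ν (x - y * q) < ν y) : IsPrincipalIdealRing R := by
  classical
  refine ⟨fun I => ?_⟩
  by_cases hI : I = ⊥
  · subst hI; exact bot_isPrincipal
  obtain ⟨a, haI, ha0⟩ := Submodule.exists_mem_ne_zero_of_ne_bot hI
  have hex : ∃ n : ℕ, ∃ a ∈ I, a ≠ 0 ∧ (ν a).toNat = n := ⟨_, a, haI, ha0, rfl⟩
  obtain ⟨b, hbI, hb0, hb⟩ := Nat.find_spec hex
  refine ⟨⟨b, le_antisymm (fun x hx => ?_) ((Ideal.span_singleton_le_iff_mem I).2 hbI)⟩⟩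
  obtain ⟨q, hq⟩ := hdiv x b hb0
  by_cases hr : x - b * q = 0
  · exact Ideal.mem_span_singleton.2 ⟨q, sub_eq_zero.1 hr⟩
  · exfalso
    refine Nat.find_min hex (m := (ν (x - b * q)).toNat) ?_
      ⟨_, I.sub_mem hx (I.mul_mem_right _ hbI), hr, rfl⟩
    rw [← hb]
    have := h0 (x - b * q)
    have := h0 b
    omega

theorem exists_near_E (A : E) {n : ℤ} (hn : 0 < n) :
    ∃ q : E, 3 * nE (A - (n : E) * q) ≤ n ^ 2 := by
  obtain ⟨x, hx⟩ : ∃ x, x = A.re % n := ⟨_, rfl⟩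
  obtain ⟨y, hy⟩ : ∃ y, y = A.im % n := ⟨_, rfl⟩
  have hx0 : 0 ≤ x := hx ▸ Int.emod_nonneg _ hn.ne'
  have hy0 : 0 ≤ y := hy ▸ Int.emod_nonneg _ hn.ne'
  have hxn : x < n := hx ▸ Int.emod_lt_of_pos _ hn
  have hyn : y < n := hy ▸ Int.emod_lt_of_pos _ hn
  have hA1 : A.re = x + n * (A.re / n) := by rw [hx]; exact (Int.emod_add_mul_ediv _ _).symm
  have hA2 : A.im = y + n * (A.im / n) := by rw [hy]; exact (Int.emod_add_mul_ediv _ _).symm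
  have key : ∀ a b : ℤ, nE (A - (n : E) * ⟨A.re / n + a, A.im / n + b⟩)
      = (x - n * a) ^ 2 - (x - n * a) * (y - n * b) + (y - n * b) ^ 2 := by
    intro a b
    have h1 : (A - (n : E) * ⟨A.re / n + a, A.im / n + b⟩).re = x - n * a := by
      simp; linarith
    have h2 : (A - (n : E) * ⟨A.re / n + a, A.im / n + b⟩).im = y - n * b := by
      simp; linarith
    rw [nE_def, h1, h2]
  by_contra! hcon
  have k00 := hcon ⟨A.re / n + 0, A.im / n + 0⟩
  have k10 := hcon ⟨A.re / n + 1, A.im / n + 0⟩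
  have k01 := hcon ⟨A.re / n + 0, A.im / n + 1⟩
  have k11 := hcon ⟨A.re / n + 1, A.im / n + 1⟩
  rw [key] at k00 k10 k01 k11
  have e : 0 ≤ (x * x - x * y + y * y) := by nlinarith [sq_nonneg (x - y)]
  rcases le_total y x with h | h
  · have a1 := mul_le_mul_of_nonneg_left k00.le (sub_nonneg.2 hxn.le)
    have a1' := mul_lt_mul_of_pos_left k00 (sub_pos.2 hxn)
    have a2 := mul_le_mul_of_nonneg_left k10.le (sub_nonneg.2 h)
    have a3 := mul_le_mul_of_nonneg_left k11.le hy0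
    have hsq : 0 ≤ n * ((3 * x - 2 * n) ^ 2 - (3 * x - 2 * n) * (3 * y - n) + (3 * y - n) ^ 2) :=
      mul_nonneg hn.le (by
        nlinarith [sq_nonneg (3 * x - 2 * n - (3 * y - n)),
        sq_nonneg (3 * x - 2 * n), sq_nonneg (3 * y - n)])
    nlinarith
  · have a1' := mul_lt_mul_of_pos_left k00 (sub_pos.2 hyn)
    have a2 := mul_le_mul_of_nonneg_left k01.le (sub_nonneg.2 h)
    have a3 := mul_le_mul_of_nonneg_left k11.le hx0
    have hsq : 0 ≤ n * ((3 * x - n) ^ 2 - (3 * x - n) * (3 * y - 2 * n) + (3 * y - 2 * n) ^ 2) :=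
      mul_nonneg hn.le (by
        nlinarith [sq_nonneg (3 * x - n - (3 * y - 2 * n)),
        sq_nonneg (3 * x - n), sq_nonneg (3 * y - 2 * n)])
    nlinarith

theorem exists_near_O (A : O) {n : ℤ} (hn : 0 < n) :
    ∃ q : O, 9 * N (A - (n : O) * q) ≤ 4 * n ^ 4 := by
  obtain ⟨a, ha⟩ := exists_near_E A.re hn
  obtain ⟨b, hb⟩ := exists_near_E A.im hn
  refine ⟨⟨a, b⟩, ?_⟩
  have h1 : 3 * hs (A - (n : O) * ⟨a, b⟩) ≤ 2 * n ^ 2 := by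
    have e1 : (A - (n : O) * ⟨a, b⟩).re = A.re - (n : E) * a := by simp
    have e2 : (A - (n : O) * ⟨a, b⟩).im = A.im - (n : E) * b := by simp
    rw [hs, e1, e2]; linarith
  have h2 := hs_nonneg (A - (n : O) * ⟨a, b⟩)
  rw [N_eq]
  nlinarith [sq_nonneg (ht (A - (n : O) * ⟨a, b⟩)), sq_nonneg n]

instance : IsPrincipalIdealRing E :=
  isPrincipalIdealRing_of_norm nE nE_nonneg fun x y hy => by
    have hn := nE_pos hy
    obtain ⟨q, hq⟩ := exists_near_E (x * star y) hn
    refine ⟨q, ?_⟩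
    have h : nE (x - y * q) * nE y = nE (x * star y - (nE y : E) * q) := by
      conv_lhs => rw [← nE_star y, ← map_mul]
      rw [← mul_star_E]; congr 1; ring
    rw [← h] at hq
    nlinarith

/-- The product of the nontrivial conjugates of `α`. -/
def coN (α : O) : O := star α * algebraMap E O (star (nO α))

theorem mul_coN (α : O) : α * coN α = (N α : O) := by
  rw [coN, ← mul_assoc, ← algebraMap_norm_eq_mul_star]
  change algebraMap E O (nO α) * _ = _
  rw [← map_mul, mul_star_E]
  simp [N_def]

theorem N_coN (α : O) (hα : α ≠ 0) : N (coN α) = N α ^ 3 := by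
  have h := congrArg N (mul_coN α)
  rw [map_mul, N_intCast] at h
  have := (N_pos hα).ne'
  apply mul_left_cancel₀ this
  rw [h]; ring

instance : IsPrincipalIdealRing O :=
  isPrincipalIdealRing_of_norm N N_nonneg fun x y hy => by
    have hn := N_pos hy
    obtain ⟨q, hq⟩ := exists_near_O (x * coN y) hn
    refine ⟨q, ?_⟩
    have h : N (x - y * q) * N y ^ 3 = N (x * coN y - (N y : O) * q) := by
      rw [← N_coN y hy, ← map_mul, ← mul_coN]; congr 1; ring
    rw [← h] at hq
    have h3 : 0 < N y ^ 3 := by positivity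
    have : N y ^ 4 = N y * N y ^ 3 := by ring
    rw [this] at hq
    by_contra! hc
    nlinarith [mul_le_mul_of_nonneg_right hc h3.le, mul_pos hn h3]

theorem isUnit_E {z : E} : IsUnit z ↔ nE z = 1 := by
  rw [isUnit_iff_norm_isUnit]
  change IsUnit (nE z) ↔ _
  rw [Int.isUnit_iff]
  have := nE_nonneg z
  constructor
  · rintro (h | h) <;> omega
  · exact Or.inl

theorem isUnit_O {α : O} : IsUnit α ↔ N α = 1 := by
  rw [isUnit_iff_norm_isUnit]
  exact isUnit_E

theorem norm_eq_nE (z : E) : Algebra.norm ℤ z = nE z := by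
  rw [Algebra.norm_apply]; exact det_toLinearMap_eq_norm z

end CubicTrace

namespace CubicTrace

open QuadraticAlgebra UniqueFactorizationMonoid

/-- Zero or a cube root of unity. -/
def IsMu (z : E) : Prop := z = 0 ∨ z ^ 3 = 1

theorem IsMu.cases {z : E} (h : IsMu z) : z = 0 ∨ z = 1 ∨ z = om ∨ z = om ^ 2 := by
  rcases h with h | h
  · exact Or.inl h
  · right
    have : (z - 1) * ((z - om) * (z - om ^ 2)) = 0 := by
      have h1 := one_add_om_add_sq
      linear_combination h - (z - 1) * (z + 1 - om) * h1
    simpa [sub_eq_zero] using this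

theorem IsMu.mul {z w : E} (hz : IsMu z) (hw : IsMu w) : IsMu (z * w) := by
  rcases hz with rfl | hz
  · left; simp
  · rcases hw with rfl | hw
    · left; simp
    · right; rw [mul_pow, hz, hw, one_mul]

theorem isMu_zero : IsMu 0 := Or.inl rfl
theorem isMu_one : IsMu 1 := Or.inr (one_pow 3)

theorem IsMu.pow {z : E} (hz : IsMu z) : ∀ n, IsMu (z ^ n)
  | 0 => by simpa using isMu_one
  | n + 1 => by rw [pow_succ]; exact (IsMu.pow hz n).mul hz

theorem IsMu.map {z : E} (hz : IsMu z) (ψ : E →+* E) : IsMu (ψ z) := by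
  rcases hz with rfl | hz
  · left; simp
  · right; rw [← map_pow, hz, map_one]

theorem IsMu.sub_dvd_three {z w : E} (hz : IsMu z) (hw : IsMu w) (h : z ≠ w) : z - w ∣ 3 := by
  have hc : ∀ a b : E, (∃ c ∈ ({3, -3, ⟨1, -1⟩, ⟨2, 1⟩, ⟨1, 2⟩, ⟨-1, -2⟩, ⟨-2, -1⟩, ⟨-1, 1⟩,
      3 * om, -3 * om, 3 * om ^ 2, -3 * om ^ 2} : Finset E), (a - b) * c = 3) → a - b ∣ 3 :=
    fun a b ⟨c, _, h⟩ => ⟨c, h.symm⟩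
  rcases hz.cases with rfl | rfl | rfl | rfl <;> rcases hw.cases with rfl | rfl | rfl | rfl <;>
  first
  | exact absurd rfl h
  | exact hc _ _ (by decide)

section Symbol

variable {R : Type*} [CommRing R] [IsDomain R] [IsPrincipalIdealRing R] [Algebra E R]
  [Ring.HasFiniteQuotients R]

/-- The number of residue classes modulo `π`. -/
noncomputable def nq (π : R) : ℕ := Nat.card (R ⧸ Ideal.span {π})

theorem map_dvd_three {z : E} (h : z ∣ 3) : algebraMap E R z ∣ 3 := by
  have := map_dvd (algebraMap E R) h
  rwa [map_ofNat] at this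

theorem IsMu.eq_of_dvd {π : R} (h3 : ¬ π ∣ 3) {z w : E} (hz : IsMu z) (hw : IsMu w)
    (h : π ∣ algebraMap E R (z - w)) : z = w := by
  by_contra hne
  exact h3 (h.trans (map_dvd_three (hz.sub_dvd_three hw hne)))

theorem three_dvd_nq_sub_one {π : R} (hπ : Prime π) (h3 : ¬ π ∣ 3) : 3 ∣ nq π - 1 := by
  have : (Ideal.span {π}).IsMaximal := PrincipalIdealRing.isMaximal_of_irreducible hπ.irreducible
  let := Ideal.Quotient.field (Ideal.span {π})
  have : Finite (R ⧸ Ideal.span {π}) :=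
    Ring.HasFiniteQuotients.finiteQuotient (by simpa using hπ.ne_zero)
  set m := Ideal.Quotient.mk (Ideal.span {π})
  have hu : (m (algebraMap E R om)) ^ 3 = 1 := by
    rw [← map_pow, ← map_pow, om_cube, map_one, map_one]
  have hne : m (algebraMap E R om) ≠ 1 := by
    intro h
    rw [← sub_eq_zero, ← map_one m, ← map_sub, Ideal.Quotient.eq_zero_iff_dvd,
      ← map_one (algebraMap E R), ← map_sub] at h
    exact absurd (IsMu.eq_of_dvd h3 (Or.inr om_cube) isMu_one h) (by decide)
  let u : (R ⧸ Ideal.span {π})ˣ := Units.ofPowEqOne _ 3 hu (by norm_num)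
  have ho : orderOf u = 3 := by
    refine orderOf_eq_prime ?_ ?_
    · ext; simp [u]
    · intro h; exact hne (by simpa [u] using congrArg Units.val h)
  rw [← ho, nq, ← Nat.card_units]
  exact orderOf_dvd_natCard u

theorem two_le_nq {π : R} (hπ : Prime π) : 2 ≤ nq π := by
  have : Finite (R ⧸ Ideal.span {π}) :=
    Ring.HasFiniteQuotients.finiteQuotient (by simpa using hπ.ne_zero)
  have : Nontrivial (R ⧸ Ideal.span {π}) :=
    Ideal.Quotient.nontrivial_iff.2 (by simpa using hπ.not_isUnit)
  exact Nat.succ_le_of_lt Finite.one_lt_card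

theorem dvd_pow_nq_sub_one {π : R} (hπ : Prime π) {a : R} (ha : ¬ π ∣ a) :
    π ∣ a ^ (nq π - 1) - 1 := by
  have : (Ideal.span {π}).IsMaximal := PrincipalIdealRing.isMaximal_of_irreducible hπ.irreducible
  let := Ideal.Quotient.field (Ideal.span {π})
  have : Finite (R ⧸ Ideal.span {π}) :=
    Ring.HasFiniteQuotients.finiteQuotient (by simpa using hπ.ne_zero)
  have := Fintype.ofFinite (R ⧸ Ideal.span {π})
  rw [← Ideal.Quotient.eq_zero_iff_dvd] at ha ⊢
  rw [map_sub, map_pow, map_one, nq, Nat.card_eq_fintype_card, FiniteField.pow_card_sub_one_eq_one _ ha,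
    sub_self]

theorem exists_isMu {π : R} (hπ : Prime π) (h3 : ¬ π ∣ 3) (a : R) :
    ∃ z, IsMu z ∧ π ∣ a ^ ((nq π - 1) / 3) - algebraMap E R z := by
  obtain ⟨k, hk⟩ := three_dvd_nq_sub_one hπ h3
  have := two_le_nq hπ
  have hk' : (nq π - 1) / 3 = k := by omega
  rw [hk']
  by_cases ha : π ∣ a
  · exact ⟨0, isMu_zero, by rw [map_zero, sub_zero]; exact dvd_pow ha (by omega)⟩
  have h := dvd_pow_nq_sub_one hπ ha
  rw [hk, mul_comm, pow_mul] at h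
  set b := a ^ k
  set w := algebraMap E R om with hw
  have h1 : 1 + w + w ^ 2 = 0 := by
    rw [hw, ← map_pow, ← map_one (algebraMap E R), ← map_add, ← map_add, one_add_om_add_sq, map_zero]
  have : b ^ 3 - 1 = (b - 1) * ((b - w) * (b - w ^ 2)) := by
    linear_combination (b - 1) * (b + 1 - w) * h1
  rw [this] at h
  rcases hπ.dvd_or_dvd h with h | h
  · exact ⟨1, isMu_one, by rwa [map_one]⟩
  rcases hπ.dvd_or_dvd h with h | h
  · exact ⟨om, Or.inr om_cube, h⟩
  · exact ⟨om ^ 2, Or.inr (by decide), by rwa [map_pow]⟩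

open Classical in
/-- The cubic residue symbol modulo a prime `π`; it is trivial for `π ∣ 3`. -/
noncomputable def lsym (π a : R) : E :=
  if h : Prime π ∧ ¬ π ∣ 3 then (exists_isMu h.1 h.2 a).choose else 1

theorem lsym_isMu (π a : R) : IsMu (lsym π a) := by
  unfold lsym; split_ifs with h
  · exact (exists_isMu h.1 h.2 a).choose_spec.1
  · exact isMu_one

theorem lsym_spec {π : R} (hπ : Prime π) (h3 : ¬ π ∣ 3) (a : R) :
    π ∣ a ^ ((nq π - 1) / 3) - algebraMap E R (lsym π a) := by
  unfold lsym; rw [dif_pos ⟨hπ, h3⟩]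
  exact (exists_isMu hπ h3 a).choose_spec.2

theorem lsym_of_dvd_three {π : R} (h3 : π ∣ 3) (a : R) : lsym π a = 1 := by
  unfold lsym; rw [dif_neg (fun h => h.2 h3)]

theorem lsym_unique {π : R} (hπ : Prime π) (h3 : ¬ π ∣ 3) {a : R} {z : E} (hz : IsMu z)
    (h : π ∣ a ^ ((nq π - 1) / 3) - algebraMap E R z) : lsym π a = z := by
  refine IsMu.eq_of_dvd h3 (lsym_isMu π a) hz ?_
  rw [map_sub]
  have := dvd_sub h (lsym_spec hπ h3 a)
  rwa [sub_sub_sub_cancel_left] at this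

theorem lsym_congr {π a b : R} (h : π ∣ a - b) : lsym π a = lsym π b := by
  by_cases hp : Prime π ∧ ¬ π ∣ 3
  · refine lsym_unique hp.1 hp.2 (lsym_isMu π b) ?_
    have := dvd_add (h.trans (sub_dvd_pow_sub_pow a b ((nq π - 1) / 3))) (lsym_spec hp.1 hp.2 b)
    rwa [sub_add_sub_cancel] at this
  · simp only [lsym, dif_neg hp]

theorem lsym_mul (π a b : R) : lsym π (a * b) = lsym π a * lsym π b := by
  by_cases hp : Prime π ∧ ¬ π ∣ 3
  · refine lsym_unique hp.1 hp.2 ((lsym_isMu π a).mul (lsym_isMu π b)) ?_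
    rw [mul_pow, map_mul]
    exact (dvd_mul_sub_mul (lsym_spec hp.1 hp.2 a) (lsym_spec hp.1 hp.2 b))
  · simp only [lsym, dif_neg hp, one_mul]

theorem nq_congr {π π' : R} (h : Associated π π') : nq π = nq π' := by
  unfold nq; rw [Ideal.span_singleton_eq_span_singleton.2 h]

theorem lsym_assoc {π π' : R} (h : Associated π π') (a : R) : lsym π a = lsym π' a := by
  by_cases hp : Prime π ∧ ¬ π ∣ 3
  · refine lsym_unique hp.1 hp.2 (lsym_isMu π' a) ?_
    rw [h.dvd_iff_dvd_left, nq_congr h]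
    exact lsym_spec (h.prime hp.1) (fun h3 => hp.2 (h.dvd_iff_dvd_left.2 h3)) a
  · have hp' : ¬ (Prime π' ∧ ¬ π' ∣ 3) := by
      rwa [← h.prime_iff, ← h.dvd_iff_dvd_left]
    simp only [lsym, dif_neg hp, dif_neg hp']

theorem lsym_eq_zero {π : R} (hπ : Prime π) (h3 : ¬ π ∣ 3) {a : R} : lsym π a = 0 ↔ π ∣ a := by
  have hs := lsym_spec hπ h3 a
  obtain ⟨k, hk⟩ := three_dvd_nq_sub_one hπ h3
  have := two_le_nq hπ
  constructor
  · intro h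
    rw [h, map_zero, sub_zero] at hs
    exact hπ.dvd_of_dvd_pow hs
  · intro h
    refine lsym_unique hπ h3 isMu_zero ?_
    rw [map_zero, sub_zero]
    exact dvd_pow h (by omega)

theorem lsym_one (π : R) : lsym π 1 = 1 := by
  by_cases hp : Prime π ∧ ¬ π ∣ 3
  · exact lsym_unique hp.1 hp.2 isMu_one (by simp)
  · simp only [lsym, dif_neg hp]

theorem exists_lsym_ne_one {π : R} (hπ : Prime π) (h3 : ¬ π ∣ 3) :
    ∃ a, ¬ π ∣ a ∧ lsym π a ≠ 1 := by
  have : (Ideal.span {π}).IsMaximal := PrincipalIdealRing.isMaximal_of_irreducible hπ.irreducible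
  let := Ideal.Quotient.field (Ideal.span {π})
  have : Finite (R ⧸ Ideal.span {π}) :=
    Ring.HasFiniteQuotients.finiteQuotient (by simpa using hπ.ne_zero)
  obtain ⟨k, hk⟩ := three_dvd_nq_sub_one hπ h3
  have := two_le_nq hπ
  have hk' : (nq π - 1) / 3 = k := by omega
  obtain ⟨u, hu⟩ := IsCyclic.exists_generator (α := (R ⧸ Ideal.span {π})ˣ)
  obtain ⟨a, ha⟩ := Ideal.Quotient.mk_surjective (u : R ⧸ Ideal.span {π})
  refine ⟨a, ?_, ?_⟩
  · rw [← Ideal.Quotient.eq_zero_iff_dvd, ha]; exact u.ne_zero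
  · intro h
    have hs := lsym_spec hπ h3 a
    rw [h, map_one, ← Ideal.Quotient.eq_zero_iff_dvd, map_sub, map_pow, ha, map_one, sub_eq_zero,
      hk'] at hs
    have h1 : u ^ k = 1 := by ext; simpa using hs
    have h2 := orderOf_dvd_of_pow_eq_one h1
    rw [orderOf_eq_card_of_forall_mem_zpowers hu, Nat.card_units] at h2
    change nq π - 1 ∣ k at h2
    have := Nat.le_of_dvd (by omega) h2
    omega

/-- The cubic residue symbol `(a / b)`, ignoring the primes of `b` dividing `3`. -/
noncomputable def cs (a b : R) : E := ((factors b).map (lsym · a)).prod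

theorem cs_isMu (a b : R) : IsMu (cs a b) :=
  Multiset.prod_induction IsMu _ (fun _ _ => IsMu.mul) isMu_one fun x hx => by
    obtain ⟨π, _, rfl⟩ := Multiset.mem_map.1 hx
    exact lsym_isMu π a

theorem cs_mul_left (a a' b : R) : cs (a * a') b = cs a b * cs a' b := by
  simp only [cs, lsym_mul, Multiset.prod_map_mul]

theorem cs_one_left (b : R) : cs 1 b = 1 := by
  simp [cs, lsym_one]

theorem cs_pow_left (a b : R) (n : ℕ) : cs (a ^ n) b = cs a b ^ n := by
  induction n with
  | zero => simp [cs_one_left]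
  | succ n ih => rw [pow_succ, cs_mul_left, ih, pow_succ]

theorem prod_lsym_of_rel {s t : Multiset R} (h : Multiset.Rel Associated s t) (a : R) :
    (s.map (lsym · a)).prod = (t.map (lsym · a)).prod := by
  induction h with
  | zero => rfl
  | cons hab _ ih => simp only [Multiset.map_cons, Multiset.prod_cons, ih, lsym_assoc hab]

theorem cs_mul_right (a : R) {b b' : R} (hb : b ≠ 0) (hb' : b' ≠ 0) :
    cs a (b * b') = cs a b * cs a b' := by
  rw [cs, prod_lsym_of_rel (factors_mul hb hb'), Multiset.map_add, Multiset.prod_add, cs, cs]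

theorem cs_assoc (a : R) {b b' : R} (h : Associated b b') : cs a b = cs a b' :=
  prod_lsym_of_rel (factors_rel_of_associated h) a

theorem cs_unit (a : R) {b : R} (hb : IsUnit b) : cs a b = 1 := by
  rw [cs, factors_of_isUnit hb]; simp

theorem cs_one_right (a : R) : cs a 1 = 1 := cs_unit a isUnit_one

theorem cs_prime (a : R) {π : R} (hπ : Prime π) : cs a π = lsym π a := by
  have h : Multiset.Rel Associated (factors π) {π} := by
    refine factors_unique (fun x hx => irreducible_of_factor x hx) (by simpa using hπ.irreducible) ?_
    simpa using factors_prod hπ.ne_zero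
  rw [cs, prod_lsym_of_rel h]; simp

theorem cs_congr {a a' b : R} (h : b ∣ a - a') : cs a b = cs a' b := by
  unfold cs
  congr 1
  refine Multiset.map_congr rfl fun π hπ => lsym_congr ((dvd_of_mem_factors hπ).trans h)

theorem cs_pow_right (a : R) {b : R} (hb : b ≠ 0) (n : ℕ) : cs a (b ^ n) = cs a b ^ n := by
  induction n with
  | zero => simp [cs_one_right]
  | succ n ih => rw [pow_succ, cs_mul_right a (pow_ne_zero _ hb) hb, ih, pow_succ]

theorem not_dvd_three_of_coprime {b π : R} (hb : IsCoprime b 3) (hπ : Prime π) (h : π ∣ b) :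
    ¬ π ∣ 3 := fun h3 => hπ.not_isUnit (hb.isUnit_of_dvd' h h3)

theorem cs_ne_zero {a b : R} (h : IsCoprime a b) : cs a b ≠ 0 := by
  intro h0
  rw [cs, Multiset.prod_eq_zero_iff, Multiset.mem_map] at h0
  obtain ⟨π, hπ, h0⟩ := h0
  have hp := prime_of_factor π hπ
  by_cases h3 : π ∣ 3
  · rw [lsym_of_dvd_three h3] at h0; exact one_ne_zero h0
  · exact hp.not_isUnit (h.isUnit_of_dvd' ((lsym_eq_zero hp h3).1 h0) (dvd_of_mem_factors hπ))

theorem cs_eq_zero_of_dvd {a b π : R} (hb0 : b ≠ 0) (hπ : Prime π) (h3 : ¬ π ∣ 3) (ha : π ∣ a)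
    (hb : π ∣ b) : cs a b = 0 := by
  obtain ⟨c, rfl⟩ := hb
  rw [cs_mul_right a hπ.ne_zero (right_ne_zero_of_mul hb0), cs_prime a hπ, (lsym_eq_zero hπ h3).2 ha,
    zero_mul]

theorem cs_eq_zero {a b : R} (hb0 : b ≠ 0) (hb : IsCoprime b 3) (h : ¬ IsCoprime a b) :
    cs a b = 0 := by
  by_contra hne
  refine h (isCoprime_of_prime_dvd (fun h => hb0 h.2) fun π hπ ha hb' => hne ?_)
  exact cs_eq_zero_of_dvd hb0 hπ (not_dvd_three_of_coprime hb hπ hb') ha hb'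

theorem cs_zero_left {b : R} (hb0 : b ≠ 0) (hb : IsCoprime b 3) (hu : ¬ IsUnit b) : cs 0 b = 0 :=
  cs_eq_zero hb0 hb (by rwa [isCoprime_zero_left])

theorem nq_map (φ : R ≃+* R) (π : R) : nq (φ π) = nq π := by
  unfold nq
  refine Nat.card_congr (Ideal.quotientEquiv _ _ φ ?_).symm.toEquiv
  rw [Ideal.map_span, Set.image_singleton]; rfl

theorem lsym_map (φ : R ≃+* R) (ψ : E ≃+* E) (h : ∀ e, φ (algebraMap E R e) = algebraMap E R (ψ e))
    (π a : R) : lsym (φ π) (φ a) = ψ (lsym π a) := by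
  have h3 : φ π ∣ 3 ↔ π ∣ 3 := by
    conv_lhs => rw [← map_ofNat φ 3]
    exact map_dvd_iff φ
  by_cases hp : Prime π ∧ ¬ π ∣ 3
  · refine lsym_unique ((MulEquiv.prime_iff φ).2 hp.1) (h3.not.2 hp.2)
      (by simpa using (lsym_isMu π a).map (ψ : E →+* E)) ?_
    rw [nq_map, ← h, ← map_pow, ← map_sub]
    exact map_dvd φ (lsym_spec hp.1 hp.2 a)
  · have hp' : ¬ (Prime (φ π) ∧ ¬ φ π ∣ 3) := by
      rwa [h3, MulEquiv.prime_iff]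
    simp only [lsym, dif_neg hp, dif_neg hp', map_one]

theorem cs_map (φ : R ≃+* R) (ψ : E ≃+* E) (h : ∀ e, φ (algebraMap E R e) = algebraMap E R (ψ e))
    (a : R) {b : R} (hb : b ≠ 0) : cs (φ a) (φ b) = ψ (cs a b) := by
  induction b using induction_on_prime with
  | h₁ => exact absurd rfl hb
  | h₂ x hx => rw [cs_unit _ hx, cs_unit _ (hx.map φ), map_one]
  | h₃ x π hx hπ ih =>
    rw [map_mul, cs_mul_right _ ((map_ne_zero_iff φ φ.injective).2 hπ.ne_zero)
      ((map_ne_zero_iff φ φ.injective).2 hx), ih hx, cs_mul_right _ hπ.ne_zero hx, map_mul,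
      cs_prime _ hπ, cs_prime _ ((MulEquiv.prime_iff φ).2 hπ), lsym_map φ ψ h]

end Symbol

instance : Module.Free ℤ O := Module.Free.trans (S := E)
instance : Module.Finite ℤ O := Module.Finite.trans E O

theorem nq_E (z : E) : nq z = (nE z).natAbs := by
  rw [← norm_eq_nE, ← Ideal.absNorm_span_singleton]; rfl

theorem nq_O (α : O) : nq α = (N α).natAbs := by
  have h : Algebra.norm ℤ α = N α := by
    rw [← Algebra.norm_norm (S := E), norm_eq_nE, N_def]
    congr 1
    rw [Algebra.norm_apply]; exact det_toLinearMap_eq_norm α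
  rw [← h, ← Ideal.absNorm_span_singleton]; rfl

theorem nq_mod_three {R : Type*} [CommRing R] [IsDomain R] [IsPrincipalIdealRing R] [Algebra E R]
    [Ring.HasFiniteQuotients R] {π : R} (hπ : Prime π) (h3 : ¬ π ∣ 3) : nq π % 3 = 1 := by
  have := three_dvd_nq_sub_one hπ h3
  have := two_le_nq hπ
  omega

theorem dvd_algebraMap_nO (α : O) : α ∣ algebraMap E O (nO α) :=
  ⟨star α, algebraMap_norm_eq_mul_star α⟩

theorem nO_algebraMap (e : E) : nO (algebraMap E O e) = e ^ 2 := norm_algebraMap e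

theorem nO_star (α : O) : nO (star α) = nO α := QuadraticAlgebra.norm_star α

theorem nO_ne_zero {α : O} (h : α ≠ 0) : nO α ≠ 0 := fun h0 => h (N_eq_zero.1 (by simp [N_def, h0, nE_def]))

theorem exists_prime_below {P : O} (hP : Prime P) :
    ∃ π : E, Prime π ∧ P ∣ algebraMap E O π := by
  have key : ∀ e : E, e ≠ 0 → P ∣ algebraMap E O e → ∃ π : E, Prime π ∧ P ∣ algebraMap E O π := by
    intro e he
    induction e using induction_on_prime with
    | h₁ => exact absurd rfl he
    | h₂ x hx => exact fun h => absurd (isUnit_of_dvd_unit h (hx.map _)) hP.not_isUnit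
    | h₃ x π hx hπ ih =>
      intro h
      rw [map_mul] at h
      rcases hP.dvd_or_dvd h with h | h
      · exact ⟨π, hπ, h⟩
      · exact ih hx h
  exact key _ (nO_ne_zero hP.ne_zero) (dvd_algebraMap_nO P)

theorem lsym_base (e : E) {P : O} (hP : Prime P) (h3 : ¬ P ∣ 3) :
    lsym P (algebraMap E O e) = cs e (nO P) := by
  obtain ⟨π, hπ, hd⟩ := exists_prime_below hP
  have h3' : ¬ π ∣ 3 := fun h => h3 (hd.trans (map_dvd_three h))
  have hd2 : nO P ∣ π ^ 2 := by
    have := map_dvd nO hd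
    rwa [nO_algebraMap] at this
  obtain ⟨f, hf, hass⟩ := (dvd_prime_pow hπ 2).1 hd2
  have hN : nq P = nq π ^ f := by
    rw [nq_O, nq_E, N_def]
    obtain ⟨u, hu⟩ := hass
    have h1 := congrArg nE hu
    rw [map_mul, isUnit_E.1 u.isUnit, mul_one, map_pow] at h1
    rw [h1, Int.natAbs_pow]
  rw [cs_assoc e hass, cs_pow_right _ hπ.ne_zero, cs_prime _ hπ]
  refine lsym_unique hP h3 ((lsym_isMu π e).pow f) ?_
  have hs := hd.trans (map_dvd (algebraMap E O) (lsym_spec hπ h3' e))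
  have hq := nq_mod_three hπ h3'
  have hP2 := two_le_nq hP
  rw [hN] at hP2 ⊢
  obtain rfl | rfl | rfl : f = 0 ∨ f = 1 ∨ f = 2 := by omega
  · norm_num at hP2
  · rw [pow_one, pow_one, ← map_pow, ← map_sub]; exact hs
  · obtain ⟨k, hk⟩ : ∃ k, nq π = 3 * k + 1 := ⟨nq π / 3, by omega⟩
    have e1 : (nq π ^ 2 - 1) / 3 = k * (3 * k + 2) := by
      rw [hk]
      have : (3 * k + 1) ^ 2 - 1 = k * (3 * k + 2) * 3 := by
        rw [Nat.sub_eq_iff_eq_add (Nat.one_le_pow _ _ (by omega))]; ring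
      rw [this, Nat.mul_div_cancel _ (by norm_num)]
    have e2 : (nq π - 1) / 3 = k := by omega
    have e3 : lsym π e ^ 2 = lsym π e ^ (3 * k + 2) := by
      rcases lsym_isMu π e with h | h
      · rw [h, zero_pow (by omega), zero_pow (by omega)]
      · rw [pow_add, pow_mul, h, one_pow, one_mul]
    rw [e2] at hs
    rw [e1, e3, pow_mul, ← map_pow, ← map_pow, ← map_sub]
    exact hs.trans (map_dvd _ (sub_dvd_pow_sub_pow _ _ _))

theorem cs_base (e : E) {α : O} (hα : α ≠ 0) (h3 : IsCoprime α 3) :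
    cs (algebraMap E O e) α = cs e (nO α) := by
  induction α using induction_on_prime with
  | h₁ => exact absurd rfl hα
  | h₂ x hx =>
    rw [cs_unit _ hx, cs_unit]
    exact isUnit_E.2 (isUnit_O.1 hx)
  | h₃ x π hx hπ ih =>
    rw [cs_mul_right _ hπ.ne_zero hx, map_mul, cs_mul_right _ (nO_ne_zero hπ.ne_zero) (nO_ne_zero hx),
      ih hx h3.of_mul_left_right, cs_prime _ hπ, lsym_base e hπ]
    exact not_dvd_three_of_coprime h3 hπ (dvd_mul_right _ _)

/-- Residues modulo `π`. -/
abbrev Res (π : E) := E ⧸ Ideal.span {π}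

/-- The quotient map modulo `π`. -/
abbrev red (π : E) : E →+* Res π := Ideal.Quotient.mk (Ideal.span {π})

theorem red_eq_zero {π x : E} : red π x = 0 ↔ π ∣ x := Ideal.Quotient.eq_zero_iff_dvd π x

theorem red_eq {π x y : E} : red π x = red π y ↔ π ∣ x - y := by
  rw [← red_eq_zero, map_sub, sub_eq_zero]

/-- The residue symbol modulo a prime as a multiplicative character. -/
noncomputable def chi (π : E) (hπ : Prime π) (h3 : ¬ π ∣ 3) : MulChar (Res π) E where
  toFun x := lsym π x.out
  map_one' := by
    rw [← lsym_one π]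
    exact lsym_congr (red_eq.1 (by rw [red, Ideal.Quotient.mk_out, map_one]))
  map_mul' x y := by
    rw [← lsym_mul]
    exact lsym_congr (red_eq.1 (by simp only [red, Ideal.Quotient.mk_out, map_mul]))
  map_nonunit' x hx := by
    rw [lsym_eq_zero hπ h3, ← red_eq_zero, red, Ideal.Quotient.mk_out]
    have : (Ideal.span {π}).IsMaximal := PrincipalIdealRing.isMaximal_of_irreducible hπ.irreducible
    let := Ideal.Quotient.field (Ideal.span {π})
    by_contra h
    exact hx (IsUnit.mk0 x h)

theorem chi_red {π : E} (hπ : Prime π) (h3 : ¬ π ∣ 3) (x : E) : chi π hπ h3 (red π x) = lsym π x :=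
  lsym_congr (red_eq.1 (by rw [red, Ideal.Quotient.mk_out]))

theorem chi_isMu {π : E} (hπ : Prime π) (h3 : ¬ π ∣ 3) (x : Res π) : IsMu (chi π hπ h3 x) :=
  lsym_isMu _ _

theorem chi_cube {π : E} (hπ : Prime π) (h3 : ¬ π ∣ 3) : chi π hπ h3 ^ 3 = 1 := by
  refine MulChar.ext fun u => ?_
  rw [MulChar.pow_apply_coe, MulChar.one_apply_coe]
  refine (chi_isMu hπ h3 u).resolve_left fun h => ?_
  exact (u.isUnit.map (chi π hπ h3)).ne_zero h

theorem chi_ne_one {π : E} (hπ : Prime π) (h3 : ¬ π ∣ 3) : chi π hπ h3 ≠ 1 := by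
  intro h
  obtain ⟨a, ha, ha1⟩ := exists_lsym_ne_one hπ h3
  have : (Ideal.span {π}).IsMaximal := PrincipalIdealRing.isMaximal_of_irreducible hπ.irreducible
  let := Ideal.Quotient.field (Ideal.span {π})
  rw [← chi_red hπ h3, h, MulChar.one_apply] at ha1
  · exact ha1 rfl
  · exact IsUnit.mk0 _ (by rwa [Ne, red_eq_zero])

theorem chi_inv {π : E} (hπ : Prime π) (h3 : ¬ π ∣ 3) :
    (chi π hπ h3)⁻¹ = (chi π hπ h3).ringHomComp (starRingEnd E) := by
  have h : (chi π hπ h3)⁻¹ = chi π hπ h3 ^ 2 :=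
    inv_eq_of_mul_eq_one_right (by rw [← pow_succ', chi_cube])
  rw [h]
  refine MulChar.ext fun u => ?_
  rw [MulChar.pow_apply_coe, MulChar.ringHomComp_apply]
  have := (chi_isMu hπ h3 u).cases
  rcases this with h | h | h | h <;> rw [h] <;> decide

theorem chi_neg_one {π : E} (hπ : Prime π) (h3 : ¬ π ∣ 3) : chi π hπ h3 (-1) = 1 := by
  have h1 : chi π hπ h3 (-1) ^ 2 = 1 := by rw [← map_pow]; simp
  rcases (chi_isMu hπ h3 (-1)).cases with h | h | h | h <;> rw [h] at h1 ⊢ <;>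
    exact absurd h1 (by decide)

section Field

variable {π : E} [hm : (Ideal.span {π}).IsMaximal] [Fintype (Res π)]

attribute [local instance] Ideal.Quotient.field

theorem nE_eq_card : nE π = Fintype.card (Res π) := by
  rw [← Nat.card_eq_fintype_card]
  change nE π = (nq π : ℤ)
  rw [nq_E, Int.natAbs_of_nonneg (nE_nonneg π)]

theorem dvd_jacobiSum (hπ : Prime π) (h3 : ¬ π ∣ 3) :
    π ∣ jacobiSum (chi π hπ h3) (chi π hπ h3) := by
  obtain ⟨k, hk⟩ := three_dvd_nq_sub_one hπ h3
  have hq := two_le_nq hπ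
  have hk' : (nq π - 1) / 3 = k := by omega
  have hc : Fintype.card (Res π) = nq π := (Nat.card_eq_fintype_card).symm
  have hval : ∀ x, red π (chi π hπ h3 x) = x ^ k := by
    intro x
    obtain ⟨y, rfl⟩ := Ideal.Quotient.mk_surjective x
    change red π (chi π hπ h3 (red π y)) = (red π y) ^ k
    rw [chi_red, ← map_pow, eq_comm, red_eq, ← hk']
    exact lsym_spec hπ h3 y
  rw [← red_eq_zero, jacobiSum, map_sum]
  have : ∀ x : Res π, red π (chi π hπ h3 x * chi π hπ h3 (1 - x)) =
      ∑ j ∈ Finset.range (k + 1), x ^ (k + j) * ((-1) ^ j * (k.choose j : Res π)) := by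
    intro x
    rw [map_mul, hval, hval, sub_eq_neg_add, add_pow, Finset.mul_sum]
    refine Finset.sum_congr rfl fun j _ => ?_
    rw [one_pow, neg_pow, pow_add]; ring
  rw [Finset.sum_congr rfl fun x _ => this x, Finset.sum_comm]
  refine Finset.sum_eq_zero fun j hj => ?_
  rw [← Finset.sum_mul, FiniteField.sum_pow_lt_card_sub_one, zero_mul]
  rw [hc]
  have := Finset.mem_range.1 hj
  omega

theorem nE_jacobiSum (hπ : Prime π) (h3 : ¬ π ∣ 3) :
    nE (jacobiSum (chi π hπ h3) (chi π hπ h3)) = nE π := by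
  set χ := chi π hπ h3
  have hinj : Function.Injective (algebraMap E (FractionRing E)) := IsFractionRing.injective _ _
  have hχ : χ.ringHomComp (algebraMap E (FractionRing E)) ≠ 1 :=
    (MulChar.ringHomComp_ne_one_iff hinj).2 (chi_ne_one hπ h3)
  have hχ2 : χ.ringHomComp (algebraMap E (FractionRing E)) *
      χ.ringHomComp (algebraMap E (FractionRing E)) ≠ 1 := by
    rw [← MulChar.ringHomComp_mul]
    refine (MulChar.ringHomComp_ne_one_iff hinj).2 fun h => chi_ne_one hπ h3 ?_
    have := chi_cube hπ h3
    rwa [pow_succ, pow_two, h, one_mul] at this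
  have hz : CharZero (FractionRing E) := charZero_of_injective_algebraMap hinj
  have hchar : ringChar (FractionRing E) ≠ ringChar (Res π) := by
    rw [ringChar.eq_zero]
    exact (CharP.char_ne_zero_of_finite (Res π) _).symm
  have h := jacobiSum_mul_jacobiSum_inv hchar hχ hχ hχ2
  rw [MulChar.ringHomComp_inv, chi_inv, jacobiSum_ringHomComp, jacobiSum_ringHomComp,
    jacobiSum_ringHomComp, ← map_mul, ← map_natCast (algebraMap E (FractionRing E))] at h
  have h2 := hinj h
  rw [starRingEnd_apply, mul_star_E] at h2
  rw [nE_eq_card (π := π)]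
  have := congrArg re h2
  simpa using this

theorem isPrimitiveRoot_om : IsPrimitiveRoot om 3 :=
  IsPrimitiveRoot.mk_of_lt _ (by norm_num) om_cube
    fun l h0 hl => by interval_cases l <;> decide

theorem jacobiSum_chi (hπ : Prime π) (h3 : ¬ π ∣ 3) (hp : (3 : E) ∣ π - 1) :
    jacobiSum (chi π hπ h3) (chi π hπ h3) = -π := by
  obtain ⟨c, hc⟩ := dvd_jacobiSum hπ h3
  have hN := nE_jacobiSum hπ h3
  have hc1 : nE c = 1 := by
    rw [hc, map_mul] at hN
    exact mul_left_cancel₀ (nE_pos hπ.ne_zero).ne' (by rw [hN, mul_one])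
  have hdiv : 3 ∣ Fintype.card (Res π) - 1 := by
    have := three_dvd_nq_sub_one hπ h3
    rwa [nq, Nat.card_eq_fintype_card] at this
  obtain ⟨z, -, hz⟩ := exists_jacobiSum_eq_neg_one_add (by norm_num) (chi_cube hπ h3) (chi_cube hπ h3) hdiv
    isPrimitiveRoot_om
  obtain ⟨t, ht⟩ := hp
  have hc3 : (3 : E) ∣ c + 1 := by
    have e : (om - 1) ^ 2 = -3 * om := by decide
    refine ⟨-z * om - t * c, ?_⟩
    rw [hz, e] at hc
    linear_combination -hc - c * ht
  have : c = -1 := by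
    obtain ⟨d, hd⟩ := hc3
    have h1 : c.re = 3 * d.re - 1 := by
      have := congrArg re hd; simp at this; linarith
    have h2 : c.im = 3 * d.im := by
      have := congrArg im hd; simp at this; linarith
    rw [nE_def] at hc1
    have b1 : -2 < c.im := by nlinarith [sq_nonneg (2 * c.re - c.im)]
    have b2 : c.im < 2 := by nlinarith [sq_nonneg (2 * c.re - c.im)]
    have h0 : c.im = 0 := by omega
    rw [h0] at hc1
    have b3 : c.re < 2 := by nlinarith
    have b4 : -2 < c.re := by nlinarith
    have h4 : c.re = -1 := by
      have : c.re ≠ 0 := by rintro h; rw [h] at hc1; norm_num at hc1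
      omega
    ext <;> simp [h0, h4]
  rw [hc, this, mul_neg_one]

theorem natCast_nE (z : E) : ((nE z).toNat : E) = (nE z : E) := by
  rw [← Int.cast_natCast, Int.toNat_of_nonneg (nE_nonneg z)]

/-- The raw form of cubic reciprocity furnished by the Frobenius action on a Gauss sum. -/
theorem gauss_reciprocity {θ : E} (hπ : Prime π) (h3 : ¬ π ∣ 3) (hp : (3 : E) ∣ π - 1)
    (hθ : Prime θ) (hθ3 : ¬ θ ∣ 3) (hco : IsCoprime (nE π) (nE θ)) :
    lsym θ ((nE π : E) * π) * lsym π (nE θ : E) = 1 := by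
  have hmθ : (Ideal.span {θ}).IsMaximal := PrincipalIdealRing.isMaximal_of_irreducible hθ.irreducible
  have hfθ : Finite (Res θ) :=
    Ring.HasFiniteQuotients.finiteQuotient (by simpa using hθ.ne_zero)
  have := Fintype.ofFinite (Res θ)
  obtain ⟨⟨ℓ, hℓ⟩, ⟨p, hp'⟩⟩ : (∃ ℓ, CharP (Res θ) ℓ) ∧ ∃ p, CharP (Res π) p := ⟨CharP.exists _, CharP.exists _⟩
  have hQ : (nE θ).toNat = Fintype.card (Res θ) := by
    rw [nE_eq_card]; rfl
  have hq : (nE π).toNat = Fintype.card (Res π) := by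
    rw [nE_eq_card]; rfl
  have hco' : Nat.Coprime (Fintype.card (Res π)) (Fintype.card (Res θ)) := by
    rw [nE_eq_card, nE_eq_card] at hco
    exact_mod_cast hco
  obtain ⟨f, hℓp, hf⟩ := FiniteField.card (Res θ) ℓ
  obtain ⟨f', hpp, hf'⟩ := FiniteField.card (Res π) p
  have hchar : ringChar (Res θ) ≠ ringChar (Res π) := by
    rw [ringChar.eq (Res θ) ℓ, ringChar.eq (Res π) p]
    rintro rfl
    rw [hf, hf'] at hco'
    have := Nat.Coprime.coprime_dvd_left (dvd_pow_self ℓ f'.ne_zero) hco'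
    have := Nat.Coprime.coprime_dvd_right (dvd_pow_self ℓ f.ne_zero) this
    exact hℓp.ne_one ((Nat.coprime_self _).1 this)
  let Ψ := AddChar.FiniteField.primitiveChar (Res π) (Res θ) hchar
  let K := CyclotomicField Ψ.n (Res θ)
  let ι : E →+* K := (algebraMap (Res θ) K).comp (red θ)
  have hι : ∀ x, ι x = 0 ↔ θ ∣ x := fun x => by
    simp only [ι, RingHom.comp_apply, map_eq_zero, red_eq_zero]
  have hKc : CharP K ℓ := charP_of_injective_algebraMap (algebraMap (Res θ) K).injective ℓ
  have hℓf : Fact ℓ.Prime := ⟨hℓp⟩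
  set χ := (chi π hπ h3).ringHomComp ι with hχdef
  have hχ1 : χ ≠ 1 := by
    intro h
    obtain ⟨a, ha, ha1⟩ := exists_lsym_ne_one hπ h3
    have h1 : χ (red π a) = 1 := by
      rw [h, MulChar.one_apply]
      exact IsUnit.mk0 _ (by rwa [Ne, red_eq_zero])
    rw [hχdef, MulChar.ringHomComp_apply, chi_red, ← sub_eq_zero, ← map_one ι, ← map_sub, hι] at h1
    exact ha1 (IsMu.eq_of_dvd (R := E) hθ3 (lsym_isMu π a) isMu_one h1)
  have hχ3 : χ ^ 3 = 1 := by
    rw [hχdef, MulChar.ringHomComp_pow, chi_cube, MulChar.ringHomComp_one]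
  have hord : orderOf χ = 3 := orderOf_eq_prime hχ3 hχ1
  have hg3 := gaussSum_pow_eq_prod_jacobiSum (χ := χ) (ψ := Ψ.char) (by rw [hord]; norm_num) Ψ.prim
  have hIco : Finset.Ico 1 (3 - 1) = {1} := rfl
  rw [hord, hIco, Finset.prod_singleton, pow_one, hχdef, jacobiSum_ringHomComp,
    jacobiSum_chi hπ h3 hp, ← hχdef] at hg3
  have hneg : χ (-1) = 1 := by
    rw [hχdef, MulChar.ringHomComp_apply, chi_neg_one, map_one]
  have hcard : (Fintype.card (Res π) : K) = ι (nE π : E) := by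
    rw [nE_eq_card, Int.cast_natCast, map_natCast]
  rw [hneg, one_mul, hcard, ← map_mul] at hg3
  set g := gaussSum χ Ψ.char
  have hg0 : g ≠ 0 := by
    refine gaussSum_ne_zero_of_nontrivial ?_ hχ1 Ψ.prim
    rw [hf', Nat.cast_pow]
    refine pow_ne_zero _ fun h0 => ?_
    rw [CharP.cast_eq_zero_iff K ℓ] at h0
    rw [hf, hf'] at hco'
    have := (Nat.prime_dvd_prime_iff_eq hℓp hpp).1 h0
    exact hchar (by rw [ringChar.eq (Res θ) ℓ, ringChar.eq (Res π) p, this])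
  have hfrob : ∀ n : ℕ, g ^ ℓ ^ n = gaussSum (χ ^ ℓ ^ n) (Ψ.char ^ ℓ ^ n) := by
    intro n
    induction n with
    | zero => simp [g]
    | succ n ih => rw [pow_succ, pow_mul, ih, gaussSum_frob, ← pow_mul, ← pow_mul]
  have h1 := hfrob f
  have hQmod := nq_mod_three hθ hθ3
  have hnq : nq θ = ℓ ^ (f : ℕ) := by rw [← hf, nq, Nat.card_eq_fintype_card]
  obtain ⟨k, hk⟩ : ∃ k, nq θ = 3 * k + 1 := ⟨nq θ / 3, by omega⟩
  have hχQ : χ ^ ℓ ^ (f : ℕ) = χ := by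
    rw [← hnq, hk, pow_succ, pow_mul, hχ3, one_pow, one_mul]
  rw [hχQ, AddChar.pow_mulShift] at h1
  have hunit : IsUnit (((ℓ ^ (f : ℕ) : ℕ) : Res π)) := by
    rw [← hf]
    refine IsUnit.mk0 _ fun h0 => ?_
    rw [CharP.cast_eq_zero_iff (Res π) p] at h0
    have := Nat.Coprime.coprime_dvd_left (hf' ▸ dvd_pow_self p f'.ne_zero) hco'
    exact hpp.ne_one (Nat.eq_one_of_dvd_coprimes this dvd_rfl h0)
  have h2 := gaussSum_mulShift χ Ψ.char hunit.unit
  rw [hunit.unit_spec, ← h1, ← hnq, hk, pow_succ, ← mul_assoc] at h2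
  have h4 : χ ((nq θ : ℕ) : Res π) * g ^ (3 * k) = 1 := by
    rw [hk]; exact mul_right_cancel₀ hg0 (by rw [h2, one_mul])
  have hχv : χ ((nq θ : ℕ) : Res π) = ι (lsym π (nE θ : E)) := by
    have : ((nq θ : ℕ) : Res π) = red π (nE θ : E) := by
      rw [← natCast_nE, map_natCast, hQ, nq, Nat.card_eq_fintype_card]
    rw [this, hχdef, MulChar.ringHomComp_apply, chi_red]
  rw [pow_mul, hg3, hχv, ← map_pow, ← map_mul] at h4
  rw [← map_one ι, ← sub_eq_zero, ← map_sub, hι] at h4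
  have hk' : (nq θ - 1) / 3 = k := by omega
  have hs := lsym_spec hθ hθ3 ((nE π : E) * -π)
  rw [hk'] at hs
  have hsgn : lsym θ ((nE π : E) * -π) = lsym θ ((nE π : E) * π) := by
    have e : (nE π : E) * -π = (nE π : E) * π * (-1) := by ring
    have e1 : lsym θ (-1 : E) = 1 := by
      rw [← chi_red hθ hθ3, map_neg, map_one, chi_neg_one]
    rw [e, lsym_mul, e1, mul_one]
  rw [← hsgn]
  refine IsMu.eq_of_dvd (R := E) hθ3 ((lsym_isMu _ _).mul (lsym_isMu _ _)) isMu_one ?_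
  have := dvd_sub h4 (hs.mul_left (lsym π (nE θ : E)))
  convert this using 1
  simp only [Algebra.algebraMap_self, RingHom.id_apply]; ring

end Field

theorem IsMu.cube {z : E} (h : IsMu z) (h0 : z ≠ 0) : z ^ 3 = 1 := h.resolve_left h0

theorem IsMu.pow_four {z : E} (h : IsMu z) : z ^ 4 = z := by
  rcases h with rfl | h
  · simp
  · rw [pow_succ, h, one_mul]

theorem IsMu.eq_of_sq_eq {z w : E} (hz : IsMu z) (hw : IsMu w) (h : z ^ 2 = w ^ 2) : z = w := by
  rw [← hz.pow_four, ← hw.pow_four, show 4 = 2 * 2 from rfl, pow_mul, pow_mul, h]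

theorem IsMu.eq_one_of_star {z : E} (hz : IsMu z) (h0 : z ≠ 0) (h : star z = z) : z = 1 := by
  rcases hz.cases with h1 | h1 | h1 | h1 <;> rw [h1] at h h0 ⊢ <;>
    first | exact absurd rfl h0 | exact absurd h (by decide)

section

variable {R : Type*} [CommRing R] [IsDomain R] [IsPrincipalIdealRing R] [Algebra E R]
  [Ring.HasFiniteQuotients R]

theorem cs_cube {a b : R} (h : IsCoprime a b) : cs a b ^ 3 = 1 :=
  (cs_isMu a b).cube (cs_ne_zero h)

theorem isCoprime_of_isUnit {a b : R} (h : IsUnit a) : IsCoprime a b := by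
  obtain ⟨v, hv⟩ := h.exists_left_inv
  exact ⟨v, 0, by rw [hv, zero_mul, add_zero]⟩

theorem cs_neg_one (b : R) : cs (-1) b = 1 := by
  have h := cs_cube (a := (-1 : R)) (b := b) isCoprime_one_left.neg_left
  rw [← cs_pow_left] at h
  have e : (-1 : R) ^ 3 = -1 := by ring
  rwa [e] at h

theorem cs_neg_left (a b : R) : cs (-a) b = cs a b := by
  rw [← neg_one_mul, cs_mul_left, cs_neg_one, one_mul]

theorem isCoprime_three {a : R} (h : (3 : R) ∣ a - 1) : IsCoprime a 3 := by
  obtain ⟨c, hc⟩ := h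
  exact ⟨1, -c, by linear_combination hc⟩

end

theorem eq_one_of_primary_unit {c : E} (hc1 : nE c = 1) (h3 : (3 : E) ∣ c - 1) : c = 1 := by
  obtain ⟨d, hd⟩ := h3
  have h1 : c.re = 3 * d.re + 1 := by
    have := congrArg re hd; simp at this; linarith
  have h2 : c.im = 3 * d.im := by
    have := congrArg im hd; simp at this; linarith
  rw [nE_def] at hc1
  have b1 : -2 < c.im := by nlinarith [sq_nonneg (2 * c.re - c.im)]
  have b2 : c.im < 2 := by nlinarith [sq_nonneg (2 * c.re - c.im)]
  have h0 : c.im = 0 := by omega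
  rw [h0] at hc1
  have b3 : c.re < 2 := by nlinarith
  have b4 : -2 < c.re := by nlinarith
  have h4 : c.re = 1 := by
    have : c.re ≠ 0 := by rintro h; rw [h] at hc1; norm_num at hc1
    omega
  ext <;> simp [h0, h4]

theorem three_dvd_iff {z : E} : (3 : E) ∣ z ↔ 3 ∣ z.re ∧ 3 ∣ z.im := by
  constructor
  · rintro ⟨w, rfl⟩
    exact ⟨⟨w.re, by simp⟩, ⟨w.im, by simp⟩⟩
  · rintro ⟨⟨a, ha⟩, ⟨b, hb⟩⟩
    exact ⟨⟨a, b⟩, by ext <;> simp [ha, hb]⟩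

theorem nE_mod_three {z : E} : nE z % 3 = ((z.re + z.im) % 3) ^ 2 % 3 := by
  rw [nE_def, ← Int.emod_emod_of_dvd _ (dvd_refl 3)]
  have : z.re ^ 2 - z.re * z.im + z.im ^ 2 = (z.re + z.im) ^ 2 - 3 * (z.re * z.im) := by ring
  rw [this, Int.sub_mul_emod_self_left, pow_two, pow_two, Int.mul_emod]
  simp

theorem exists_om_pow {z : E} (h : nE z % 3 ≠ 0) :
    ∃ k : ℕ, (3 : E) ∣ z - om ^ k ∨ (3 : E) ∣ z + om ^ k := by
  rw [nE_mod_three] at h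
  have e0 : om ^ 0 = ⟨1, 0⟩ := rfl
  have e1 : om ^ 1 = ⟨0, 1⟩ := by decide
  have e2 : om ^ 2 = ⟨-1, -1⟩ := by decide
  simp only [three_dvd_iff, re_sub, im_sub, re_add, im_add]
  have h' : (z.re + z.im) % 3 ≠ 0 := fun h0 => h (by rw [h0]; rfl)
  have ha : z.re % 3 = 0 ∨ z.re % 3 = 1 ∨ z.re % 3 = 2 := by omega
  have hb : z.im % 3 = 0 ∨ z.im % 3 = 1 ∨ z.im % 3 = 2 := by omega
  rcases ha with ha | ha | ha <;> rcases hb with hb | hb | hb <;>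
    first
    | omega
    | exact ⟨0, by rw [e0]; dsimp only; omega⟩
    | exact ⟨1, by rw [e1]; dsimp only; omega⟩
    | exact ⟨2, by rw [e2]; dsimp only; omega⟩

theorem isUnit_om : IsUnit om := IsUnit.of_mul_eq_one (om ^ 2) (by decide)

theorem exists_primary {z : E} (h : nE z % 3 ≠ 0) :
    ∃ u : E, IsUnit u ∧ (3 : E) ∣ z * u - 1 := by
  obtain ⟨k, h | h⟩ := exists_om_pow h
  · refine ⟨om ^ (2 * k), isUnit_om.pow _, ?_⟩
    have e : z * om ^ (2 * k) - 1 = (z - om ^ k) * om ^ (2 * k) := by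
      have : om ^ k * om ^ (2 * k) = 1 := by
        rw [← pow_add, show k + 2 * k = 3 * k by ring, pow_mul, om_cube, one_pow]
      linear_combination this
    rw [e]; exact h.mul_right _
  · refine ⟨-om ^ (2 * k), (isUnit_om.pow _).neg, ?_⟩
    have e : z * -om ^ (2 * k) - 1 = -((z + om ^ k) * om ^ (2 * k)) := by
      have : om ^ k * om ^ (2 * k) = 1 := by
        rw [← pow_add, show k + 2 * k = 3 * k by ring, pow_mul, om_cube, one_pow]
      linear_combination this
    rw [e]; exact (h.mul_right _).neg_right

theorem isUnit_E_eq {u : E} (hu : IsUnit u) : ∃ k : ℕ, u = om ^ k ∨ u = -om ^ k := by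
  have h1 := isUnit_E.1 hu
  obtain ⟨k, h⟩ := exists_om_pow (z := u) (by rw [h1]; decide)
  have hom : nE om = 1 := by decide
  have e : om ^ (2 * k) * om ^ k = 1 := by
    rw [← pow_add, show 2 * k + k = 3 * k by ring, pow_mul, om_cube, one_pow]
  refine ⟨k, h.imp (fun h => ?_) fun h => ?_⟩
  · have := eq_one_of_primary_unit (c := u * om ^ (2 * k)) (by simp [h1, hom])
      (by
        convert h.mul_right (om ^ (2 * k)) using 1
        linear_combination e)
    linear_combination om ^ k * this - u * e
  · have := eq_one_of_primary_unit (c := -u * om ^ (2 * k))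
      (by simp only [map_mul, map_pow, hom, one_pow, mul_one]; rw [nE_def] at h1 ⊢; simpa using h1)
      (by
        convert (h.mul_right (om ^ (2 * k))).neg_right using 1
        linear_combination e)
    linear_combination -om ^ k * this - u * e

theorem Prime.exists_primary {p : E} (hp : Prime p) (h3 : ¬ p ∣ 3) :
    ∃ p', Associated p p' ∧ Prime p' ∧ (3 : E) ∣ p' - 1 := by
  have h := nq_mod_three hp h3
  have h0 := nE_nonneg p
  obtain ⟨u, hu, hd⟩ := CubicTrace.exists_primary (z := p) (by rw [nq_E] at h; omega)
  have ha : Associated p (p * u) := ⟨hu.unit, by simp⟩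
  exact ⟨p * u, ha, ha.prime hp, hd⟩

theorem primary_ne_zero {b : E} (hb : (3 : E) ∣ b - 1) : b ≠ 0 := by
  rintro rfl
  exact absurd (three_dvd_iff.1 hb).1 (by decide)

theorem primary_induction {P : E → Prop} (h1 : P 1)
    (hm : ∀ p c, Prime p → (3 : E) ∣ p - 1 → (3 : E) ∣ c - 1 → P c → P (p * c)) :
    ∀ b, (3 : E) ∣ b - 1 → P b := by
  have key : ∀ n : ℕ, ∀ b, (3 : E) ∣ b - 1 → (nE b).toNat = n → P b := by
    intro n
    induction n using Nat.strong_induction_on with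
    | _ n ih =>
      intro b hb hn
      by_cases hu : IsUnit b
      · rw [eq_one_of_primary_unit (isUnit_E.1 hu) hb]; exact h1
      obtain ⟨p, hp, hpb⟩ := WfDvdMonoid.exists_irreducible_factor hu (primary_ne_zero hb)
      have h3 : ¬ p ∣ 3 := not_dvd_three_of_coprime (isCoprime_three hb) hp.prime hpb
      obtain ⟨p', ha, hp', hp1⟩ := Prime.exists_primary hp.prime h3
      obtain ⟨c, rfl⟩ := ha.symm.dvd.trans hpb
      have hc : (3 : E) ∣ c - 1 := by
        have := dvd_sub hb (hp1.mul_right c)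
        convert this using 1; ring
      refine hm p' c hp' hp1 hc (ih _ ?_ c hc rfl)
      have hc0 := nE_pos (primary_ne_zero hc)
      have hp2 := two_le_nq hp'
      rw [nq_E] at hp2
      have : 2 ≤ nE p' := by have := nE_nonneg p'; omega
      rw [← hn, map_mul, Int.toNat_lt_toNat (by positivity)]
      nlinarith
  exact fun b hb => key _ b hb rfl

/-- Conjugation as an automorphism of the Eisenstein integers. -/
def conjE : E ≃+* E := starRingAut

theorem cs_star (a : E) {b : E} (hb : b ≠ 0) : cs (star a) (star b) = star (cs a b) :=
  cs_map conjE conjE (fun _ => rfl) a hb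

theorem primary_star {a : E} (h : (3 : E) ∣ a - 1) : (3 : E) ∣ star a - 1 := by
  rw [three_dvd_iff] at h ⊢
  simp only [re_sub, im_sub, re_star, im_star] at h ⊢
  simp at h ⊢
  omega

theorem prime_star {p : E} (h : Prime p) : Prime (star p) := (MulEquiv.prime_iff conjE).2 h

theorem not_dvd_three_of_primary {p : E} (hp : Prime p) (h : (3 : E) ∣ p - 1) : ¬ p ∣ 3 :=
  not_dvd_three_of_coprime (isCoprime_three h) hp dvd_rfl

theorem associated_or_of_not_isCoprime {π θ : E} (hπ : Prime π) (hθ : Prime θ)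
    (h : ¬ IsCoprime (nE π) (nE θ)) : Associated π θ ∨ Associated (star π) θ := by
  rw [Int.isCoprime_iff_gcd_eq_one] at h
  obtain ⟨ℓ, hℓ, hd⟩ := Nat.exists_prime_and_dvd h
  have h1 : (ℓ : ℤ) ∣ nE π := (Int.natCast_dvd_natCast.2 hd).trans (Int.gcd_dvd_left _ _)
  have h2 : (ℓ : ℤ) ∣ nE θ := (Int.natCast_dvd_natCast.2 hd).trans (Int.gcd_dvd_right _ _)
  have hℓ1 : ¬ IsUnit ((ℓ : ℤ) : E) := by
    rw [isUnit_E, nE_intCast]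
    intro h
    have := hℓ.two_le
    norm_cast at h
    nlinarith
  obtain ⟨p, hp, hpl⟩ := WfDvdMonoid.exists_irreducible_factor hℓ1 (by exact_mod_cast hℓ.ne_zero)
  have hd : ∀ π : E, Prime π → (ℓ : ℤ) ∣ nE π → Associated p π ∨ Associated p (star π) := by
    intro π hπ h
    have : p ∣ π * star π := by
      rw [mul_star_E]; exact hpl.trans (Int.cast_dvd_cast _ _ h)
    exact (hp.prime.dvd_or_dvd this).imp (hp.prime.associated_of_dvd hπ)
      (hp.prime.associated_of_dvd (prime_star hπ))
  have hst : ∀ {a b : E}, Associated a b → Associated (star a) (star b) :=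
    fun h => h.map (conjE : E →* E)
  rcases hd π hπ h1 with h | h <;> rcases hd θ hθ h2 with h' | h'
  · exact Or.inl (h.symm.trans h')
  · exact Or.inr (by simpa using hst (h.symm.trans h'))
  · exact Or.inr (h.symm.trans h')
  · exact Or.inl (by simpa using hst (h.symm.trans h'))

theorem reciprocity_of_coprime_norm {π θ : E} (hπ : Prime π) (hπ1 : (3 : E) ∣ π - 1)
    (hθ : Prime θ) (hθ1 : (3 : E) ∣ θ - 1) (hco : IsCoprime (nE π) (nE θ)) :
    cs π θ = cs θ π := by
  have key : ∀ {π θ : E}, Prime π → (3 : E) ∣ π - 1 → Prime θ → (3 : E) ∣ θ - 1 →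
      IsCoprime (nE π) (nE θ) →
      cs π θ * cs π θ * cs (star π) θ * (cs θ π * cs (star θ) π) = 1 := by
    intro π θ hπ hπ1 hθ hθ1 hco
    have hm : (Ideal.span {π}).IsMaximal :=
      PrincipalIdealRing.isMaximal_of_irreducible hπ.irreducible
    have hf : Finite (Res π) :=
      Ring.HasFiniteQuotients.finiteQuotient (by simpa using hπ.ne_zero)
    have := Fintype.ofFinite (Res π)
    have h := gauss_reciprocity hπ (not_dvd_three_of_primary hπ hπ1) hπ1 hθ
      (not_dvd_three_of_primary hθ hθ1) hco
    rw [← cs_prime _ hθ, ← cs_prime _ hπ, ← mul_star_E, ← mul_star_E, cs_mul_left, cs_mul_left,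
      cs_mul_left] at h
    linear_combination h
  have h1 := key hπ hπ1 hθ hθ1 hco
  have h2 := key hθ hθ1 hπ hπ1 hco.symm
  have hne : cs π θ * cs (star π) θ * cs θ π * cs (star θ) π ≠ 0 := by
    intro h
    apply one_ne_zero (α := E)
    linear_combination -h1 + cs π θ * h
  exact mul_left_cancel₀ hne (by linear_combination h1 - h2)

theorem reciprocity_star {π : E} (hπ : Prime π) (hπ1 : (3 : E) ∣ π - 1)
    (hna : ¬ Associated π (star π)) : cs π (star π) = 1 := by
  have hs := prime_star hπ
  have hT3 : (3 : E) ∣ -(π + star π) - 1 := by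
    have := (dvd_add hπ1 (primary_star hπ1)).neg_right
    have := dvd_sub this (dvd_refl (3 : E))
    convert this using 1; ring
  have hTs : star (-(π + star π)) = -(π + star π) := by simp [add_comm]
  have hd : ¬ star π ∣ -(π + star π) := fun h => hna <| (hs.associated_of_dvd hπ (by
    have := dvd_sub h.neg_right (dvd_refl (star π))
    simpa using this)).symm
  have hd' : ¬ π ∣ -(π + star π) := fun h => hna <| hπ.associated_of_dvd hs (by
    have := dvd_sub h.neg_right (dvd_refl π)
    simpa using this)
  have hrec : ∀ b, (3 : E) ∣ b - 1 → ¬ π ∣ b → ¬ star π ∣ b → cs b π = cs π b := by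
    refine primary_induction ?_ ?_
    · intros; rw [cs_one_left, cs_one_right]
    · intro p c hp hp1 hc ih h1 h2
      rw [cs_mul_left, cs_mul_right _ hp.ne_zero (primary_ne_zero hc),
        ih (fun h => h1 (h.mul_left _)) (fun h => h2 (h.mul_left _))]
      congr 1
      refine reciprocity_of_coprime_norm hp hp1 hπ hπ1 (Classical.not_not.1 fun h => ?_)
      rcases associated_or_of_not_isCoprime hπ hp (fun h' => h h'.symm) with h | h
      · exact h1 (h.dvd.mul_right _)
      · exact h2 (h.dvd.mul_right _)
  have hTe := hrec _ hT3 hd' hd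
  have hcop : IsCoprime π (-(π + star π)) :=
    ((dvd_or_isCoprime _ _ hπ.irreducible).resolve_left hd')
  have h1 : cs π (-(π + star π)) = 1 := by
    refine (cs_isMu _ _).eq_one_of_star (cs_ne_zero hcop) ?_
    rw [← cs_star _ (primary_ne_zero hT3), hTs, ← cs_neg_left]
    exact cs_congr ⟨1, by ring⟩
  have h2 : cs π (star π) = star (cs (-(π + star π)) π) := by
    rw [← cs_star _ hπ.ne_zero, hTs, cs_neg_left]
    exact cs_congr ⟨-1, by ring⟩
  rw [h2, hTe, h1, star_one]

theorem reciprocity_prime {π θ : E} (hπ : Prime π) (hπ1 : (3 : E) ∣ π - 1)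
    (hθ : Prime θ) (hθ1 : (3 : E) ∣ θ - 1) : cs π θ = cs θ π := by
  by_cases h : IsCoprime (nE π) (nE θ)
  · exact reciprocity_of_coprime_norm hπ hπ1 hθ hθ1 h
  by_cases ha : Associated π θ
  · rw [cs_eq_zero_of_dvd hθ.ne_zero hθ (not_dvd_three_of_primary hθ hθ1) ha.symm.dvd dvd_rfl,
      cs_eq_zero_of_dvd hπ.ne_zero hπ (not_dvd_three_of_primary hπ hπ1) ha.dvd dvd_rfl]
  have hs := (associated_or_of_not_isCoprime hπ hθ h).resolve_left ha
  have hna : ¬ Associated π (star π) := fun h => ha (h.trans hs)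
  have h1 := reciprocity_star hπ hπ1 hna
  have h2 : cs (star π) π = 1 := by
    have := cs_star π (b := star π) (prime_star hπ).ne_zero
    rwa [star_star, h1, star_one] at this
  obtain ⟨u, rfl⟩ := hs
  have hu : (u : E) = 1 := by
    refine eq_one_of_primary_unit (isUnit_E.1 u.isUnit) ?_
    have := dvd_sub hθ1 ((primary_star hπ1).mul_right (u : E))
    convert this using 1; ring
  rw [hu, mul_one, h1, h2]

/-- Cubic reciprocity in the Eisenstein integers. -/
theorem reciprocity_E {a b : E} (ha : (3 : E) ∣ a - 1) (hb : (3 : E) ∣ b - 1) :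
    cs a b = cs b a := by
  refine primary_induction (P := fun a => cs a b = cs b a) ?_ ?_ a ha
  · rw [cs_one_left, cs_one_right]
  · intro p c hp hp1 hc ih
    rw [cs_mul_left, cs_mul_right _ hp.ne_zero (primary_ne_zero hc), ih]
    congr 1
    refine primary_induction (P := fun b => cs p b = cs b p) ?_ ?_ b hb
    · rw [cs_one_left, cs_one_right]
    · intro q d hq hq1 hd ih'
      rw [cs_mul_left, cs_mul_right _ hq.ne_zero (primary_ne_zero hd), ih',
        reciprocity_prime hp hp1 hq hq1]

theorem cs_om {b : E} (hb : (3 : E) ∣ b - 1) : ∀ k : ℕ, nE b = 3 * k + 1 → cs om b = om ^ k := by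
  refine primary_induction (P := fun b => ∀ k : ℕ, nE b = 3 * k + 1 → cs om b = om ^ k) ?_ ?_ b hb
  · intro k hk
    rw [cs_one_right]
    have : k = 0 := by rw [map_one] at hk; omega
    rw [this, pow_zero]
  · intro p c hp hp1 hc ih k hk
    have h3 := not_dvd_three_of_primary hp hp1
    have hmod := nq_mod_three hp h3
    rw [nq_E] at hmod
    have hp0 := nE_nonneg p
    have hc0 := nE_nonneg c
    obtain ⟨j, hj⟩ : ∃ j : ℕ, nE p = 3 * j + 1 := ⟨((nE p) / 3).toNat, by omega⟩
    have hcm : nE c % 3 = 1 := by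
      have h : nE p * nE c = 3 * k + 1 := by rw [← map_mul, hk]
      have h' : nE c = 3 * (k - j * nE c) + 1 := by rw [hj] at h; linarith
      omega
    obtain ⟨l, hl⟩ : ∃ l : ℕ, nE c = 3 * l + 1 := ⟨((nE c) / 3).toNat, by omega⟩
    have hkk : k = 3 * (j * l) + j + l := by
      rw [map_mul, hj, hl] at hk
      zify; linarith
    rw [cs_mul_right _ hp.ne_zero (primary_ne_zero hc), ih l hl, hkk, pow_add, pow_add, pow_mul,
      om_cube, one_pow, one_mul, cs_prime _ hp]
    congr 1
    refine IsMu.eq_of_dvd (R := E) h3 (lsym_isMu _ _) (IsMu.pow (Or.inr om_cube) j) ?_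
    have h := lsym_spec hp h3 om
    have hj' : (nq p - 1) / 3 = j := by rw [nq_E]; omega
    rw [hj'] at h
    rw [← neg_sub, ← dvd_neg] at h
    simpa using h

theorem nine_dvd_iff {z : E} : (9 : E) ∣ z ↔ 9 ∣ z.re ∧ 9 ∣ z.im := by
  constructor
  · rintro ⟨w, rfl⟩
    exact ⟨⟨w.re, by simp⟩, ⟨w.im, by simp⟩⟩
  · rintro ⟨⟨a, ha⟩, ⟨b, hb⟩⟩
    exact ⟨⟨a, b⟩, by ext <;> simp [ha, hb]⟩

theorem nE_primary_mod {b : E} (hb : (3 : E) ∣ b - 1) : nE b % 3 = 1 := by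
  rw [nE_mod_three]
  have := three_dvd_iff.1 hb
  simp only [re_sub, im_sub, re_one, im_one] at this
  have : (b.re + b.im) % 3 = 1 := by omega
  rw [this]; rfl

theorem primary_congr {b b' : E} (hb : (3 : E) ∣ b - 1) (h9 : (9 : E) ∣ b - b') :
    (3 : E) ∣ b' - 1 := by
  have := dvd_sub hb ((Dvd.intro 3 (by norm_num) : (3 : E) ∣ 9).trans h9)
  convert this using 1; ring

theorem cs_om_congr {b b' : E} (hb : (3 : E) ∣ b - 1) (h9 : (9 : E) ∣ b - b') :
    cs om b = cs om b' := by
  have hb' := primary_congr hb h9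
  have h1 := nE_primary_mod hb
  have h1' := nE_primary_mod hb'
  have h0 := nE_nonneg b
  have h0' := nE_nonneg b'
  obtain ⟨k, hk⟩ : ∃ k : ℕ, nE b = 3 * k + 1 := ⟨((nE b) / 3).toNat, by omega⟩
  obtain ⟨k', hk'⟩ : ∃ k : ℕ, nE b' = 3 * k + 1 := ⟨((nE b') / 3).toNat, by omega⟩
  rw [cs_om hb k hk, cs_om hb' k' hk']
  have h99 : (9 : ℤ) ∣ nE b - nE b' := by
    obtain ⟨⟨s, hs⟩, ⟨t, ht⟩⟩ := nine_dvd_iff.1 h9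
    simp only [re_sub, im_sub] at hs ht
    refine ⟨s * (b.re + b'.re) - (s * b.im + b'.re * t) + t * (b.im + b'.im), ?_⟩
    rw [nE_def, nE_def]
    linear_combination (b.re + b'.re) * hs - b.im * hs - b'.re * ht + (b.im + b'.im) * ht
  have hmod : k % 3 = k' % 3 := by omega
  rw [← Nat.div_add_mod k 3, ← Nat.div_add_mod k' 3, hmod, pow_add, pow_add, pow_mul, pow_mul,
    om_cube, one_pow, one_pow]

theorem cs_unit_congr {u b b' : E} (hu : IsUnit u) (hb : (3 : E) ∣ b - 1)
    (h9 : (9 : E) ∣ b - b') : cs u b = cs u b' := by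
  obtain ⟨k, rfl | rfl⟩ := isUnit_E_eq hu
  · rw [cs_pow_left, cs_pow_left, cs_om_congr hb h9]
  · rw [cs_neg_left, cs_neg_left, cs_pow_left, cs_pow_left, cs_om_congr hb h9]

theorem cs_lam_congr {b b' : E} (hb : (3 : E) ∣ b - 1) (h9 : (9 : E) ∣ b - b') :
    cs (1 - om) b = cs (1 - om) b' := by
  have key : ∀ {b b' c : E}, b = 1 + 3 * c → nE c % 3 ≠ 0 → (9 : E) ∣ b - b' →
      cs (1 - om) b = cs (1 - om) b' := by
    intro b b' c hbc hc h9
    obtain ⟨u, hu, hd⟩ := exists_primary hc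
    obtain ⟨e, he⟩ := h9
    have hb : (3 : E) ∣ b - 1 := ⟨c, by rw [hbc]; ring⟩
    have main : ∀ {b c : E}, b = 1 + 3 * c → (3 : E) ∣ c * u - 1 →
        cs (1 - om) b ^ 2 * cs om b ^ 2 = cs u b := by
      intro b c hbc hd
      have hb : (3 : E) ∣ b - 1 := ⟨c, by rw [hbc]; ring⟩
      have h1 : cs (c * u) b = 1 := by
        rw [reciprocity_E hd hb, ← cs_one_left (c * u)]
        obtain ⟨v, hv⟩ := hu.exists_right_inv
        exact cs_congr ⟨3 * v, by rw [hbc]; linear_combination -3 * c * hv⟩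
      have h2 : cs (3 * c) b = 1 := by
        rw [← cs_neg_one b]
        exact cs_congr ⟨1, by rw [hbc]; ring⟩
      have h3 : cs 3 b = cs u b := by
        have : cs (3 * c) b * cs u b = cs 3 b * cs (c * u) b := by
          rw [← cs_mul_left, ← cs_mul_left, mul_assoc]
        rw [h1, h2] at this
        linear_combination -this
      have e3 : (3 : E) = -((1 - om) ^ 2 * om ^ 2) := by decide
      rw [← h3]
      conv_rhs => rw [e3]
      rw [cs_neg_left, cs_mul_left, cs_pow_left, cs_pow_left]
    have m1 := main hbc hd
    have m2 := main (b := b') (c := c - 3 * e) (by linear_combination hbc - he)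
      (by
        have := dvd_sub hd (Dvd.intro (e * u) rfl : (3 : E) ∣ 3 * (e * u))
        convert this using 1; ring)
    have h9' : (9 : E) ∣ b - b' := ⟨e, he⟩
    rw [cs_unit_congr hu hb h9', ← m2, cs_om_congr hb h9'] at m1
    refine (cs_isMu _ _).eq_of_sq_eq (cs_isMu _ _) (mul_right_cancel₀ ?_ m1)
    exact pow_ne_zero _ (cs_ne_zero (isCoprime_of_isUnit isUnit_om))
  obtain ⟨c, hc⟩ := hb
  by_cases hc3 : nE c % 3 = 0
  · have e4 : (4 : E) ≠ 0 := by decide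
    have hb0 : b ≠ 0 := primary_ne_zero ⟨c, hc⟩
    have hb0' : b' ≠ 0 := primary_ne_zero (primary_congr ⟨c, hc⟩ h9)
    have h4 := key (b := 4 * b) (b' := 4 * b') (c := 4 * c + 1) (by linear_combination 4 * hc)
      (by
        rw [nE_mod_three] at hc3 ⊢
        have h : (c.re + c.im) % 3 = 0 ∨ (c.re + c.im) % 3 = 1 ∨ (c.re + c.im) % 3 = 2 := by omega
        have h0 : (c.re + c.im) % 3 = 0 := by
          rcases h with h | h | h
          · exact h
          · rw [h] at hc3; norm_num at hc3
          · rw [h] at hc3; norm_num at hc3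
        have : ((4 * c + 1).re + (4 * c + 1).im) % 3 = 1 := by
          simp; omega
        rw [this]; norm_num)
      (by rw [← mul_sub]; exact h9.mul_left _)
    rw [cs_mul_right _ e4 hb0, cs_mul_right _ e4 hb0'] at h4
    refine mul_left_cancel₀ (cs_ne_zero ⟨-(1 - om ^ 2), 1, ?_⟩) h4
    decide
  · exact key (by linear_combination hc) hc3 h9

/-- Periodicity of the cubic symbol in its modulus. -/
theorem cs_periodic {D : E} (hD : D ≠ 0) {b b' : E} (hb : (3 : E) ∣ b - 1)
    (h9 : (9 : E) ∣ b - b') (h : D ∣ b - b') : cs D b = cs D b' := by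
  have hb' := primary_congr hb h9
  induction D using induction_on_prime with
  | h₁ => exact absurd rfl hD
  | h₂ u hu => exact cs_unit_congr hu hb h9
  | h₃ a p ha hp ih =>
    rw [cs_mul_left, cs_mul_left, ih ha ((Dvd.intro_left _ rfl).trans h)]
    congr 1
    have hpd : p ∣ b - b' := (Dvd.intro _ rfl).trans h
    by_cases h3 : p ∣ 3
    · have e3 : (3 : E) = (1 - om) * ((1 - om) * -om ^ 2) := by decide
      have hl : p ∣ 1 - om := by
        rw [e3] at h3
        refine (hp.dvd_or_dvd h3).elim id fun h => (hp.dvd_or_dvd h).elim id fun h => ?_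
        exact absurd (isUnit_of_dvd_unit h (isUnit_om.pow 2).neg) hp.not_isUnit
      obtain ⟨v, hv⟩ := hl
      have hn : nE p * nE v = 3 := by rw [← map_mul, ← hv]; decide
      have hv1 : IsUnit v := by
        rw [isUnit_E]
        have hp1 : nE p ≠ 1 := fun h => hp.not_isUnit (isUnit_E.2 h)
        have h0 := nE_pos hp.ne_zero
        have h1 : 0 < nE v := by by_contra hneg; nlinarith [nE_nonneg v]
        have h2 : 2 ≤ nE p := by omega
        nlinarith
      have e := cs_lam_congr hb h9
      rw [hv, cs_mul_left, cs_mul_left, cs_unit_congr hv1 hb h9] at e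
      exact mul_right_cancel₀ (cs_ne_zero (isCoprime_of_isUnit hv1)) e
    · obtain ⟨p', ⟨u, rfl⟩, hp', hp1⟩ := Prime.exists_primary hp h3
      have e : cs (p * u) b = cs (p * u) b' := by
        rw [reciprocity_E hp1 hb, reciprocity_E hp1 hb']
        exact cs_congr ((Units.mul_right_dvd).2 hpd)
      rw [cs_mul_left, cs_mul_left, cs_unit_congr u.isUnit hb h9] at e
      exact mul_right_cancel₀ (cs_ne_zero (isCoprime_of_isUnit u.isUnit)) e

open scoped Classical in
theorem exists_isCoprime_add_mul {R : Type*} [CommRing R] [IsDomain R] [IsPrincipalIdealRing R]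
    {a b u : R} (hu : u ≠ 0) (h : ∀ p, Prime p → p ∣ a → p ∣ b → ¬ p ∣ u) :
    ∃ k, IsCoprime (a + b * k) u := by
  refine ⟨((factors u).filter (¬ · ∣ a)).prod, isCoprime_of_prime_dvd (fun h => hu h.2)
    fun p hp hpa hpu => ?_⟩
  by_cases hd : p ∣ a
  · rcases hp.dvd_or_dvd ((dvd_add_right hd).1 hpa) with hb | hk
    · exact h p hp hd hb hpu
    · obtain ⟨q, hq, hpq⟩ := hp.exists_mem_multiset_dvd hk
      rw [Multiset.mem_filter] at hq
      exact hq.2 ((hp.associated_of_dvd (prime_of_factor q hq.1) hpq).symm.dvd.trans hd)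
  · obtain ⟨q, hq, hpq⟩ := exists_mem_factors_of_dvd hu hp.irreducible hpu
    refine hd ((dvd_add_left ?_).1 hpa)
    refine (hpq.dvd.trans (Multiset.dvd_prod ?_)).mul_left _
    exact Multiset.mem_filter.2 ⟨hq, fun h => hd (hpq.dvd.trans h)⟩

theorem O_ext {α β : O} (h1 : α.re = β.re) (h2 : α.im = β.im) : α = β := QuadraticAlgebra.ext h1 h2

theorem dvd_O_iff {e : E} {α : O} : algebraMap E O e ∣ α ↔ e ∣ α.re ∧ e ∣ α.im := by
  constructor
  · rintro ⟨w, rfl⟩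
    exact ⟨⟨w.re, by simp⟩, ⟨w.im, by simp⟩⟩
  · rintro ⟨⟨a, ha⟩, ⟨b, hb⟩⟩
    exact ⟨⟨a, b⟩, by ext1 <;> simp [ha, hb]⟩

theorem three_dvd_O_iff {α : O} : (3 : O) ∣ α ↔ (3 : E) ∣ α.re ∧ (3 : E) ∣ α.im := by
  rw [← dvd_O_iff, map_ofNat]

theorem primary_O_iff {α : O} : (3 : O) ∣ α - 1 ↔ (3 : E) ∣ α.re - 1 ∧ (3 : E) ∣ α.im := by
  rw [three_dvd_O_iff]
  simp

theorem primary_O_ne_zero {α : O} (h : (3 : O) ∣ α - 1) : α ≠ 0 := by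
  rintro rfl
  exact primary_ne_zero (primary_O_iff.1 h).1 rfl

theorem primary_mul {R : Type*} [CommRing R] {a b : R} (ha : (3 : R) ∣ a - 1)
    (hb : (3 : R) ∣ b - 1) : (3 : R) ∣ a * b - 1 := by
  have := dvd_add (ha.mul_right b) hb
  convert this using 1; ring

theorem nine_dvd_sq {v : E} (h : (3 : E) ∣ v) : (9 : E) ∣ v ^ 2 := by
  have := pow_dvd_pow_of_dvd h 2
  norm_num at this ⊢
  exact this

theorem primary_nO {α : O} (h : (3 : O) ∣ α - 1) : (3 : E) ∣ nO α - 1 := by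
  obtain ⟨h1, h2⟩ := primary_O_iff.1 h
  have := dvd_add (primary_mul h1 h1) (h2.mul_right α.im)
  rw [nO_def]
  convert this using 1; ring

theorem nO_nine {α : O} (h : (3 : O) ∣ α - 1) : (9 : E) ∣ nO α - α.re ^ 2 := by
  obtain ⟨h1, h2⟩ := primary_O_iff.1 h
  rw [nO_def]
  simpa using nine_dvd_sq h2

theorem isCoprime_im_nO {α : O} (h : IsCoprime α.re α.im) : IsCoprime α.im (nO α) := by
  rw [nO_def, pow_two α.im]
  exact IsCoprime.add_mul_left_right (h.symm.pow_right (n := 2)) _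

theorem isCoprime_three_O {α : O} (h : (3 : O) ∣ α - 1) : IsCoprime α 3 := isCoprime_three h

theorem cs_im_nO {α : O} (h : (3 : O) ∣ α - 1) (h0 : α.im ≠ 0) :
    cs α.im (nO α) = cs α.im α.re ^ 2 := by
  obtain ⟨h1, h2⟩ := primary_O_iff.1 h
  rw [← cs_pow_right _ (primary_ne_zero h1)]
  refine cs_periodic h0 (primary_nO h) (nO_nine h) ?_
  rw [nO_def]
  exact ⟨α.im, by ring⟩

theorem reciprocity_O_aux {α β : O} (hα : (3 : O) ∣ α - 1) (hβ : (3 : O) ∣ β - 1)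
    (pα : IsCoprime α.re α.im) (pβ : IsCoprime β.re β.im) (h : IsCoprime α β)
    (hre : IsCoprime α.re β.re) : cs α β = cs β α := by
  obtain ⟨hu, hv⟩ := primary_O_iff.1 hα
  obtain ⟨hx, hy⟩ := primary_O_iff.1 hβ
  have him : ∀ {α : O}, (3 : O) ∣ α - 1 → IsCoprime α.re α.im → α.im = 0 → α = 1 := by
    intro α hα pα h0
    rw [h0, isCoprime_zero_right, isUnit_E] at pα
    exact O_ext (eq_one_of_primary_unit pα (primary_O_iff.1 hα).1) h0
  by_cases hv0 : α.im = 0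
  · rw [him hα pα hv0, cs_one_left, cs_one_right]
  by_cases hy0 : β.im = 0
  · rw [him hβ pβ hy0, cs_one_left, cs_one_right]
  have hα0 := primary_O_ne_zero hα
  have hβ0 := primary_O_ne_zero hβ
  set Δ := α.im * β.re - α.re * β.im with hΔ
  have e1 : cs Δ (nO α) = cs α.im (nO α) * cs β α := by
    rw [← cs_base _ hα0 (isCoprime_three_O hα), ← cs_base _ hα0 (isCoprime_three_O hα),
      ← cs_mul_left]
    refine cs_congr ⟨-algebraMap E O β.im, ?_⟩
    ext1 <;> (simp [hΔ]; try ring)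
  have e2 : cs Δ (nO β) = cs β.im (nO β) * cs α β := by
    rw [← cs_neg_left, ← cs_base _ hβ0 (isCoprime_three_O hβ),
      ← cs_base _ hβ0 (isCoprime_three_O hβ), ← cs_mul_left]
    refine cs_congr ⟨-algebraMap E O α.im, ?_⟩
    ext1 <;> (simp [hΔ]; try ring)
  have c1 := cs_ne_zero (isCoprime_im_nO pα)
  have c2 := cs_ne_zero (isCoprime_im_nO pβ)
  have n1 := cs_ne_zero h
  have n2 := cs_ne_zero h.symm
  by_cases hΔ0 : Δ = 0
  · have hunit : ∀ {α : O}, (3 : O) ∣ α - 1 → cs Δ (nO α) ≠ 0 → IsUnit α := by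
      intro α hα h
      by_contra hu
      refine h ?_
      rw [hΔ0]
      refine cs_zero_left (primary_ne_zero (primary_nO hα)) (isCoprime_three (primary_nO hα)) ?_
      rwa [isUnit_E, ← N_def, ← isUnit_O]
    rw [cs_unit _ (hunit hα (by rw [e1]; exact mul_ne_zero c1 n2)),
      cs_unit _ (hunit hβ (by rw [e2]; exact mul_ne_zero c2 n1))]
  have e3 : cs Δ (β.re ^ 2 * nO α) = cs Δ (α.re ^ 2 * nO β) := by
    refine cs_periodic hΔ0 ?_ ?_ ?_
    · exact primary_mul (by rw [pow_two]; exact primary_mul hx hx) (primary_nO hα)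
    · have := dvd_sub ((nine_dvd_sq hv).mul_left (β.re ^ 2)) ((nine_dvd_sq hy).mul_left (α.re ^ 2))
      rw [nO_def, nO_def]
      convert this using 1; ring
    · rw [nO_def, nO_def]
      exact ⟨α.im * β.re + α.re * β.im, by rw [hΔ]; ring⟩
  have f1 : cs Δ β.re = cs α.re β.re * cs β.im β.re := by
    rw [← cs_mul_left, ← cs_neg_left]
    exact cs_congr ⟨-α.im, by rw [hΔ]; ring⟩
  have f2 : cs Δ α.re = cs β.re α.re * cs α.im α.re := by
    rw [← cs_mul_left]
    exact cs_congr ⟨-β.im, by rw [hΔ]; ring⟩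
  have hx0 := primary_ne_zero hx
  have hu0 := primary_ne_zero hu
  rw [cs_mul_right _ (pow_ne_zero 2 hx0) (primary_ne_zero (primary_nO hα)),
    cs_mul_right _ (pow_ne_zero 2 hu0) (primary_ne_zero (primary_nO hβ)), cs_pow_right _ hx0,
    cs_pow_right _ hu0, f1, f2, e1, e2, cs_im_nO hα hv0, cs_im_nO hβ hy0, reciprocity_E hx hu] at e3
  have g1 := cs_ne_zero hre
  have g2 := cs_ne_zero pα.symm
  have g3 := cs_ne_zero pβ.symm
  refine mul_left_cancel₀ (pow_ne_zero 2 (mul_ne_zero (mul_ne_zero g1 g2) g3)) ?_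
  linear_combination -e3

theorem reciprocity_O {α β : O} (hα : (3 : O) ∣ α - 1) (hβ : (3 : O) ∣ β - 1)
    (pα : IsCoprime α.re α.im) (pβ : IsCoprime β.re β.im) : cs α β = cs β α := by
  by_cases h : IsCoprime α β
  swap
  · rw [cs_eq_zero (primary_O_ne_zero hβ) (isCoprime_three hβ) h,
      cs_eq_zero (primary_O_ne_zero hα) (isCoprime_three hα) fun h' => h h'.symm]
  obtain ⟨hu, hv⟩ := primary_O_iff.1 hα
  obtain ⟨hx, hy⟩ := primary_O_iff.1 hβ
  have hb0 := primary_O_ne_zero hβ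
  obtain ⟨k', hk'⟩ : ∃ k', IsCoprime (β.re + -(3 * β.im * (nO α * nO β)) * k') α.re := by
    refine exists_isCoprime_add_mul (primary_ne_zero hu) fun p hp hpx hpb hpu => ?_
    have h3 : ¬ p ∣ 3 := not_dvd_three_of_coprime (isCoprime_three hu) hp hpu
    have hpy : ¬ p ∣ β.im := fun h => hp.not_isUnit (pβ.isUnit_of_dvd' hpx h)
    have hpv : ¬ p ∣ α.im := fun h => hp.not_isUnit (pα.isUnit_of_dvd' hpu h)
    rw [dvd_neg] at hpb
    rcases hp.dvd_or_dvd hpb with h | h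
    · exact (hp.dvd_or_dvd h).elim h3 hpy
    rw [nO_def, nO_def] at h
    rcases hp.dvd_or_dvd h with h | h
    · exact hpv (hp.dvd_of_dvd_pow ((dvd_add_right (dvd_pow hpu two_ne_zero)).1 h))
    · exact hpy (hp.dvd_of_dvd_pow ((dvd_add_right (dvd_pow hpx two_ne_zero)).1 h))
  set k := nO α * nO β * k' with hk
  let γ : O := ⟨1, 3 * k⟩
  have hγ : (3 : O) ∣ γ - 1 := primary_O_iff.2 ⟨by simp [γ], Dvd.intro _ rfl⟩
  have pγ : IsCoprime γ.re γ.im := isCoprime_one_left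
  have hγα : IsCoprime γ α := by
    have hd : α ∣ γ - 1 := by
      refine (dvd_algebraMap_nO α).trans ?_
      rw [dvd_O_iff]
      exact ⟨by simp [γ], by simp [γ]; exact ⟨3 * (nO β * k'), by rw [hk]; ring⟩⟩
    obtain ⟨c, hc⟩ := hd
    exact ⟨1, -c, by linear_combination hc⟩
  have hre : (β * γ).re = β.re - 3 * k * β.im := by simp [γ]; ring
  have him : (β * γ).im = β.im + 3 * k * β.re := by simp [γ]; ring
  have pβγ : IsCoprime (β * γ).re (β * γ).im := by
    refine isCoprime_of_prime_dvd ?_ fun p hp h1 h2 => ?_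
    · rintro ⟨h1, h2⟩
      exact mul_ne_zero hb0 (primary_O_ne_zero hγ) (O_ext h1 h2)
    · rw [hre] at h1; rw [him] at h2
      have h3 : p ∣ (1 + (3 * k) ^ 2) := by
        by_contra hd
        refine hp.not_isUnit (pβ.isUnit_of_dvd' ?_ ?_)
        · refine (hp.dvd_or_dvd ?_).resolve_left hd
          convert dvd_add h1 (h2.mul_left (3 * k)) using 1; ring
        · refine (hp.dvd_or_dvd ?_).resolve_left hd
          convert dvd_sub h2 (h1.mul_left (3 * k)) using 1; ring
      have h4 : p ∣ nO β := by
        rw [nO_def]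
        convert dvd_add (h1.mul_right (β.re + 3 * k * β.im)) (h3.mul_right (β.im ^ 2)) using 1
        ring
      refine hp.not_dvd_one ((dvd_add_left (a := p) (b := 1) ?_).1 h3)
      refine dvd_pow (h4.trans ⟨3 * (nO α * k'), by rw [hk]; ring⟩) two_ne_zero
  have r1 := reciprocity_O_aux hα hγ pα pγ hγα.symm isCoprime_one_right
  have r2 := reciprocity_O_aux hα (primary_mul hβ hγ) pα pβγ (h.mul_right hγα.symm) (by
    rw [hre, show β.re - 3 * k * β.im = β.re + -(3 * β.im * (nO α * nO β)) * k' by rw [hk]; ring]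
    exact hk'.symm)
  rw [cs_mul_left, cs_mul_right _ hb0 (primary_O_ne_zero hγ), r1] at r2
  exact mul_right_cancel₀ (cs_ne_zero hγα) r2

/-- The automorphism of `O` over `E`. -/
def sig : O ≃+* O := starRingAut

/-- The automorphism of `O` over the Gaussian integers. -/
def tau : O ≃+* O where
  toFun α := ⟨star α.re, star α.im⟩
  invFun α := ⟨star α.re, star α.im⟩
  left_inv α := by ext1 <;> simp
  right_inv α := by ext1 <;> simp
  map_mul' α β := by ext1 <;> simp
  map_add' α β := by ext1 <;> simp

theorem tau_re (α : O) : (tau α).re = star α.re := rfl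
theorem tau_im (α : O) : (tau α).im = star α.im := rfl

theorem star_re (α : O) : (star α).re = α.re := by simp
theorem star_im (α : O) : (star α).im = -α.im := by simp

theorem cs_sig (α : O) {β : O} (hβ : β ≠ 0) : cs (star α) (star β) = cs α β :=
  cs_map sig (RingEquiv.refl E) (fun e => by ext1 <;> simp [sig]) α hβ

theorem cs_tau (α : O) {β : O} (hβ : β ≠ 0) : cs (tau α) (tau β) = star (cs α β) :=
  cs_map tau conjE (fun e => by ext1 <;> simp [tau, conjE]) α hβ

theorem primary_O_star {α : O} (h : (3 : O) ∣ α - 1) : (3 : O) ∣ star α - 1 := by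
  rw [primary_O_iff] at h ⊢
  rw [star_re, star_im]
  exact ⟨h.1, h.2.neg_right⟩

theorem primary_O_tau {α : O} (h : (3 : O) ∣ α - 1) : (3 : O) ∣ tau α - 1 := by
  rw [primary_O_iff] at h ⊢
  refine ⟨primary_star h.1, ?_⟩
  obtain ⟨c, hc⟩ := h.2
  exact ⟨star c, by rw [tau_im, hc, star_mul']; rfl⟩

theorem N_star (α : O) : N (star α) = N α := by rw [N_def, N_def, nO_star]

theorem N_tau (α : O) : N (tau α) = N α := by
  rw [N_def, N_def, ← nE_star (nO α), nO_def, nO_def, tau_re, tau_im]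
  simp

/-- Elements whose two coordinates are coprime. -/
def Prim (α : O) : Prop := IsCoprime α.re α.im

theorem Prim.star {α : O} (h : Prim α) : Prim (star α) := by
  unfold Prim at h ⊢
  rw [star_re, star_im]; exact h.neg_right

theorem Prim.tau {α : O} (h : Prim α) : Prim (tau α) := IsCoprime.map h (conjE : E →+* E)

/-- The symbol of an element over its own conjugate. -/
noncomputable def fsym (α : O) : E := cs (star α) α

theorem fsym_isMu (α : O) : IsMu (fsym α) := cs_isMu _ _

theorem fsym_eq_zero_of_not_prim {α β : O} (hα : (3 : O) ∣ α - 1) (h : ¬ Prim α)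
    (hβ : (3 : O) ∣ β - 1) (hd : α ∣ β) : fsym β = 0 := by
  refine cs_eq_zero (primary_O_ne_zero hβ) (isCoprime_three hβ) fun hc => h ?_
  refine isCoprime_of_prime_dvd (fun h0 => primary_O_ne_zero hα (O_ext h0.1 h0.2))
    fun p hp h1 h2 => hp.not_isUnit ?_
  have d1 : algebraMap E O p ∣ β := (dvd_O_iff.2 ⟨h1, h2⟩).trans hd
  have d2 : algebraMap E O p ∣ star β := by
    rw [dvd_O_iff] at d1 ⊢
    rw [star_re, star_im]
    exact ⟨d1.1, d1.2.neg_right⟩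
  have := isUnit_O.1 (hc.isUnit_of_dvd' d2 d1)
  rw [N_def, nO_algebraMap, map_pow] at this
  rw [isUnit_E]
  nlinarith [nE_nonneg p]

theorem prim_of_dvd {α β : O} (hα : (3 : O) ∣ α - 1) (hβ : (3 : O) ∣ β - 1) (hd : α ∣ β)
    (h : fsym β ≠ 0) : Prim α := by
  by_contra h'
  exact h (fsym_eq_zero_of_not_prim hα h' hβ hd)

theorem fsym_mul {α β : O} (hα : (3 : O) ∣ α - 1) (hβ : (3 : O) ∣ β - 1) :
    fsym (α * β) = fsym α * fsym β * cs β (star α) ^ 2 := by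
  by_cases pα : Prim α
  swap
  · rw [fsym_eq_zero_of_not_prim hα pα hα dvd_rfl,
      fsym_eq_zero_of_not_prim hα pα (primary_mul hα hβ) (dvd_mul_right _ _)]
    simp
  by_cases pβ : Prim β
  swap
  · rw [fsym_eq_zero_of_not_prim hβ pβ hβ dvd_rfl,
      fsym_eq_zero_of_not_prim hβ pβ (primary_mul hα hβ) (dvd_mul_left _ _)]
    simp
  have hα0 := primary_O_ne_zero hα
  have e1 : cs (star β) α = cs β (star α) := by
    rw [← cs_sig _ hα0, star_star]
  have e2 : cs (star α) β = cs β (star α) :=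
    reciprocity_O (primary_O_star hα) hβ pα.star pβ
  rw [fsym, fsym, fsym, cs_mul_right _ hα0 (primary_O_ne_zero hβ), star_mul', cs_mul_left,
    cs_mul_left, e1, e2]
  ring

theorem fsym_unit_mul {ε α : O} (hε : IsUnit ε) (h3 : (3 : O) ∣ ε - 1) (hα : (3 : O) ∣ α - 1) :
    fsym (ε * α) = fsym α := by
  have hs : IsUnit (star ε) := hε.map sig
  rw [fsym_mul h3 hα, cs_unit _ hs, fsym, cs_unit _ hε]
  ring

/-- The square root of `-1` in `O`. -/
def II : O := ⟨0, 1⟩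

theorem II_cube : (-II) ^ 3 = II := by decide

theorem cs_II {α : O} : cs II α = 1 := by
  have hu : IsUnit (-II) := IsUnit.of_mul_eq_one II (by decide)
  rw [← II_cube, cs_pow_left, cs_cube (isCoprime_of_isUnit hu)]

theorem fsym_eq {α : O} (hα : (3 : O) ∣ α - 1) : fsym α = cs (2 * α.im) (nO α) := by
  rw [← cs_base _ (primary_O_ne_zero hα) (isCoprime_three hα), fsym]
  have : cs (star α) α = cs (-(algebraMap E O (2 * α.im) * II)) α := by
    refine cs_congr ⟨1, ?_⟩
    ext1
    · simp [II]
    · simp [II]; ring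
  rw [this, cs_neg_left, cs_mul_left, cs_II, mul_one]

theorem fsym_eq_of_im_ne_zero {α : O} (hα : (3 : O) ∣ α - 1) (h : α.im ≠ 0) :
    fsym α = cs 2 (nO α) * cs α.im α.re ^ 2 := by
  rw [fsym_eq hα, cs_mul_left, cs_im_nO hα h]

/-- The relative norm to the Gaussian integers. -/
theorem exists_gaussian (α : O) : ∃ a b : ℤ, α * tau α = ⟨a, b⟩ ∧ N α = a ^ 2 + b ^ 2 := by
  have hfix : ∀ z : E, star z = z → z = (z.re : ℤ) := by
    intro z hz
    have := congrArg im hz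
    simp at this
    ext
    · simp
    · simp; omega
  have hs : tau (α * tau α) = α * tau α := by
    rw [map_mul, show tau (tau α) = α from tau.left_inv α, mul_comm]
  have h1 := hfix _ (congrArg re hs)
  have h2 := hfix _ (congrArg im hs)
  refine ⟨(α * tau α).re.re, (α * tau α).im.re, O_ext h1 h2, ?_⟩
  have h3 : N (α * tau α) = ((α * tau α).re.re ^ 2 + (α * tau α).im.re ^ 2) ^ 2 := by
    rw [N_def, nO_def, h1, h2, ← Int.cast_pow, ← Int.cast_pow, ← Int.cast_add, nE_intCast]
    simp
  rw [map_mul, N_tau, ← pow_two] at h3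
  exact (pow_left_inj₀ (N_nonneg α) (by positivity) two_ne_zero).1 h3

theorem intCast_dvd_of_dvd {α : O} {p : ℕ} (hp : p.Prime) (hN : N α = p) {n : ℤ}
    (h : α ∣ (n : O)) : (p : ℤ) ∣ n := by
  have h1 : N α ∣ N (n : O) := map_dvd N h
  rw [hN, N_intCast] at h1
  exact (Nat.prime_iff_prime_int.1 hp).dvd_of_dvd_pow h1

theorem dvd_natCast_norm (α : O) : α ∣ (N α : O) := ⟨coN α, (mul_coN α).symm⟩

theorem prime_of_norm {α : O} {p : ℕ} (hp : p.Prime) (hN : N α = p) : Prime α := by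
  refine Irreducible.prime ⟨fun h => ?_, fun a b hab => ?_⟩
  · rw [isUnit_O, hN] at h
    exact hp.ne_one (by exact_mod_cast h)
  · rw [isUnit_O, isUnit_O]
    have h : N a * N b = p := by rw [← map_mul, ← hab, hN]
    have ha := N_nonneg a
    have hb := N_nonneg b
    lift N a to ℕ using ha with x
    lift N b to ℕ using hb with y
    norm_cast at h ⊢
    exact (Nat.prime_mul_iff.1 (h.symm ▸ hp)).elim (fun h => Or.inr h.2) fun h => Or.inl h.2

theorem sq_eq_of_sum_sq {p a b A B : ℤ} (hp : Prime p) (h0 : 0 < p) (h : p = a ^ 2 + b ^ 2)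
    (H : p = A ^ 2 + B ^ 2) : A ^ 2 = a ^ 2 ∨ A ^ 2 = b ^ 2 := by
  have key : ∀ b, p = a ^ 2 + b ^ 2 → p ∣ a * B - b * A → A ^ 2 = a ^ 2 ∨ A ^ 2 = b ^ 2 := by
    intro b h hd
    obtain ⟨k, hk⟩ := hd
    have h2 : p ∣ (a * A + b * B) := by
      refine hp.dvd_of_dvd_pow (n := 2) ⟨p - p * k ^ 2, ?_⟩
      have : (a * A + b * B) ^ 2 = (a ^ 2 + b ^ 2) * (A ^ 2 + B ^ 2) - (a * B - b * A) ^ 2 := by ring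
      rw [this, ← h, ← H, hk]; ring
    obtain ⟨l, hl⟩ := h2
    have h3 : p ^ 2 * (k ^ 2 + l ^ 2) = p ^ 2 * 1 := by
      have : (a * A + b * B) ^ 2 = (a ^ 2 + b ^ 2) * (A ^ 2 + B ^ 2) - (a * B - b * A) ^ 2 := by ring
      rw [← h, ← H, hk, hl] at this
      linear_combination this
    have h4 := mul_left_cancel₀ (pow_ne_zero 2 h0.ne') h3
    have hkl : k = 0 ∨ l = 0 := by
      by_contra! hc
      have := Int.one_le_abs hc.1
      have := Int.one_le_abs hc.2
      nlinarith [sq_abs k, sq_abs l]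
    rcases hkl with rfl | rfl
    · left
      have e : a * B = b * A := by linarith
      have e2 : p * (A ^ 2 - a ^ 2) = 0 := by
        have : (a * B) ^ 2 = (b * A) ^ 2 := by rw [e]
        linear_combination (A ^ 2) * h - a ^ 2 * H - this
      have := (mul_eq_zero.1 e2).resolve_left h0.ne'
      linarith
    · right
      have e : a * A = -(b * B) := by linarith
      have e2 : p * (A ^ 2 - b ^ 2) = 0 := by
        have : (a * A) ^ 2 = (b * B) ^ 2 := by rw [e]; ring
        linear_combination (A ^ 2) * h - b ^ 2 * H + this
      have := (mul_eq_zero.1 e2).resolve_left h0.ne'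
      linarith
  have hd : p ∣ (a * B - b * A) * (a * B - -b * A) :=
    ⟨a ^ 2 - A ^ 2, by linear_combination (A ^ 2) * h - a ^ 2 * H⟩
  rcases hp.dvd_or_dvd hd with hd | hd
  · exact key b h hd
  · have := key (-b) (by rw [h]; ring) hd
    rwa [neg_sq] at this

theorem cs_star_tau {α : O} (hα : (3 : O) ∣ α - 1) (pα : Prim α) (hne : cs (star (tau α)) α ≠ 0) :
    cs (star (tau α)) α = 1 := by
  have hα0 := primary_O_ne_zero hα
  refine (cs_isMu _ _).eq_one_of_star hne ?_
  have h1 := cs_sig (tau (star (tau α))) (β := tau α) (by simpa using hα0)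
  rw [cs_tau _ hα0] at h1
  rw [← h1, show star (tau (star (tau α))) = α by ext1 <;> simp [tau],
    reciprocity_O hα (primary_O_star (primary_O_tau hα)) pα pα.tau.star]

theorem N_primary_mod {α : O} (hα : (3 : O) ∣ α - 1) : N α % 3 = 1 :=
  nE_primary_mod (primary_nO hα)

theorem cs_trace_eq_fsym {α : O} (hα : (3 : O) ∣ α - 1) {p : ℕ} (hp : p.Prime) (hN : N α = p)
    {A B : ℤ} (hAB : (p : ℤ) = A ^ 2 + B ^ 2) :
    cs ((2 * A : ℤ) : O) α = fsym α ∧ fsym α ≠ 0 := by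
  obtain ⟨a, b, hz, hab⟩ := exists_gaussian α
  rw [hN] at hab
  have hpZ := Nat.prime_iff_prime_int.1 hp
  have hp3 : p % 3 = 1 := by
    have := N_primary_mod hα
    rw [hN] at this
    exact_mod_cast this
  have hp2 : p ≠ 2 := by omega
  have ha0 : ∀ a b : ℤ, (p : ℤ) = a ^ 2 + b ^ 2 → ¬ (p : ℤ) ∣ 2 * a := by
    intro a b hab hd
    have hd := (hpZ.dvd_or_dvd hd).resolve_left fun h => hp2
      ((Nat.prime_dvd_prime_iff_eq hp Nat.prime_two).1 (by exact_mod_cast h))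
    have hp1 : (2 : ℤ) ≤ p := by exact_mod_cast hp.two_le
    have h1 : a ^ 2 < p ^ 2 := by nlinarith [sq_nonneg b]
    have ha : a = 0 := Int.eq_zero_of_abs_lt_dvd hd (abs_lt_of_sq_lt_sq h1 (by positivity))
    rw [ha] at hab
    have : ¬ IsSquare (p : ℤ) := hpZ.not_isSquare
    exact this ⟨b, by rw [hab]; ring⟩
  have hαp := prime_of_norm hp hN
  have h3 := not_dvd_three_of_coprime (isCoprime_three hα) hαp dvd_rfl
  have hα0 := primary_O_ne_zero hα
  have hzbar : star α * star (tau α) = ⟨a, -b⟩ := by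
    rw [← star_mul', hz]; ext1 <;> simp
  have h1 : cs ((2 * a : ℤ) : O) α = cs (star α * star (tau α)) α := by
    refine cs_congr ⟨tau α, ?_⟩
    rw [hzbar, hz]
    ext1 <;> simp; ring
  have h2 : cs ((2 * b : ℤ) : O) α = cs (star α * star (tau α)) α := by
    have e : cs ((2 * b : ℤ) : O) α = cs ((2 * b : ℤ) * II) α := by
      rw [cs_mul_left, cs_II, mul_one]
    rw [e, ← cs_neg_left (star α * star (tau α))]
    refine cs_congr ⟨tau α, ?_⟩
    rw [hzbar, hz]
    ext1 <;> simp [II]; ring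
  have hne : cs ((2 * a : ℤ) : O) α ≠ 0 := by
    rw [cs_prime _ hαp, Ne, lsym_eq_zero hαp h3]
    exact fun h => ha0 a b hab (intCast_dvd_of_dvd hp hN h)
  have hne' := hne
  rw [h1, cs_mul_left] at hne
  have hst := cs_star_tau hα (prim_of_dvd hα hα dvd_rfl (left_ne_zero_of_mul hne)) (right_ne_zero_of_mul hne)
  rw [cs_mul_left, hst, mul_one] at h1 h2
  refine ⟨?_, left_ne_zero_of_mul hne⟩
  have hneg : ∀ x y : ℤ, x ^ 2 = y ^ 2 → cs ((2 * x : ℤ) : O) α = cs ((2 * y : ℤ) : O) α := by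
    intro x y h
    rcases sq_eq_sq_iff_eq_or_eq_neg.1 h with rfl | rfl
    · rfl
    · rw [mul_neg, Int.cast_neg, cs_neg_left]
  rcases sq_eq_of_sum_sq hpZ (by exact_mod_cast hp.pos) hab hAB with h | h
  · rw [hneg _ _ h, h1]; rfl
  · rw [hneg _ _ h, h2]; rfl

theorem gaussian_pow_four {z : GaussianInt} (h : z ^ 4 = 1) : star z * z = 1 := by
  have h1 : (z.norm) ^ 4 = 1 := by
    have := congrArg Zsqrtd.normMonoidHom h
    rwa [map_pow, map_one] at this
  have h2 : z.norm = 1 := by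
    have h0 : 0 ≤ z.norm := Zsqrtd.norm_nonneg (by norm_num) z
    exact (pow_eq_one_iff_of_nonneg h0 (by norm_num)).1 h1
  rw [mul_comm, ← Zsqrtd.norm_eq_mul_conj, h2, Int.cast_one]

theorem apE_eq_neg_sum (p : ℕ) [hp : Fact p.Prime] (h2 : p ≠ 2) :
    apE p = -∑ x : ZMod p, quadraticChar (ZMod p) (x ^ 3 - x) := by
  have hF : ringChar (ZMod p) ≠ 2 := by rwa [ZMod.ringChar_zmod_n]
  have h : (Nat.card {xy : ZMod p × ZMod p // xy.2 ^ 2 = xy.1 ^ 3 - xy.1} : ℤ) =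
      ∑ x : ZMod p, (quadraticChar (ZMod p) (x ^ 3 - x) + 1) := by
    have e : {xy : ZMod p × ZMod p // xy.2 ^ 2 = xy.1 ^ 3 - xy.1} ≃
        Σ x : ZMod p, {y : ZMod p // y ^ 2 = x ^ 3 - x} :=
      { toFun := fun xy => ⟨xy.1.1, xy.1.2, xy.2⟩
        invFun := fun s => ⟨(s.1, s.2.1), s.2.2⟩
        left_inv := fun _ => rfl
        right_inv := fun _ => rfl }
    rw [Nat.card_congr e, Nat.card_sigma, Nat.cast_sum]
    refine Finset.sum_congr rfl fun x _ => ?_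
    rw [← quadraticChar_card_sqrts hF, Nat.card_eq_fintype_card, Set.toFinset_card]
    rfl
  rw [apE, h, Finset.sum_add_distrib]
  simp [ZMod.card]

theorem exists_apE_eq (p : ℕ) [hp : Fact p.Prime] (h4 : p % 4 = 1) :
    ∃ A B : ℤ, apE p = 2 * A ∧ (p : ℤ) = A ^ 2 + B ^ 2 := by
  have h2 : p ≠ 2 := by omega
  have hF : ringChar (ZMod p) ≠ 2 := by rwa [ZMod.ringChar_zmod_n]
  have hζ : IsPrimitiveRoot (⟨0, 1⟩ : GaussianInt) 4 :=
    IsPrimitiveRoot.mk_of_lt _ (by norm_num) (by decide) fun l h0 hl => by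
      interval_cases l <;> decide
  obtain ⟨χ, hχ⟩ := MulChar.exists_mulChar_orderOf (ZMod p) (n := 4)
    (by rw [ZMod.card]; omega) hζ
  have hχ4 : χ ^ 4 = 1 := by rw [← hχ]; exact pow_orderOf_eq_one χ
  have hχ2 : χ ^ 2 ≠ 1 := pow_ne_one_of_lt_orderOf two_ne_zero (by rw [hχ]; norm_num)
  have hval : ∀ x : ZMod p, x ≠ 0 → χ x ^ 4 = 1 := fun x hx => by
    rw [← MulChar.pow_apply' χ four_ne_zero, hχ4, MulChar.one_apply (IsUnit.mk0 x hx)]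
  have hη : ∀ x : ZMod p, (χ ^ 2) x = (quadraticChar (ZMod p) x : GaussianInt) := by
    have hsq : ∀ x : ZMod p, x ≠ 0 → IsSquare x → χ x ^ 2 = 1 := by
      rintro x hx ⟨y, rfl⟩
      have hy : y ≠ 0 := left_ne_zero_of_mul hx
      rw [← hval y hy, map_mul]; ring
    obtain ⟨u, hu⟩ : ∃ u : (ZMod p)ˣ, χ u ^ 2 ≠ 1 := by
      by_contra! h
      refine hχ2 (MulChar.ext fun u => ?_)
      rw [MulChar.pow_apply_coe, h, MulChar.one_apply_coe]
    have hu0 : (u : ZMod p) ≠ 0 := u.ne_zero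
    have hu1 : χ u ^ 2 = -1 := by
      have := hval u hu0
      have : (χ u ^ 2 - 1) * (χ u ^ 2 + 1) = 0 := by linear_combination this
      exact eq_neg_of_add_eq_zero_left ((mul_eq_zero.1 this).resolve_left (sub_ne_zero.2 hu))
    have hqu : quadraticChar (ZMod p) u = -1 :=
      (quadraticChar_dichotomy hu0).resolve_left fun h =>
        hu (hsq _ hu0 ((quadraticChar_one_iff_isSquare hu0).1 h))
    intro x
    by_cases hx : x = 0
    · rw [hx, MulChar.map_zero, MulChar.map_zero, Int.cast_zero]
    rw [MulChar.pow_apply' χ two_ne_zero]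
    rcases quadraticChar_dichotomy hx with h | h
    · rw [h, hsq x hx ((quadraticChar_one_iff_isSquare hx).1 h), Int.cast_one]
    · have h1 : quadraticChar (ZMod p) (x * u) = 1 := by rw [map_mul, h, hqu]; norm_num
      have h2 := hsq _ (mul_ne_zero hx hu0)
        ((quadraticChar_one_iff_isSquare (mul_ne_zero hx hu0)).1 h1)
      rw [map_mul, mul_pow, hu1] at h2
      rw [h, Int.cast_neg, Int.cast_one]
      linear_combination -h2
  have hinv : χ⁻¹ = χ.ringHomComp (starRingEnd GaussianInt) := by
    refine MulChar.ext fun u => ?_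
    rw [MulChar.ringHomComp_apply, starRingEnd_apply]
    have h1 := gaussian_pow_four (hval u u.ne_zero)
    have h2 : χ⁻¹ u * χ u = 1 := by
      rw [← MulChar.mul_apply, inv_mul_cancel, MulChar.one_apply_coe]
    exact mul_right_cancel₀ (right_ne_zero_of_mul_eq_one h2) (h2.trans h1.symm)
  have hinv2 : (χ ^ 2)⁻¹ = χ ^ 2 := inv_eq_of_mul_eq_one_right (by rw [← pow_add, hχ4])
  have hstar2 : (χ ^ 2).ringHomComp (starRingEnd GaussianInt) = χ ^ 2 := by
    rw [← MulChar.ringHomComp_pow, ← hinv, inv_pow, hinv2]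
  set J := jacobiSum χ (χ ^ 2) with hJ
  have hJstar : jacobiSum (χ⁻¹) (χ ^ 2) = star J := by
    rw [← hstar2, hinv, jacobiSum_ringHomComp]
    rfl
  have hm1 : (χ ^ 2) (-1) = 1 := by
    rw [MulChar.pow_apply' χ two_ne_zero, ← map_pow, neg_one_sq, map_one]
  have hsum : ((∑ x : ZMod p, quadraticChar (ZMod p) (x ^ 3 - x) : ℤ) : GaussianInt) =
      J + star J := by
    have e1 : ∀ x : ZMod p, (quadraticChar (ZMod p) (x ^ 3 - x) : GaussianInt) =
        χ (x ^ 2) * (χ ^ 2) (1 - x ^ 2) := by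
      intro x
      rw [← hη, show x ^ 3 - x = (-1) * (x * (1 - x ^ 2)) by ring, map_mul, hm1, one_mul, map_mul,
        map_pow, MulChar.pow_apply' χ two_ne_zero x]
    have e2 : ∀ g : ZMod p → GaussianInt, ∑ x : ZMod p, g (x ^ 2) =
        ∑ t : ZMod p, (1 + (χ ^ 2) t) * g t := by
      intro g
      rw [← Finset.sum_fiberwise_of_maps_to (g := fun x : ZMod p => x ^ 2)
        (fun x _ => Finset.mem_univ _)]
      refine Finset.sum_congr rfl fun t _ => ?_
      rw [Finset.sum_congr rfl (g := fun _ => g t)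
        (fun x hx => by rw [(Finset.mem_filter.1 hx).2]), Finset.sum_const, nsmul_eq_mul, hη]
      congr 1
      have := quadraticChar_card_sqrts hF t
      have h' := congrArg (Int.cast : ℤ → GaussianInt) this
      push_cast at h'
      rw [add_comm, ← h']
      congr 2
      ext x; simp
    rw [Int.cast_sum, Finset.sum_congr rfl fun x _ => e1 x, e2 fun t => χ t * (χ ^ 2) (1 - t),
      ← hJstar, hJ, jacobiSum, jacobiSum, ← Finset.sum_add_distrib]
    refine Finset.sum_congr rfl fun t _ => ?_
    have : χ⁻¹ = χ ^ 2 * χ := by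
      rw [← pow_succ]
      exact inv_eq_of_mul_eq_one_right (by rw [← pow_succ', hχ4])
    rw [this, MulChar.mul_apply]
    ring
  have hnorm : J * star J = p := by
    have hinj : Function.Injective (algebraMap GaussianInt (FractionRing GaussianInt)) :=
      IsFractionRing.injective _ _
    have hz : CharZero (FractionRing GaussianInt) := charZero_of_injective_algebraMap hinj
    have hchar : ringChar (FractionRing GaussianInt) ≠ ringChar (ZMod p) := by
      rw [ringChar.eq_zero]
      rw [ZMod.ringChar_zmod_n]
      exact hp.out.ne_zero.symm
    have hχ1 : χ ≠ 1 := by rintro rfl; exact hχ2 (one_pow 2)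
    have h := jacobiSum_mul_jacobiSum_inv hchar
      ((MulChar.ringHomComp_ne_one_iff hinj).2 hχ1) ((MulChar.ringHomComp_ne_one_iff hinj).2 hχ2)
      (by
        rw [← MulChar.ringHomComp_mul]
        refine (MulChar.ringHomComp_ne_one_iff hinj).2 fun h => hχ1 ?_
        rw [← hχ4, show 4 = 1 + 2 + 1 from rfl, pow_add, pow_add, pow_one, h, one_mul])
    rw [MulChar.ringHomComp_inv, MulChar.ringHomComp_inv, hinv2, jacobiSum_ringHomComp,
      jacobiSum_ringHomComp, hJstar, ← map_mul, ZMod.card,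
      ← map_natCast (algebraMap GaussianInt (FractionRing GaussianInt))] at h
    exact hinj h
  refine ⟨-J.re, J.im, ?_, ?_⟩
  · rw [apE_eq_neg_sum p h2]
    have := congrArg Zsqrtd.re hsum
    rw [Zsqrtd.re_intCast] at this
    rw [this]
    simp; ring
  · have := congrArg Zsqrtd.re hnorm
    simp at this
    rw [← this]; ring

theorem ZMod.exists_cube_iff (p : ℕ) [hp : Fact p.Prime] {k : ℕ} (hk : p - 1 = 3 * k) {a : ZMod p}
    (ha : a ≠ 0) : (∃ b, b ^ 3 = a) ↔ a ^ k = 1 := by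
  constructor
  · rintro ⟨b, rfl⟩
    rw [← pow_mul, ← hk]
    exact ZMod.pow_card_sub_one_eq_one fun h => ha (by rw [h]; exact zero_pow three_ne_zero)
  · intro h
    obtain ⟨g, hg⟩ := IsCyclic.exists_generator (α := (ZMod p)ˣ)
    obtain ⟨m, hm⟩ := (mem_powers_iff_mem_zpowers).2 (hg (Units.mk0 a ha))
    have ho : orderOf g = 3 * k := by
      rw [orderOf_eq_card_of_forall_mem_zpowers hg, Nat.card_eq_fintype_card, ZMod.card_units, hk]
    have h1 : g ^ (m * k) = 1 := by
      change g ^ m = _ at hm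
      rw [pow_mul, hm]
      ext
      simpa using h
    have h2 := orderOf_dvd_of_pow_eq_one h1
    have hk0 : 0 < k := by have := hp.out.two_le; omega
    rw [ho] at h2
    obtain ⟨j, rfl⟩ := Nat.dvd_of_mul_dvd_mul_right hk0 h2
    refine ⟨((g ^ j : (ZMod p)ˣ) : ZMod p), ?_⟩
    change g ^ (3 * j) = _ at hm
    rw [← Units.val_pow_eq_pow_val, ← pow_mul, mul_comm, hm]
    rfl

theorem mod_twelve_of_norm {α : O} (hα : (3 : O) ∣ α - 1) {p : ℕ} (hp : p.Prime) (hN : N α = p) :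
    p % 12 = 1 := by
  have h3 := N_primary_mod hα
  obtain ⟨a, b, -, hab⟩ := exists_gaussian α
  rw [hN] at h3 hab
  have h4 : p % 4 = 1 ∨ p % 2 = 0 := by
    have h1 : (p : ℤ) % 4 ≠ 3 := by
      rw [hab]
      rcases Int.emod_two_eq_zero_or_one a with h | h <;>
        rcases Int.emod_two_eq_zero_or_one b with h' | h' <;>
        (obtain ⟨c, hc⟩ : ∃ c, a = 2 * c + a % 2 := ⟨a / 2, by omega⟩
         obtain ⟨d, hd⟩ : ∃ d, b = 2 * d + b % 2 := ⟨b / 2, by omega⟩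
         rw [h] at hc; rw [h'] at hd
         rw [hc, hd]; ring_nf; omega)
    omega
  rcases h4 with h4 | h4
  · omega
  · have := (hp.eq_one_or_self_of_dvd 2 (Nat.dvd_of_mod_eq_zero h4)).resolve_left (by norm_num)
    omega

theorem exists_cube_iff_fsym {α : O} (hα : (3 : O) ∣ α - 1) {p : ℕ} (hp : p.Prime)
    (hN : N α = p) : (∃ b : ZMod p, b ^ 3 = ((apE p : ℤ) : ZMod p)) ↔ fsym α = 1 := by
  have hF : Fact p.Prime := ⟨hp⟩
  have h12 := mod_twelve_of_norm hα hp hN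
  obtain ⟨A, B, hA, hAB⟩ := exists_apE_eq p (by omega)
  obtain ⟨h1, h0⟩ := cs_trace_eq_fsym hα hp hN hAB
  have hαp := prime_of_norm hp hN
  have h3 := not_dvd_three_of_coprime (isCoprime_three hα) hαp dvd_rfl
  have hdvd : ∀ n : ℤ, α ∣ (n : O) ↔ (n : ZMod p) = 0 := by
    intro n
    rw [ZMod.intCast_zmod_eq_zero_iff_dvd]
    refine ⟨intCast_dvd_of_dvd hp hN, fun h => ?_⟩
    have := dvd_natCast_norm α
    rw [hN] at this
    exact this.trans (Int.cast_dvd_cast _ _ h)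
  obtain ⟨k, hk⟩ : ∃ k, p - 1 = 3 * k := ⟨(p - 1) / 3, by omega⟩
  have hspec := lsym_spec hαp h3 ((2 * A : ℤ) : O)
  have hnq : (nq α - 1) / 3 = k := by rw [nq_O, hN, Int.natAbs_natCast]; omega
  rw [hnq, ← cs_prime _ hαp, h1] at hspec
  have hne : ((2 * A : ℤ) : ZMod p) ≠ 0 := by
    rw [Ne, ← hdvd, ← lsym_eq_zero hαp h3, ← cs_prime _ hαp, h1]
    exact h0
  rw [hA, ZMod.exists_cube_iff p hk hne, ← Int.cast_pow, ← sub_eq_zero, ← Int.cast_one (R := ZMod p),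
    ← Int.cast_sub, ← hdvd]
  constructor
  · intro h
    refine IsMu.eq_of_dvd (R := O) h3 (fsym_isMu α) isMu_one ?_
    convert dvd_sub h hspec using 1
    push_cast; simp
  · intro h
    rw [h] at hspec
    simpa using hspec

theorem exists_ringHom_zmod {p : ℕ} (hp : p.Prime) (h12 : p % 12 = 1) :
    Nonempty (O →+* ZMod p) := by
  have hF : Fact p.Prime := ⟨hp⟩
  obtain ⟨c, hc⟩ := ZMod.exists_sq_eq_neg_one_iff.2 (show p % 4 ≠ 3 by omega)
  obtain ⟨w, hw⟩ : ∃ w : (ZMod p)ˣ, orderOf w = 3 := by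
    have h3 : Fact (Nat.Prime 3) := ⟨Nat.prime_three⟩
    refine exists_prime_orderOf_dvd_card 3 ?_
    rw [ZMod.card_units]
    omega
  have hw1 : (w : ZMod p) * w = (-1 : ℤ) • (1 : ZMod p) + (-1 : ℤ) • (w : ZMod p) := by
    have h1 : (w : ZMod p) ^ 3 = 1 := by
      have := pow_orderOf_eq_one w
      rw [hw] at this
      simpa using congrArg Units.val this
    have h2 : (w : ZMod p) ≠ 1 := by
      intro h
      have : w = 1 := Units.ext h
      rw [this, orderOf_one] at hw
      norm_num at hw
    have h3 : ((w : ZMod p) - 1) * (w * w + w + 1) = 0 := by linear_combination h1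
    have h4 := (mul_eq_zero.1 h3).resolve_left (sub_ne_zero.2 h2)
    simp only [neg_smul, one_smul]
    linear_combination h4
  let φ : E →ₐ[ℤ] ZMod p := QuadraticAlgebra.lift ⟨(w : ZMod p), hw1⟩
  let : Algebra E (ZMod p) := φ.toRingHom.toAlgebra
  have hc1 : c * c = (-1 : E) • (1 : ZMod p) + (0 : E) • c := by
    rw [neg_smul, one_smul, zero_smul, add_zero, ← hc]
  exact ⟨(QuadraticAlgebra.lift ⟨c, hc1⟩ : O →ₐ[E] ZMod p).toRingHom⟩

theorem exists_norm_eq_prime {p : ℕ} (hp : p.Prime) (h12 : p % 12 = 1) : ∃ α : O, N α = p := by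
  obtain ⟨φ⟩ := exists_ringHom_zmod hp h12
  obtain ⟨α, hα⟩ := (IsPrincipalIdealRing.principal (RingHom.ker φ)).principal
  have hcard : nq α = p := by
    have e := RingHom.quotientKerEquivOfSurjective (ZMod.ringHom_surjective φ)
    rw [nq, ← Ideal.submodule_span_eq, ← hα]
    exact (Nat.card_congr e.toEquiv).trans (Nat.card_zmod p)
  refine ⟨α, ?_⟩
  rw [nq_O] at hcard
  rw [← hcard, Int.natAbs_of_nonneg (N_nonneg α)]

theorem hs_mul (α β : O) : hs (α * β) = hs α * hs β + 3 * (ht α * ht β) := by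
  simp [hs, ht, nE_def]; ring

theorem ht_mul (α β : O) : ht (α * β) = hs α * ht β + ht α * hs β := by
  simp [hs, ht, nE_def]; ring

/-- The unit with real norm `2 + √3`. -/
def eta : O := ⟨⟨0, -1⟩, ⟨-1, -1⟩⟩

/-- The fundamental unit among those congruent to `1` modulo `3`. -/
def eps : O := ⟨⟨-26, 0⟩, ⟨15, 30⟩⟩

theorem isUnit_om_O : IsUnit (⟨om, 0⟩ : O) := by
  rw [isUnit_O, N_eq]; decide

theorem isUnit_eta : IsUnit eta := by
  rw [isUnit_O, N_eq]; decide

theorem isUnit_eps : IsUnit eps := by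
  rw [isUnit_O, N_eq]; decide

theorem O_mod_three (α : O) : ∃ a b c d : Fin 3,
    (3 : O) ∣ α - ⟨⟨(a : ℕ), (b : ℕ)⟩, ⟨(c : ℕ), (d : ℕ)⟩⟩ := by
  have h : ∀ n : ℤ, ∃ a : Fin 3, (3 : ℤ) ∣ n - ((a : ℕ) : ℤ) := fun n =>
    ⟨⟨(n % 3).toNat, by omega⟩, by dsimp only; omega⟩
  obtain ⟨a, ha⟩ := h α.re.re
  obtain ⟨b, hb⟩ := h α.re.im
  obtain ⟨c, hc⟩ := h α.im.re
  obtain ⟨d, hd⟩ := h α.im.im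
  exact ⟨a, b, c, d, three_dvd_O_iff.2 ⟨three_dvd_iff.2 ⟨ha, hb⟩, three_dvd_iff.2 ⟨hc, hd⟩⟩⟩

theorem N_mod_three_congr {α β : O} (h : (3 : O) ∣ α - β) : N α % 3 = N β % 3 := by
  obtain ⟨γ, hγ⟩ := h
  obtain rfl : α = β + 3 * γ := by rw [← hγ]; ring
  rw [N_eq, N_eq]
  have h3 : (3 : O) = ⟨⟨3, 0⟩, ⟨0, 0⟩⟩ := by decide
  have h1 : (3 : ℤ) ∣ hs (β + 3 * γ) - hs β := by
    refine ⟨3 * hs γ + 2 * β.re.re * γ.re.re - β.re.re * γ.re.im - β.re.im * γ.re.re +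
      2 * β.re.im * γ.re.im + (2 * β.im.re * γ.im.re - β.im.re * γ.im.im - β.im.im * γ.im.re +
      2 * β.im.im * γ.im.im), ?_⟩
    rw [h3]
    simp [hs, nE_def]; ring
  obtain ⟨k, hk⟩ := h1
  rw [show hs (β + 3 * γ) = hs β + 3 * k by linear_combination hk]
  ring_nf
  omega

theorem exists_unit_mul_primary {α : O} (h : N α % 3 ≠ 0) : ∃ u, IsUnit u ∧ (3 : O) ∣ α * u - 1 := by
  have key : ∀ a b c d : Fin 3, N (⟨⟨(a : ℕ), (b : ℕ)⟩, ⟨(c : ℕ), (d : ℕ)⟩⟩ : O) % 3 ≠ 0 →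
      ∃ k : Fin 24, ∃ j : Fin 3, ∀ x : O,
        x = ((⟨⟨(a : ℕ), (b : ℕ)⟩, ⟨(c : ℕ), (d : ℕ)⟩⟩ : O) * (eta ^ (k : ℕ) *
          (⟨om, 0⟩ : O) ^ (j : ℕ)) - 1) →
        (x.re.re % 3 = 0 ∧ x.re.im % 3 = 0) ∧ (x.im.re % 3 = 0 ∧ x.im.im % 3 = 0) := by
    simp only [forall_eq]
    decide +kernel
  obtain ⟨a, b, c, d, hα⟩ := O_mod_three α
  rw [N_mod_three_congr hα] at h
  obtain ⟨k, j, hkj⟩ := key a b c d h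
  obtain ⟨⟨h1, h2⟩, h3, h4⟩ := hkj _ rfl
  set β : O := ⟨⟨(a : ℕ), (b : ℕ)⟩, ⟨(c : ℕ), (d : ℕ)⟩⟩
  refine ⟨eta ^ (k : ℕ) * (⟨om, 0⟩ : O) ^ (j : ℕ), (isUnit_eta.pow _).mul (isUnit_om_O.pow _), ?_⟩
  have h5 : (3 : O) ∣ β * (eta ^ (k : ℕ) * (⟨om, 0⟩ : O) ^ (j : ℕ)) - 1 :=
    three_dvd_O_iff.2 ⟨three_dvd_iff.2 ⟨Int.dvd_of_emod_eq_zero h1, Int.dvd_of_emod_eq_zero h2⟩,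
      three_dvd_iff.2 ⟨Int.dvd_of_emod_eq_zero h3, Int.dvd_of_emod_eq_zero h4⟩⟩
  have := dvd_add (hα.mul_right (eta ^ (k : ℕ) * (⟨om, 0⟩ : O) ^ (j : ℕ))) h5
  convert this using 1
  ring

theorem isUnit_iff_hs_ht {u : O} : IsUnit u ↔ hs u ^ 2 - 3 * ht u ^ 2 = 1 := by
  rw [isUnit_O, N_eq]

theorem eta_inv_exists : ∃ e : O, e * eta = 1 ∧ hs e = 2 ∧ ht e = -1 := by
  obtain ⟨u, hu⟩ := isUnit_eta
  refine ⟨(u⁻¹ : Oˣ), by rw [← hu, Units.inv_mul], ?_, ?_⟩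
  all_goals
    have h : ((u⁻¹ : Oˣ) : O) * eta = 1 := by rw [← hu, Units.inv_mul]
    have h1 := congrArg hs h
    have h2 := congrArg ht h
    rw [hs_mul] at h1
    rw [ht_mul] at h2
    rw [show hs eta = 2 by decide, show ht eta = 1 by decide, show hs (1 : O) = 1 by decide] at h1
    rw [show hs eta = 2 by decide, show ht eta = 1 by decide, show ht (1 : O) = 0 by decide] at h2
    linarith

theorem unit_eq_eta_pow (n : ℕ) : ∀ {u : O}, IsUnit u → 0 ≤ ht u → hs u ≤ n →
    ∃ ζ : O, ∃ k : ℕ, hs ζ = 1 ∧ ht ζ = 0 ∧ u = ζ * eta ^ k := by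
  induction n using Nat.strong_induction_on with
  | _ n ih =>
    intro u hu ht0 hsn
    have h1 := isUnit_iff_hs_ht.1 hu
    have h0 := hs_nonneg u
    rcases ht0.eq_or_lt with h | h
    · refine ⟨u, 0, ?_, h.symm, by rw [pow_zero, mul_one]⟩
      rw [← h] at h1
      nlinarith
    · obtain ⟨e, he, hse, hte⟩ := eta_inv_exists
      have hs' : hs (u * e) = 2 * hs u - 3 * ht u := by rw [hs_mul, hse, hte]; ring
      have ht' : ht (u * e) = 2 * ht u - hs u := by rw [ht_mul, hse, hte]; ring
      have hlt : hs u < 3 * ht u := by nlinarith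
      have hle : hs u ≤ 2 * ht u := by nlinarith
      have hpos := hs_nonneg (u * e)
      obtain ⟨ζ, k, hζ, hζ', hk⟩ := ih (hs (u * e)).toNat (by omega) (u := u * e)
        (hu.mul (IsUnit.of_mul_eq_one _ he)) (by omega) (by omega)
      refine ⟨ζ, k + 1, hζ, hζ', ?_⟩
      rw [pow_succ, ← mul_assoc, ← hk, mul_assoc, he, mul_one]

theorem hs_eta_pow (k : ℕ) : 1 ≤ hs (eta ^ k) ∧ 0 ≤ ht (eta ^ k) := by
  induction k with
  | zero => decide
  | succ k ih =>
    rw [pow_succ, hs_mul, ht_mul, show hs eta = 2 by decide, show ht eta = 1 by decide]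
    constructor <;> linarith

theorem root_of_hs_eq_one {ζ : O} (h : hs ζ = 1) : ∃ a b c d : Fin 3,
    ζ = ⟨⟨((a : ℕ) : ℤ) - 1, ((b : ℕ) : ℤ) - 1⟩, ⟨((c : ℕ) : ℤ) - 1, ((d : ℕ) : ℤ) - 1⟩⟩ := by
  have hb : ∀ x y : ℤ, x ^ 2 - x * y + y ^ 2 ≤ 1 → (-1 ≤ x ∧ x ≤ 1) ∧ (-1 ≤ y ∧ y ≤ 1) := by
    intro x y h
    refine ⟨⟨?_, ?_⟩, ?_, ?_⟩ <;> nlinarith [sq_nonneg (x - 2 * y), sq_nonneg (y - 2 * x)]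
  have h1 := nE_nonneg ζ.re
  have h2 := nE_nonneg ζ.im
  have h3 : nE ζ.re ≤ 1 := by simp only [hs] at h; linarith
  have h4 : nE ζ.im ≤ 1 := by simp only [hs] at h; linarith
  rw [nE_def] at h3 h4
  obtain ⟨⟨h5, h6⟩, h7, h8⟩ := hb _ _ h3
  obtain ⟨⟨h9, h10⟩, h11, h12⟩ := hb _ _ h4
  have hf : ∀ n : ℤ, -1 ≤ n → n ≤ 1 → ∃ a : Fin 3, n = ((a : ℕ) : ℤ) - 1 := fun n _ _ =>
    ⟨⟨(n + 1).toNat, by omega⟩, by dsimp only; omega⟩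
  obtain ⟨a, ha⟩ := hf _ h5 h6
  obtain ⟨b, hb⟩ := hf _ h7 h8
  obtain ⟨c, hc⟩ := hf _ h9 h10
  obtain ⟨d, hd⟩ := hf _ h11 h12
  exact ⟨a, b, c, d, by rw [← ha, ← hb, ← hc, ← hd]⟩

theorem primary_unit_eq_one {u : O} (hu : IsUnit u) (h3 : (3 : O) ∣ u - 1) (hs0 : hs u < 1351) :
    u = 1 := by
  have key : ∀ k : Fin 6, ∀ a b c d : Fin 3, ∀ x : O,
      x = ⟨⟨((a : ℕ) : ℤ) - 1, ((b : ℕ) : ℤ) - 1⟩, ⟨((c : ℕ) : ℤ) - 1, ((d : ℕ) : ℤ) - 1⟩⟩ →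
      hs x = 1 → ∀ y, y = x * eta ^ (k : ℕ) →
      ((y - 1).re.re % 3 = 0 ∧ (y - 1).re.im % 3 = 0) ∧
        ((y - 1).im.re % 3 = 0 ∧ (y - 1).im.im % 3 = 0) → y = 1 := by
    simp only [forall_eq]
    decide +kernel
  have main : ∀ u : O, IsUnit u → (3 : O) ∣ u - 1 → hs u < 1351 → 0 ≤ ht u → u = 1 := by
    intro u hu h3 hs0 ht0
    obtain ⟨ζ, k, hζ, hζ', rfl⟩ := unit_eq_eta_pow (hs u).toNat hu ht0 (Int.self_le_toNat _)
    have hk : k < 6 := by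
      by_contra! hk
      obtain ⟨m, rfl⟩ := Nat.exists_eq_add_of_le hk
      obtain ⟨h1, h2⟩ := hs_eta_pow m
      rw [hs_mul, hζ, hζ', pow_add, hs_mul, show hs (eta ^ 6) = 1351 by decide,
        show ht (eta ^ 6) = 780 by decide] at hs0
      linarith
    obtain ⟨a, b, c, d, habcd⟩ := root_of_hs_eq_one hζ
    obtain ⟨⟨c1, c2⟩, c3, c4⟩ := three_dvd_O_iff.1 h3 |>.imp three_dvd_iff.1 three_dvd_iff.1
    exact key ⟨k, hk⟩ a b c d ζ habcd hζ _ rfl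
      ⟨⟨Int.emod_eq_zero_of_dvd c1, Int.emod_eq_zero_of_dvd c2⟩,
        Int.emod_eq_zero_of_dvd c3, Int.emod_eq_zero_of_dvd c4⟩
  rcases le_total 0 (ht u) with h | h
  · exact main u hu h3 hs0 h
  · have : star u = 1 := main (star u) ((isUnit_O).2 (by rw [N_star]; exact isUnit_O.1 hu))
      (primary_O_star h3) (by simpa [hs, nE_def] using hs0) (by simpa [ht] using h)
    rw [← star_star u, this, star_one]

/-- Reduced elements: primary, and in a fundamental domain for the action of the primary units. -/
def Red (α : O) : Prop := (3 : O) ∣ α - 1 ∧ -(15 * hs α) < 26 * ht α ∧ 26 * ht α ≤ 15 * hs α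

theorem primary_of_mul_right {α u : O} (hα : (3 : O) ∣ α - 1) (h : (3 : O) ∣ α * u - 1) :
    (3 : O) ∣ u - 1 := by
  have := dvd_sub h (hα.mul_right u)
  convert this using 1
  ring

theorem Red.eq_of_associated {α β : O} (hα : Red α) (hβ : Red β) (h : Associated α β) : α = β := by
  obtain ⟨u, rfl⟩ := h
  have hu := u.isUnit
  suffices (u : O) = 1 by rw [this, mul_one]
  have h3 := primary_of_mul_right hα.1 hβ.1
  refine primary_unit_eq_one hu h3 ?_
  have h1 := isUnit_iff_hs_ht.1 hu
  obtain ⟨-, a1, a2⟩ := hα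
  obtain ⟨-, b1, b2⟩ := hβ
  rw [hs_mul, ht_mul] at b1 b2
  have hs1 := hs_nonneg (u : O)
  have hα0 := hs_nonneg α
  generalize hs (u : O) = S at *
  generalize ht (u : O) = T at *
  generalize hs α = s at *
  generalize ht α = t at *
  have hs0 : 0 < s := by omega
  by_contra! hS
  have hT : 780 ^ 2 ≤ T ^ 2 := by nlinarith
  rcases le_total 0 T with hT0 | hT0
  · have h5 : 780 ≤ T := by nlinarith
    have h6 : 1351 * T ≥ 780 * S := by nlinarith
    nlinarith [mul_le_mul_of_nonneg_left h6 hs0.le, mul_nonneg (sub_nonneg.2 a2) hT0,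
      mul_pos hs0 (show 0 < T by omega), mul_nonneg hs0.le hs1]
  · have h5 : T ≤ -780 := by nlinarith
    have h6 : 1351 * (-T) ≥ 780 * S := by nlinarith
    nlinarith [mul_le_mul_of_nonneg_left h6 hs0.le, mul_nonneg (sub_nonneg.2 a2) hs1,
      mul_pos hs0 (show 0 < -T by omega), mul_nonneg hs0.le hs1]

theorem eps_inv_exists : ∃ e : O, e * eps = 1 ∧ hs e = 1351 ∧ ht e = -780 := by
  obtain ⟨u, hu⟩ := isUnit_eps
  refine ⟨(u⁻¹ : Oˣ), by rw [← hu, Units.inv_mul], ?_, ?_⟩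
  all_goals
    have h : ((u⁻¹ : Oˣ) : O) * eps = 1 := by rw [← hu, Units.inv_mul]
    have h1 := congrArg hs h
    have h2 := congrArg ht h
    rw [hs_mul] at h1
    rw [ht_mul] at h2
    rw [show hs eps = 1351 by decide, show ht eps = 780 by decide, show hs (1 : O) = 1 by decide]
      at h1
    rw [show hs eps = 1351 by decide, show ht eps = 780 by decide, show ht (1 : O) = 0 by decide]
      at h2
    linarith

theorem three_dvd_eps_sub_one : (3 : O) ∣ eps - 1 :=
  three_dvd_O_iff.2 ⟨three_dvd_iff.2 (by decide), three_dvd_iff.2 (by decide)⟩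

theorem primary_unit_mul {R : Type*} [CommRing R] {α u : R} (hα : (3 : R) ∣ α - 1)
    (hu : (3 : R) ∣ u - 1) : (3 : R) ∣ α * u - 1 := by
  have := dvd_add (hα.mul_right u) hu
  convert this using 1
  ring

theorem exists_red_of_primary (n : ℕ) : ∀ {α : O}, (3 : O) ∣ α - 1 → hs α ≤ n →
    ∃ u, IsUnit u ∧ (3 : O) ∣ u - 1 ∧ Red (α * u) := by
  induction n using Nat.strong_induction_on with
  | _ n ih =>
    intro α hα hsn
    have h0 := hs_nonneg α
    have hpos : 0 < hs α := h0.lt_of_ne fun h =>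
      primary_O_ne_zero hα (hs_eq_zero.1 h.symm)
    obtain ⟨e, he, hse, hte⟩ := eps_inv_exists
    have he1 : IsUnit e := IsUnit.of_mul_eq_one _ he
    have he3 : (3 : O) ∣ e - 1 := by
      have h := three_dvd_eps_sub_one.mul_left e
      rw [mul_sub, he, mul_one] at h
      rw [← dvd_neg]
      convert h using 1
      ring
    have step : ∀ e : O, IsUnit e → (3 : O) ∣ e - 1 → hs (α * e) < hs α →
        ∃ u, IsUnit u ∧ (3 : O) ∣ u - 1 ∧ Red (α * u) := by
      intro e he1 he3 hlt
      have hpos := hs_nonneg (α * e)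
      obtain ⟨u, hu, hu3, hr⟩ := ih (hs (α * e)).toNat (by omega) (primary_unit_mul hα he3)
        (Int.self_le_toNat _)
      exact ⟨e * u, he1.mul hu, primary_unit_mul he3 hu3, by rwa [← mul_assoc]⟩
    by_cases h1 : 15 * hs α < 26 * ht α
    · exact step e he1 he3 (by rw [hs_mul, hse, hte]; linarith)
    by_cases h2 : 26 * ht α < -(15 * hs α)
    · refine step eps isUnit_eps three_dvd_eps_sub_one ?_
      rw [hs_mul, show hs eps = 1351 by decide, show ht eps = 780 by decide]
      linarith
    by_cases h3 : 26 * ht α = -(15 * hs α)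
    · refine ⟨eps, isUnit_eps, three_dvd_eps_sub_one, primary_unit_mul hα three_dvd_eps_sub_one, ?_⟩
      rw [hs_mul, ht_mul, show hs eps = 1351 by decide, show ht eps = 780 by decide]
      constructor <;> linarith
    · refine ⟨1, isUnit_one, by simp, ?_⟩
      rw [mul_one]
      exact ⟨hα, by omega, by omega⟩

theorem exists_red {α : O} (h : N α % 3 ≠ 0) : ∃ β, Red β ∧ Associated α β := by
  obtain ⟨u, hu, h3⟩ := exists_unit_mul_primary h
  obtain ⟨v, hv, -, hr⟩ := exists_red_of_primary (hs (α * u)).toNat h3 (Int.self_le_toNat _)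
  exact ⟨_, hr, (hu.mul hv).unit, by rw [IsUnit.unit_spec, mul_assoc]⟩

theorem exists_norm_eq {p : ℕ} (hp : p.Prime) (h12 : p % 12 = 1) : ∃ α : O, Red α ∧ N α = p := by
  obtain ⟨α, hα⟩ := exists_norm_eq_prime hp h12
  obtain ⟨β, hβ, u, rfl⟩ := exists_red (α := α) (by rw [hα]; omega)
  exact ⟨_, hβ, by rw [map_mul, hα, isUnit_O.1 u.isUnit, mul_one]⟩

theorem Red.hs_sq_le {α : O} (h : Red α) : hs α ^ 2 ≤ 676 * N α := by
  obtain ⟨-, h1, h2⟩ := h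
  rw [N_eq]
  nlinarith

theorem Red.ne_zero {α : O} (h : Red α) : α ≠ 0 := primary_O_ne_zero h.1

theorem Red.N_pos {α : O} (h : Red α) : 0 < N α := CubicTrace.N_pos h.ne_zero

theorem fsym_eq_of_associated {α β : O} (hα : (3 : O) ∣ α - 1) (hβ : (3 : O) ∣ β - 1)
    (h : Associated α β) : fsym α = fsym β := by
  obtain ⟨u, rfl⟩ := h
  rw [mul_comm, fsym_unit_mul u.isUnit (primary_of_mul_right hα hβ) hα]

theorem finite_hs_le (M : ℤ) : {α : O | hs α ≤ M}.Finite := by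
  have hb : ∀ x y : ℤ, x ^ 2 - x * y + y ^ 2 ≤ M → x ∈ Set.Icc (-(2 * M)) (2 * M) ∧
      y ∈ Set.Icc (-(2 * M)) (2 * M) := by
    intro x y h
    have h1 : 3 * x ^ 2 ≤ 4 * M := by nlinarith [sq_nonneg (x - 2 * y)]
    have h2 : 3 * y ^ 2 ≤ 4 * M := by nlinarith [sq_nonneg (y - 2 * x)]
    refine ⟨⟨?_, ?_⟩, ?_, ?_⟩ <;> nlinarith
  have hf : ((fun q : (ℤ × ℤ) × (ℤ × ℤ) => (⟨⟨q.1.1, q.1.2⟩, ⟨q.2.1, q.2.2⟩⟩ : O)) ''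
      ((Set.Icc (-(2 * M)) (2 * M) ×ˢ Set.Icc (-(2 * M)) (2 * M)) ×ˢ
        (Set.Icc (-(2 * M)) (2 * M) ×ˢ Set.Icc (-(2 * M)) (2 * M)))).Finite :=
    ((((Set.finite_Icc _ _).prod (Set.finite_Icc _ _)).prod
      ((Set.finite_Icc _ _).prod (Set.finite_Icc _ _)))).image _
  refine hf.subset fun α hα => ?_
  have h1 := nE_nonneg α.re
  have h2 := nE_nonneg α.im
  change nE α.re + nE α.im ≤ M at hα
  exact ⟨((α.re.re, α.re.im), (α.im.re, α.im.im)),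
    ⟨hb _ _ (by rw [← nE_def]; linarith), hb _ _ (by rw [← nE_def]; linarith)⟩, rfl⟩

theorem finite_red (M : ℕ) : {α : O | Red α ∧ N α ≤ M}.Finite := by
  refine (finite_hs_le (676 * M)).subset fun α hα => ?_
  have h1 := hα.1.hs_sq_le
  have h2 := hα.2
  have h3 := hs_nonneg α
  change hs α ≤ 676 * M
  nlinarith

theorem exists_add_one_le {ε : ℝ} (hε : 0 < ε) : ∃ C : ℝ, 1 ≤ C ∧ ∀ a : ℕ,
    (a : ℝ) + 1 ≤ C * (2 : ℝ) ^ (ε * a) := by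
  set c := min 1 (ε * Real.log 2) with hc
  have hl := Real.log_pos one_lt_two
  have hc0 : 0 < c := lt_min one_pos (by positivity)
  have hc1 : c ≤ 1 := min_le_left _ _
  refine ⟨c⁻¹, (one_le_inv₀ hc0).2 hc1, fun a => ?_⟩
  rw [inv_mul_eq_div, le_div_iff₀ hc0]
  calc ((a : ℝ) + 1) * c ≤ (ε * Real.log 2) * a + 1 := by
        have h2 : c ≤ ε * Real.log 2 := min_le_right _ _
        have := mul_le_mul_of_nonneg_right h2 (Nat.cast_nonneg (α := ℝ) a)
        linarith
    _ ≤ Real.exp (ε * Real.log 2 * a) := Real.add_one_le_exp _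
    _ = _ := by rw [Real.rpow_def_of_pos two_pos]; ring_nf

theorem prod_count_add_one_le {ι : Type*} [DecidableEq ι] {ε C Q : ℝ} (hε : 0 < ε) (hC1 : 1 ≤ C)
    (hC : ∀ a : ℕ, (a : ℝ) + 1 ≤ C * (2 : ℝ) ^ (ε * a)) (hQ : 2 ≤ Q ^ ε) (hQ0 : 0 ≤ Q)
    (w : ι → ℝ) (K : Finset ι)
    (s : Multiset ι) (hw : ∀ i ∈ s, 2 ≤ w i) (hK : ∀ i ∈ s, w i < Q → i ∈ K) :
    ((∏ i ∈ s.toFinset, (s.count i + 1) : ℕ) : ℝ) ≤ C ^ K.card * (s.map w).prod ^ ε := by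
  have hprod : (s.map w).prod ^ ε = ∏ i ∈ s.toFinset, (w i ^ s.count i) ^ ε := by
    rw [Finset.prod_multiset_map_count, Real.finsetProd_rpow]
    intro i hi
    exact pow_nonneg (two_pos.le.trans (hw i (Multiset.mem_toFinset.1 hi))) _
  have hCK : ∏ i ∈ s.toFinset, (if i ∈ K then C else 1) ≤ C ^ K.card := by
    rw [Finset.prod_ite, Finset.prod_const_one, mul_one, Finset.prod_const]
    refine pow_le_pow_right₀ hC1 (Finset.card_le_card fun i hi => (Finset.mem_filter.1 hi).2)
  push_cast
  rw [hprod]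
  have h0 : ∀ i ∈ s, 0 ≤ w i := fun i hi => two_pos.le.trans (hw i hi)
  calc ∏ i ∈ s.toFinset, ((s.count i : ℝ) + 1)
      ≤ ∏ i ∈ s.toFinset, ((if i ∈ K then C else 1) * (w i ^ s.count i) ^ ε) := by
        refine Finset.prod_le_prod (fun i _ => by positivity) fun i hi => ?_
        have hi' := Multiset.mem_toFinset.1 hi
        have h2 := hw i hi'
        rw [← Real.rpow_natCast, ← Real.rpow_mul (h0 i hi'), mul_comm (_ : ℝ) ε]
        split_ifs with h
        · exact (hC _).trans (mul_le_mul_of_nonneg_left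
            (Real.rpow_le_rpow two_pos.le h2 (by positivity)) (by linarith))
        · have h3 : Q ≤ w i := by
            by_contra! h'
            exact h (hK i hi' h')
          rw [one_mul, Real.rpow_mul (h0 i hi'), Real.rpow_natCast]
          calc ((s.count i : ℝ) + 1) ≤ 2 ^ s.count i := by
                exact_mod_cast Nat.lt_two_pow_self
            _ ≤ _ := pow_le_pow_left₀ two_pos.le
                (hQ.trans (Real.rpow_le_rpow hQ0 h3 hε.le)) _
    _ = _ := Finset.prod_mul_distrib
    _ ≤ _ := mul_le_mul_of_nonneg_right hCK (Finset.prod_nonneg fun i hi =>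
        Real.rpow_nonneg (pow_nonneg (h0 i (Multiset.mem_toFinset.1 hi)) _) _)

theorem card_divisors_le {ε : ℝ} (hε : 0 < ε) : ∃ C : ℝ, 0 < C ∧ ∀ n : ℕ,
    (n.divisors.card : ℝ) ≤ C * (n : ℝ) ^ ε := by
  obtain ⟨C, hC1, hC⟩ := exists_add_one_le hε
  set Q : ℝ := 2 ^ (1 / ε) with hQ
  have hQ2 : 2 ≤ Q ^ ε := by
    rw [hQ, ← Real.rpow_mul two_pos.le, one_div_mul_cancel hε.ne', Real.rpow_one]
  refine ⟨C ^ (Finset.range ⌈Q⌉₊).card, by positivity, fun n => ?_⟩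
  rcases eq_or_ne n 0 with rfl | hn
  · simp; positivity
  have h := prod_count_add_one_le hε hC1 hC hQ2 (by positivity) (fun p : ℕ => (p : ℝ))
    (Finset.range ⌈Q⌉₊) (n.primeFactorsList : Multiset ℕ)
    (fun p hp => by exact_mod_cast (Nat.prime_of_mem_primeFactorsList hp).two_le)
    (fun p _ h => by rw [Finset.mem_range]; exact Nat.lt_ceil.2 h)
  have e1 : (n.divisors.card : ℝ) = ((∏ i ∈ (n.primeFactorsList : Multiset ℕ).toFinset,
      ((n.primeFactorsList : Multiset ℕ).count i + 1) : ℕ) : ℝ) := by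
    rw [Nat.card_divisors hn]
    congr 1
    refine Finset.prod_congr rfl fun p _ => ?_
    rw [Multiset.coe_count, Nat.primeFactorsList_count_eq]
  have e2 : ((n.primeFactorsList : Multiset ℕ).map (fun p : ℕ => (p : ℝ))).prod = n := by
    rw [Multiset.map_coe, Multiset.prod_coe, ← Nat.cast_list_prod, Nat.prod_primeFactorsList hn]
  rw [e2] at h
  rw [e1]
  exact h

theorem N_eq_of_associated {α β : O} (h : Associated α β) : N α = N β := by
  obtain ⟨u, rfl⟩ := h
  rw [map_mul, isUnit_O.1 u.isUnit, mul_one]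

open Classical in
theorem card_reduced_dvd_le {ε : ℝ} (hε : 0 < ε) : ∃ C : ℝ, 0 < C ∧ ∀ β : O, β ≠ 0 → N β % 3 ≠ 0 →
    ∀ S : Finset O, (∀ δ ∈ S, Red δ ∧ δ ∣ β) → (S.card : ℝ) ≤ C * (N β : ℝ) ^ ε := by
  obtain ⟨C, hC1, hC⟩ := exists_add_one_le hε
  set Q : ℝ := 2 ^ (1 / ε) with hQ
  have hQ2 : 2 ≤ Q ^ ε := by
    rw [hQ, ← Real.rpow_mul two_pos.le, one_div_mul_cancel hε.ne', Real.rpow_one]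
  set K : Finset (Associates O) := (finite_red ⌈Q⌉₊).toFinset.image Associates.mk
  refine ⟨C ^ K.card, by positivity, fun β hβ hβ3 S hS => ?_⟩
  set m : O → Multiset (Associates O) := fun δ => (factors δ).map Associates.mk with hm
  set w : Associates O → ℝ := fun a => (N (Quot.out a) : ℝ) with hw
  have hwm : ∀ α : O, w (Associates.mk α) = N α := fun α => by
    rw [hw]; exact congrArg _ (N_eq_of_associated (Associates.mk_quot_out α))
  have hirr : ∀ δ : O, ∀ a ∈ m δ, Irreducible a := by
    intro δ a ha
    obtain ⟨π, hπ, rfl⟩ := Multiset.mem_map.1 ha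
    exact Associates.irreducible_mk.2 (irreducible_of_factor π hπ)
  have hmprod : ∀ δ : O, δ ≠ 0 → (m δ).prod = Associates.mk δ := by
    intro δ hδ
    rw [hm, Associates.prod_mk]
    exact Associates.mk_eq_mk_iff_associated.2 (factors_prod hδ)
  have hprime : ∀ a ∈ m β, ∃ π, Prime π ∧ π ∣ β ∧ Associates.mk π = a := by
    intro a ha
    obtain ⟨π, hπ, rfl⟩ := Multiset.mem_map.1 ha
    exact ⟨π, prime_of_factor π hπ, dvd_of_mem_factors hπ, rfl⟩
  have h := prod_count_add_one_le hε hC1 hC hQ2 (by positivity) w K (m β)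
    (fun a ha => by
      obtain ⟨π, hπ, -, rfl⟩ := hprime a ha
      rw [hwm]
      have h0 := N_pos hπ.ne_zero
      have h1 : N π ≠ 1 := fun h => hπ.not_isUnit (isUnit_O.2 h)
      exact_mod_cast (by omega : 2 ≤ N π))
    (fun a ha hlt => by
      obtain ⟨π, hπ, hd, rfl⟩ := hprime a ha
      rw [hwm] at hlt
      have h3 : N π % 3 ≠ 0 := fun h3 => hβ3 (Int.emod_eq_zero_of_dvd
        ((Int.dvd_of_emod_eq_zero h3).trans (map_dvd N hd)))
      obtain ⟨ρ, hρ, has⟩ := exists_red h3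
      refine Finset.mem_image.2 ⟨ρ, ?_, (Associates.mk_eq_mk_iff_associated.2 has).symm⟩
      rw [Set.Finite.mem_toFinset]
      refine ⟨hρ, ?_⟩
      rw [← N_eq_of_associated has]
      have := hlt.le.trans (Nat.le_ceil Q)
      exact_mod_cast this)
  have e2 : ((m β).map w).prod = N β := by
    rw [hm, Multiset.map_map, N_eq_of_associated (factors_prod hβ).symm,
      ← Multiset.prod_hom (factors β) N, ← eq_intCast (Int.castRingHom ℝ),
      ← Multiset.prod_hom _ (Int.castRingHom ℝ), Multiset.map_map]
    congr 1
    exact Multiset.map_congr rfl fun π _ => hwm π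
  rw [e2, ← Multiset.card_Iic] at h
  refine le_trans ?_ h
  norm_cast
  refine Finset.card_le_card_of_injOn m (fun δ hδ => ?_) fun δ hδ δ' hδ' heq => ?_
  · have hδ' := hS δ hδ
    rw [Finset.mem_coe, Finset.mem_Iic, ← Associates.prod_le_prod_iff_le (hirr _) (hirr _),
      hmprod δ hδ'.1.ne_zero, hmprod β hβ]
    exact Associates.mk_le_mk_of_dvd hδ'.2
  · have h1 := hS δ hδ
    have h2 := hS δ' hδ'
    refine h1.1.eq_of_associated h2.1 (Associates.mk_eq_mk_iff_associated.1 ?_)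
    rw [← hmprod δ h1.1.ne_zero, ← hmprod δ' h2.1.ne_zero, heq]

/-- The complex embedding of the Eisenstein integers. -/
noncomputable def emb : E →+* ℂ :=
  (QuadraticAlgebra.lift (R := ℤ) (a := -1) (b := -1) ⟨(⟨-1 / 2, √3 / 2⟩ : ℂ), by
    have h : √3 * √3 = 3 := Real.mul_self_sqrt (by norm_num)
    apply Complex.ext <;> simp <;> linarith⟩ : E →ₐ[ℤ] ℂ).toRingHom

theorem emb_apply (z : E) : emb z = z.re + z.im * (⟨-1 / 2, √3 / 2⟩ : ℂ) := by
  change (QuadraticAlgebra.lift _ : E →ₐ[ℤ] ℂ) z = _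
  simp [QuadraticAlgebra.lift]

theorem emb_star (z : E) : emb (star z) = star (emb z) := by
  rw [emb_apply, emb_apply]
  apply Complex.ext <;> (simp <;> ring)

theorem norm_emb_sq (z : E) : ‖emb z‖ ^ 2 = nE z := by
  have h : √3 ^ 2 = 3 := Real.sq_sqrt (by norm_num)
  rw [emb_apply, ← Complex.normSq_eq_norm_sq, Complex.normSq_apply, nE_def]
  simp
  linear_combination (z.im : ℝ) ^ 2 / 4 * h

theorem emb_eq_zero {z : E} : emb z = 0 ↔ z = 0 := by
  rw [← norm_eq_zero, ← pow_eq_zero_iff two_ne_zero, norm_emb_sq, Int.cast_eq_zero, nE_eq_zero]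

theorem IsMu.norm_emb {z : E} (hz : IsMu z) (h0 : z ≠ 0) : ‖emb z‖ = 1 := by
  rcases hz.cases with h | h | h | h
  · exact absurd h h0
  all_goals
    rw [← pow_eq_one_iff_of_nonneg (norm_nonneg _) two_ne_zero, norm_emb_sq, h]
    norm_cast

theorem IsMu.norm_emb_le {z : E} (hz : IsMu z) : ‖emb z‖ ≤ 1 := by
  by_cases h : z = 0
  · rw [h, map_zero, _root_.norm_zero]; exact zero_le_one
  · exact (hz.norm_emb h).le

open Classical in
/-- Reduced elements of given norm. -/
noncomputable def RN (n : ℕ) : Finset O := (finite_red n).toFinset.filter fun α => N α = n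

theorem mem_RN {n : ℕ} {α : O} : α ∈ RN n ↔ Red α ∧ N α = n := by
  rw [RN, Finset.mem_filter, Set.Finite.mem_toFinset]
  exact ⟨fun h => ⟨h.1.1, h.2⟩, fun h => ⟨⟨h.1, h.2.le⟩, h.2⟩⟩

/-- The cubic trace symbol as a complex number. -/
noncomputable def fC (α : O) : ℂ := emb (fsym α)

/-- The sum of the cubic trace symbol over reduced elements of norm `n`. -/
noncomputable def FC (n : ℕ) : ℂ := ∑ α ∈ RN n, fC α

theorem norm_fC_le (α : O) : ‖fC α‖ ≤ 1 := (fsym_isMu α).norm_emb_le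

theorem norm_FC_le (n : ℕ) : ‖FC n‖ ≤ (RN n).card := by
  refine (norm_sum_le _ _).trans ((Finset.sum_le_sum fun α _ => norm_fC_le α).trans ?_)
  simp

theorem card_RN_le {ε : ℝ} (hε : 0 < ε) : ∃ C : ℝ, 0 < C ∧ ∀ n : ℕ,
    ((RN n).card : ℝ) ≤ C * (n : ℝ) ^ ε := by
  obtain ⟨C, hC0, hC⟩ := card_reduced_dvd_le (ε := ε / 4) (by positivity)
  refine ⟨C, hC0, fun n => ?_⟩
  rcases Finset.eq_empty_or_nonempty (RN n) with h | ⟨α, hα⟩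
  · rw [h, Finset.card_empty, Nat.cast_zero]; positivity
  have hα' := mem_RN.1 hα
  have hn : (N ((n : ℤ) : O)) = (n : ℤ) ^ 4 := N_intCast _
  have hn0 := hα'.1.N_pos
  have hn3 := N_primary_mod hα'.1.1
  rw [hα'.2] at hn0 hn3
  have h := hC ((n : ℤ) : O) (fun h => by
      rw [h, (N_eq_zero).2 rfl] at hn
      have : (0 : ℤ) < (n : ℤ) ^ 4 := by positivity
      omega)
    (by
      rw [hn]
      intro h
      have := Int.prime_three.dvd_of_dvd_pow (Int.dvd_of_emod_eq_zero h)
      omega) (RN n) fun δ hδ => by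
        have := mem_RN.1 hδ
        refine ⟨this.1, ?_⟩
        have h := dvd_natCast_norm δ
        rwa [this.2] at h
  rw [hn] at h
  convert h using 2
  push_cast
  rw [← Real.rpow_natCast, ← Real.rpow_mul (by positivity)]
  congr 1
  push_cast; ring

theorem card_RN_prime {p : ℕ} (hp : p.Prime) (h12 : p % 12 = 1) : (RN p).card = 4 := by
  obtain ⟨α, hα, hN⟩ := exists_norm_eq hp h12
  have hF : Fact p.Prime := ⟨hp⟩
  have hprime := prime_of_norm hp hN
  have hcard : Nat.card (O ⧸ Ideal.span {α}) = p := by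
    have := nq_O α
    rw [hN] at this
    exact this
  have hrep : ∀ z : O, ∃ n : ℤ, α ∣ z - n := by
    intro z
    have h1 : (1 : O ⧸ Ideal.span {α}) ≠ 0 := by
      rw [← map_one (Ideal.Quotient.mk _), Ne, Ideal.Quotient.eq_zero_iff_dvd]
      exact fun h => hprime.not_isUnit (isUnit_of_dvd_one h)
    obtain ⟨n, hn⟩ := mem_zmultiples_of_prime_card hcard h1 (g' := Ideal.Quotient.mk _ z)
    refine ⟨n, ?_⟩
    rw [← Ideal.Quotient.eq_zero_iff_dvd, map_sub, map_intCast, sub_eq_zero, ← hn]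
    simp
  have hno : ∀ g : O ≃+* O, Associated (g α) α → ∀ z : O, α ∣ g z - z := by
    intro g hg z
    obtain ⟨n, hn⟩ := hrep z
    have h1 := map_dvd g hn
    rw [map_sub, map_intCast] at h1
    have := dvd_sub (hg.symm.dvd.trans h1) hn
    convert this using 1
    ring
  have hnot : ∀ m : ℤ, N (m : O) ∣ 144 ^ 4 → ¬ α ∣ (m : O) := by
    intro m hm h
    have h1 := (map_dvd N h).trans hm
    rw [hN] at h1
    have h2 : p ∣ 144 ^ 4 := by exact_mod_cast h1
    have h3 := hp.dvd_of_dvd_pow h2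
    rw [show 144 = 2 ^ 4 * 3 ^ 2 by norm_num] at h3
    rcases hp.dvd_mul.1 h3 with h | h
    · have := (Nat.prime_dvd_prime_iff_eq hp Nat.prime_two).1 (hp.dvd_of_dvd_pow h); omega
    · have := (Nat.prime_dvd_prime_iff_eq hp Nat.prime_three).1 (hp.dvd_of_dvd_pow h); omega
  have hsig : ¬ Associated (star α) α := fun h => hnot 2 (by rw [N_intCast]; norm_num) <| by
    have := (hno sig h ⟨0, 1⟩).mul_right ⟨0, 1⟩
    convert this using 1
    decide
  have htau : ¬ Associated (tau α) α := fun h => hnot 3 (by rw [N_intCast]; norm_num) <| by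
    have := (hno tau h ⟨om, 0⟩).mul_right ⟨⟨1, 2⟩, 0⟩
    convert this using 1
    decide
  have hst : ¬ Associated (star (tau α)) α := fun h => hnot 2 (by rw [N_intCast]; norm_num) <| by
    have := (hno (tau.trans sig) h ⟨0, 1⟩).mul_right ⟨0, 1⟩
    convert this using 1
    decide
  have htt : ∀ x : O, tau (tau x) = x := fun x => by ext1 <;> simp [tau]
  have hts : ∀ x : O, star (tau x) = tau (star x) := fun x => by ext1 <;> simp [tau]
  have hred : ∀ x : O, N x = p → ∃ y, Red y ∧ Associated x y ∧ N y = p := fun x hx => by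
    obtain ⟨y, hy, h⟩ := exists_red (α := x) (by rw [hx]; omega)
    exact ⟨y, hy, h, by rw [← hx, N_eq_of_associated h]⟩
  have hNs : N (star α) = p := by rw [N_star, hN]
  have hNt : N (tau α) = p := by rw [N_tau, hN]
  have hNst : N (star (tau α)) = p := by rw [N_star, hNt]
  obtain ⟨β₁, r₁, a₁, n₁⟩ := hred _ hNs
  obtain ⟨β₂, r₂, a₂, n₂⟩ := hred _ hNt
  obtain ⟨β₃, r₃, a₃, n₃⟩ := hred _ hNst
  have hmap : ∀ (g : O ≃+* O) {x y : O}, Associated x y → Associated (g x) (g y) :=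
    fun g _ _ h => h.map g
  have d₁ : α ≠ β₁ := fun h => hsig (a₁.trans (h ▸ Associated.refl _))
  have d₂ : α ≠ β₂ := fun h => htau (a₂.trans (h ▸ Associated.refl _))
  have d₃ : α ≠ β₃ := fun h => hst (a₃.trans (h ▸ Associated.refl _))
  have d₁₂ : β₁ ≠ β₂ := fun h => hst <| by
    have := hmap sig (a₁.trans (h ▸ a₂.symm))
    simp only [sig, starRingAut_apply, star_star] at this
    exact this.symm
  have d₁₃ : β₁ ≠ β₃ := fun h => htau <| by
    have := hmap sig (a₁.trans (h ▸ a₃.symm))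
    simp only [sig, starRingAut_apply, star_star] at this
    exact this.symm
  have d₂₃ : β₂ ≠ β₃ := fun h => hsig <| by
    have := hmap tau (a₂.trans (h ▸ a₃.symm))
    rw [htt, hts, htt] at this
    exact this.symm
  have heq : RN p = {α, β₁, β₂, β₃} := by
    ext β
    simp only [mem_RN, Finset.mem_insert, Finset.mem_singleton]
    constructor
    · rintro ⟨hβ, hNβ⟩
      have hβp := prime_of_norm hp hNβ
      have hprod : (p : O) = α * (star α * (tau α * star (tau α))) := by
        have e1 : α * star α = algebraMap E O (nO α) :=
          (algebraMap_norm_eq_mul_star α).symm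
        have e2 : tau α * star (tau α) = algebraMap E O (star (nO α)) := by
          refine (algebraMap_norm_eq_mul_star (tau α)).symm.trans (congrArg _ ?_)
          change nO (tau α) = _
          rw [nO_def, nO_def, tau_re, tau_im]
          simp
        rw [← mul_assoc, e1, e2, ← map_mul, mul_star_E, ← N_def, hN]
        simp
      have hdvd : β ∣ α * (star α * (tau α * star (tau α))) := by
        have := dvd_natCast_norm β
        rw [hNβ] at this
        rw [← hprod]
        exact_mod_cast this
      have has : ∀ x : O, N x = p → β ∣ x → Associated β x := fun x hx h =>
        hβp.associated_of_dvd (prime_of_norm hp hx) h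
      rcases hβp.dvd_or_dvd hdvd with h | h
      · exact Or.inl (hβ.eq_of_associated hα (has _ hN h))
      rcases hβp.dvd_or_dvd h with h | h
      · exact Or.inr (Or.inl (hβ.eq_of_associated r₁ ((has _ hNs h).trans a₁)))
      rcases hβp.dvd_or_dvd h with h | h
      · exact Or.inr (Or.inr (Or.inl (hβ.eq_of_associated r₂ ((has _ hNt h).trans a₂))))
      · exact Or.inr (Or.inr (Or.inr (hβ.eq_of_associated r₃ ((has _ hNst h).trans a₃))))
    · rintro (rfl | rfl | rfl | rfl)
      exacts [⟨hα, hN⟩, ⟨r₁, n₁⟩, ⟨r₂, n₂⟩, ⟨r₃, n₃⟩]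
  rw [heq, Finset.card_insert_of_notMem (by simp [d₁, d₂, d₃]),
    Finset.card_insert_of_notMem (by simp [d₁₂, d₁₃]), Finset.card_pair d₂₃]

theorem fsym_tau {α : O} (hα : (3 : O) ∣ α - 1) : fsym (tau α) = star (fsym α) := by
  have : star (tau α) = tau (star α) := by ext1 <;> simp [tau]
  rw [fsym, this, cs_tau _ (primary_O_ne_zero hα), fsym]

open Classical in
theorem FC_prime {p : ℕ} (hp : p.Prime) : FC p = if p % 12 = 1 then
    (if ∃ b : ZMod p, b ^ 3 = ((apE p : ℤ) : ZMod p) then 4 else -2) else 0 := by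
  split_ifs with h12 hc
  · rw [FC, Finset.sum_congr rfl (g := fun _ => 1) fun α hα => ?_, Finset.sum_const,
      card_RN_prime hp h12]
    · norm_num
    · have hα' := mem_RN.1 hα
      rw [fC, (exists_cube_iff_fsym hα'.1.1 hp hα'.2).1 hc, map_one]
  · have hinv : ∀ α ∈ RN p, ∃ β ∈ RN p, Associated (tau α) β ∧ fC β = star (fC α) := by
      intro α hα
      have hα' := mem_RN.1 hα
      have hN : N (tau α) = p := by rw [N_tau, hα'.2]
      obtain ⟨β, hβ, h⟩ := exists_red (α := tau α) (by rw [hN]; omega)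
      refine ⟨β, mem_RN.2 ⟨hβ, by rw [← N_eq_of_associated h, hN]⟩, h, ?_⟩
      rw [fC, fC, ← fsym_eq_of_associated (primary_O_tau hα'.1.1) hβ.1 h, fsym_tau hα'.1.1,
        emb_star]
    choose! g hg hga hgf using hinv
    have hinj : Set.InjOn g (RN p) := by
      intro α hα β hβ h
      have h1 := ((hga α hα).trans (h ▸ (hga β hβ).symm)).map tau.symm
      simp only [RingEquiv.symm_apply_apply] at h1
      exact (mem_RN.1 hα).1.eq_of_associated (mem_RN.1 hβ).1 h1
    have himg : (RN p).image g = RN p :=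
      Finset.eq_of_subset_of_card_le (Finset.image_subset_iff.2 hg)
        (Finset.card_image_of_injOn hinj).ge
    have h1 : FC p = ∑ α ∈ RN p, star (fC α) := by
      rw [FC, ← himg, Finset.sum_image hinj, himg]
      exact Finset.sum_congr rfl hgf
    have h2 : FC p + FC p = -4 := by
      nth_rw 2 [h1]
      rw [FC, ← Finset.sum_add_distrib, Finset.sum_congr rfl (g := fun _ => (-1 : ℂ)) fun α hα => ?_,
        Finset.sum_const, card_RN_prime hp h12]
      · norm_num
      · have hα' := mem_RN.1 hα
        have hne1 : fsym α ≠ 1 := fun h => hc ((exists_cube_iff_fsym hα'.1.1 hp hα'.2).2 h)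
        have : Fact p.Prime := ⟨hp⟩
        obtain ⟨A, B, -, hAB⟩ := exists_apE_eq p (by omega)
        have hne0 := (cs_trace_eq_fsym hα'.1.1 hp hα'.2 hAB).2
        rw [fC, ← emb_star, ← map_add, ← map_one emb, ← map_neg]
        congr 1
        rcases (fsym_isMu α).cases with h | h | h | h
        · exact absurd h hne0
        · exact absurd h hne1
        · rw [h]; decide
        · rw [h]; decide
    linear_combination h2 / 2
  · rw [FC]
    refine Finset.sum_eq_zero fun α hα => ?_
    have hα' := mem_RN.1 hα
    exact absurd (mod_twelve_of_norm hα'.1.1 hp hα'.2) h12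

theorem exists_prime_norm_dvd {q m : ℕ} (hq : q.Prime) (hqm : ¬ q ∣ m) {δ : O}
    (hδ : Red δ) (hN : N δ = (q * m : ℕ)) : ∃ ρ, Red ρ ∧ N ρ = q ∧ ρ ∣ δ := by
  have hex : ∃ π ∈ factors δ, (q : ℤ) ∣ N π := by
    have h1 : (q : ℤ) ∣ ((factors δ).map N).prod := by
      rw [Multiset.prod_hom, N_eq_of_associated (factors_prod hδ.ne_zero), hN]
      push_cast; exact dvd_mul_right _ _
    obtain ⟨x, hx, hqx⟩ := (Nat.prime_iff_prime_int.1 hq).exists_mem_multiset_dvd h1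
    obtain ⟨π, hπ, rfl⟩ := Multiset.mem_map.1 hx
    exact ⟨π, hπ, hqx⟩
  obtain ⟨π, hπ, hqπ⟩ := hex
  have hπδ : π ∣ δ := dvd_of_mem_factors hπ
  have hπp := prime_of_factor π hπ
  have h3 : N π % 3 ≠ 0 := fun h => by
    have h1 := (Int.dvd_of_emod_eq_zero h).trans (map_dvd N hπδ)
    have h2 := N_primary_mod hδ.1
    omega
  obtain ⟨ρ, hρ, has⟩ := exists_red h3
  have hρp : Prime ρ := has.prime hπp
  refine ⟨ρ, hρ, ?_, has.symm.dvd.trans hπδ⟩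
  have hqρ : (q : ℤ) ∣ N ρ := by rwa [← N_eq_of_associated has]
  have hρq : ρ ∣ (q : O) := by
    have h1 := dvd_natCast_norm ρ
    obtain ⟨n, hn⟩ := Int.eq_ofNat_of_zero_le (N_nonneg ρ)
    have hn0 : n ≠ 0 := by rintro rfl; have := hρ.N_pos; omega
    rw [hn] at h1
    have h2 : ρ ∣ ((n.primeFactorsList : Multiset ℕ).map (Nat.castRingHom O)).prod := by
      rw [Multiset.prod_hom, Multiset.prod_coe, Nat.prod_primeFactorsList hn0]
      simpa using h1
    obtain ⟨x, hx, hρx⟩ := hρp.exists_mem_multiset_dvd h2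
    obtain ⟨l, hl, rfl⟩ := Multiset.mem_map.1 hx
    have hlp := Nat.prime_of_mem_primeFactorsList (Multiset.mem_coe.1 hl)
    have h4 : N ρ ∣ N ((l : ℤ) : O) := map_dvd N (by simpa using hρx)
    rw [N_intCast] at h4
    have h5 : q ∣ l ^ 4 := by exact_mod_cast hqρ.trans h4
    rw [(Nat.prime_dvd_prime_iff_eq hq hlp).1 (hq.dvd_of_dvd_pow h5)]
    simpa using hρx
  have h4 : N ρ ∣ (q : ℤ) ^ 4 := by
    have := map_dvd N (show ρ ∣ ((q : ℤ) : O) by simpa using hρq)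
    rwa [N_intCast] at this
  obtain ⟨n, hn⟩ := Int.eq_ofNat_of_zero_le (N_nonneg ρ)
  have h5 : n ∣ q * m := by
    have := map_dvd N (has.symm.dvd.trans hπδ)
    rw [hN, hn] at this
    exact_mod_cast this
  rw [hn] at h4 hqρ ⊢
  obtain ⟨j, -, rfl⟩ := (Nat.dvd_prime_pow hq).1 (show n ∣ q ^ 4 by exact_mod_cast h4)
  have hj0 : j ≠ 0 := by
    rintro rfl
    exact hq.one_lt.ne' (Nat.dvd_one.1 (by exact_mod_cast hqρ))
  have hj1 : j < 2 := by
    by_contra! h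
    have h6 := (pow_dvd_pow q h).trans h5
    rw [pow_two] at h6
    exact hqm (Nat.dvd_of_mul_dvd_mul_left hq.pos h6)
  rw [show j = 1 by omega, pow_one]

theorem fC_eq_of_associated {α β : O} (hα : (3 : O) ∣ α - 1) (hβ : (3 : O) ∣ β - 1)
    (h : Associated α β) : fC α = fC β := by
  rw [fC, fC, fsym_eq_of_associated hα hβ h]

theorem FC_mul {q m : ℕ} (hq : q.Prime) (hqm : ¬ q ∣ m) :
    FC (q * m) = ∑ ρ ∈ RN q, ∑ γ ∈ RN m, fC (ρ * γ) := by
  have hred : ∀ x ∈ RN q ×ˢ RN m, ∃ δ ∈ RN (q * m), Associated (x.1 * x.2) δ := by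
    rintro ⟨ρ, γ⟩ hx
    obtain ⟨h1, h2⟩ := Finset.mem_product.1 hx
    have h1' := mem_RN.1 h1
    have h2' := mem_RN.1 h2
    have hN : N (ρ * γ) = (q * m : ℕ) := by rw [map_mul, h1'.2, h2'.2]; push_cast; rfl
    have h3 := N_primary_mod (primary_mul h1'.1.1 h2'.1.1)
    dsimp only at h3
    obtain ⟨δ, hδ, h⟩ := exists_red (α := ρ * γ) (by rw [h3]; exact one_ne_zero)
    exact ⟨δ, mem_RN.2 ⟨hδ, by rw [← N_eq_of_associated h, hN]⟩, h⟩
  choose! g hg hga using hred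
  rw [FC, ← Finset.sum_product']
  symm
  refine Finset.sum_bij (fun x _ => g x) hg ?_ ?_ ?_
  · rintro ⟨ρ, γ⟩ hx ⟨ρ', γ'⟩ hx' h
    have has : Associated (ρ * γ) (ρ' * γ') :=
      (hga _ hx).trans ((show g (ρ, γ) = g (ρ', γ') from h) ▸ (hga _ hx').symm)
    obtain ⟨h1, h2⟩ := Finset.mem_product.1 hx
    obtain ⟨h3, h4⟩ := Finset.mem_product.1 hx'
    have h1' := mem_RN.1 h1
    have h2' := mem_RN.1 h2
    have h3' := mem_RN.1 h3
    have h4' := mem_RN.1 h4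
    have hρp := prime_of_norm hq h1'.2
    have hd : ρ ∣ ρ' * γ' := (dvd_mul_right _ _).trans has.dvd
    have hρρ : ρ = ρ' := by
      rcases hρp.dvd_or_dvd hd with h | h
      · exact h1'.1.eq_of_associated h3'.1
          (hρp.associated_of_dvd (prime_of_norm hq h3'.2) h)
      · have := map_dvd N h
        dsimp only at h1' h4'
        rw [h1'.2, h4'.2] at this
        exact absurd (by exact_mod_cast this) hqm
    subst hρρ
    have := h2'.1.eq_of_associated h4'.1 (Associated.of_mul_left has (Associated.refl _) hρp.ne_zero)
    dsimp only at this
    rw [this]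
  · intro δ hδ
    have hδ' := mem_RN.1 hδ
    obtain ⟨ρ, hρ, hNρ, γ, rfl⟩ := exists_prime_norm_dvd hq hqm hδ'.1 hδ'.2
    have hNγ : N γ = m := by
      have h1 := hδ'.2
      rw [map_mul, hNρ] at h1
      push_cast at h1
      exact mul_left_cancel₀ (by exact_mod_cast hq.ne_zero) h1
    have h3 : N γ % 3 ≠ 0 := fun h => by
      have h1 := N_primary_mod hδ'.1.1
      rw [map_mul, Int.mul_emod, h] at h1
      simp at h1
    obtain ⟨γ', hγ', h⟩ := exists_red h3
    have hmem : (ρ, γ') ∈ RN q ×ˢ RN m := Finset.mem_product.2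
      ⟨mem_RN.2 ⟨hρ, hNρ⟩, mem_RN.2 ⟨hγ', by rw [← N_eq_of_associated h, hNγ]⟩⟩
    refine ⟨(ρ, γ'), hmem, ?_⟩
    exact ((mem_RN.1 (hg _ hmem)).1.eq_of_associated hδ'.1
      ((hga _ hmem).symm.trans (Associated.mul_left ρ h.symm)))
  · rintro ⟨ρ, γ⟩ hx
    obtain ⟨h1, h2⟩ := Finset.mem_product.1 hx
    exact fC_eq_of_associated (primary_mul (mem_RN.1 h1).1.1 (mem_RN.1 h2).1.1)
      (mem_RN.1 (hg _ hx)).1.1 (hga _ hx)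

theorem fC_mul {α β : O} (hα : (3 : O) ∣ α - 1) (hβ : (3 : O) ∣ β - 1) :
    fC (α * β) = fC α * fC β * emb (cs β (star α)) ^ 2 := by
  rw [fC, fsym_mul hα hβ, map_mul, map_mul, map_pow, fC, fC]

theorem exists_ringHom_of_norm {π : O} {p : ℕ} (hp : p.Prime) (hN : N π = p) :
    ∃ ψ : O →+* ZMod p, ∀ x, ψ x = 0 ↔ π ∣ x := by
  have hc : Nat.card (O ⧸ Ideal.span {π}) = p := by
    have := nq_O π
    rw [nq, hN] at this
    simpa using this
  have : Finite (O ⧸ Ideal.span {π}) := Nat.finite_of_card_ne_zero (by rw [hc]; exact hp.ne_zero)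
  have := Fintype.ofFinite (O ⧸ Ideal.span {π})
  rw [Nat.card_eq_fintype_card] at hc
  refine ⟨(ZMod.ringEquivOfPrime _ hp hc).symm.toRingHom.comp (Ideal.Quotient.mk _), fun x => ?_⟩
  simp [Ideal.Quotient.eq_zero_iff_mem, Ideal.mem_span_singleton]

/-- The conjugate-twisted cubic character attached to `ρ`. -/
noncomputable def twist (ρ α : O) : ℂ := emb (cs α (star ρ)) ^ 2

theorem norm_twist_le (ρ α : O) : ‖twist ρ α‖ ≤ 1 := by
  rw [twist, norm_pow]
  exact pow_le_one₀ (norm_nonneg _) (cs_isMu _ _).norm_emb_le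

theorem twist_mul (ρ α β : O) : twist ρ (α * β) = twist ρ α * twist ρ β := by
  rw [twist, cs_mul_left, map_mul, mul_pow]; rfl

theorem twist_one (ρ : O) : twist ρ 1 = 1 := by
  rw [twist, cs_one_left, map_one, one_pow]

theorem twist_prod (ρ : O) {ι : Type*} (s : Finset ι) (g : ι → O) :
    twist ρ (∏ i ∈ s, g i) = ∏ i ∈ s, twist ρ (g i) :=
  map_prod (⟨⟨twist ρ, twist_one ρ⟩, twist_mul ρ⟩ : O →* ℂ) g s

theorem image_natCast_range (m : ℕ) [NeZero m] :
    (Finset.range m).image (fun t : ℕ => (t : ZMod m)) = Finset.univ := by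
  ext x
  simp only [Finset.mem_image, Finset.mem_range, Finset.mem_univ, iff_true]
  exact ⟨x.val, ZMod.val_lt x, ZMod.natCast_zmod_val x⟩

theorem exists_twist_eq {ρ : O} (hρ : (3 : O) ∣ ρ - 1) {p : ℕ} [Fact p.Prime] (hN : N ρ = p) :
    ∃ (ψ : O →+* ZMod p) (G : ZMod p → ℂ), (∀ α, twist ρ α = G (ψ α)) ∧ ∑ x, G x = 0 := by
  have hp : p.Prime := Fact.out
  have hN' : N (star ρ) = p := by rw [N_star, hN]
  have hπ := prime_of_norm hp hN'
  have h3 : ¬ star ρ ∣ 3 :=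
    not_dvd_three_of_coprime (isCoprime_three (primary_O_star hρ)) hπ dvd_rfl
  obtain ⟨ψ, hψ⟩ := exists_ringHom_of_norm hp hN'
  have hsurj := ZMod.ringHom_surjective ψ
  choose s hs using hsurj
  have hG : ∀ α, twist ρ α = twist ρ (s (ψ α)) := fun α => by
    rw [twist, twist, cs_prime _ hπ, cs_prime _ hπ, lsym_congr (b := s (ψ α))]
    rw [← hψ, map_sub, hs, sub_self]
  refine ⟨ψ, fun x => twist ρ (s x), hG, ?_⟩
  obtain ⟨a, ha, ha1⟩ := exists_lsym_ne_one hπ h3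
  have ha0 : lsym (star ρ) a ≠ 0 := fun h => ha ((lsym_eq_zero hπ h3).1 h)
  have h3' := (lsym_isMu (star ρ) a).resolve_left ha0
  have hz : twist ρ a ≠ 1 := by
    rw [twist, cs_prime _ hπ, ← map_pow, ← map_one emb]
    intro h
    have h2 : lsym (star ρ) a ^ 2 = 1 := by
      rw [← sub_eq_zero] at h ⊢
      rwa [← map_sub, emb_eq_zero] at h
    exact ha1 (by linear_combination h3' - lsym (star ρ) a * h2)
  have hψa : ψ a ≠ 0 := fun h => ha ((hψ a).1 h)
  have key : ∑ x, twist ρ (s x) = twist ρ a * ∑ x, twist ρ (s x) := by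
    rw [Finset.mul_sum, ← Equiv.sum_comp (Equiv.mulLeft₀ (ψ a) hψa)]
    refine Finset.sum_congr rfl fun x _ => ?_
    rw [← twist_mul, hG (a * s x), map_mul, hs]
    rfl
  have : (1 - twist ρ a) * ∑ x, twist ρ (s x) = 0 := by linear_combination key
  exact (mul_eq_zero.1 this).resolve_left (sub_ne_zero.2 (Ne.symm hz))

theorem norm_sum_range_le {g : ℕ → ℂ} (hg : ∀ t, ‖g t‖ ≤ 1) {q : ℕ} (hq : 0 < q)
    (hz : ∀ t₀, ∑ t ∈ Finset.range q, g (t₀ + t) = 0) (n : ℕ) :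
    ‖∑ t ∈ Finset.range n, g t‖ ≤ q := by
  induction n using Nat.strong_induction_on generalizing g with
  | _ n ih =>
    rcases le_or_gt q n with h | h
    · obtain ⟨m, rfl⟩ := Nat.exists_eq_add_of_le h
      rw [Finset.sum_range_add]
      have h0 := hz 0
      simp only [zero_add] at h0
      rw [h0, zero_add]
      refine ih m (by omega) (g := fun t => g (q + t)) (fun t => hg _) fun t₀ => ?_
      simpa only [add_assoc] using hz (q + t₀)
    · calc ‖∑ t ∈ Finset.range n, g t‖ ≤ ∑ t ∈ Finset.range n, 1 :=
            norm_sum_le_of_le _ fun t _ => hg t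
        _ ≤ q := by simp; omega

theorem sum_range_mul_eq_zero {p q : ℕ} [NeZero p] [NeZero q] (hpq : p.Coprime q)
    {F : ZMod p → ℂ} (G : ZMod q → ℂ) (hF : ∑ x, F x = 0) (a : ZMod p) (b : ZMod q) :
    ∑ t ∈ Finset.range (p * q), F (a + t) * G (b + t) = 0 := by
  let e := ZMod.chineseRemainder hpq
  have h1 : ∑ t ∈ Finset.range (p * q), F (a + t) * G (b + t) =
      ∑ x : ZMod (p * q), F (a + (e x).1) * G (b + (e x).2) := by
    rw [← image_natCast_range, Finset.sum_image]
    · refine Finset.sum_congr rfl fun t _ => ?_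
      rw [map_natCast]
      rfl
    · intro x hx y hy hxy
      simp only [Finset.coe_range, Set.mem_Iio] at hx hy
      have := (ZMod.natCast_eq_natCast_iff' _ _ _).1 hxy
      rwa [Nat.mod_eq_of_lt hx, Nat.mod_eq_of_lt hy] at this
  have h3 := Equiv.sum_comp e.toEquiv (fun z => F (a + z.1) * G (b + z.2))
  refine h1.trans (h3.trans ?_)
  rw [Fintype.sum_prod_type]
  simp only [← Finset.mul_sum]
  rw [← Finset.sum_mul]
  have h2 : ∑ x, F (a + x) = 0 := by rw [← hF]; exact Equiv.sum_comp (Equiv.addLeft a) F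
  rw [h2, zero_mul]

theorem norm_sum_twist_le {ρ₁ ρ₂ : O} (h₁ : (3 : O) ∣ ρ₁ - 1) (h₂ : (3 : O) ∣ ρ₂ - 1) {p q : ℕ}
    (hp : p.Prime) (hq : q.Prime) (hpq : p ≠ q) (hN₁ : N ρ₁ = p) (hN₂ : N ρ₂ = q) (α : O)
    (n : ℕ) : ‖∑ t ∈ Finset.range n, twist ρ₁ (α + t) * star (twist ρ₂ (α + t))‖ ≤ p * q := by
  have := Fact.mk hp
  have := Fact.mk hq
  obtain ⟨ψ₁, G₁, hG₁, h0⟩ := exists_twist_eq h₁ hN₁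
  obtain ⟨ψ₂, G₂, hG₂, -⟩ := exists_twist_eq h₂ hN₂
  have := norm_sum_range_le (g := fun t => twist ρ₁ (α + t) * star (twist ρ₂ (α + t)))
    (q := p * q) (fun t => ?_) (Nat.mul_pos hp.pos hq.pos) (fun t₀ => ?_) n
  · exact_mod_cast this
  · rw [norm_mul, _root_.norm_star]
    exact mul_le_one₀ (norm_twist_le _ _) (norm_nonneg _) (norm_twist_le _ _)
  · have h := sum_range_mul_eq_zero ((Nat.coprime_primes hp hq).2 hpq)
      (fun x => star (G₂ x)) h0 (ψ₁ (α + t₀)) (ψ₂ (α + t₀))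
    rw [← h]
    refine Finset.sum_congr rfl fun t _ => ?_
    rw [hG₁, hG₂]
    simp only [Nat.cast_add, map_add, map_natCast, add_assoc]

/-- Lattice points of `O` with all coordinates in `[-L, L]`. -/
def box (L : ℕ) : Finset O :=
  (Finset.range (2 * L + 1) ×ˢ Finset.range (2 * L + 1) ×ˢ Finset.range (2 * L + 1) ×ˢ
    Finset.range (2 * L + 1)).image fun x => ⟨⟨(x.2.2.2 : ℤ) - L, (x.1 : ℤ) - L⟩,
      ⟨(x.2.1 : ℤ) - L, (x.2.2.1 : ℤ) - L⟩⟩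

theorem box_injOn (L : ℕ) (s : Set (ℕ × ℕ × ℕ × ℕ)) : Set.InjOn (fun x : ℕ × ℕ × ℕ × ℕ =>
    (⟨⟨(x.2.2.2 : ℤ) - L, (x.1 : ℤ) - L⟩, ⟨(x.2.1 : ℤ) - L, (x.2.2.1 : ℤ) - L⟩⟩ : O)) s := by
  rintro ⟨a, b, c, d⟩ - ⟨a', b', c', d'⟩ - h
  simp only [QuadraticAlgebra.mk.injEq] at h
  simp only [Prod.mk.injEq]
  omega

theorem card_box (L : ℕ) : (box L).card = (2 * L + 1) ^ 4 := by
  rw [box, Finset.card_image_of_injOn (box_injOn L _)]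
  simp only [Finset.card_product, Finset.card_range]
  ring

theorem mem_box {L : ℕ} {α : O} : α ∈ box L ↔
    |α.re.re| ≤ L ∧ |α.re.im| ≤ L ∧ |α.im.re| ≤ L ∧ |α.im.im| ≤ L := by
  obtain ⟨⟨d, a⟩, ⟨b, c⟩⟩ := α
  simp only [box, Finset.mem_image, Finset.mem_product, Finset.mem_range,
    QuadraticAlgebra.mk.injEq, Prod.exists, abs_le]
  constructor
  · rintro ⟨a', b', c', d', h⟩; omega
  · rintro h
    exact ⟨(a + L).toNat, (b + L).toNat, (c + L).toNat, (d + L).toNat, by omega⟩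

theorem norm_sum_box_le {ρ₁ ρ₂ : O} (h₁ : (3 : O) ∣ ρ₁ - 1) (h₂ : (3 : O) ∣ ρ₂ - 1) {p q : ℕ}
    (hp : p.Prime) (hq : q.Prime) (hpq : p ≠ q) (hN₁ : N ρ₁ = p) (hN₂ : N ρ₂ = q) (L : ℕ) :
    ‖∑ x ∈ box L, twist ρ₁ x * star (twist ρ₂ x)‖ ≤ (2 * L + 1) ^ 3 * (p * q) := by
  rw [box, Finset.sum_image (box_injOn L _)]
  simp only [Finset.sum_product]
  have h : ∀ a b c : ℕ, ‖∑ d ∈ Finset.range (2 * L + 1),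
      twist ρ₁ ⟨⟨(d : ℤ) - L, (a : ℤ) - L⟩, ⟨(b : ℤ) - L, (c : ℤ) - L⟩⟩ *
        star (twist ρ₂ ⟨⟨(d : ℤ) - L, (a : ℤ) - L⟩, ⟨(b : ℤ) - L, (c : ℤ) - L⟩⟩)‖ ≤ p * q := by
    intro a b c
    have := norm_sum_twist_le h₁ h₂ hp hq hpq hN₁ hN₂
      ⟨⟨-L, (a : ℤ) - L⟩, ⟨(b : ℤ) - L, (c : ℤ) - L⟩⟩ (2 * L + 1)
    convert this using 5 with d hd d hd
    · ext <;> simp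
      ring
    · congr 1
      ext <;> simp
      ring
  calc _ ≤ ∑ a ∈ Finset.range (2 * L + 1), ∑ b ∈ Finset.range (2 * L + 1),
        ∑ c ∈ Finset.range (2 * L + 1), (p * q : ℝ) :=
        norm_sum_le_of_le _ fun a _ => norm_sum_le_of_le _ fun b _ =>
          norm_sum_le_of_le _ fun c _ => h a b c
    _ = _ := by simp; ring

/-- Finite sets of reduced elements whose norms are primes at most `M`. -/
def PrimeNorms (M : ℝ) (A : Finset O) : Prop :=
  ∀ ρ ∈ A, Red ρ ∧ ∃ p : ℕ, p.Prime ∧ N ρ = p ∧ (p : ℝ) ≤ M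

theorem PrimeNorms.card_fiber_le {M : ℝ} {A : Finset O} (hA : PrimeNorms M A) (n : ℕ) :
    (A.filter fun ρ => N ρ = n).card ≤ 4 := by
  rcases Finset.eq_empty_or_nonempty (A.filter fun ρ => N ρ = n) with h | ⟨ρ, h⟩
  · simp [h]
  · obtain ⟨hρ, hn⟩ := Finset.mem_filter.1 h
    obtain ⟨hr, p, hp, hNp, -⟩ := hA ρ hρ
    have hpn : p = n := by rw [hNp] at hn; exact_mod_cast hn
    subst hpn
    rw [← card_RN_prime hp (mod_twelve_of_norm hr.1 hp hNp)]
    refine Finset.card_le_card fun α hα => ?_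
    obtain ⟨h1, h2⟩ := Finset.mem_filter.1 hα
    exact mem_RN.2 ⟨(hA α h1).1, h2⟩

theorem PrimeNorms.card_le {M : ℝ} (hM : 0 ≤ M) {A : Finset O} (hA : PrimeNorms M A) :
    (A.card : ℝ) ≤ 4 * M := by
  have h := Finset.card_le_mul_card_image (f := fun ρ => (N ρ).toNat) A 4 fun n hn => by
    refine le_trans (Finset.card_le_card fun ρ hρ => ?_) (hA.card_fiber_le n)
    obtain ⟨h1, h2⟩ := Finset.mem_filter.1 hρ
    refine Finset.mem_filter.2 ⟨h1, ?_⟩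
    rw [← h2, Int.toNat_of_nonneg (N_nonneg ρ)]
  have h2 : (A.image fun ρ => (N ρ).toNat).card ≤ ⌊M⌋₊ := by
    refine le_trans (Finset.card_le_card (t := Finset.Icc 1 ⌊M⌋₊) fun n hn => ?_) (by simp)
    obtain ⟨ρ, hρ, rfl⟩ := Finset.mem_image.1 hn
    obtain ⟨hr, p, hp, hNp, hle⟩ := hA ρ hρ
    rw [hNp]
    exact Finset.mem_Icc.2 ⟨hp.one_lt.le, Nat.le_floor hle⟩
  have h3 : (A.card : ℝ) ≤ 4 * (⌊M⌋₊ : ℝ) := by exact_mod_cast h.trans (Nat.mul_le_mul_left 4 h2)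
  exact h3.trans (by linarith [Nat.floor_le hM])

theorem sum_box_norm_sq_le {M : ℝ} (hM : 0 ≤ M) {A : Finset O} (hA : PrimeNorms M A) {L : ℕ}
    (hL : M ^ 3 ≤ L) {θ : O → ℂ} (hθ : ∀ ρ, ‖θ ρ‖ ≤ 1) :
    ∑ x ∈ box L, ‖∑ ρ ∈ A, θ ρ * twist ρ x‖ ^ 2 ≤ 8 * A.card * (2 * L + 1 : ℝ) ^ 4 := by
  have h1 : ((∑ x ∈ box L, ‖∑ ρ ∈ A, θ ρ * twist ρ x‖ ^ 2 : ℝ) : ℂ) =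
      ∑ ρ₁ ∈ A, ∑ ρ₂ ∈ A, θ ρ₁ * star (θ ρ₂) *
        ∑ x ∈ box L, twist ρ₁ x * star (twist ρ₂ x) := by
    push_cast
    have : ∀ x, ((‖∑ ρ ∈ A, θ ρ * twist ρ x‖ : ℂ)) ^ 2 =
        ∑ ρ₁ ∈ A, ∑ ρ₂ ∈ A, θ ρ₁ * star (θ ρ₂) * (twist ρ₁ x * star (twist ρ₂ x)) := by
      intro x
      rw [← Complex.mul_conj', ← Complex.star_def, star_sum, Finset.sum_mul_sum]
      refine Finset.sum_congr rfl fun ρ₁ _ => Finset.sum_congr rfl fun ρ₂ _ => ?_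
      rw [star_mul']
      ring
    simp only [this]
    rw [Finset.sum_comm]
    refine Finset.sum_congr rfl fun ρ₁ _ => ?_
    rw [Finset.sum_comm]
    refine Finset.sum_congr rfl fun ρ₂ _ => ?_
    rw [Finset.mul_sum]
  have h2 : ∑ x ∈ box L, ‖∑ ρ ∈ A, θ ρ * twist ρ x‖ ^ 2 ≤
      ∑ ρ₁ ∈ A, ∑ ρ₂ ∈ A, ‖∑ x ∈ box L, twist ρ₁ x * star (twist ρ₂ x)‖ := by
    calc _ = ‖((∑ x ∈ box L, ‖∑ ρ ∈ A, θ ρ * twist ρ x‖ ^ 2 : ℝ) : ℂ)‖ := by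
          rw [Complex.norm_real, Real.norm_of_nonneg (by positivity)]
      _ ≤ _ := by
          rw [h1]
          refine norm_sum_le_of_le _ fun ρ₁ _ => norm_sum_le_of_le _ fun ρ₂ _ => ?_
          rw [norm_mul, norm_mul, _root_.norm_star]
          exact mul_le_of_le_one_left (norm_nonneg _)
            (mul_le_one₀ (hθ _) (norm_nonneg _) (hθ _))
  have hcard := hA.card_le hM
  have h3 : ∀ ρ₁ ∈ A, ∑ ρ₂ ∈ A, ‖∑ x ∈ box L, twist ρ₁ x * star (twist ρ₂ x)‖ ≤
      8 * (2 * L + 1 : ℝ) ^ 4 := by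
    intro ρ₁ hρ₁
    obtain ⟨hr, p, hp, hNp, hpM⟩ := hA ρ₁ hρ₁
    rw [← Finset.sum_filter_add_sum_filter_not A fun ρ => N ρ = p]
    have h4 : ∑ ρ₂ ∈ A with N ρ₂ = p, ‖∑ x ∈ box L, twist ρ₁ x * star (twist ρ₂ x)‖ ≤
        4 * (2 * L + 1 : ℝ) ^ 4 := by
      calc _ ≤ ∑ ρ₂ ∈ A with N ρ₂ = p, (2 * L + 1 : ℝ) ^ 4 := by
            refine Finset.sum_le_sum fun ρ₂ _ => ?_
            calc _ ≤ ∑ x ∈ box L, (1 : ℝ) := norm_sum_le_of_le _ fun x _ => by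
                  rw [norm_mul, _root_.norm_star]
                  exact mul_le_one₀ (norm_twist_le _ _) (norm_nonneg _) (norm_twist_le _ _)
              _ = _ := by simp [card_box]
        _ ≤ _ := by
            rw [Finset.sum_const, nsmul_eq_mul]
            have : ((A.filter fun ρ => N ρ = p).card : ℝ) ≤ 4 := by
              exact_mod_cast hA.card_fiber_le p
            gcongr
    have h5 : ∑ ρ₂ ∈ A with ¬ N ρ₂ = p, ‖∑ x ∈ box L, twist ρ₁ x * star (twist ρ₂ x)‖ ≤
        4 * (2 * L + 1 : ℝ) ^ 4 := by
      calc _ ≤ ∑ ρ₂ ∈ A with ¬ N ρ₂ = p, (2 * L + 1 : ℝ) ^ 3 * (M * M) := by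
            refine Finset.sum_le_sum fun ρ₂ h => ?_
            obtain ⟨h6, h7⟩ := Finset.mem_filter.1 h
            obtain ⟨hr', q, hq, hNq, hqM⟩ := hA ρ₂ h6
            have hpq : p ≠ q := by rintro rfl; exact h7 hNq
            refine (norm_sum_box_le hr.1 hr'.1 hp hq hpq hNp hNq L).trans ?_
            gcongr
        _ ≤ A.card * ((2 * L + 1 : ℝ) ^ 3 * (M * M)) := by
            rw [Finset.sum_const, nsmul_eq_mul]
            gcongr
            exact Finset.filter_subset _ _
        _ ≤ 4 * M * ((2 * L + 1 : ℝ) ^ 3 * (M * M)) := by gcongr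
        _ = 4 * (2 * L + 1 : ℝ) ^ 3 * M ^ 3 := by ring
        _ ≤ 4 * (2 * L + 1 : ℝ) ^ 3 * (2 * L + 1) := by gcongr; linarith
        _ = _ := by ring
    linarith
  calc _ ≤ _ := h2
    _ ≤ ∑ ρ₁ ∈ A, 8 * (2 * L + 1 : ℝ) ^ 4 := Finset.sum_le_sum h3
    _ = _ := by rw [Finset.sum_const, nsmul_eq_mul]; ring

theorem hs_mul_le (α β : O) : hs (α * β) ≤ 2 * (hs α * hs β) := by
  have h1 := N_nonneg α
  have h2 := N_nonneg β
  rw [N_eq] at h1 h2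
  have h3 := hs_nonneg α
  have h4 := hs_nonneg β
  have h5 : |3 * (ht α * ht β)| ≤ |hs α * hs β| := by
    apply sq_le_sq.1
    have : (3 * ht α ^ 2) * (3 * ht β ^ 2) ≤ hs α ^ 2 * hs β ^ 2 :=
      mul_le_mul (by linarith) (by linarith) (by positivity) (by positivity)
    linarith
  rw [abs_of_nonneg (mul_nonneg h3 h4)] at h5
  rw [hs_mul]
  linarith [le_abs_self (3 * (ht α * ht β))]

theorem hs_prod_le {ι : Type*} (s : Finset ι) (g : ι → O) :
    hs (∏ i ∈ s, g i) ≤ 2 ^ s.card * ∏ i ∈ s, hs (g i) := by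
  classical
  induction s using Finset.induction_on with
  | empty => simp [hs, nE_def]
  | insert i s hi ih =>
    rw [Finset.prod_insert hi, Finset.prod_insert hi, Finset.card_insert_of_notMem hi, pow_succ]
    have := mul_le_mul_of_nonneg_left ih (hs_nonneg (g i))
    linarith [hs_mul_le (g i) (∏ i ∈ s, g i)]

theorem sq_re_le_hs (α : O) : α.re.re ^ 2 ≤ 2 * hs α ∧ α.re.im ^ 2 ≤ 2 * hs α ∧
    α.im.re ^ 2 ≤ 2 * hs α ∧ α.im.im ^ 2 ≤ 2 * hs α := by
  simp only [hs, nE_def]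
  refine ⟨?_, ?_, ?_, ?_⟩ <;>
  nlinarith [sq_nonneg (α.re.re - 2 * α.re.im), sq_nonneg (α.re.im - 2 * α.re.re), 
    sq_nonneg (α.im.re - 2 * α.im.im), sq_nonneg (α.im.im - 2 * α.im.re)]

theorem mem_box_of_hs_le {α : O} {L : ℕ} (h : 2 * hs α ≤ L ^ 2) : α ∈ box L := by
  obtain ⟨h1, h2, h3, h4⟩ := sq_re_le_hs α
  rw [mem_box]
  refine ⟨?_, ?_, ?_, ?_⟩ <;> exact abs_le_of_sq_le_sq (by linarith) (by positivity)

theorem primary_prod {ι : Type*} (s : Finset ι) (g : ι → O) (h : ∀ i ∈ s, (3 : O) ∣ g i - 1) :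
    (3 : O) ∣ ∏ i ∈ s, g i - 1 := by
  classical
  induction s using Finset.induction_on with
  | empty => simp
  | insert i s hi ih =>
    rw [Finset.prod_insert hi]
    exact primary_mul (h i (Finset.mem_insert_self _ _))
      (ih fun j hj => h j (Finset.mem_insert_of_mem hj))

open Classical in
theorem sum_pow_fiber_le {k : ℕ} {C Q ε : ℝ} (hQ : 1 ≤ Q) (hC : 0 < C) (hε : 0 < ε) (hk : k ≠ 0)
    (hdiv : ∀ β : O, β ≠ 0 → N β % 3 ≠ 0 →
      ∀ S : Finset O, (∀ δ ∈ S, Red δ ∧ δ ∣ β) → (S.card : ℝ) ≤ C * (N β : ℝ) ^ (ε / k))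
    {B : Finset O} (hB : ∀ γ ∈ B, Red γ ∧ (N γ : ℝ) ≤ Q) {L : ℕ}
    (hL : ∀ f ∈ Fintype.piFinset (fun _ : Fin k => B), ∏ i, f i ∈ box L)
    {V : O → ℝ} (hV : ∀ x, 0 ≤ V x) :
    ∑ f ∈ Fintype.piFinset (fun _ : Fin k => B), V (∏ i, f i) ≤
      (C * Q ^ ε) ^ k * ∑ x ∈ box L, V x := by
  rw [← Finset.sum_fiberwise_of_maps_to hL, Finset.mul_sum]
  refine Finset.sum_le_sum fun x _ => ?_
  have h1 : ∀ f ∈ (Fintype.piFinset fun _ : Fin k => B).filter (fun f => ∏ i, f i = x),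
      V (∏ i, f i) = V x := fun f hf => by rw [(Finset.mem_filter.1 hf).2]
  rw [Finset.sum_congr rfl h1, Finset.sum_const, nsmul_eq_mul]
  refine mul_le_mul_of_nonneg_right ?_ (hV x)
  rcases Finset.eq_empty_or_nonempty
    ((Fintype.piFinset fun _ : Fin k => B).filter (fun f => ∏ i, f i = x)) with h | ⟨f, hf⟩
  · rw [h]
    simp only [Finset.card_empty, Nat.cast_zero]
    positivity
  obtain ⟨hf, hfx⟩ := Finset.mem_filter.1 hf
  rw [Fintype.mem_piFinset] at hf
  have hx : (3 : O) ∣ x - 1 := hfx ▸ primary_prod _ _ fun i _ => (hB _ (hf i)).1.1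
  have hNx : (N x : ℝ) ≤ Q ^ k := by
    rw [← hfx, map_prod]
    push_cast
    calc ∏ i, (N (f i) : ℝ) ≤ ∏ _i : Fin k, Q := Finset.prod_le_prod
          (fun i _ => by exact_mod_cast N_nonneg _) fun i _ => (hB _ (hf i)).2
      _ = _ := by simp
  have h2 := hdiv x (primary_O_ne_zero hx) (by rw [N_primary_mod hx]; norm_num)
    (B.filter (· ∣ x)) fun δ hδ => ⟨(hB δ (Finset.mem_filter.1 hδ).1).1, (Finset.mem_filter.1 hδ).2⟩
  have h3 : (N x : ℝ) ^ (ε / k) ≤ Q ^ ε := by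
    calc (N x : ℝ) ^ (ε / k) ≤ (Q ^ k) ^ (ε / k) :=
          Real.rpow_le_rpow (by exact_mod_cast N_nonneg x) hNx (by positivity)
      _ = Q ^ ε := by
          rw [← Real.rpow_natCast, ← Real.rpow_mul (by linarith)]
          congr 1
          field_simp
  have h4 : ((Fintype.piFinset fun _ : Fin k => B).filter (fun f => ∏ i, f i = x)).card ≤
      (B.filter (· ∣ x)).card ^ k := by
    have := Fintype.card_piFinset_const (B.filter (· ∣ x)) k
    rw [← this]
    refine Finset.card_le_card fun g hg => ?_
    obtain ⟨hg, hgx⟩ := Finset.mem_filter.1 hg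
    rw [Fintype.mem_piFinset] at hg ⊢
    exact fun i => Finset.mem_filter.2 ⟨hg i, hgx ▸ Finset.dvd_prod_of_mem g (Finset.mem_univ i)⟩
  calc (_ : ℝ) ≤ ((B.filter (· ∣ x)).card : ℝ) ^ k := by exact_mod_cast h4
    _ ≤ _ := by
      gcongr
      exact h2.trans (by gcongr)

theorem exists_unimodular (z : ℂ) (k : ℕ) : ∃ θ : ℂ, ‖θ‖ ≤ 1 ∧ θ * z ^ k = ((‖z‖ ^ k : ℝ) : ℂ) := by
  by_cases hz : z = 0
  · exact ⟨1, by simp, by simp [hz]⟩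
  refine ⟨(star z / ‖z‖) ^ k, ?_, ?_⟩
  · have : ‖z‖ ≠ 0 := by simpa using hz
    rw [norm_pow, norm_div, _root_.norm_star, Complex.norm_real, norm_norm, div_self this, one_pow]
  · have : (‖z‖ : ℂ) ≠ 0 := by simpa using hz
    rw [← mul_pow, div_mul_eq_mul_div, Complex.star_def, Complex.conj_mul', pow_two,
      mul_div_assoc, div_self this, mul_one]
    push_cast
    rfl

/-- A bilinear estimate for the twisted cubic characters. -/
theorem bilinear_le {k : ℕ} (hk : k ≠ 0) {ε : ℝ} (hε : 0 < ε) : ∃ C : ℝ, 0 < C ∧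
    ∀ M Q : ℝ, 0 ≤ M → 1 ≤ Q → M ^ 12 ≤ Q ^ k → ∀ A B : Finset O, PrimeNorms M A →
    (∀ γ ∈ B, Red γ ∧ (N γ : ℝ) ≤ Q) → ∀ b : O → ℂ, (∀ γ, ‖b γ‖ ≤ 1) →
    (∑ ρ ∈ A, ‖∑ γ ∈ B, b γ * twist ρ γ‖) ^ k ≤
      C * (Q * Q ^ ε) ^ k * ((A.card : ℝ) ^ (k - 1) * √A.card) := by
  obtain ⟨C, hC, hdiv⟩ := card_reduced_dvd_le (ε := ε / k) (by positivity)
  set c : ℝ := 2 * 52 ^ k with hc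
  have hc1 : 2 ≤ c := by
    have : (1 : ℝ) ≤ 52 ^ k := one_le_pow₀ (by norm_num)
    linarith
  refine ⟨√8 * (5 * c) ^ 4 * C ^ k, by positivity, fun M Q hM hQ hMQ A B hA hB b hb => ?_⟩
  set S : O → ℂ := fun ρ => ∑ γ ∈ B, b γ * twist ρ γ with hS
  set r := √√Q with hr
  have hr2 : r ^ 2 = √Q := Real.sq_sqrt (by positivity)
  have hr4 : r ^ 4 = Q := by
    rw [show r ^ 4 = (r ^ 2) ^ 2 by ring, hr2, Real.sq_sqrt (by positivity)]
  have hr1 : 1 ≤ r := by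
    rw [hr, Real.one_le_sqrt, Real.one_le_sqrt]; exact hQ
  have hrk : 1 ≤ r ^ k := one_le_pow₀ hr1
  set L := ⌈c * r ^ k⌉₊ with hL
  have hL1 : c * r ^ k ≤ L := Nat.le_ceil _
  have hL2 : (2 * L + 1 : ℝ) ≤ 5 * c * r ^ k := by
    have : (L : ℝ) < c * r ^ k + 1 := Nat.ceil_lt_add_one (by positivity)
    nlinarith
  have hLM : M ^ 3 ≤ L := by
    have : (M ^ 3) ^ 4 ≤ (r ^ k) ^ 4 := by
      rw [← pow_mul, ← pow_mul, mul_comm k 4, pow_mul r, hr4]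
      exact hMQ
    have := (pow_le_pow_iff_left₀ (by positivity) (by positivity) (by norm_num)).1 this
    nlinarith
  have hbox : ∀ f ∈ Fintype.piFinset (fun _ : Fin k => B), ∏ i, f i ∈ box L := by
    intro f hf
    rw [Fintype.mem_piFinset] at hf
    refine mem_box_of_hs_le ?_
    have h1 := hs_prod_le Finset.univ f
    rw [Finset.card_univ, Fintype.card_fin] at h1
    have h2 : ∏ i, (hs (f i) : ℝ) ≤ ∏ _i : Fin k, 26 * r ^ 2 := by
      refine Finset.prod_le_prod (fun i _ => by exact_mod_cast hs_nonneg _) fun i _ => ?_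
      have h3 : (hs (f i) : ℝ) ^ 2 ≤ 676 * N (f i) := by
        exact_mod_cast (hB _ (hf i)).1.hs_sq_le
      refine abs_le_of_sq_le_sq' ?_ (by positivity) |>.2
      have := (hB _ (hf i)).2
      nlinarith
    rw [Finset.prod_const, Finset.card_univ, Fintype.card_fin] at h2
    have h4 : (hs (∏ i, f i) : ℝ) ≤ 2 ^ k * (26 * r ^ 2) ^ k := by
      have : (hs (∏ i, f i) : ℝ) ≤ 2 ^ k * ∏ i, (hs (f i) : ℝ) := by exact_mod_cast h1
      exact this.trans (by gcongr)
    have h5 : (2 : ℝ) ^ k * (26 * r ^ 2) ^ k = 52 ^ k * (r ^ k) ^ 2 := by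
      rw [mul_pow, ← mul_assoc, ← mul_pow, ← pow_mul, ← pow_mul, mul_comm k 2]; norm_num
    have h6 : (2 * hs (∏ i, f i) : ℝ) ≤ (L : ℝ) ^ 2 := by
      calc (2 * hs (∏ i, f i) : ℝ) ≤ c * (r ^ k) ^ 2 := by
            rw [h5] at h4
            rw [hc]
            linarith
        _ ≤ (c * r ^ k) ^ 2 := by
            rw [mul_pow]
            gcongr
            nlinarith
        _ ≤ _ := by gcongr
    exact_mod_cast h6
  choose θ hθ hθS using fun ρ => exists_unimodular (S ρ) k
  have hθ' : ∀ ρ, ‖θ ρ‖ ≤ 1 := hθ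
  set V : O → ℝ := fun x => ‖∑ ρ ∈ A, θ ρ * twist ρ x‖ with hV
  have key : ∑ ρ ∈ A, ‖S ρ‖ ^ k ≤ ∑ f ∈ Fintype.piFinset (fun _ : Fin k => B), V (∏ i, f i) := by
    have h1 : ((∑ ρ ∈ A, ‖S ρ‖ ^ k : ℝ) : ℂ) = ∑ f ∈ Fintype.piFinset (fun _ : Fin k => B),
        (∏ i, b (f i)) * ∑ ρ ∈ A, θ ρ * twist ρ (∏ i, f i) := by
      simp only [Finset.mul_sum]
      rw [Finset.sum_comm, Complex.ofReal_sum]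
      refine Finset.sum_congr rfl fun ρ _ => ?_
      rw [← hθS, hS]
      simp only
      rw [Finset.sum_pow', Finset.mul_sum]
      refine Finset.sum_congr rfl fun f _ => ?_
      rw [twist_prod, Finset.prod_mul_distrib]
      ring
    calc _ = ‖((∑ ρ ∈ A, ‖S ρ‖ ^ k : ℝ) : ℂ)‖ := by
          rw [Complex.norm_real, Real.norm_of_nonneg (by positivity)]
      _ ≤ _ := by
          rw [h1]
          refine norm_sum_le_of_le _ fun f _ => ?_
          rw [norm_mul, norm_prod]
          exact mul_le_of_le_one_left (norm_nonneg _)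
            (Finset.prod_le_one (fun _ _ => norm_nonneg _) fun _ _ => hb _)
  have hsieve := sum_box_norm_sq_le hM hA hLM hθ'
  have hbound : ∑ x ∈ box L, V x ≤ √8 * √A.card * (2 * L + 1 : ℝ) ^ 4 := by
    refine abs_le_of_sq_le_sq' ?_ (by positivity) |>.2
    calc (∑ x ∈ box L, V x) ^ 2 ≤ (box L).card * ∑ x ∈ box L, V x ^ 2 := sq_sum_le_card_mul_sum_sq
      _ ≤ (2 * L + 1 : ℝ) ^ 4 * (8 * A.card * (2 * L + 1 : ℝ) ^ 4) := by
          rw [card_box]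
          push_cast
          gcongr
      _ = _ := by
          rw [mul_pow, mul_pow, Real.sq_sqrt (by norm_num), Real.sq_sqrt (by positivity)]
          ring
  have hk1 : k - 1 + 1 = k := by omega
  have hpow : (∑ ρ ∈ A, ‖S ρ‖) ^ k ≤ (A.card : ℝ) ^ (k - 1) * ∑ ρ ∈ A, ‖S ρ‖ ^ k := by
    rcases A.eq_empty_or_nonempty with h | h
    · simp [h, hk]
    · have := pow_sum_div_card_le_sum_pow (s := A) (f := fun ρ => ‖S ρ‖) (fun _ _ => norm_nonneg _)
        (k - 1)
      rwa [hk1, div_le_iff₀' (pow_pos (by exact_mod_cast h.card_pos) _)] at this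
  calc (∑ ρ ∈ A, ‖S ρ‖) ^ k ≤ (A.card : ℝ) ^ (k - 1) * ∑ ρ ∈ A, ‖S ρ‖ ^ k := hpow
    _ ≤ (A.card : ℝ) ^ (k - 1) * ((C * Q ^ ε) ^ k * (√8 * √A.card * (5 * c * r ^ k) ^ 4)) := by
        gcongr
        refine key.trans ((sum_pow_fiber_le hQ hC hε hk hdiv hB hbox (V := V)
          fun x => norm_nonneg _).trans ?_)
        gcongr
        exact hbound.trans (by gcongr)
    _ = _ := by
        rw [mul_pow (5 * c), ← pow_mul, mul_comm k 4, pow_mul, hr4]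
        ring

theorem finite_Res {b : E} (hb : b ≠ 0) : Finite (Res b) := by
  refine Nat.finite_of_card_ne_zero ?_
  change nq b ≠ 0
  have := nE_pos hb
  rw [nq_E]
  omega

/-- `F` only depends on the residue modulo `b`. -/
def PeriodicMod {M : Type*} (b : E) (F : E → M) : Prop := ∀ u v, b ∣ u - v → F u = F v

/-- The sum of `F` over representatives of the residues modulo `b`. -/
noncomputable def qsum {M : Type*} [AddCommMonoid M] (b : E) (F : E → M) : M :=
  ∑ᶠ x : Res b, F x.out

section

variable {M : Type*} [AddCommMonoid M] {b : E} {F : E → M}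

theorem qsum_eq_sum [Fintype (Res b)] (F : E → M) : qsum b F = ∑ x : Res b, F x.out :=
  finsum_eq_sum_of_fintype _

theorem PeriodicMod.out (hF : PeriodicMod b F) (u : E) : F (red b u).out = F u :=
  hF _ _ (red_eq.1 (by rw [red, Ideal.Quotient.mk_out]))

theorem qsum_add_right (hF : PeriodicMod b F) (k : E) : qsum b (fun u => F (u + k)) = qsum b F := by
  unfold qsum
  refine (finsum_eq_of_bijective (fun x => x + red b k) (Equiv.addRight (red b k)).bijective ?_)
  intro x
  refine hF _ _ (red_eq.1 ?_)
  simp only [red, Ideal.Quotient.mk_out, map_add]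

theorem qsum_sum {ι : Type*} (hb : b ≠ 0) (s : Finset ι) (F : ι → E → M) :
    qsum b (fun u => ∑ i ∈ s, F i u) = ∑ i ∈ s, qsum b (F i) := by
  have := finite_Res hb
  have := Fintype.ofFinite (Res b)
  simp only [qsum_eq_sum]
  exact Finset.sum_comm

end

theorem norm_qsum_le {b : E} (hb : b ≠ 0) {F : E → ℂ} (hF : ∀ u, ‖F u‖ ≤ 1) :
    ‖qsum b F‖ ≤ nE b := by
  have := finite_Res hb
  have := Fintype.ofFinite (Res b)
  rw [qsum_eq_sum]
  have h : (nE b : ℝ) = Fintype.card (Res b) := by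
    have h1 : Nat.card (Res b) = (nE b).natAbs := nq_E b
    rw [Nat.card_eq_fintype_card] at h1
    rw [h1, Nat.cast_natAbs, abs_of_nonneg (nE_nonneg b)]
  calc _ ≤ ∑ x : Res b, (1 : ℝ) := norm_sum_le_of_le _ fun x _ => hF _
    _ = _ := by simp [h]

theorem qsum_mul {b c : E} (hbc : IsCoprime b c) (hb : b ≠ 0) (hc : c ≠ 0) {F G : E → ℂ}
    (hF : PeriodicMod b F) (hG : PeriodicMod c G) :
    qsum (b * c) (fun u => F u * G u) = qsum b F * qsum c G := by
  have := finite_Res hb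
  have := finite_Res hc
  have := finite_Res (mul_ne_zero hb hc)
  have := Fintype.ofFinite (Res b)
  have := Fintype.ofFinite (Res c)
  have := Fintype.ofFinite (Res (b * c))
  rw [qsum_eq_sum F, qsum_eq_sum G, Finset.sum_mul_sum, ← Fintype.sum_prod_type' 
    (f := fun (x : Res b) (y : Res c) => F x.out * G y.out), qsum_eq_sum]
  refine Fintype.sum_bijective (fun x => (red b x.out, red c x.out)) ?_ _ _ fun x => ?_
  · refine (Fintype.bijective_iff_injective_and_card _).2 ⟨fun x y hxy => ?_, ?_⟩
    · obtain ⟨h1, h2⟩ := Prod.mk.inj hxy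
      have := hbc.mul_dvd (red_eq.1 h1) (red_eq.1 h2)
      rw [← Ideal.Quotient.mk_out x, ← Ideal.Quotient.mk_out y]
      exact red_eq.2 this
    · rw [Fintype.card_prod, ← Nat.card_eq_fintype_card, ← Nat.card_eq_fintype_card,
        ← Nat.card_eq_fintype_card]
      change nq (b * c) = nq b * nq c
      rw [nq_E, nq_E, nq_E, map_mul, Int.natAbs_mul]
  · rw [hF.out, hG.out]

/-- The squared residue symbol modulo `x`, as a complex number. -/
noncomputable def csq (x u : E) : ℂ := emb (cs u x) ^ 2

theorem norm_csq_le (x u : E) : ‖csq x u‖ ≤ 1 := by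
  rw [csq, norm_pow]
  exact pow_le_one₀ (norm_nonneg _) (cs_isMu _ _).norm_emb_le

theorem csq_periodic (x : E) : PeriodicMod x (csq x) := fun u u' h => by
  rw [csq, csq, cs_congr h]

theorem PeriodicMod.corr {b : E} {F : E → ℂ} (hF : PeriodicMod b F) (k l : E) :
    PeriodicMod b fun u => F (u + k) * star (F (u + l)) := fun u u' h => by
  simp only
  rw [hF (u + k) (u' + k) (by simpa using h), hF (u + l) (u' + l) (by simpa using h)]

/-- The autocorrelation of the squared residue symbol. -/
noncomputable def corr (x k : E) : ℂ := qsum x fun u => csq x (u + k) * star (csq x u)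

theorem norm_corr_le_nE {x : E} (hx : x ≠ 0) (k : E) : ‖corr x k‖ ≤ nE x := by
  refine norm_qsum_le hx fun u => ?_
  rw [norm_mul, _root_.norm_star]
  exact mul_le_one₀ (norm_csq_le _ _) (norm_nonneg _) (norm_csq_le _ _)

theorem norm_corr_prime_le {p : E} (hp : Prime p) (h3 : ¬ p ∣ 3) {k : E} (hk : ¬ p ∣ k) :
    ‖corr p k‖ ≤ 1 := by
  have := finite_Res hp.ne_zero
  have := Fintype.ofFinite (Res p)
  have : (Ideal.span {p}).IsMaximal := PrincipalIdealRing.isMaximal_of_irreducible hp.irreducible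
  let := Ideal.Quotient.field (Ideal.span {p})
  set ψ : MulChar (Res p) ℂ := (chi p hp h3 ^ 2).ringHomComp emb with hψ
  have hψ1 : ψ ≠ 1 := by
    intro h
    have hinj : Function.Injective emb := RingHom.injective_iff_ker_eq_bot _ |>.2 (by
      ext z; simp [emb_eq_zero])
    rw [hψ, MulChar.ringHomComp_eq_one_iff hinj] at h
    have h1 := chi_cube hp h3
    rw [pow_succ, h, one_mul] at h1
    exact chi_ne_one hp h3 h1
  have hcsq : ∀ u, csq p u = ψ (red p u) := by
    intro u
    rw [csq, cs_prime _ hp, hψ, MulChar.ringHomComp_apply, MulChar.pow_apply' _ (by norm_num),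
      chi_red, map_pow]
  have hle : ∀ x, ‖ψ x‖ ≤ 1 := fun x => by
    obtain ⟨u, rfl⟩ := Ideal.Quotient.mk_surjective x
    exact (hcsq u) ▸ norm_csq_le _ _
  have hk0 : -red p k ≠ 0 := by rwa [neg_ne_zero, Ne, red_eq_zero]
  have hinv : ∀ x, star (ψ x) = ψ⁻¹ x := fun x => by rw [← MulChar.star_eq_inv]; rfl
  have h1 : corr p k = ψ (red p k) * star (ψ (-red p k)) * jacobiSum ψ⁻¹ ψ := by
    rw [corr, qsum_eq_sum, jacobiSum, Finset.mul_sum,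
      ← Equiv.sum_comp (Equiv.mulLeft₀ (-red p k) hk0)]
    refine Finset.sum_congr rfl fun x _ => ?_
    have hout : ∀ y : Res p, red p y.out = y := fun y => Ideal.Quotient.mk_out y
    rw [hcsq, hcsq, map_add, hout, hinv, hinv]
    change ψ (-red p k * x + red p k) * ψ⁻¹ (-red p k * x) = _
    rw [show -red p k * x + red p k = red p k * (1 - x) by ring, map_mul, map_mul]
    ring
  rw [h1, jacobiSum_comm, jacobiSum_nontrivial_inv hψ1, norm_mul, norm_mul, _root_.norm_star,
    _root_.norm_neg]
  exact mul_le_one₀ (mul_le_one₀ (hle _) (norm_nonneg _) (hle _)) (norm_nonneg _) (hle _)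

theorem exists_norm_corr_le {x : E} (hx : (3 : E) ∣ x - 1) (hs : Squarefree x) (k : E) :
    ∃ r, r ∣ x ∧ r ∣ k ∧ ‖corr x k‖ ≤ nE r := by
  revert hs
  refine primary_induction (P := fun x => Squarefree x → ∃ r, r ∣ x ∧ r ∣ k ∧ ‖corr x k‖ ≤ nE r)
    ?_ ?_ x hx
  · exact fun _ => ⟨1, dvd_rfl, one_dvd _, norm_corr_le_nE one_ne_zero k⟩
  · intro p c hp hp1 hc1 ih hs
    obtain ⟨r, hrc, hrk, hr⟩ := ih (hs.squarefree_of_dvd (Dvd.intro_left _ rfl))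
    have hpc : IsCoprime p c := by
      refine ((dvd_or_isCoprime p c hp.irreducible).resolve_left fun h => ?_)
      exact hp.not_isUnit (hs p (mul_dvd_mul_left p h))
    have h3 : ¬ p ∣ 3 := not_dvd_three_of_coprime (isCoprime_three hp1) hp dvd_rfl
    have hmul : corr (p * c) k = corr p k * corr c k := by
      rw [corr, corr, corr, ← qsum_mul hpc hp.ne_zero (primary_ne_zero hc1)]
      · congr 1
        ext u
        simp only [csq, cs_mul_right _ hp.ne_zero (primary_ne_zero hc1), map_mul, mul_pow, star_mul']
        ring
      · simpa using (csq_periodic p).corr k 0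
      · simpa using (csq_periodic c).corr k 0
    rw [hmul, norm_mul]
    by_cases hpk : p ∣ k
    · refine ⟨p * r, mul_dvd_mul_left p hrc, (hpc.of_isCoprime_of_dvd_right hrc).mul_dvd hpk hrk, ?_⟩
      rw [map_mul, Int.cast_mul]
      exact mul_le_mul (norm_corr_le_nE hp.ne_zero k) hr (norm_nonneg _)
        (by exact_mod_cast nE_nonneg p)
    · refine ⟨r, hrc.mul_left p, hrk, ?_⟩
      exact (mul_le_of_le_one_left (norm_nonneg _) (norm_corr_prime_le hp h3 hpk)).trans hr

theorem nE_le_of_dvd {r k : E} (h : r ∣ k) (hk : k ≠ 0) : nE r ≤ nE k :=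
  Int.le_of_dvd (nE_pos hk) (map_dvd nE h)

/-- The second moment of short sums of a periodic function times a residue symbol. -/
theorem qsum_sq_le {m x : E} (hm : m ≠ 0) (hx : (3 : E) ∣ x - 1) (hs : Squarefree x)
    (hmx : IsCoprime m x) {F : E → ℂ} (hF : PeriodicMod m F) (hF1 : ∀ u, ‖F u‖ ≤ 1) {g : ℕ}
    (hg : 0 < g) (H : ℕ) :
    qsum (m * x) (fun u => ‖∑ h ∈ Finset.range H, F (u + g * h) * csq x (u + g * h)‖ ^ 2) ≤
      H * nE m * nE x + H ^ 2 * nE m * (g * H : ℝ) ^ 2 := by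
  have hx0 := primary_ne_zero hx
  have hmx0 := mul_ne_zero hm hx0
  have := finite_Res hmx0
  have := Fintype.ofFinite (Res (m * x))
  have hm1 : (0 : ℝ) ≤ nE m := by exact_mod_cast nE_nonneg m
  have hxn : (0 : ℝ) ≤ nE x := by exact_mod_cast nE_nonneg x
  set S : ℝ := qsum (m * x)
    (fun u => ‖∑ h ∈ Finset.range H, F (u + g * h) * csq x (u + g * h)‖ ^ 2) with hS
  have h1 : (S : ℂ) = ∑ h₁ ∈ Finset.range H, ∑ h₂ ∈ Finset.range H,
      qsum m (fun u => F (u + g * h₁) * star (F (u + g * h₂))) *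
        corr x (g * h₁ - g * h₂) := by
    have h2 : ∀ h₁ h₂ : ℕ, corr x (g * h₁ - g * h₂) =
        qsum x (fun u => csq x (u + g * h₁) * star (csq x (u + g * h₂))) := by
      intro h₁ h₂
      have hp := (csq_periodic x).corr (g * h₁ - g * h₂ : E) 0
      rw [corr]
      simp only [add_zero] at hp
      refine (qsum_add_right hp (g * h₂ : E)).symm.trans ?_
      congr 1
      ext u
      rw [show u + g * h₂ + (g * h₁ - g * h₂) = (u + g * h₁ : E) by ring]
    simp only [h2]
    have h3 : ∀ h₁ h₂ : ℕ, qsum m (fun u => F (u + g * h₁) * star (F (u + g * h₂))) *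
        qsum x (fun u => csq x (u + g * h₁) * star (csq x (u + g * h₂))) =
        qsum (m * x) (fun u => (F (u + g * h₁) * star (F (u + g * h₂))) *
          (csq x (u + g * h₁) * star (csq x (u + g * h₂)))) := fun h₁ h₂ =>
      (qsum_mul hmx hm hx0 (hF.corr _ _) ((csq_periodic x).corr _ _)).symm
    simp only [h3]
    simp only [← qsum_sum hmx0]
    rw [hS, qsum_eq_sum, qsum_eq_sum, Complex.ofReal_sum]
    refine Finset.sum_congr rfl fun y _ => ?_
    push_cast
    rw [← Complex.mul_conj', ← Complex.star_def, star_sum, Finset.sum_mul_sum]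
    refine Finset.sum_congr rfl fun h₁ _ => Finset.sum_congr rfl fun h₂ _ => ?_
    rw [star_mul']
    ring
  have h2 : ∀ h₁ ∈ Finset.range H, ∀ h₂ ∈ Finset.range H,
      ‖qsum m (fun u => F (u + g * h₁) * star (F (u + g * h₂))) * corr x (g * h₁ - g * h₂)‖ ≤
        (if h₁ = h₂ then (nE m * nE x : ℝ) else 0) + nE m * (g * H : ℝ) ^ 2 := by
    intro h₁ hh₁ h₂ hh₂
    have ha : ‖qsum m (fun u => F (u + g * h₁) * star (F (u + g * h₂)))‖ ≤ nE m := by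
      refine norm_qsum_le hm fun u => ?_
      rw [norm_mul, _root_.norm_star]
      exact mul_le_one₀ (hF1 _) (norm_nonneg _) (hF1 _)
    rw [norm_mul]
    split_ifs with h
    · have := mul_le_mul ha (norm_corr_le_nE hx0 (g * h₁ - g * h₂ : E)) (norm_nonneg _) hm1
      have h4 : (0 : ℝ) ≤ nE m * (g * H : ℝ) ^ 2 := by positivity
      linarith
    · obtain ⟨r, -, hrk, hr⟩ := exists_norm_corr_le hx hs (g * h₁ - g * h₂ : E)
      rw [zero_add]
      refine mul_le_mul ha (hr.trans ?_) (norm_nonneg _) hm1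
      have e : (g * h₁ - g * h₂ : E) = (((g : ℤ) * ((h₁ : ℤ) - h₂) : ℤ) : E) := by
        push_cast; ring
      have hne : (g : ℤ) * ((h₁ : ℤ) - h₂) ≠ 0 := mul_ne_zero (by omega) (by omega)
      have hk : nE (g * h₁ - g * h₂ : E) = ((g : ℤ) * ((h₁ : ℤ) - h₂)) ^ 2 := by
        rw [e, nE_intCast]
      have hk0 : (g * h₁ - g * h₂ : E) ≠ 0 := fun h0 => by
        rw [h0, nE_eq_zero.2 rfl] at hk
        exact hne (pow_eq_zero_iff (two_ne_zero) |>.1 hk.symm)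
      have h5 := nE_le_of_dvd hrk hk0
      rw [hk] at h5
      have h6 : ((g : ℤ) * ((h₁ : ℤ) - h₂)) ^ 2 ≤ ((g : ℤ) * H) ^ 2 := by
        rw [mul_pow, mul_pow]
        refine mul_le_mul_of_nonneg_left ?_ (by positivity)
        rw [Finset.mem_range] at hh₁ hh₂
        exact sq_le_sq.2 (by rw [abs_le, abs_of_nonneg] <;> omega)
      exact_mod_cast h5.trans h6
  have hS0 : 0 ≤ S := by
    rw [hS, qsum_eq_sum]
    positivity
  calc S = ‖(S : ℂ)‖ := by rw [Complex.norm_real, Real.norm_of_nonneg hS0]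
    _ ≤ ∑ h₁ ∈ Finset.range H, ∑ h₂ ∈ Finset.range H,
        ((if h₁ = h₂ then (nE m * nE x : ℝ) else 0) + nE m * (g * H : ℝ) ^ 2) := by
      rw [h1]
      exact norm_sum_le_of_le _ fun h₁ hh₁ => norm_sum_le_of_le _ fun h₂ hh₂ => h2 h₁ hh₁ h₂ hh₂
    _ = _ := by
      simp only [Finset.sum_add_distrib, Finset.sum_ite_eq, Finset.sum_const, Finset.card_range,
        nsmul_eq_mul, Finset.sum_ite_mem, Finset.inter_self]
      ring

/-- Eisenstein integers with both coordinates in `[-L, L]`. -/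
noncomputable def boxE (L : ℕ) : Finset E :=
  (Finset.Icc (-L : ℤ) L ×ˢ Finset.Icc (-L : ℤ) L).map
    ⟨fun x => ⟨x.1, x.2⟩, fun x y h => by
      simp only [QuadraticAlgebra.mk.injEq] at h
      exact Prod.ext h.1 h.2⟩

theorem mem_boxE {L : ℕ} {u : E} : u ∈ boxE L ↔ |u.re| ≤ L ∧ |u.im| ≤ L := by
  obtain ⟨a, b⟩ := u
  simp only [boxE, Finset.mem_map, Finset.mem_product, Finset.mem_Icc, Prod.exists,
    abs_le]
  exact ⟨by rintro ⟨_, _, h, h'⟩; cases h'; exact h, fun h => ⟨a, b, h, rfl⟩⟩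

theorem card_boxE (L : ℕ) : (boxE L).card = (2 * L + 1) ^ 2 := by
  rw [boxE, Finset.card_map, Finset.card_product, Int.card_Icc, pow_two]
  congr 1 <;> omega

theorem sum_boxE {M : Type*} [AddCommMonoid M] (L : ℕ) (F : E → M) : ∑ u ∈ boxE L, F u =
    ∑ a ∈ Finset.Icc (-L : ℤ) L, ∑ b ∈ Finset.Icc (-L : ℤ) L, F ⟨a, b⟩ := by
  rw [boxE, Finset.sum_map, Finset.sum_product]
  rfl

theorem sq_le_nE (z : E) : 3 * z.re ^ 2 ≤ 4 * nE z ∧ 3 * z.im ^ 2 ≤ 4 * nE z := by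
  rw [nE_def]
  constructor <;> nlinarith [sq_nonneg (z.re - 2 * z.im), sq_nonneg (z.im - 2 * z.re)]

theorem nE_le_of_mem_boxE {L : ℕ} {u : E} (h : u ∈ boxE L) : nE u ≤ 3 * L ^ 2 := by
  rw [mem_boxE, abs_le, abs_le] at h
  rw [nE_def]
  nlinarith

theorem card_boxE_filter_le {b : E} (hb : b ≠ 0) {L : ℕ} {s : Finset E} (hs : s ⊆ boxE L)
    (h : ∀ u ∈ s, ∀ u' ∈ s, b ∣ u - u') : (s.card : ℝ) ≤ 192 * (L ^ 2 / nE b) + 2 := by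
  rcases s.eq_empty_or_nonempty with rfl | ⟨u₀, hu₀⟩
  · have : (0 : ℝ) ≤ nE b := by exact_mod_cast nE_nonneg b
    simp only [Finset.card_empty, Nat.cast_zero]
    positivity
  have hb0 : (0 : ℝ) < nE b := by exact_mod_cast nE_pos hb
  set K : ℕ := ⌊√(24 * (L ^ 2 / nE b) : ℝ)⌋₊ with hK
  have hK2 : (K : ℝ) ^ 2 ≤ 24 * (L ^ 2 / nE b) := by
    have := Nat.floor_le (Real.sqrt_nonneg (24 * (L ^ 2 / nE b) : ℝ))
    calc (K : ℝ) ^ 2 ≤ √(24 * (L ^ 2 / nE b) : ℝ) ^ 2 := by gcongr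
      _ = _ := Real.sq_sqrt (by positivity)
  have hcard : s.card ≤ (boxE K).card := by
    classical
    refine Finset.card_le_card_of_surjOn (fun z => u₀ + b * z) fun u hu => ?_
    obtain ⟨z, hz⟩ := h u hu u₀ hu₀
    refine ⟨z, ?_, by linear_combination -hz⟩
    have h1 : nE (u - u₀) ≤ 12 * L ^ 2 := by
      have h1 := mem_boxE.1 (hs hu)
      have h2 := mem_boxE.1 (hs hu₀)
      rw [abs_le, abs_le] at h1 h2
      have : u - u₀ ∈ boxE (2 * L) := by
        rw [mem_boxE, abs_le, abs_le]
        simp only [re_sub, im_sub]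
        push_cast
        omega
      have := nE_le_of_mem_boxE this
      push_cast at this
      linarith
    rw [hz, map_mul] at h1
    have h2 : (nE z : ℝ) ≤ 12 * (L ^ 2 / nE b) := by
      rw [← mul_div_assoc, le_div_iff₀ hb0, mul_comm]
      exact_mod_cast h1
    obtain ⟨h3, h4⟩ := sq_le_nE z
    have h5 : ∀ t : ℤ, 3 * t ^ 2 ≤ 4 * nE z → |t| ≤ K := by
      intro t ht
      have ht' : (3 * t ^ 2 : ℝ) ≤ 4 * nE z := by exact_mod_cast ht
      have : (t.natAbs : ℝ) ≤ √(24 * (L ^ 2 / nE b) : ℝ) := by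
        rw [Nat.cast_natAbs, Int.cast_abs]
        have : (0 : ℝ) ≤ L ^ 2 / nE b := by positivity
        exact Real.abs_le_sqrt (by linarith)
      rw [← Int.natCast_natAbs]
      exact Int.ofNat_le.2 (Nat.le_floor this)
    exact mem_boxE.2 ⟨h5 _ h3, h5 _ h4⟩
  rw [card_boxE] at hcard
  have : (s.card : ℝ) ≤ (2 * K + 1 : ℝ) ^ 2 := by exact_mod_cast hcard
  nlinarith [sq_nonneg (2 * K - 1 : ℝ)]

theorem sum_boxE_le {b : E} (hb : b ≠ 0) {L : ℕ} (hL : nE b ≤ 243 * L ^ 2) {Φ : E → ℝ}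
    (hΦ : PeriodicMod b Φ) (h0 : ∀ u, 0 ≤ Φ u) :
    ∑ u ∈ boxE L, Φ u ≤ 1000 * (L ^ 2 / nE b) * qsum b Φ := by
  classical
  have := finite_Res hb
  have := Fintype.ofFinite (Res b)
  have hb0 : (0 : ℝ) < nE b := by exact_mod_cast nE_pos hb
  rw [qsum_eq_sum, Finset.mul_sum, ← Finset.sum_fiberwise (boxE L) (red b)]
  refine Finset.sum_le_sum fun x _ => ?_
  have h1 : ∀ u ∈ (boxE L).filter (fun u => red b u = x), Φ u = Φ x.out := fun u hu => by
    rw [← hΦ.out u, (Finset.mem_filter.1 hu).2]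
  rw [Finset.sum_congr rfl h1, Finset.sum_const, nsmul_eq_mul]
  refine mul_le_mul_of_nonneg_right ?_ (h0 _)
  refine (card_boxE_filter_le hb (Finset.filter_subset _ _) fun u hu u' hu' => ?_).trans ?_
  · rw [← red_eq, (Finset.mem_filter.1 hu).2, (Finset.mem_filter.1 hu').2]
  · have : (1 : ℝ) ≤ 243 * (L ^ 2 / nE b) := by
      rw [← mul_div_assoc, le_div_iff₀ hb0, one_mul]
      exact_mod_cast hL
    linarith

theorem exists_sq_mul_squarefree (n : ℕ) : ∀ {v : E}, v ≠ 0 → nE v ≤ n →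
    ∃ a b : E, v = a ^ 2 * b ∧ Squarefree b := by
  induction n with
  | zero => exact fun {v} hv h => absurd (nE_pos hv) (by push_cast at h; omega)
  | succ n ih =>
    intro v hv h
    by_cases hs : Squarefree v
    · exact ⟨1, v, by ring, hs⟩
    · simp only [Squarefree, not_forall] at hs
      obtain ⟨p, ⟨v', hv'⟩, hp⟩ := hs
      have hv0 : v' ≠ 0 := by rintro rfl; simp [hv'] at hv
      have hp0 : p ≠ 0 := by rintro rfl; simp [hv'] at hv
      have h1 : 1 < nE p := lt_of_le_of_ne (nE_pos hp0) fun h => hp (isUnit_E.2 h.symm)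
      have h2 := nE_pos hv0
      have h3 : nE v = nE p * nE p * nE v' := by rw [hv', map_mul, map_mul]
      have h5 : 2 ≤ nE p * nE p := by nlinarith
      obtain ⟨a, b, h4, hb⟩ := ih hv0 (by push_cast at h; nlinarith)
      exact ⟨p * a, b, by rw [hv', h4]; ring, hb⟩

theorem nE_mod_three_ne_zero {x : E} (h : IsCoprime x 3) : nE x % 3 ≠ 0 := by
  obtain ⟨s, t, hst⟩ := h
  intro h0
  have h1 : nE s * nE x = nE (1 - t * 3) := by rw [← map_mul, ← hst]; congr 1; ring
  have h2 : nE (1 - t * 3) =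
      1 + 3 * (-2 * t.re + t.im + 3 * (t.re ^ 2 - t.re * t.im + t.im ^ 2)) := by
    have e : (1 - t * 3 : E) = ⟨1 - t.re * 3, -(t.im * 3)⟩ := by ext <;> simp
    rw [e, nE_def]
    ring
  have h3 : (3 : ℤ) ∣ nE s * nE x := (Int.dvd_of_emod_eq_zero h0).mul_left _
  rw [h1, h2] at h3
  omega

theorem exists_smooth_mul {v : E} (hv : v ≠ 0) : ∃ w x a : E, v = w * x ∧ IsCoprime (9 * w) x ∧
    (3 : E) ∣ x - 1 ∧ Squarefree x ∧ a ^ 2 ∣ v ∧ nE w ≤ 9 * nE a ^ 3 := by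
  obtain ⟨a, b, hab, hb⟩ := exists_sq_mul_squarefree (nE v).toNat hv (by omega)
  have ha0 : a ≠ 0 := by rintro rfl; simp [hab] at hv
  set r := IsBezout.gcd b (3 * a) with hr
  obtain ⟨x₀, hx₀⟩ : r ∣ b := IsBezout.gcd_dvd_left _ _
  have hr3 : r ∣ 3 * a := IsBezout.gcd_dvd_right _ _
  have h3a : (3 : E) * a ≠ 0 := mul_ne_zero (by decide) ha0
  have hc : IsCoprime x₀ (3 * a) := by
    refine isCoprime_of_prime_dvd (fun h => h3a h.2) fun p hp hpx hpa => ?_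
    have h1 : p ∣ b := hx₀ ▸ hpx.mul_left r
    have h2 : p ∣ r := IsBezout.dvd_gcd h1 hpa
    exact hp.not_isUnit (hb p (hx₀ ▸ mul_dvd_mul h2 hpx))
  have hc3 : IsCoprime x₀ 3 := hc.of_mul_right_left
  have hca : IsCoprime x₀ a := hc.of_mul_right_right
  obtain ⟨u, hu, hxu⟩ := exists_primary (nE_mod_three_ne_zero hc3)
  obtain ⟨u, rfl⟩ := hu
  have hcr : IsCoprime x₀ r := hc.of_isCoprime_of_dvd_right hr3
  refine ⟨a ^ 2 * r * ↑u⁻¹, x₀ * u, a, ?_, ?_, hxu, ?_, ⟨b, hab⟩, ?_⟩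
  · rw [hab, hx₀]
    have := u.inv_mul
    linear_combination -(a ^ 2 * r * x₀) * this
  · have h9 : IsCoprime x₀ 9 := by
      have : (9 : E) = 3 ^ 2 := by norm_num
      rw [this]
      exact hc3.pow_right
    have hun : IsCoprime x₀ (↑u⁻¹ : E) := isCoprime_of_isUnit u⁻¹.isUnit |>.symm
    have h1 : IsCoprime x₀ (9 * (a ^ 2 * r * ↑u⁻¹)) :=
      h9.mul_right (((hca.pow_right).mul_right hcr).mul_right hun)
    exact (h1.mul_left (isCoprime_of_isUnit u.isUnit)).symm
  · exact ((associated_mul_unit_left x₀ _ u.isUnit).squarefree_iff).2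
      (hb.squarefree_of_dvd ⟨r, by rw [hx₀]; ring⟩)
  · have h1 : nE (↑u⁻¹ : E) = 1 := isUnit_E.1 u⁻¹.isUnit
    have h2 := nE_le_of_dvd hr3 h3a
    have h3 : nE 3 = 9 := by decide
    rw [map_mul, h3] at h2
    rw [map_mul, map_mul, map_pow, h1, mul_one]
    have := nE_nonneg a
    calc nE a ^ 2 * nE r ≤ nE a ^ 2 * (9 * nE a) := by gcongr
      _ = _ := by ring

theorem PeriodicMod.mul {b c : E} {F G : E → ℂ} (hF : PeriodicMod b F) (hG : PeriodicMod c G) :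
    PeriodicMod (b * c) fun u => F u * G u := fun u u' h => by
  simp only
  rw [hF u u' (dvd_of_mul_right_dvd h), hG u u' (dvd_of_mul_left_dvd h)]

/-- Factor of the symbol depending on the argument modulo `9 * w`. -/
noncomputable def wsq (w u : E) : ℂ :=
  open Classical in if (3 : E) ∣ u - 1 then emb (cs w u) ^ 2 else 0

theorem norm_wsq_le (w u : E) : ‖wsq w u‖ ≤ 1 := by
  unfold wsq
  split_ifs
  · rw [norm_pow]
    exact pow_le_one₀ (norm_nonneg _) (cs_isMu _ _).norm_emb_le
  · simp

theorem three_dvd_iff_of_dvd {b u u' : E} (hb : (3 : E) ∣ b) (h : b ∣ u - u') :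
    (3 : E) ∣ u - 1 ↔ (3 : E) ∣ u' - 1 := by
  have h1 := hb.trans h
  constructor <;> intro h2
  · convert h2.sub h1 using 1; ring
  · convert h2.add h1 using 1; ring

theorem wsq_periodic {w : E} (hw : w ≠ 0) : PeriodicMod (9 * w) (wsq w) := fun u u' h => by
  have h9 : (9 : E) ∣ u - u' := dvd_of_mul_right_dvd h
  have h3 := three_dvd_iff_of_dvd (dvd_mul_of_dvd_left (by exact ⟨3, by norm_num⟩) w) h
  unfold wsq
  by_cases hu : (3 : E) ∣ u - 1
  · rw [if_pos hu, if_pos (h3.1 hu), cs_periodic hw hu h9 (dvd_of_mul_left_dvd h)]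
  · rw [if_neg hu, if_neg (h3.not.1 hu)]

theorem fC_eq {w x u : E} (hx : (3 : E) ∣ x - 1) (hw : w ≠ 0)
    (h : (3 : O) ∣ (⟨u, w * x⟩ : O) - 1) :
    fC ⟨u, w * x⟩ = emb (cs 2 (nO ⟨u, w * x⟩)) * (wsq w u * csq x u) := by
  have hu := (primary_O_iff.1 h).1
  rw [fC, fsym_eq_of_im_ne_zero h (mul_ne_zero hw (primary_ne_zero hx)), wsq, if_pos hu, csq,
    cs_mul_left, reciprocity_E hx hu]
  simp only [map_mul, map_pow, mul_pow]

theorem card_sign_change_le (p : Polynomial ℝ) (m : ℕ) {s : Finset ℤ}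
    (hs : ∀ a ∈ s, ¬ (0 ≤ p.eval (a : ℝ) ↔ 0 ≤ p.eval ((a : ℝ) + m))) :
    s.card ≤ p.natDegree * (m + 1) := by
  classical
  have h1 : s ⊆ p.roots.toFinset.biUnion fun r => Finset.Icc ⌈r - m⌉ ⌊r⌋ := by
    intro a ha
    have hp : p ≠ 0 := by rintro rfl; simpa using hs a ha
    have h0 : (0 : ℝ) ∈ Set.uIcc (p.eval (a : ℝ)) (p.eval ((a : ℝ) + m)) := by
      have := hs a ha
      rw [Set.mem_uIcc]
      by_cases h : 0 ≤ p.eval (a : ℝ)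
      · right
        simp only [h, true_iff, not_le] at this
        exact ⟨this.le, h⟩
      · left
        simp only [h, false_iff, not_not] at this
        exact ⟨(not_le.1 h).le, this⟩
    obtain ⟨r, hr, hr0⟩ := intermediate_value_uIcc p.continuous.continuousOn h0
    rw [Set.uIcc_of_le (by simp)] at hr
    simp only [Finset.mem_biUnion, Multiset.mem_toFinset, Polynomial.mem_roots hp,
      Polynomial.IsRoot.def, Finset.mem_Icc, Int.ceil_le, Int.le_floor]
    exact ⟨r, hr0, by linarith [hr.2], hr.1⟩
  refine (Finset.card_le_card h1).trans ((Finset.card_biUnion_le_card_mul _ _ (m + 1) ?_).trans ?_)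
  · intro r _
    rw [Int.card_Icc]
    have h2 := Int.le_ceil (r - m)
    have h3 := Int.floor_le r
    have : (⌊r⌋ : ℝ) ≤ ((⌈r - m⌉ + m : ℤ) : ℝ) := by push_cast; linarith
    have := Int.cast_le.1 this
    omega
  · exact Nat.mul_le_mul_right _ ((Multiset.toFinset_card_le _).trans p.card_roots')

theorem norm_sum_Icc_sub_le {f : ℤ → ℂ} (hf : ∀ a, ‖f a‖ ≤ 1) (L m : ℕ) :
    ‖∑ a ∈ Finset.Icc (-L : ℤ) L, f a - ∑ a ∈ Finset.Icc (-L : ℤ) L, f (a + m)‖ ≤ 2 * m := by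
  have h1 : ∑ a ∈ Finset.Icc (-L : ℤ) L, f (a + m) =
      ∑ a ∈ Finset.Icc (-L + m : ℤ) (L + m), f a := by
    rw [← Finset.map_add_right_Icc, Finset.sum_map]
    rfl
  have hs : ∀ s : Finset ℤ, s.card ≤ m → ‖∑ a ∈ s, f a‖ ≤ m := fun s hs =>
    (norm_sum_le_of_le _ fun a _ => hf a).trans (by simpa using hs)
  rw [h1, ← Finset.sum_sdiff_sub_sum_sdiff, two_mul]
  refine (norm_sub_le _ _).trans (add_le_add (hs _ ?_) (hs _ ?_))
  · refine (Finset.card_le_card (t := Finset.Ico (-L : ℤ) (-L + m)) fun a ha => ?_).trans (by simp)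
    simp only [Finset.mem_sdiff, Finset.mem_Icc, Finset.mem_Ico] at ha ⊢
    omega
  · refine (Finset.card_le_card (t := Finset.Ioc (L : ℤ) (L + m)) fun a ha => ?_).trans (by simp)
    simp only [Finset.mem_sdiff, Finset.mem_Icc, Finset.mem_Ioc] at ha ⊢
    omega

theorem norm_sum_shift_le {R : ℤ → Prop} [DecidablePred R] {P : ℤ → ℂ} (hP : ∀ a, ‖P a‖ ≤ 1)
    {D : ℕ} (hR : ∀ m : ℕ, ∀ s : Finset ℤ, (∀ a ∈ s, ¬ (R a ↔ R (a + m))) → s.card ≤ D * (m + 1))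
    (L g H : ℕ) :
    H * ‖∑ a ∈ Finset.Icc (-L : ℤ) L, if R a then P a else 0‖ ≤
      ∑ a ∈ Finset.Icc (-L : ℤ) L, ‖∑ h ∈ Finset.range H, P (a + g * h)‖ +
        H * (2 * (g * H) + D * (g * H + 1)) := by
  set T : ℤ → ℂ := fun a => if R a then P a else 0 with hT
  have hT1 : ∀ a, ‖T a‖ ≤ 1 := fun a => by
    rw [hT]; dsimp only; split_ifs
    · exact hP a
    · simp
  have h1 : ∀ h ∈ Finset.range H,
      ‖∑ a ∈ Finset.Icc (-L : ℤ) L, T a -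
        ∑ a ∈ Finset.Icc (-L : ℤ) L, if R a then P (a + g * h) else 0‖ ≤
        2 * (g * H) + D * (g * H + 1) := by
    intro h hh
    have h2 := norm_sum_Icc_sub_le hT1 L (g * h)
    have h3 : ‖∑ a ∈ Finset.Icc (-L : ℤ) L, T (a + (g * h : ℕ)) -
        ∑ a ∈ Finset.Icc (-L : ℤ) L, if R a then P (a + g * h) else 0‖ ≤
        D * ((g * h : ℕ) + 1) := by
      rw [← Finset.sum_sub_distrib]
      set s := (Finset.Icc (-L : ℤ) L).filter fun a => ¬ (R a ↔ R (a + (g * h : ℕ))) with hs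
      have h4 : ∀ a ∈ Finset.Icc (-L : ℤ) L,
          ‖T (a + (g * h : ℕ)) - if R a then P (a + g * h) else 0‖ ≤ if ¬ (R a ↔ R (a + (g * h : ℕ)))
            then 1 else 0 := by
        intro a _
        rw [hT]
        push_cast
        by_cases ha : R a <;> by_cases hb : R (a + g * h) <;> simp [ha, hb, hP]
      refine (norm_sum_le_of_le _ h4).trans ?_
      rw [Finset.sum_boole]
      exact_mod_cast hR _ s fun a ha => (Finset.mem_filter.1 ha).2
    have h5 : ((g * h : ℕ) : ℝ) ≤ g * H := by
      rw [Nat.cast_mul]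
      gcongr
      exact (Finset.mem_range.1 hh).le
    calc _ ≤ _ := norm_sub_le_norm_sub_add_norm_sub _ (∑ a ∈ Finset.Icc (-L : ℤ) L,
          T (a + (g * h : ℕ))) _
      _ ≤ 2 * (g * h : ℕ) + D * ((g * h : ℕ) + 1) := add_le_add h2 h3
      _ ≤ _ := by gcongr
  have h2 : (H : ℂ) * ∑ a ∈ Finset.Icc (-L : ℤ) L, T a =
      (∑ h ∈ Finset.range H, ∑ a ∈ Finset.Icc (-L : ℤ) L, if R a then P (a + g * h) else 0) +
      ∑ h ∈ Finset.range H, (∑ a ∈ Finset.Icc (-L : ℤ) L, T a -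
        ∑ a ∈ Finset.Icc (-L : ℤ) L, if R a then P (a + g * h) else 0) := by
    rw [← Finset.sum_add_distrib]
    simp
  have h3 : (H : ℝ) * ‖∑ a ∈ Finset.Icc (-L : ℤ) L, T a‖ =
      ‖(H : ℂ) * ∑ a ∈ Finset.Icc (-L : ℤ) L, T a‖ := by
    rw [norm_mul, Complex.norm_natCast]
  rw [h3, h2]
  refine (norm_add_le _ _).trans (add_le_add ?_ ((norm_sum_le_of_le _ h1).trans (by
    rw [Finset.sum_const, Finset.card_range, nsmul_eq_mul])))
  rw [Finset.sum_comm]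
  refine norm_sum_le_of_le _ fun a _ => ?_
  by_cases ha : R a
  · simp [ha]
  · simp [ha]

theorem card_filter_nE_le (L : ℕ) {P : ℝ} (hP : 1 ≤ P) :
    (((boxE L).filter fun v => (nE v : ℝ) ≤ P).card : ℝ) ≤ 20 * P := by
  set K := ⌊√(4 / 3 * P)⌋₊ with hK
  have hK2 : (K : ℝ) ^ 2 ≤ 4 / 3 * P := by
    have := Nat.floor_le (Real.sqrt_nonneg (4 / 3 * P))
    calc (K : ℝ) ^ 2 ≤ √(4 / 3 * P) ^ 2 := by gcongr
      _ = _ := Real.sq_sqrt (by positivity)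
  have h1 : (boxE L).filter (fun v => (nE v : ℝ) ≤ P) ⊆ boxE K := by
    intro v hv
    have hv := (Finset.mem_filter.1 hv).2
    obtain ⟨h3, h4⟩ := sq_le_nE v
    have h5 : ∀ t : ℤ, 3 * t ^ 2 ≤ 4 * nE v → |t| ≤ K := by
      intro t ht
      have ht' : (3 * t ^ 2 : ℝ) ≤ 4 * nE v := by exact_mod_cast ht
      have : (t.natAbs : ℝ) ≤ √(4 / 3 * P) := by
        rw [Nat.cast_natAbs, Int.cast_abs]
        exact Real.abs_le_sqrt (by linarith)
      rw [← Int.natCast_natAbs]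
      exact Int.ofNat_le.2 (Nat.le_floor this)
    exact mem_boxE.2 ⟨h5 _ h3, h5 _ h4⟩
  have h2 : (((boxE L).filter fun v => (nE v : ℝ) ≤ P).card : ℝ) ≤ (2 * K + 1 : ℝ) ^ 2 := by
    have := Finset.card_le_card h1
    rw [card_boxE] at this
    exact_mod_cast this
  nlinarith [sq_nonneg (2 * K - 1 : ℝ)]

theorem exists_sum_Icc_le : ∃ c : ℝ, 0 < c ∧ ∀ L : ℕ,
    ∑ n ∈ Finset.Icc (-L : ℤ) L, ((|n| + 1 : ℤ) : ℝ) ^ (-(3 / 2) : ℝ) ≤ c := by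
  have hs : Summable fun n : ℤ => ((|n| + 1 : ℤ) : ℝ) ^ (-(3 / 2) : ℝ) := by
    have h1 : Summable fun n : ℕ => ((n : ℝ) + 1) ^ (-(3 / 2) : ℝ) := by
      have := (summable_nat_add_iff 1).2 (Real.summable_nat_rpow.2 (show (-(3 / 2) : ℝ) < -1 by norm_num))
      simpa using this
    refine Summable.of_nat_of_neg ?_ ?_
    · simpa using h1
    · simpa using h1
  have h0 : ∀ n : ℤ, 0 ≤ ((|n| + 1 : ℤ) : ℝ) ^ (-(3 / 2) : ℝ) := fun n =>
    Real.rpow_nonneg (by positivity) _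
  refine ⟨∑' n : ℤ, ((|n| + 1 : ℤ) : ℝ) ^ (-(3 / 2) : ℝ) + 1, by positivity, fun L => ?_⟩
  exact (hs.sum_le_tsum _ fun n _ => h0 n).trans (by linarith)

theorem mul_le_nE {a : E} (ha : a ≠ 0) : 3 * ((|a.re| + 1) * (|a.im| + 1)) ≤ 16 * nE a := by
  obtain ⟨h1, h2⟩ := sq_le_nE a
  have h3 := nE_pos ha
  have h4 : ∀ t : ℤ, 3 * t ^ 2 ≤ 4 * nE a → 3 * (|t| + 1) ^ 2 ≤ 16 * nE a := by
    intro t ht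
    rw [← sq_abs] at ht
    have := abs_nonneg t
    rcases this.eq_or_lt with h | h
    · rw [← h]; omega
    · have : 1 ≤ |t| := h
      nlinarith
  have h5 := h4 _ h1
  have h6 := h4 _ h2
  nlinarith [sq_nonneg (|a.re| - |a.im|)]

theorem exists_card_sq_dvd_le : ∃ C : ℝ, 0 < C ∧ ∀ (L : ℕ) (A : ℝ), 0 < A → ∀ s ⊆ boxE L,
    (∀ v ∈ s, v ≠ 0 ∧ ∃ a : E, a ^ 2 ∣ v ∧ A < nE a) →
    (s.card : ℝ) ≤ C * (L ^ 2 * A ^ (-(1 / 2) : ℝ)) := by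
  classical
  obtain ⟨c, hc, hsum⟩ := exists_sum_Icc_le
  refine ⟨198 * ((3 / 16) ^ (-(3 / 2) : ℝ) * (c * c)), by positivity, fun L A hA s hs h => ?_⟩
  choose! a ha using fun v hv => (h v hv).2
  have hbound : ∀ v ∈ s, a v ≠ 0 ∧ nE (a v) ^ 2 ≤ 3 * L ^ 2 := fun v hv => by
    have hv0 := (h v hv).1
    have ha0 : a v ≠ 0 := fun h0 => by
      have := (ha v hv).1
      rw [h0, zero_pow two_ne_zero, zero_dvd_iff] at this
      exact hv0 this
    have h1 := nE_le_of_dvd (ha v hv).1 hv0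
    rw [map_pow] at h1
    exact ⟨ha0, h1.trans (nE_le_of_mem_boxE (hs hv))⟩
  have hmaps : ∀ v ∈ s, a v ∈ boxE (2 * L) := fun v hv => by
    obtain ⟨ha0, h1⟩ := hbound v hv
    obtain ⟨h3, h4⟩ := sq_le_nE (a v)
    have hp := nE_pos ha0
    have h5 : ∀ t : ℤ, 3 * t ^ 2 ≤ 4 * nE (a v) → |t| ≤ (2 * L : ℕ) := by
      intro t ht
      refine abs_le_of_sq_le_sq ?_ (by positivity)
      push_cast
      have hL : 1 ≤ (L : ℤ) := by
        by_contra hL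
        have : (L : ℤ) = 0 := by omega
        rw [this] at h1
        nlinarith
      have h6 : nE (a v) ≤ 2 * L := abs_le_of_sq_le_sq (by nlinarith) (by positivity) |> (le_abs_self _).trans
      nlinarith
    exact mem_boxE.2 ⟨h5 _ h3, h5 _ h4⟩
  have hfib : ∀ b ∈ boxE (2 * L), ((s.filter fun v => a v = b).card : ℝ) ≤
      198 * (L ^ 2 * A ^ (-(1 / 2) : ℝ)) * ((3 / 16) ^ (-(3 / 2) : ℝ) *
        (((|b.re| + 1 : ℤ) : ℝ) ^ (-(3 / 2) : ℝ) * ((|b.im| + 1 : ℤ) : ℝ) ^ (-(3 / 2) : ℝ))) := by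
    intro b _
    rcases (s.filter fun v => a v = b).eq_empty_or_nonempty with h0 | ⟨v, hv'⟩
    · rw [h0]
      simp only [Finset.card_empty, Nat.cast_zero]
      positivity
    obtain ⟨hv, rfl⟩ := Finset.mem_filter.1 hv'
    obtain ⟨ha0, h1⟩ := hbound v hv
    have hn : (0 : ℝ) < nE (a v) := by exact_mod_cast nE_pos ha0
    have h2 := card_boxE_filter_le (pow_ne_zero 2 ha0)
      ((Finset.filter_subset (fun v' => a v' = a v) s).trans hs) fun u hu u' hu' => by
        obtain ⟨hu, e⟩ := Finset.mem_filter.1 hu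
        obtain ⟨hu', e'⟩ := Finset.mem_filter.1 hu'
        exact dvd_sub (e ▸ (ha u hu).1) (e' ▸ (ha u' hu').1)
    rw [map_pow] at h2
    push_cast at h2
    have h3 : (1 : ℝ) ≤ 3 * (L ^ 2 / (nE (a v) : ℝ) ^ 2) := by
      rw [← mul_div_assoc, le_div_iff₀ (by positivity), one_mul]
      exact_mod_cast h1
    have h4 : (nE (a v) : ℝ)⁻¹ ^ 2 = (nE (a v) : ℝ) ^ (-(1 / 2) : ℝ) * (nE (a v) : ℝ) ^ (-(3 / 2) : ℝ) := by
      rw [← Real.rpow_add hn, inv_pow, ← Real.rpow_natCast, ← Real.rpow_neg hn.le]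
      norm_num
    have h5 : (nE (a v) : ℝ) ^ (-(1 / 2) : ℝ) ≤ A ^ (-(1 / 2) : ℝ) :=
      Real.rpow_le_rpow_of_nonpos hA (ha v hv).2.le (by norm_num)
    have h6 : (nE (a v) : ℝ) ^ (-(3 / 2) : ℝ) ≤ ((3 / 16) ^ (-(3 / 2) : ℝ) *
        (((|(a v).re| + 1 : ℤ) : ℝ) ^ (-(3 / 2) : ℝ) * ((|(a v).im| + 1 : ℤ) : ℝ) ^ (-(3 / 2) : ℝ))) := by
      have e1 : (0 : ℝ) < ((|(a v).re| + 1 : ℤ) : ℝ) := by positivity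
      have e2 : (0 : ℝ) < ((|(a v).im| + 1 : ℤ) : ℝ) := by positivity
      rw [← Real.mul_rpow e1.le e2.le, ← Real.mul_rpow (by norm_num) (by positivity)]
      refine Real.rpow_le_rpow_of_nonpos (by positivity) ?_ (by norm_num)
      have h7 : ((3 * ((|(a v).re| + 1) * (|(a v).im| + 1)) : ℤ) : ℝ) ≤ (16 * nE (a v) : ℤ) := Int.cast_le.2 (mul_le_nE ha0)
      push_cast at h7 ⊢
      linarith
    calc _ ≤ 192 * (L ^ 2 / (nE (a v) : ℝ) ^ 2) + 2 := h2
      _ ≤ 198 * (L ^ 2 * (nE (a v) : ℝ)⁻¹ ^ 2) := by rw [inv_pow, ← div_eq_mul_inv]; linarith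
      _ ≤ 198 * (L ^ 2 * (A ^ (-(1 / 2) : ℝ) * ((3 / 16) ^ (-(3 / 2) : ℝ) *
        (((|(a v).re| + 1 : ℤ) : ℝ) ^ (-(3 / 2) : ℝ) * ((|(a v).im| + 1 : ℤ) : ℝ) ^ (-(3 / 2) : ℝ))))) := by
        rw [h4]
        gcongr
      _ = _ := by ring
  rw [Finset.card_eq_sum_card_fiberwise hmaps, Nat.cast_sum]
  refine (Finset.sum_le_sum hfib).trans ?_
  rw [← Finset.mul_sum, ← Finset.mul_sum, sum_boxE]
  simp only [← Finset.mul_sum]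
  rw [← Finset.sum_mul]
  have h7 := hsum (2 * L)
  have h8 : 0 ≤ ∑ n ∈ Finset.Icc (-(2 * L : ℕ) : ℤ) (2 * L : ℕ), ((|n| + 1 : ℤ) : ℝ) ^ (-(3 / 2) : ℝ) :=
    Finset.sum_nonneg fun n _ => Real.rpow_nonneg (by positivity) _
  have h9 := mul_le_mul h7 h7 h8 hc.le
  calc _ ≤ 198 * (L ^ 2 * A ^ (-(1 / 2) : ℝ)) * ((3 / 16) ^ (-(3 / 2) : ℝ) * (c * c)) := by gcongr
    _ = _ := by ring

theorem card_region_change_le {p₁ p₂ p₃ : Polynomial ℝ} (h₁ : p₁.natDegree ≤ 4)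
    (h₂ : p₂.natDegree ≤ 4) (h₃ : p₃.natDegree ≤ 4) {R : ℤ → Prop}
    (hR : ∀ a : ℤ, R a ↔ ¬ 0 ≤ p₁.eval (a : ℝ) ∧ 0 ≤ p₂.eval (a : ℝ) ∧ 0 ≤ p₃.eval (a : ℝ))
    (m : ℕ) (s : Finset ℤ) (hs : ∀ a ∈ s, ¬ (R a ↔ R (a + m))) : s.card ≤ 12 * (m + 1) := by
  classical
  set t : Polynomial ℝ → Finset ℤ := fun p =>
    s.filter fun a => ¬ (0 ≤ p.eval (a : ℝ) ↔ 0 ≤ p.eval ((a : ℝ) + m)) with ht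
  have hc : ∀ p : Polynomial ℝ, p.natDegree ≤ 4 → (t p).card ≤ 4 * (m + 1) := fun p hp =>
    (card_sign_change_le p m fun a ha => (Finset.mem_filter.1 ha).2).trans
      (Nat.mul_le_mul_right _ hp)
  have h1 : s ⊆ t p₁ ∪ (t p₂ ∪ t p₃) := fun a ha => by
    have := hs a ha
    rw [hR, hR] at this
    push_cast at this
    simp only [ht, Finset.mem_union, Finset.mem_filter, ha, true_and]
    tauto
  have h2 := Finset.card_le_card h1
  have h3 := Finset.card_union_le (t p₁) (t p₂ ∪ t p₃)
  have h4 := Finset.card_union_le (t p₂) (t p₃)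
  have := hc p₁ h₁
  have := hc p₂ h₂
  have := hc p₃ h₃
  omega

theorem dvd_nE_sub {d : ℤ} {z z' : E} (h : (d : E) ∣ z - z') : d ∣ nE z - nE z' := by
  obtain ⟨t, ht⟩ := h
  have e : z = ⟨z'.re + d * t.re, z'.im + d * t.im⟩ := by
    have := sub_eq_iff_eq_add.1 ht
    rw [this]
    ext <;> simp [add_comm]
  rw [e, nE_def, nE_def]
  exact ⟨2 * z'.re * t.re + d * t.re ^ 2 - z'.re * t.im - t.re * z'.im - d * t.re * t.im +
    2 * z'.im * t.im + d * t.im ^ 2, by ring⟩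

/-- The symbol restricted to primary elements whose norm is divisible by `d`. -/
noncomputable def pC (d : ℕ) (v u : E) : ℂ :=
  open Classical in if (3 : O) ∣ (⟨u, v⟩ : O) - 1 ∧ (d : ℤ) ∣ N ⟨u, v⟩ then fC ⟨u, v⟩ else 0

theorem norm_pC_le (d : ℕ) (v u : E) : ‖pC d v u‖ ≤ 1 := by
  unfold pC
  split_ifs
  · exact norm_fC_le _
  · simp

theorem norm_sum_pC_le {w x : E} (hx : (3 : E) ∣ x - 1) (hw : w ≠ 0) {d g : ℕ}
    (hg : g = 18 * d) (u : E) (H : ℕ) :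
    ‖∑ h ∈ Finset.range H, pC d (w * x) (u + g * h)‖ ≤
      ‖∑ h ∈ Finset.range H, wsq w (u + g * h) * csq x (u + g * h)‖ := by
  classical
  have hd : ∀ h : ℕ, nO ⟨u + g * h, w * x⟩ - nO ⟨u, w * x⟩ = 18 * (d * (h * (2 * u + g * h))) := by
    intro h
    rw [nO_def, nO_def, hg]
    push_cast
    ring
  have h3 : ∀ h : ℕ, (3 : O) ∣ (⟨u + g * h, w * x⟩ : O) - 1 ↔ (3 : O) ∣ (⟨u, w * x⟩ : O) - 1 := by
    intro h
    rw [primary_O_iff, primary_O_iff]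
    refine and_congr_left fun _ => three_dvd_iff_of_dvd dvd_rfl ⟨6 * d * h, ?_⟩
    rw [hg]; push_cast; ring
  have hN : ∀ h : ℕ, (d : ℤ) ∣ N ⟨u + g * h, w * x⟩ ↔ (d : ℤ) ∣ N ⟨u, w * x⟩ := by
    intro h
    have h1 : (d : ℤ) ∣ nE (nO ⟨u + g * h, w * x⟩) - nE (nO ⟨u, w * x⟩) :=
      dvd_nE_sub ⟨18 * (h * (2 * u + g * h)), by rw [hd]; push_cast; ring⟩
    rw [N_def, N_def]
    exact (dvd_iff_dvd_of_dvd_sub h1)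
  by_cases hu : (3 : O) ∣ (⟨u, w * x⟩ : O) - 1 ∧ (d : ℤ) ∣ N ⟨u, w * x⟩
  · have h1 : ∀ h : ℕ, pC d (w * x) (u + g * h) =
        emb (cs 2 (nO ⟨u, w * x⟩)) * (wsq w (u + g * h) * csq x (u + g * h)) := by
      intro h
      have hp := (h3 h).2 hu.1
      rw [pC, if_pos ⟨hp, (hN h).2 hu.2⟩, fC_eq hx hw hp]
      congr 2
      refine cs_periodic (by decide) (primary_nO hp) ?_ ?_
      · exact ⟨2 * (d * (h * (2 * u + g * h))), by rw [hd]; ring⟩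
      · exact ⟨9 * (d * (h * (2 * u + g * h))), by rw [hd]; ring⟩
    simp only [h1, ← Finset.mul_sum, norm_mul]
    exact mul_le_of_le_one_left (norm_nonneg _) (cs_isMu _ _).norm_emb_le
  · have h1 : ∀ h : ℕ, pC d (w * x) (u + g * h) = 0 := fun h => by
      rw [pC, if_neg]
      rwa [h3, hN]
    simp only [h1, Finset.sum_const_zero, _root_.norm_zero]
    exact norm_nonneg _

/-- The symbol restricted to reduced elements of norm at most `Y`, divisible by `d`. -/
noncomputable def tC (d Y : ℕ) (α : O) : ℂ :=
  open Classical in if Red α ∧ N α ≤ Y ∧ (d : ℤ) ∣ N α then fC α else 0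

theorem norm_tC_le (d Y : ℕ) (α : O) : ‖tC d Y α‖ ≤ 1 := by
  unfold tC
  split_ifs
  · exact norm_fC_le _
  · simp

open Polynomial in
theorem norm_sum_tC_shift_le (d Y : ℕ) (v : E) (L g H : ℕ) :
    H * ‖∑ u ∈ boxE L, tC d Y ⟨u, v⟩‖ ≤ ∑ u ∈ boxE L, ‖∑ h ∈ Finset.range H, pC d v (u + g * h)‖ +
      (2 * L + 1) * (H * (2 * (g * H) + 12 * (g * H + 1))) := by
  classical
  rw [sum_boxE, sum_boxE, Finset.sum_comm, Finset.sum_comm (s := Finset.Icc (-L : ℤ) L)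
    (t := Finset.Icc (-L : ℤ) L) (f := fun a b => ‖_‖)]
  have h1 : ∀ b ∈ Finset.Icc (-L : ℤ) L,
      H * ‖∑ a ∈ Finset.Icc (-L : ℤ) L, tC d Y ⟨⟨a, b⟩, v⟩‖ ≤
      ∑ a ∈ Finset.Icc (-L : ℤ) L, ‖∑ h ∈ Finset.range H, pC d v (⟨a, b⟩ + g * h)‖ +
        H * (2 * (g * H) + 12 * (g * H + 1)) := by
    intro b _
    set hp : ℝ[X] := X ^ 2 - C (b : ℝ) * X + C ((b : ℝ) ^ 2 + nE v) with hhp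
    set tp : ℝ[X] := C (b * v.re : ℝ) - C (v.im : ℝ) * X with htp
    set R : ℤ → Prop := fun a => (-(15 * hs ⟨⟨a, b⟩, v⟩) < 26 * ht ⟨⟨a, b⟩, v⟩ ∧
      26 * ht ⟨⟨a, b⟩, v⟩ ≤ 15 * hs ⟨⟨a, b⟩, v⟩) ∧ N ⟨⟨a, b⟩, v⟩ ≤ Y with hR
    have ehs : ∀ a : ℤ, hp.eval (a : ℝ) = (hs ⟨⟨a, b⟩, v⟩ : ℝ) := fun a => by
      simp only [hhp, eval_add, eval_sub, eval_pow, eval_X, eval_mul, eval_C, hs, nE_def]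
      push_cast
      ring
    have eht : ∀ a : ℤ, tp.eval (a : ℝ) = (ht ⟨⟨a, b⟩, v⟩ : ℝ) := fun a => by
      simp only [htp, eval_sub, eval_X, eval_mul, eval_C, ht]
      push_cast
      ring
    have hdh : hp.natDegree ≤ 2 := by rw [hhp]; compute_degree
    have hdt : tp.natDegree ≤ 1 := by rw [htp]; compute_degree
    have hRiff : ∀ a : ℤ, R a ↔ ¬ 0 ≤ (-(C 15 * hp + C 26 * tp)).eval (a : ℝ) ∧
        0 ≤ (C 15 * hp - C 26 * tp).eval (a : ℝ) ∧
        0 ≤ (C (Y : ℝ) - (hp ^ 2 - C 3 * tp ^ 2)).eval (a : ℝ) := by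
      intro a
      simp only [eval_add, eval_sub, eval_pow, eval_mul, eval_C, eval_neg, ehs, eht, hR, N_eq]
      rw [and_assoc]
      refine and_congr ?_ (and_congr ?_ ?_)
      · rw [not_le, ← Int.cast_lt (R := ℝ)]; push_cast; constructor <;> intro h <;> linarith
      · rw [← Int.cast_le (R := ℝ)]; push_cast; constructor <;> intro h <;> linarith
      · rw [← Int.cast_le (R := ℝ)]; push_cast; constructor <;> intro h <;> linarith
    have hd1 : (-(C 15 * hp + C 26 * tp)).natDegree ≤ 4 := by
      rw [natDegree_neg]
      exact (natDegree_add_le_of_degree_le ((natDegree_C_mul_le _ _).trans hdh)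
        ((natDegree_C_mul_le _ _).trans (hdt.trans one_le_two))).trans (by norm_num)
    have hd2 : (C 15 * hp - C 26 * tp).natDegree ≤ 4 :=
      (natDegree_sub_le_of_le ((natDegree_C_mul_le _ _).trans hdh)
        ((natDegree_C_mul_le _ _).trans hdt)).trans (by norm_num)
    have hd3 : (C (Y : ℝ) - (hp ^ 2 - C 3 * tp ^ 2)).natDegree ≤ 4 :=
      (natDegree_sub_le_of_le (natDegree_C _).le (natDegree_sub_le_of_le
        (natDegree_pow_le_of_le 2 hdh) ((natDegree_C_mul_le _ _).trans
          (natDegree_pow_le_of_le 2 hdt)))).trans (by norm_num)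
    have key := norm_sum_shift_le (R := R) (P := fun a => pC d v ⟨a, b⟩)
      (fun a => norm_pC_le _ _ _) (D := 12) (card_region_change_le hd1 hd2 hd3 hRiff) L g H
    have e1 : ∀ a : ℤ, tC d Y ⟨⟨a, b⟩, v⟩ = if R a then pC d v ⟨a, b⟩ else 0 := fun a => by
      rw [tC, pC, ← ite_and]
      refine if_congr ?_ rfl rfl
      simp only [hR, Red]
      tauto
    have e2 : ∀ (a : ℤ) (h : ℕ), (⟨a, b⟩ : E) + g * h = ⟨a + g * h, b⟩ := fun a h => by
      ext <;> simp
    simp only [e1, e2]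
    exact key
  have h2 : (Finset.Icc (-L : ℤ) L).card = 2 * L + 1 := by rw [Int.card_Icc]; omega
  calc _ ≤ H * ∑ b ∈ Finset.Icc (-L : ℤ) L, ‖∑ a ∈ Finset.Icc (-L : ℤ) L, tC d Y ⟨⟨a, b⟩, v⟩‖ := by
        gcongr
        exact norm_sum_le _ _
    _ ≤ _ := by
      rw [Finset.mul_sum]
      refine (Finset.sum_le_sum h1).trans ?_
      rw [Finset.sum_add_distrib, Finset.sum_const, h2, nsmul_eq_mul]
      push_cast
      exact le_rfl

theorem norm_sum_tC_le {w x : E} (hwx : IsCoprime (9 * w) x) (hx : (3 : E) ∣ x - 1)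
    (hs : Squarefree x) (hw : w ≠ 0) {d g : ℕ} (hd : 0 < d) (hg : g = 18 * d) (Y : ℕ) {L : ℕ}
    (hL : w * x ∈ boxE L) {H : ℕ} (hH : 0 < H) :
    H * ‖∑ u ∈ boxE L, tC d Y ⟨u, w * x⟩‖ ≤
      100 * L ^ 2 * (√H + H * (g * H) / √(nE x)) + 78 * (L * (g * H ^ 2)) := by
  have hx0 := primary_ne_zero hx
  have hg0 : 0 < g := by omega
  have hL1 : (1 : ℝ) ≤ L := by
    have h1 := nE_le_of_mem_boxE hL
    have h2 := nE_pos (mul_ne_zero hw hx0)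
    rcases Nat.eq_zero_or_pos L with h | h
    · simp [h, -map_mul] at h1; omega
    · exact_mod_cast h
  have hm : (9 : E) * w ≠ 0 := mul_ne_zero (by decide) hw
  have hnm : (0 : ℝ) < nE (9 * w) := by exact_mod_cast nE_pos hm
  have hnx : (0 : ℝ) < nE x := by exact_mod_cast nE_pos hx0
  set S : E → ℂ := fun u => ∑ h ∈ Finset.range H, wsq w (u + g * h) * csq x (u + g * h) with hS
  have hper : PeriodicMod (9 * w * x) fun u => ‖S u‖ ^ 2 := fun u u' h => by
    have := (wsq_periodic hw).mul (csq_periodic x)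
    simp only [hS]
    congr 2
    refine Finset.sum_congr rfl fun k _ => this (u + g * k) (u' + g * k) ?_
    convert h using 1
    ring
  have hb : nE (9 * w * x) ≤ 243 * L ^ 2 := by
    have h1 := nE_le_of_mem_boxE hL
    have h9 : nE 9 = 81 := by decide
    rw [mul_assoc, map_mul, h9]
    linarith
  have h1 := sum_boxE_le (mul_ne_zero hm hx0) hb hper fun u => by positivity
  have h2 := qsum_sq_le hm hx hs hwx (wsq_periodic hw) (norm_wsq_le w) hg0 H
  have h3 : ∑ u ∈ boxE L, ‖S u‖ ^ 2 ≤ 1000 * L ^ 2 * (H + H ^ 2 * (g * H : ℝ) ^ 2 / nE x) := by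
    refine h1.trans ((mul_le_mul_of_nonneg_left h2 (mul_nonneg (by norm_num)
      (div_nonneg (by positivity) (by exact_mod_cast nE_nonneg _)))).trans_eq ?_)
    rw [map_mul nE (9 * w) x]
    push_cast
    field_simp
  have h4 : (∑ u ∈ boxE L, ‖S u‖) ^ 2 ≤ (100 * L ^ 2 * (√H + H * (g * H) / √(nE x))) ^ 2 := by
    refine sq_sum_le_card_mul_sum_sq.trans ?_
    rw [card_boxE]
    have e1 : (((2 * L + 1) ^ 2 : ℕ) : ℝ) ≤ 9 * L ^ 2 := by push_cast; nlinarith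
    have e2 : (H : ℝ) + H ^ 2 * (g * H : ℝ) ^ 2 / nE x ≤ (√H + H * (g * H) / √(nE x)) ^ 2 := by
      have : 0 ≤ 2 * √H * (H * (g * H) / √(nE x)) := by positivity
      have e3 : (H * (g * H) / √(nE x) : ℝ) ^ 2 = H ^ 2 * (g * H : ℝ) ^ 2 / nE x := by
        rw [div_pow, Real.sq_sqrt hnx.le, mul_pow]
      have e4 : √(H : ℝ) ^ 2 = H := Real.sq_sqrt (by positivity)
      nlinarith
    calc _ ≤ 9 * L ^ 2 * (1000 * L ^ 2 * (H + H ^ 2 * (g * H : ℝ) ^ 2 / nE x)) := by gcongr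
      _ ≤ 9 * L ^ 2 * (1000 * L ^ 2 * (√H + H * (g * H) / √(nE x)) ^ 2) := by gcongr
      _ = 9000 * (L ^ 4 * (√H + H * (g * H) / √(nE x)) ^ 2) := by ring
      _ ≤ 10000 * (L ^ 4 * (√H + H * (g * H) / √(nE x)) ^ 2) := by gcongr; norm_num
      _ = _ := by ring
  have h5 : ∑ u ∈ boxE L, ‖S u‖ ≤ 100 * L ^ 2 * (√H + H * (g * H) / √(nE x)) :=
    (abs_le_of_sq_le_sq h4 (by positivity)) |> (le_abs_self _).trans
  refine (norm_sum_tC_shift_le d Y (w * x) L g H).trans (add_le_add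
    ((Finset.sum_le_sum fun u _ => norm_sum_pC_le hx hw hg u H).trans h5) ?_)
  have hgH : (1 : ℝ) ≤ g * H := by exact_mod_cast Nat.mul_pos hg0 hH
  calc (2 * L + 1 : ℝ) * (H * (2 * (g * H) + 12 * (g * H + 1))) ≤
      (3 * L) * (H * (26 * (g * H))) := by gcongr <;> linarith
    _ = _ := by ring

theorem sum_box {M : Type*} [AddCommMonoid M] (L : ℕ) (F : O → M) :
    ∑ α ∈ box L, F α = ∑ v ∈ boxE L, ∑ u ∈ boxE L, F ⟨u, v⟩ := by
  rw [← Finset.sum_product']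
  refine Finset.sum_nbij' (fun α => (α.im, α.re)) (fun x => ⟨x.2, x.1⟩) ?_ ?_ ?_ ?_ ?_
  · intro α hα
    have := mem_box.1 hα
    simp only [Finset.mem_product, mem_boxE]
    tauto
  · intro x hx
    simp only [Finset.mem_product, mem_boxE] at hx
    rw [mem_box]
    tauto
  · intro _ _; rfl
  · intro _ _; rfl
  · intro _ _; rfl

theorem exists_norm_sum_box_tC_le : ∃ C : ℝ, 0 < C ∧ ∀ (d Y L H : ℕ) (A P : ℝ), 0 < d → 0 < H →
    0 < L → 0 < A → 1 ≤ P → ‖∑ α ∈ box L, tC d Y α‖ ≤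
      C * (L ^ 4 * (1 / √H + d * H * √(A ^ 3 / P) + A ^ (-(1 / 2) : ℝ)) + L ^ 3 * (d * H) +
        L ^ 2 * P) := by
  classical
  obtain ⟨C, hC, hcard⟩ := exists_card_sq_dvd_le
  refine ⟨1000000 + 9 * C, by positivity, fun d Y L H A P hd hH hL hA hP => ?_⟩
  have hL1 : (1 : ℝ) ≤ L := by exact_mod_cast hL
  have hH1 : (1 : ℝ) ≤ H := by exact_mod_cast hH
  set B := 100 * (L : ℝ) ^ 2 * (1 / √H + 18 * d * H * (3 * √(A ^ 3 / P))) + 1404 * (L * (d * H))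
    with hB
  set s₁ := (boxE L).filter fun v => (nE v : ℝ) ≤ P with hs₁
  set s₂ := (boxE L).filter fun v => v ≠ 0 ∧ ∃ a : E, a ^ 2 ∣ v ∧ A < nE a with hs₂
  have htriv : ∀ v, ‖∑ u ∈ boxE L, tC d Y ⟨u, v⟩‖ ≤ 9 * L ^ 2 := fun v => by
    refine (norm_sum_le_of_le _ fun u _ => norm_tC_le d Y ⟨u, v⟩).trans ?_
    rw [Finset.sum_const, card_boxE, nsmul_eq_mul, mul_one]
    push_cast
    nlinarith
  have hgood : ∀ v ∈ boxE L, v ∉ s₁ → v ∉ s₂ → ‖∑ u ∈ boxE L, tC d Y ⟨u, v⟩‖ ≤ B := by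
    intro v hv h1 h2
    simp only [hs₁, Finset.mem_filter, hv, true_and, not_le] at h1
    have hv0 : v ≠ 0 := by
      rintro rfl
      rw [nE_eq_zero.2 rfl] at h1
      norm_num at h1
      linarith
    simp only [hs₂, Finset.mem_filter, hv, hv0, true_and, ne_eq, not_false_eq_true, not_exists,
      not_and, not_lt] at h2
    obtain ⟨w, x, a, rfl, hwx, hx, hsq, ha, hwa⟩ := exists_smooth_mul hv0
    have hw : w ≠ 0 := left_ne_zero_of_mul hv0
    have key := norm_sum_tC_le hwx hx hsq hw hd rfl Y hv hH
    have hnx : (0 : ℝ) < nE x := by exact_mod_cast nE_pos (primary_ne_zero hx)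
    have hnw : (0 : ℝ) < nE w := by exact_mod_cast nE_pos hw
    have hna : (0 : ℝ) ≤ nE a := by exact_mod_cast nE_nonneg a
    have h3 : (nE w : ℝ) ≤ 9 * A ^ 3 := by
      have h4 : (nE w : ℝ) ≤ 9 * (nE a : ℝ) ^ 3 := by exact_mod_cast hwa
      have := h2 a ha
      calc _ ≤ _ := h4
        _ ≤ _ := by gcongr
    have h5 : 1 / √(nE x : ℝ) ≤ 3 * √(A ^ 3 / P) := by
      have h6 : P ≤ 9 * A ^ 3 * nE x := by
        rw [map_mul, Int.cast_mul] at h1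
        exact h1.le.trans (by gcongr)
      have h7 : (1 / √(nE x : ℝ)) ≤ √(9 * (A ^ 3 / P)) := by
        rw [one_div, ← Real.sqrt_inv]
        refine Real.sqrt_le_sqrt ?_
        rw [inv_le_iff_one_le_mul₀ hnx, mul_comm, ← mul_div_assoc, ← mul_div_assoc,
          le_div_iff₀ (by linarith)]
        linarith
      rwa [Real.sqrt_mul (by norm_num), show (9 : ℝ) = 3 ^ 2 by norm_num,
        Real.sqrt_sq (by norm_num)] at h7
    have hHp : (0 : ℝ) < H := by linarith
    refine le_of_mul_le_mul_left (key.trans ?_) hHp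
    have e1 : √(H : ℝ) = H * (1 / √H) := by
      rw [mul_one_div, Real.div_sqrt]
    have e2 : (H * ((18 * d : ℕ) * H) / √(nE x) : ℝ) = H * (18 * d * H * (1 / √(nE x))) := by
      push_cast; ring
    rw [e2]
    nth_rewrite 1 [e1]
    calc _ = H * (100 * L ^ 2 * (1 / √H + 18 * d * H * (1 / √(nE x))) + 1404 * (L * (d * H))) := by
          push_cast; ring
      _ ≤ H * B := by rw [hB]; gcongr
  have hc₁ : (s₁.card : ℝ) ≤ 20 * P := card_filter_nE_le L hP
  have hc₂ : (s₂.card : ℝ) ≤ C * (L ^ 2 * A ^ (-(1 / 2) : ℝ)) :=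
    hcard L A hA s₂ (Finset.filter_subset _ _) fun v hv => (Finset.mem_filter.1 hv).2
  have hB0 : 0 ≤ B := by positivity
  have hall : ∀ v ∈ boxE L, ‖∑ u ∈ boxE L, tC d Y ⟨u, v⟩‖ ≤
      B + ((if v ∈ s₁ then 9 * (L : ℝ) ^ 2 else 0) + if v ∈ s₂ then 9 * (L : ℝ) ^ 2 else 0) := by
    intro v hv
    have := htriv v
    have h0 : (0 : ℝ) ≤ 9 * (L : ℝ) ^ 2 := by positivity
    by_cases h1 : v ∈ s₁ <;> by_cases h2 : v ∈ s₂ <;> simp only [h1, h2, if_true, if_false]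
    · linarith
    · linarith
    · linarith
    · linarith [hgood v hv h1 h2]
  rw [sum_box]
  refine (norm_sum_le_of_le _ hall).trans ?_
  clear_value B
  rw [Finset.sum_add_distrib, Finset.sum_add_distrib, Finset.sum_const, card_boxE,
    Finset.sum_ite_mem, Finset.sum_ite_mem, Finset.sum_const, Finset.sum_const,
    Finset.inter_eq_right.2 (Finset.filter_subset _ _),
    Finset.inter_eq_right.2 (Finset.filter_subset _ _)]
  simp only [nsmul_eq_mul]
  have e1 : (((2 * L + 1) ^ 2 : ℕ) : ℝ) ≤ 9 * L ^ 2 := by push_cast; nlinarith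
  have p1 : 0 ≤ 1 / √(H : ℝ) := by positivity
  have p2 : 0 ≤ d * H * √(A ^ 3 / P) := by positivity
  have p3 : 0 ≤ A ^ (-(1 / 2) : ℝ) := by positivity
  have p4 : (0 : ℝ) ≤ L ^ 4 * (1 / √H) := by positivity
  have p5 : (0 : ℝ) ≤ L ^ 4 * (d * H * √(A ^ 3 / P)) := by positivity
  have p6 : (0 : ℝ) ≤ L ^ 4 * A ^ (-(1 / 2) : ℝ) := by positivity
  have p7 : (0 : ℝ) ≤ L ^ 3 * (d * H) := by positivity
  have p8 : (0 : ℝ) ≤ L ^ 2 * P := by positivity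
  calc _ ≤ 9 * L ^ 2 * B + (20 * P * (9 * L ^ 2) + C * (L ^ 2 * A ^ (-(1 / 2) : ℝ)) * (9 * L ^ 2)) := by
        gcongr
    _ = 900 * (L ^ 4 * (1 / √H)) + 48600 * (L ^ 4 * (d * H * √(A ^ 3 / P))) +
        12636 * (L ^ 3 * (d * H)) + 180 * (L ^ 2 * P) + 9 * C * (L ^ 4 * A ^ (-(1 / 2) : ℝ)) := by
      rw [hB]; ring
    _ ≤ _ := by
      have := mul_nonneg hC.le p4
      have := mul_nonneg hC.le p5
      have := mul_nonneg hC.le p6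
      have := mul_nonneg hC.le p7
      have := mul_nonneg hC.le p8
      nlinarith

theorem sum_FC_eq {d Y L : ℕ} (hL : 52 * √(Y : ℝ) ≤ L ^ 2) :
    ∑ n ∈ (Finset.Icc 1 Y).filter (d ∣ ·), FC n = ∑ α ∈ box L, tC d Y α := by
  classical
  simp only [tC, ← Finset.sum_filter]
  rw [← Finset.sum_fiberwise_of_maps_to (t := (Finset.Icc 1 Y).filter (d ∣ ·))
    (g := fun α => (N α).toNat)]
  · refine Finset.sum_congr rfl fun n hn => ?_
    obtain ⟨hn1, hdn⟩ := Finset.mem_filter.1 hn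
    rw [Finset.mem_Icc] at hn1
    rw [FC]
    refine Finset.sum_congr (Finset.ext fun α => ?_) fun _ _ => rfl
    rw [mem_RN, Finset.mem_filter, Finset.mem_filter]
    constructor
    · rintro ⟨hα, hN⟩
      refine ⟨⟨mem_box_of_hs_le ?_, hα, by omega, hN ▸ Int.natCast_dvd_natCast.2 hdn⟩, by omega⟩
      have h1 : (hs α : ℝ) ^ 2 ≤ 676 * N α := by exact_mod_cast hα.hs_sq_le
      have h2 : (N α : ℝ) ≤ Y := by rw [hN]; exact_mod_cast hn1.2
      have h3 : (hs α : ℝ) ≤ 26 * √(Y : ℝ) := by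
        refine (le_abs_self _).trans (abs_le_of_sq_le_sq ?_ (by positivity))
        rw [mul_pow, Real.sq_sqrt (by positivity)]
        linarith
      have : (2 * hs α : ℝ) ≤ L ^ 2 := by linarith
      exact_mod_cast this
    · rintro ⟨⟨-, hα, -, -⟩, hN⟩
      have := hα.N_pos
      exact ⟨hα, by omega⟩
  · intro α hα
    obtain ⟨-, hα, hY, hd⟩ := Finset.mem_filter.1 hα
    have := hα.N_pos
    rw [Finset.mem_filter, Finset.mem_Icc]
    refine ⟨by omega, ?_⟩
    rw [← Int.natCast_dvd_natCast, Int.toNat_of_nonneg this.le]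
    exact hd

theorem typeI : ∃ C : ℝ, 0 < C ∧ ∀ (X : ℝ) (d Y : ℕ), 1 ≤ X → 0 < d → (d : ℝ) ≤ X ^ (0.02 : ℝ) →
    (Y : ℝ) ≤ X → ‖∑ n ∈ (Finset.Icc 1 Y).filter (d ∣ ·), FC n‖ ≤ C * X ^ (0.97 : ℝ) := by
  obtain ⟨C, hC, h⟩ := exists_norm_sum_box_tC_le
  refine ⟨C * 200000, by positivity, fun X d Y hX hd hdX hY => ?_⟩
  have hX0 : 0 < X := by linarith
  have hrp : ∀ t : ℝ, 0 < X ^ t := fun t => Real.rpow_pos_of_pos hX0 t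
  have h1rp : ∀ t : ℝ, 0 ≤ t → 1 ≤ X ^ t := fun t ht => Real.one_le_rpow hX ht
  have hmul : ∀ s t : ℝ, X ^ s * X ^ t = X ^ (s + t) := fun s t => (Real.rpow_add hX0 s t).symm
  have hle : ∀ s t : ℝ, s ≤ t → X ^ s ≤ X ^ t := fun s t hst => Real.rpow_le_rpow_of_exponent_le hX hst
  have hpow : ∀ (s : ℝ) (n : ℕ), (X ^ s) ^ n = X ^ (s * n) := fun s n => by
    rw [← Real.rpow_natCast, ← Real.rpow_mul hX0.le]
  set L := ⌈8 * X ^ (0.25 : ℝ)⌉₊ with hLdef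
  set H := ⌈X ^ (0.06 : ℝ)⌉₊ with hHdef
  have hL1 : 8 * X ^ (0.25 : ℝ) ≤ L := Nat.le_ceil _
  have hL2 : (L : ℝ) ≤ 9 * X ^ (0.25 : ℝ) := by
    have := Nat.ceil_lt_add_one (show 0 ≤ 8 * X ^ (0.25 : ℝ) by positivity)
    rw [← hLdef] at this
    have := h1rp 0.25 (by norm_num)
    linarith
  have hH1 : X ^ (0.06 : ℝ) ≤ H := Nat.le_ceil _
  have hH2 : (H : ℝ) ≤ 2 * X ^ (0.06 : ℝ) := by
    have := Nat.ceil_lt_add_one (hrp 0.06).le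
    rw [← hHdef] at this
    have := h1rp 0.06 (by norm_num)
    linarith
  have hL0 : 0 < L := Nat.ceil_pos.2 (by positivity)
  have hH0 : 0 < H := Nat.ceil_pos.2 (hrp _)
  rw [sum_FC_eq (L := L)]
  · refine (h d Y L H (X ^ (0.06 : ℝ)) (X ^ (0.47 : ℝ)) hd hH0 hL0 (hrp _) (h1rp _ (by norm_num))).trans ?_
    rw [mul_assoc C]
    refine mul_le_mul_of_nonneg_left ?_ hC.le
    have e1 : 1 / √(H : ℝ) ≤ X ^ (-0.03 : ℝ) := by
      rw [one_div, Real.rpow_neg hX0.le]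
      refine inv_anti₀ (hrp _) (Real.le_sqrt_of_sq_le ?_)
      rw [hpow]
      norm_num at hH1 ⊢
      exact hH1
    have e2 : √((X ^ (0.06 : ℝ)) ^ 3 / X ^ (0.47 : ℝ)) = X ^ (-0.145 : ℝ) := by
      rw [Real.sqrt_eq_rpow, hpow, ← Real.rpow_sub hX0, ← Real.rpow_mul hX0.le]
      norm_num
    have e3 : (X ^ (0.06 : ℝ)) ^ (-(1 / 2) : ℝ) = X ^ (-0.03 : ℝ) := by
      rw [← Real.rpow_mul hX0.le]
      norm_num
    have e4 : (d * H : ℝ) ≤ 2 * X ^ (0.08 : ℝ) := by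
      calc (d * H : ℝ) ≤ X ^ (0.02 : ℝ) * (2 * X ^ (0.06 : ℝ)) := by gcongr
        _ = 2 * (X ^ (0.02 : ℝ) * X ^ (0.06 : ℝ)) := by ring
        _ = _ := by rw [hmul]; norm_num
    have e5 : d * H * X ^ (-0.145 : ℝ) ≤ 2 * X ^ (-0.03 : ℝ) := by
      calc _ ≤ 2 * X ^ (0.08 : ℝ) * X ^ (-0.145 : ℝ) := by gcongr
        _ = 2 * X ^ (-0.065 : ℝ) := by rw [mul_assoc, hmul]; norm_num
        _ ≤ _ := by have := hle (-0.065) (-0.03) (by norm_num); linarith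
    rw [e2, e3]
    have hL4 : (L : ℝ) ^ 4 ≤ 6561 * X ^ (1 : ℝ) := by
      calc (L : ℝ) ^ 4 ≤ (9 * X ^ (0.25 : ℝ)) ^ 4 := by gcongr
        _ = _ := by rw [mul_pow, hpow]; norm_num
    have hL3 : (L : ℝ) ^ 3 ≤ 729 * X ^ (0.75 : ℝ) := by
      calc (L : ℝ) ^ 3 ≤ (9 * X ^ (0.25 : ℝ)) ^ 3 := by gcongr
        _ = _ := by rw [mul_pow, hpow]; norm_num
    have hL2' : (L : ℝ) ^ 2 ≤ 81 * X ^ (0.5 : ℝ) := by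
      calc (L : ℝ) ^ 2 ≤ (9 * X ^ (0.25 : ℝ)) ^ 2 := by gcongr
        _ = _ := by rw [mul_pow, hpow]; norm_num
    calc _ ≤ 6561 * X ^ (1 : ℝ) * (X ^ (-0.03 : ℝ) + 2 * X ^ (-0.03 : ℝ) + X ^ (-0.03 : ℝ)) +
          729 * X ^ (0.75 : ℝ) * (2 * X ^ (0.08 : ℝ)) + 81 * X ^ (0.5 : ℝ) * X ^ (0.47 : ℝ) := by
          gcongr
      _ = 26244 * (X ^ (1 : ℝ) * X ^ (-0.03 : ℝ)) + 1458 * (X ^ (0.75 : ℝ) * X ^ (0.08 : ℝ)) +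
          81 * (X ^ (0.5 : ℝ) * X ^ (0.47 : ℝ)) := by ring
      _ = 26244 * X ^ (0.97 : ℝ) + 1458 * X ^ (0.83 : ℝ) + 81 * X ^ (0.97 : ℝ) := by
        rw [hmul, hmul, hmul]; norm_num
      _ ≤ _ := by
        have := hle 0.83 0.97 (by norm_num)
        have := hrp 0.97
        linarith
  · have h1 : √(Y : ℝ) ≤ X ^ (0.5 : ℝ) := by
      rw [show (0.5 : ℝ) = 1 / 2 by norm_num, ← Real.sqrt_eq_rpow]
      exact Real.sqrt_le_sqrt hY
    calc 52 * √(Y : ℝ) ≤ 64 * X ^ (0.5 : ℝ) := by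
          have := Real.sqrt_nonneg (Y : ℝ)
          linarith
      _ = (8 * X ^ (0.25 : ℝ)) ^ 2 := by rw [mul_pow, hpow]; norm_num
      _ ≤ _ := by gcongr

end CubicTrace

namespace CubicTrace

open QuadraticAlgebra UniqueFactorizationMonoid
open ArithmeticFunction (vonMangoldt)

/-- The part of an arithmetic function supported on `n ≤ V`. -/
noncomputable def low (V : ℝ) (f : ArithmeticFunction ℝ) : ArithmeticFunction ℝ :=
  ⟨fun n => if (n : ℝ) ≤ V then f n else 0, by simp⟩

theorem low_apply (V : ℝ) (f : ArithmeticFunction ℝ) (n : ℕ) :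
    low V f n = if (n : ℝ) ≤ V then f n else 0 := rfl

/-- The Möbius function with real values. -/
noncomputable def muR : ArithmeticFunction ℝ := (ArithmeticFunction.moebius : ArithmeticFunction ℤ)

/-- The constant function `1` on positive integers. -/
noncomputable def zetaR : ArithmeticFunction ℝ := (ArithmeticFunction.zeta : ArithmeticFunction ℕ)

theorem abs_muR_le (n : ℕ) : |muR n| ≤ 1 := by
  rw [muR, ArithmeticFunction.intCoe_apply]
  exact_mod_cast ArithmeticFunction.abs_moebius_le_one

theorem zetaR_apply (n : ℕ) : zetaR n = if n = 0 then 0 else 1 := by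
  rw [zetaR, ArithmeticFunction.natCoe_apply, ArithmeticFunction.zeta_apply]
  split_ifs <;> simp

theorem vaughan (U V : ℝ) :
    vonMangoldt = low V vonMangoldt + low U muR * ArithmeticFunction.log -
      low V vonMangoldt * low U muR * zetaR +
      (vonMangoldt - low V vonMangoldt) * (zetaR * (muR - low U muR)) := by
  have h1 : vonMangoldt * zetaR = ArithmeticFunction.log :=
    ArithmeticFunction.vonMangoldt_mul_zeta
  have h2 : muR * zetaR = 1 := ArithmeticFunction.coe_moebius_mul_coe_zeta
  linear_combination (low U muR) * h1 - (vonMangoldt - low V vonMangoldt) * h2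

/-- The sum of `f n * FC n` over `1 ≤ n ≤ x`. -/
noncomputable def SF (x : ℕ) (f : ℕ → ℝ) : ℂ := ∑ n ∈ Finset.Icc 1 x, (f n : ℂ) * FC n

theorem mul_apply_eq_sum_divisors (f g : ArithmeticFunction ℝ) (n : ℕ) :
    (f * g) n = ∑ d ∈ n.divisors, f d * g (n / d) := by
  rw [ArithmeticFunction.mul_apply, Nat.sum_divisorsAntidiagonal fun a b => f a * g b]

theorem SF_mul (x : ℕ) (f g : ArithmeticFunction ℝ) :
    SF x (f * g : ArithmeticFunction ℝ) = ∑ d ∈ Finset.Icc 1 x,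
      (f d : ℂ) * ∑ n ∈ (Finset.Icc 1 x).filter (d ∣ ·), (g (n / d) : ℂ) * FC n := by
  simp only [SF, mul_apply_eq_sum_divisors, Complex.ofReal_sum, Finset.sum_mul, Finset.mul_sum]
  rw [Finset.sum_comm' (t' := Finset.Icc 1 x) (s' := fun d => (Finset.Icc 1 x).filter (d ∣ ·))]
  · simp [mul_assoc]
  · intro n d
    simp only [Finset.mem_Icc, Nat.mem_divisors, Finset.mem_filter]
    constructor
    · rintro ⟨⟨h1, h2⟩, h3, h4⟩
      exact ⟨⟨⟨h1, h2⟩, h3⟩, Nat.pos_of_dvd_of_pos h3 (by omega), (Nat.le_of_dvd (by omega) h3).trans h2⟩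
    · rintro ⟨⟨⟨h1, h2⟩, h3⟩, h4, h5⟩
      exact ⟨⟨h1, h2⟩, h3, by omega⟩

theorem abel_eq (x : ℕ) (g : ℕ → ℝ) (c : ℕ → ℂ) :
    ∑ n ∈ Finset.Icc 1 x, (g n : ℂ) * c n = g x * ∑ n ∈ Finset.Icc 1 x, c n -
      ∑ m ∈ Finset.range x, ((g (m + 1) - g m : ℝ) : ℂ) * ∑ n ∈ Finset.Icc 1 m, c n := by
  induction x with
  | zero => simp
  | succ k ih =>
    rw [Finset.sum_Icc_succ_top (by omega), ih, Finset.sum_range_succ,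
      Finset.sum_Icc_succ_top (by omega)]
    push_cast
    ring

theorem abel_le (x : ℕ) (g : ℕ → ℝ) (c : ℕ → ℂ) (hg : Monotone g) (hg0 : 0 ≤ g 0) (B : ℝ)
    (hB : ∀ y ≤ x, ‖∑ n ∈ Finset.Icc 1 y, c n‖ ≤ B) :
    ‖∑ n ∈ Finset.Icc 1 x, (g n : ℂ) * c n‖ ≤ 2 * g x * B := by
  have hgn : ∀ n, 0 ≤ g n := fun n => hg0.trans (hg (Nat.zero_le n))
  have hB0 : 0 ≤ B := (norm_nonneg _).trans (hB x le_rfl)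
  rw [abel_eq]
  refine (norm_sub_le _ _).trans ?_
  have h1 : ‖(g x : ℂ) * ∑ n ∈ Finset.Icc 1 x, c n‖ ≤ g x * B := by
    rw [norm_mul, Complex.norm_real, Real.norm_of_nonneg (hgn x)]
    exact mul_le_mul_of_nonneg_left (hB x le_rfl) (hgn x)
  have h2 : ‖∑ m ∈ Finset.range x, ((g (m + 1) - g m : ℝ) : ℂ) * ∑ n ∈ Finset.Icc 1 m, c n‖ ≤
      ∑ m ∈ Finset.range x, (g (m + 1) - g m) * B := by
    refine (norm_sum_le _ _).trans (Finset.sum_le_sum fun m hm => ?_)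
    have h3 : 0 ≤ g (m + 1) - g m := sub_nonneg.2 (hg (Nat.le_succ m))
    rw [norm_mul, Complex.norm_real, Real.norm_of_nonneg h3]
    exact mul_le_mul_of_nonneg_left (hB m (Finset.mem_range.1 hm).le) h3
  rw [← Finset.sum_mul, Finset.sum_range_sub] at h2
  nlinarith [mul_nonneg hg0 hB0]

theorem SF_typeI : ∃ C, 0 < C ∧ ∀ (x : ℕ) (f g : ArithmeticFunction ℝ) (D F : ℝ), 1 ≤ x →
    0 ≤ D → D ≤ (x : ℝ) ^ (0.02 : ℝ) → 0 ≤ F →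
    (∀ d, 0 < d → d ≤ x → |f d| ≤ F) → (∀ d : ℕ, D < d → f d = 0) → Monotone (g : ℕ → ℝ) →
    ‖SF x (f * g : ArithmeticFunction ℝ)‖ ≤ C * (D * F * g x * (x : ℝ) ^ (0.97 : ℝ)) := by
  obtain ⟨C, hC, hI⟩ := typeI
  refine ⟨2 * C, by positivity, fun x f g D F hx hD0 hD hF hf hfD hg => ?_⟩
  have hx1 : (1 : ℝ) ≤ x := by exact_mod_cast hx
  have hgx : 0 ≤ g x := by
    have := hg (Nat.zero_le x)
    simpa using this
  rw [SF_mul]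
  have key : ∀ d ∈ Finset.Icc 1 x, ‖(f d : ℂ) * ∑ n ∈ (Finset.Icc 1 x).filter (d ∣ ·),
      (g (n / d) : ℂ) * FC n‖ ≤
      if d ∈ Finset.Icc 1 ⌊D⌋₊ then F * (2 * g x * (C * (x : ℝ) ^ (0.97 : ℝ))) else 0 := by
    intro d hd
    obtain ⟨hd1, hdx⟩ := Finset.mem_Icc.1 hd
    split_ifs with h
    · have hdD : (d : ℝ) ≤ D := (Nat.le_floor_iff hD0).1 (Finset.mem_Icc.1 h).2
      rw [norm_mul, Complex.norm_real, Real.norm_eq_abs]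
      refine mul_le_mul (hf d hd1 hdx) ?_ (norm_nonneg _) hF
      rw [Finset.sum_filter]
      have e : ∀ n, (if d ∣ n then (g (n / d) : ℂ) * FC n else 0) =
          (g (n / d) : ℂ) * (if d ∣ n then FC n else 0) := by
        intro n
        split_ifs <;> simp
      simp only [e]
      refine (abel_le x (fun n => g (n / d)) _ (fun a b hab => hg (Nat.div_le_div_right hab))
        (by simp) (C * (x : ℝ) ^ (0.97 : ℝ)) fun y hy => ?_).trans ?_
      · rw [← Finset.sum_filter]
        exact hI x d y hx1 hd1 (hdD.trans hD) (by exact_mod_cast hy)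
      · have := hg (Nat.div_le_self x d)
        gcongr
    · have : D < d := by
        by_contra! hh
        exact h (Finset.mem_Icc.2 ⟨hd1, Nat.le_floor hh⟩)
      simp [hfD d this]
  refine (norm_sum_le _ _).trans ((Finset.sum_le_sum key).trans ?_)
  rw [← Finset.sum_filter]
  refine (Finset.sum_le_sum_of_subset_of_nonneg (t := Finset.Icc 1 ⌊D⌋₊) (fun d hd => ?_) ?_).trans ?_
  · exact (Finset.mem_filter.1 hd).2
  · intros
    positivity
  · rw [Finset.sum_const, Nat.card_Icc, nsmul_eq_mul]
    have : ((⌊D⌋₊ + 1 - 1 : ℕ) : ℝ) ≤ D := by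
      rw [Nat.add_sub_cancel]
      exact Nat.floor_le hD0
    calc _ ≤ D * (F * (2 * g x * (C * (x : ℝ) ^ (0.97 : ℝ)))) := by gcongr
      _ = _ := by ring

theorem SF_add (x : ℕ) (f g : ArithmeticFunction ℝ) :
    SF x (f + g : ArithmeticFunction ℝ) = SF x f + SF x g := by
  simp [SF, add_mul, Finset.sum_add_distrib]

theorem SF_sub (x : ℕ) (f g : ArithmeticFunction ℝ) :
    SF x (f - g : ArithmeticFunction ℝ) = SF x f - SF x g := by
  rw [sub_eq_add_neg, SF_add, sub_eq_add_neg]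
  congr 1
  rw [SF, SF, ← Finset.sum_neg_distrib]
  refine Finset.sum_congr rfl fun n _ => ?_
  rw [ArithmeticFunction.neg_apply]
  push_cast
  ring

theorem log_le_rpow {ε : ℝ} (hε : 0 < ε) {x : ℝ} (hx : 0 ≤ x) : Real.log x ≤ 1 / ε * x ^ ε := by
  have := Real.log_le_rpow_div hx hε
  rw [one_div_mul_eq_div]
  exact this

theorem SF_low : ∃ C, 0 < C ∧ ∀ (x : ℕ) (V : ℝ), 1 ≤ x → 0 ≤ V →
    ‖SF x (low V vonMangoldt)‖ ≤ C * (V * (x : ℝ) ^ (0.5 : ℝ)) := by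
  obtain ⟨C, hC, h⟩ := card_RN_le (ε := 0.25) (by norm_num)
  refine ⟨4 * C, by positivity, fun x V hx hV => ?_⟩
  have hx1 : (1 : ℝ) ≤ x := by exact_mod_cast hx
  have key : ∀ n ∈ Finset.Icc 1 x, ‖(low V vonMangoldt n : ℂ) * FC n‖ ≤
      if n ∈ Finset.Icc 1 ⌊V⌋₊ then 4 * C * (x : ℝ) ^ (0.5 : ℝ) else 0 := by
    intro n hn
    obtain ⟨hn1, hnx⟩ := Finset.mem_Icc.1 hn
    have hnx' : (n : ℝ) ≤ x := by exact_mod_cast hnx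
    rw [low_apply]
    split_ifs with h1 h2 h2
    · rw [norm_mul, Complex.norm_real, Real.norm_of_nonneg ArithmeticFunction.vonMangoldt_nonneg]
      calc _ ≤ (1 / 0.25 * (x : ℝ) ^ (0.25 : ℝ)) * (C * (x : ℝ) ^ (0.25 : ℝ)) := by
            refine mul_le_mul ?_ ?_ (norm_nonneg _) (by positivity)
            · refine ArithmeticFunction.vonMangoldt_le_log.trans
                ((log_le_rpow (ε := 0.25) (by norm_num) (by positivity)).trans ?_)
              gcongr
            · refine (norm_FC_le n).trans ((h n).trans ?_)
              gcongr
        _ = 4 * C * ((x : ℝ) ^ (0.25 : ℝ) * (x : ℝ) ^ (0.25 : ℝ)) := by ring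
        _ = _ := by
          rw [← Real.rpow_add (by positivity)]
          norm_num
    · exact absurd (Finset.mem_Icc.2 ⟨hn1, Nat.le_floor h1⟩) h2
    · simp only [Complex.ofReal_zero, zero_mul, _root_.norm_zero]
      positivity
    · simp
  refine (norm_sum_le _ _).trans ((Finset.sum_le_sum key).trans ?_)
  rw [← Finset.sum_filter]
  refine (Finset.sum_le_sum_of_subset_of_nonneg (t := Finset.Icc 1 ⌊V⌋₊) (fun d hd => ?_) ?_).trans ?_
  · exact (Finset.mem_filter.1 hd).2
  · intros
    positivity
  · rw [Finset.sum_const, Nat.card_Icc, nsmul_eq_mul]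
    have : ((⌊V⌋₊ + 1 - 1 : ℕ) : ℝ) ≤ V := by
      rw [Nat.add_sub_cancel]
      exact Nat.floor_le hV
    calc _ ≤ V * (4 * C * (x : ℝ) ^ (0.5 : ℝ)) := by gcongr
      _ = _ := by ring

theorem abs_low_le (U : ℝ) (f : ArithmeticFunction ℝ) (n : ℕ) : |low U f n| ≤ |f n| := by
  rw [low_apply]
  split_ifs <;> simp

theorem monotone_log : Monotone (ArithmeticFunction.log : ℕ → ℝ) := by
  intro a b hab
  rw [ArithmeticFunction.log_apply, ArithmeticFunction.log_apply]
  rcases Nat.eq_zero_or_pos a with rfl | ha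
  · simpa using Real.log_natCast_nonneg b
  · exact Real.log_le_log (by exact_mod_cast ha) (by exact_mod_cast hab)

theorem monotone_zetaR : Monotone (zetaR : ℕ → ℝ) := by
  intro a b hab
  rw [zetaR_apply, zetaR_apply]
  split_ifs <;> first | omega | norm_num

theorem abs_low_mul_low_le (U V : ℝ) (n : ℕ) :
    |(low V vonMangoldt * low U muR) n| ≤ Real.log n := by
  rw [mul_apply_eq_sum_divisors, ← ArithmeticFunction.vonMangoldt_sum]
  refine (Finset.abs_sum_le_sum_abs _ _).trans (Finset.sum_le_sum fun d _ => ?_)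
  rw [abs_mul]
  have h1 := abs_low_le V vonMangoldt d
  rw [abs_of_nonneg (ArithmeticFunction.vonMangoldt_nonneg (n := d))] at h1
  have h2 := (abs_low_le U muR (n / d)).trans (abs_muR_le _)
  nlinarith [abs_nonneg (low V vonMangoldt d), abs_nonneg (low U muR (n / d))]

theorem low_mul_low_eq_zero {U V : ℝ} (hV : 0 ≤ V) {n : ℕ} (hn : V * U < n) :
    (low V vonMangoldt * low U muR) n = 0 := by
  rw [mul_apply_eq_sum_divisors]
  refine Finset.sum_eq_zero fun d hd => ?_
  rw [low_apply, low_apply]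
  split_ifs with h1 h2
  · exfalso
    have h3 : ((d * (n / d) : ℕ) : ℝ) = n := by
      exact_mod_cast Nat.mul_div_cancel' (Nat.dvd_of_mem_divisors hd)
    rw [Nat.cast_mul] at h3
    have : (d : ℝ) * ((n / d : ℕ) : ℝ) ≤ V * U := by gcongr
    linarith
  all_goals simp

/-- The coefficients of the bilinear term in Vaughan's identity. -/
noncomputable def highM (U : ℝ) : ArithmeticFunction ℝ := zetaR * (muR - low U muR)

theorem SF_vonMangoldt_sub_le : ∃ C, 0 < C ∧ ∀ x : ℕ, 1 ≤ x →
    ‖SF x vonMangoldt - SF x ((vonMangoldt - low ((x : ℝ) ^ (0.005 : ℝ)) vonMangoldt) *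
      highM ((x : ℝ) ^ (0.015 : ℝ)) : ArithmeticFunction ℝ)‖ ≤ C * (x : ℝ) ^ (0.995 : ℝ) := by
  obtain ⟨C₁, hC₁, h₁⟩ := SF_typeI
  obtain ⟨C₂, hC₂, h₂⟩ := SF_low
  refine ⟨C₂ + C₁ * (1 / 0.005) + C₁ * (1 / 0.005), by positivity, fun x hx => ?_⟩
  have hx1 : (1 : ℝ) ≤ x := by exact_mod_cast hx
  have hx0 : (0 : ℝ) < x := by positivity
  obtain ⟨X, hX⟩ : ∃ X : ℝ, X = x := ⟨x, rfl⟩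
  specialize h₁ x
  specialize h₂ x
  simp only [← hX] at hx1 hx0 h₁ h₂ ⊢
  set U := X ^ (0.015 : ℝ) with hU
  set V := X ^ (0.005 : ℝ) with hV
  have hU0 : 0 ≤ U := by positivity
  have hV0 : 0 ≤ V := by positivity
  have hlog : Real.log X ≤ 1 / 0.005 * X ^ (0.005 : ℝ) := log_le_rpow (by norm_num) hx0.le
  have hle : ∀ a b : ℝ, a ≤ b → X ^ a ≤ X ^ b := fun a b h => Real.rpow_le_rpow_of_exponent_le hx1 h
  have hadd : ∀ a b : ℝ, X ^ a * X ^ b = X ^ (a + b) := fun a b => (Real.rpow_add hx0 a b).symm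
  have e : SF x vonMangoldt = SF x (low V vonMangoldt) +
      SF x (low U muR * ArithmeticFunction.log : ArithmeticFunction ℝ) -
      SF x (low V vonMangoldt * low U muR * zetaR : ArithmeticFunction ℝ) +
      SF x ((vonMangoldt - low V vonMangoldt) * highM U : ArithmeticFunction ℝ) := by
    conv_lhs => rw [vaughan U V]
    rw [SF_add, SF_sub, SF_add]
    rfl
  rw [e, add_sub_cancel_right]
  have b0 := h₂ V hx hV0
  have b1 := h₁ (low U muR) ArithmeticFunction.log U 1 hx hU0 (hle 0.015 0.02 (by norm_num)) zero_le_one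
    (fun d _ _ => (abs_low_le U muR d).trans (abs_muR_le d))
    (fun d hd => by rw [low_apply, if_neg (not_le.2 hd)]) monotone_log
  have b2 := h₁ (low V vonMangoldt * low U muR) zetaR (V * U) (Real.log X) hx (by positivity)
    (by rw [hU, hV, hadd]; exact hle _ 0.02 (by norm_num)) (Real.log_nonneg hx1)
    (fun d hd hdx => (abs_low_mul_low_le U V d).trans
      (Real.log_le_log (by exact_mod_cast hd) (by rw [hX]; exact_mod_cast hdx)))
    (fun d hd => low_mul_low_eq_zero hV0 hd) monotone_zetaR
  rw [zetaR_apply, if_neg (by omega)] at b2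
  rw [ArithmeticFunction.log_apply, ← hX] at b1
  refine (norm_sub_le _ _).trans ((add_le_add (norm_add_le _ _) le_rfl).trans ?_)
  rw [add_mul, add_mul]
  refine add_le_add (add_le_add (b0.trans ?_) (b1.trans ?_)) (b2.trans ?_)
  · rw [hV, hadd]
    exact mul_le_mul_of_nonneg_left (hle _ _ (by norm_num)) hC₂.le
  · rw [mul_assoc C₁]
    refine mul_le_mul_of_nonneg_left ?_ hC₁.le
    calc U * 1 * Real.log X * X ^ (0.97 : ℝ) ≤
          U * 1 * (1 / 0.005 * X ^ (0.005 : ℝ)) * X ^ (0.97 : ℝ) := by gcongr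
      _ = 1 / 0.005 * (X ^ (0.015 : ℝ) * X ^ (0.005 : ℝ) * X ^ (0.97 : ℝ)) := by rw [hU]; ring
      _ ≤ _ := by
        rw [hadd, hadd]
        exact mul_le_mul_of_nonneg_left (hle _ _ (by norm_num)) (by norm_num)
  · rw [mul_assoc C₁]
    refine mul_le_mul_of_nonneg_left ?_ hC₁.le
    calc V * U * Real.log X * 1 * X ^ (0.97 : ℝ) ≤
          V * U * (1 / 0.005 * X ^ (0.005 : ℝ)) * 1 * X ^ (0.97 : ℝ) := by gcongr
      _ = 1 / 0.005 * (X ^ (0.005 : ℝ) * X ^ (0.015 : ℝ) * X ^ (0.005 : ℝ) * X ^ (0.97 : ℝ)) := by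
        rw [hU, hV]; ring
      _ ≤ _ := by
        rw [hadd, hadd, hadd]
        exact mul_le_mul_of_nonneg_left (hle _ _ (by norm_num)) (by norm_num)

theorem highM_apply (U : ℝ) (m : ℕ) :
    highM U m = ∑ d ∈ m.divisors, zetaR d * (muR - low U muR) (m / d) :=
  mul_apply_eq_sum_divisors _ _ _

theorem sub_low_apply (U : ℝ) (f : ArithmeticFunction ℝ) (n : ℕ) :
    (f - low U f) n = if (n : ℝ) ≤ U then 0 else f n := by
  rw [sub_eq_add_neg, ArithmeticFunction.add_apply, ArithmeticFunction.neg_apply, low_apply]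
  split_ifs <;> simp

theorem highM_eq_zero {U : ℝ} {m : ℕ} (hm : (m : ℝ) ≤ U) : highM U m = 0 := by
  rw [highM_apply]
  refine Finset.sum_eq_zero fun d _ => ?_
  rw [sub_low_apply, if_pos, mul_zero]
  exact le_trans (by exact_mod_cast Nat.div_le_self m d) hm

theorem abs_highM_le (U : ℝ) (m : ℕ) : |highM U m| ≤ m.divisors.card := by
  rw [highM_apply]
  refine (Finset.abs_sum_le_sum_abs _ _).trans ?_
  rw [Finset.card_eq_sum_ones, Nat.cast_sum]
  refine Finset.sum_le_sum fun d _ => ?_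
  rw [abs_mul, zetaR_apply, sub_low_apply]
  have := abs_muR_le (m / d)
  split_ifs <;> simp [this]

theorem exists_eps_bound {ε : ℝ} (hε : 0 < ε) : ∃ C : ℝ, 1 ≤ C ∧ ∀ (n : ℕ) (x : ℝ), (n : ℝ) ≤ x →
    (n.divisors.card : ℝ) ≤ C * x ^ ε ∧ ((RN n).card : ℝ) ≤ C * x ^ ε ∧
      Real.log n ≤ C * x ^ ε := by
  obtain ⟨C₁, hC₁, h₁⟩ := card_divisors_le hε
  obtain ⟨C₂, hC₂, h₂⟩ := card_RN_le hε
  refine ⟨1 + C₁ + C₂ + 1 / ε, ?_, fun n x hx => ?_⟩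
  · have : 0 < 1 / ε := by positivity
    linarith
  have hn : (n : ℝ) ^ ε ≤ x ^ ε := Real.rpow_le_rpow (by positivity) hx hε.le
  have hx0 : 0 ≤ x ^ ε := le_trans (by positivity) hn
  have h3 : 0 < 1 / ε := by positivity
  refine ⟨(h₁ n).trans ?_, (h₂ n).trans ?_,
    (log_le_rpow hε (Nat.cast_nonneg n)).trans ?_⟩
  all_goals
    refine mul_le_mul ?_ hn (by positivity) (by positivity)
    linarith

/-- The summand of the bilinear form attached to a prime `q` and an integer `m`. -/
noncomputable def bilT (U : ℝ) (q m : ℕ) : ℂ :=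
  ((Real.log q * highM U m : ℝ) : ℂ) *
    ∑ ρ ∈ RN q, ∑ γ ∈ RN m, fC ρ * fC γ * twist ρ γ

/-- The primes above `V` dividing `n`. -/
noncomputable def primesAbove (V : ℝ) (n : ℕ) : Finset ℕ :=
  n.divisors.filter fun q => q.Prime ∧ V < q

theorem FC_mul_eq_twist {q m : ℕ} (hq : q.Prime) (hqm : ¬ q ∣ m) :
    FC (q * m) = ∑ ρ ∈ RN q, ∑ γ ∈ RN m, fC ρ * fC γ * twist ρ γ := by
  rw [FC_mul hq hqm]
  refine Finset.sum_congr rfl fun ρ hρ => Finset.sum_congr rfl fun γ hγ => ?_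
  exact fC_mul (mem_RN.1 hρ).1.1 (mem_RN.1 hγ).1.1

theorem norm_bilT_le {U y : ℝ} {q m : ℕ}
    (h₁ : Real.log q ≤ y) (h₂ : (m.divisors.card : ℝ) ≤ y)
    (h₃ : ((RN q).card : ℝ) ≤ y) (h₄ : ((RN m).card : ℝ) ≤ y) : ‖bilT U q m‖ ≤ y ^ 4 := by
  have hy : 0 ≤ y := le_trans (by positivity) h₂
  rw [bilT, norm_mul, Complex.norm_real, Real.norm_eq_abs, abs_mul,
    abs_of_nonneg (Real.log_natCast_nonneg q)]
  have h5 : ‖∑ ρ ∈ RN q, ∑ γ ∈ RN m, fC ρ * fC γ * twist ρ γ‖ ≤ y * y := by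
    calc _ ≤ ∑ ρ ∈ RN q, ∑ γ ∈ RN m, (1 : ℝ) := by
          refine (norm_sum_le _ _).trans (Finset.sum_le_sum fun ρ _ =>
            (norm_sum_le _ _).trans (Finset.sum_le_sum fun γ _ => ?_))
          rw [norm_mul, norm_mul]
          exact mul_le_one₀ (mul_le_one₀ (norm_fC_le _) (norm_nonneg _) (norm_fC_le _))
            (norm_nonneg _) (norm_twist_le _ _)
      _ = (RN q).card * (RN m).card := by simp
      _ ≤ y * y := by gcongr
  calc _ ≤ y * y * (y * y) := by
        gcongr
        exact (abs_highM_le U m).trans h₂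
    _ = _ := by ring

open Classical in
theorem card_sq_dvd_le {S : ℝ} (hS : 1 ≤ S) (x : ℕ) :
    (((Finset.Icc 1 x).filter fun n => ∃ s : ℕ, S ≤ s ∧ s ^ 2 ∣ n).card : ℝ) ≤ 2 * x / S := by
  have hS0 : 0 < ⌈S⌉₊ := Nat.ceil_pos.2 (by linarith)
  have hsub : ((Finset.Icc 1 x).filter fun n => ∃ s : ℕ, S ≤ s ∧ s ^ 2 ∣ n) ⊆
      (Finset.Ioo (⌈S⌉₊ - 1) (x + 1)).biUnion fun s => (Finset.Ioc 0 x).filter (s ^ 2 ∣ ·) := by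
    intro n hn
    obtain ⟨h1, s, hs, hsn⟩ := Finset.mem_filter.1 hn
    rw [Finset.mem_Icc] at h1
    have h2 : ⌈S⌉₊ ≤ s := Nat.ceil_le.2 hs
    have h3 : s ^ 2 ≤ n := Nat.le_of_dvd (by omega) hsn
    have h4 : s ≤ s ^ 2 := Nat.le_self_pow (by norm_num) s
    simp only [Finset.mem_biUnion, Finset.mem_Ioo, Finset.mem_filter, Finset.mem_Ioc]
    exact ⟨s, by omega, by omega, hsn⟩
  have h1 := (Finset.card_le_card hsub).trans Finset.card_biUnion_le
  calc _ ≤ ((∑ s ∈ Finset.Ioo (⌈S⌉₊ - 1) (x + 1),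
          ((Finset.Ioc 0 x).filter (s ^ 2 ∣ ·)).card : ℕ) : ℝ) := by exact_mod_cast h1
    _ ≤ ∑ s ∈ Finset.Ioo (⌈S⌉₊ - 1) (x + 1), (x : ℝ) * ((s : ℝ) ^ 2)⁻¹ := by
        rw [Nat.cast_sum]
        refine Finset.sum_le_sum fun s _ => ?_
        rw [Nat.Ioc_filter_dvd_card_eq_div, ← div_eq_mul_inv]
        exact_mod_cast Nat.cast_div_le (α := ℝ) (m := x) (n := s ^ 2)
    _ ≤ x * (2 / (((⌈S⌉₊ - 1 : ℕ) : ℝ) + 1)) := by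
        rw [← Finset.mul_sum]
        exact mul_le_mul_of_nonneg_left (sum_Ioo_inv_sq_le _ _) (Nat.cast_nonneg x)
    _ ≤ x * (2 / S) := by
        have : S ≤ ((⌈S⌉₊ - 1 : ℕ) : ℝ) + 1 := by
          rw [← Nat.cast_add_one, Nat.sub_add_cancel hS0]
          exact Nat.le_ceil S
        gcongr
    _ = _ := by ring

theorem exists_sq_dvd_of_isPrimePow {q : ℕ} (hq : IsPrimePow q) (hq' : ¬ q.Prime) :
    ∃ s : ℕ, s ^ 2 ∣ q ∧ q ≤ s ^ 3 := by
  obtain ⟨p, k, hp, hk, rfl⟩ := (isPrimePow_nat_iff _).1 hq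
  have hk2 : 2 ≤ k := by
    by_contra h
    obtain rfl : k = 1 := by omega
    exact hq' (by simpa using hp)
  refine ⟨p ^ (k / 2), ?_, ?_⟩
  · rw [← pow_mul]
    exact pow_dvd_pow _ (by omega)
  · rw [← pow_mul]
    exact Nat.pow_le_pow_right hp.pos (by omega)

theorem term_eq_bilT {U V S : ℝ} (hSV : S ^ 3 ≤ V) (hV : S ≤ V) {n : ℕ}
    (hn : ¬ ∃ s : ℕ, S ≤ s ∧ s ^ 2 ∣ n) :
    (((vonMangoldt - low V vonMangoldt) * highM U : ArithmeticFunction ℝ) n : ℂ) * FC n =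
      ∑ q ∈ primesAbove V n, bilT U q (n / q) := by
  rw [mul_apply_eq_sum_divisors, Complex.ofReal_sum, Finset.sum_mul, primesAbove,
    Finset.sum_filter]
  refine Finset.sum_congr rfl fun q hq => ?_
  have hqn := Nat.dvd_of_mem_divisors hq
  rw [sub_low_apply]
  by_cases hqV : (q : ℝ) ≤ V
  · rw [if_pos hqV, if_neg (fun h => not_lt.2 hqV h.2)]
    simp
  rw [if_neg hqV]
  push Not at hqV
  by_cases hp : q.Prime
  · rw [if_pos ⟨hp, hqV⟩, ArithmeticFunction.vonMangoldt_apply_prime hp, bilT,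
      ← FC_mul_eq_twist hp, Nat.mul_div_cancel' hqn]
    intro h
    refine hn ⟨q, hV.trans hqV.le, ?_⟩
    rw [sq]
    have := mul_dvd_mul_left q h
    rwa [Nat.mul_div_cancel' hqn] at this
  · rw [if_neg fun h => hp h.1]
    by_cases hpp : IsPrimePow q
    · exfalso
      obtain ⟨s, hs, hs3⟩ := exists_sq_dvd_of_isPrimePow hpp hp
      refine hn ⟨s, ?_, hs.trans hqn⟩
      have h1 : S ^ 3 ≤ (s : ℝ) ^ 3 := by
        calc S ^ 3 ≤ V := hSV
          _ ≤ q := hqV.le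
          _ ≤ _ := by exact_mod_cast hs3
      exact le_of_pow_le_pow_left₀ (by norm_num) (by positivity) h1
    · rw [ArithmeticFunction.vonMangoldt_eq_zero_iff.2 hpp]
      simp

theorem SF_sub_bilT_le : ∃ C, 0 < C ∧ ∀ (x : ℕ) (U : ℝ), 1 ≤ x →
    ‖SF x ((vonMangoldt - low ((x : ℝ) ^ (0.005 : ℝ)) vonMangoldt) *
      highM U : ArithmeticFunction ℝ) -
      ∑ n ∈ Finset.Icc 1 x, ∑ q ∈ primesAbove ((x : ℝ) ^ (0.005 : ℝ)) n, bilT U q (n / q)‖ ≤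
      C * (x : ℝ) ^ (0.9985 : ℝ) := by
  classical
  obtain ⟨C, hC, hb⟩ := exists_eps_bound (ε := 0.00001) (by norm_num)
  refine ⟨4 * C ^ 5, by positivity, fun x U hx => ?_⟩
  have hx1 : (1 : ℝ) ≤ x := by exact_mod_cast hx
  have hx0 : (0 : ℝ) < x := by positivity
  obtain ⟨X, hX⟩ : ∃ X : ℝ, X = x := ⟨x, rfl⟩
  simp only [← hX] at hx1 hx0 ⊢
  set V := X ^ (0.005 : ℝ) with hV
  set S := X ^ (0.0016 : ℝ) with hS
  have hS1 : 1 ≤ S := Real.one_le_rpow hx1 (by norm_num)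
  have hV0 : 0 ≤ V := by positivity
  have hle : ∀ a b : ℝ, a ≤ b → X ^ a ≤ X ^ b := fun a b h => Real.rpow_le_rpow_of_exponent_le hx1 h
  have hSV : S ^ 3 ≤ V := by
    rw [hS, ← Real.rpow_natCast, ← Real.rpow_mul hx0.le]
    exact hle _ _ (by norm_num)
  set y := C * X ^ (0.00001 : ℝ) with hy
  have hy1 : 1 ≤ y := one_le_mul_of_one_le_of_one_le hC (Real.one_le_rpow hx1 (by norm_num))
  have hbd : ∀ n : ℕ, n ≤ x → (n.divisors.card : ℝ) ≤ y ∧ ((RN n).card : ℝ) ≤ y ∧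
      Real.log n ≤ y := fun n hn => hb n X (by rw [hX]; exact_mod_cast hn)
  rw [SF, ← Finset.sum_sub_distrib]
  have key : ∀ n ∈ Finset.Icc 1 x,
      ‖(((vonMangoldt - low V vonMangoldt) * highM U : ArithmeticFunction ℝ) n : ℂ) * FC n -
        ∑ q ∈ primesAbove V n, bilT U q (n / q)‖ ≤
      if ∃ s : ℕ, S ≤ s ∧ s ^ 2 ∣ n then 2 * y ^ 5 else 0 := by
    intro n hn
    obtain ⟨hn1, hnx⟩ := Finset.mem_Icc.1 hn
    split_ifs with h
    · obtain ⟨hτ, hR, hl⟩ := hbd n hnx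
      have e1 : ‖(((vonMangoldt - low V vonMangoldt) * highM U : ArithmeticFunction ℝ) n : ℂ) *
          FC n‖ ≤ y ^ 4 := by
        rw [norm_mul, Complex.norm_real, Real.norm_eq_abs, mul_apply_eq_sum_divisors]
        have e2 : |∑ d ∈ n.divisors, (vonMangoldt - low V vonMangoldt) d * highM U (n / d)| ≤
            ∑ d ∈ n.divisors, y * y := by
          refine (Finset.abs_sum_le_sum_abs _ _).trans (Finset.sum_le_sum fun d hd => ?_)
          have hd' := Nat.dvd_of_mem_divisors hd
          have hdn : d ≤ n := Nat.le_of_dvd (by omega) hd'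
          rw [abs_mul]
          refine mul_le_mul ?_ ((abs_highM_le _ _).trans
            (hbd _ ((Nat.div_le_self n d).trans hnx)).1) (abs_nonneg _) (by positivity)
          rw [sub_low_apply]
          split_ifs
          · rw [abs_zero]
            positivity
          · rw [abs_of_nonneg ArithmeticFunction.vonMangoldt_nonneg]
            exact ArithmeticFunction.vonMangoldt_le_log.trans (hbd d (hdn.trans hnx)).2.2
        rw [Finset.sum_const, nsmul_eq_mul] at e2
        calc _ ≤ (n.divisors.card * (y * y)) * ((RN n).card : ℝ) :=
              mul_le_mul e2 (norm_FC_le n) (norm_nonneg _) (by positivity)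
          _ ≤ (y * (y * y)) * y := by gcongr
          _ = _ := by ring
      have e3 : ‖∑ q ∈ primesAbove V n, bilT U q (n / q)‖ ≤ y ^ 5 := by
        have e4 : ∀ q ∈ primesAbove V n, ‖bilT U q (n / q)‖ ≤ y ^ 4 := by
          intro q hq
          have hq' := Finset.mem_filter.1 hq
          have hqx : q ≤ x := (Nat.le_of_dvd (by omega) (Nat.dvd_of_mem_divisors hq'.1)).trans hnx
          have hmx : n / q ≤ x := (Nat.div_le_self n q).trans hnx
          exact norm_bilT_le (hbd q hqx).2.2 (hbd _ hmx).1 (hbd q hqx).2.1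
            (hbd _ hmx).2.1
        refine (norm_sum_le_of_le _ e4).trans ?_
        rw [Finset.sum_const, nsmul_eq_mul]
        have : ((primesAbove V n).card : ℝ) ≤ y :=
          le_trans (by exact_mod_cast Finset.card_le_card (Finset.filter_subset _ _)) hτ
        calc _ ≤ y * y ^ 4 := by gcongr
          _ = _ := by ring
      have e5 : y ^ 4 ≤ y ^ 5 := pow_le_pow_right₀ hy1 (by norm_num)
      refine (norm_sub_le _ _).trans ?_
      linarith
    · rw [term_eq_bilT hSV (hle _ _ (by norm_num)) h, sub_self, _root_.norm_zero]
  refine (norm_sum_le_of_le _ key).trans ?_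
  rw [← Finset.sum_filter, Finset.sum_const, nsmul_eq_mul]
  calc _ ≤ 2 * X / S * (2 * y ^ 5) := by
        rw [hX]
        gcongr
        exact card_sq_dvd_le hS1 x
    _ = 4 * C ^ 5 * (X ^ (1 - 0.0016 : ℝ) * X ^ (0.00005 : ℝ)) := by
        have e1 : X ^ (1 - 0.0016 : ℝ) = X / S := by rw [Real.rpow_sub hx0, Real.rpow_one]
        have e2 : (X ^ (0.00001 : ℝ)) ^ 5 = X ^ (0.00005 : ℝ) := by
          rw [← Real.rpow_natCast, ← Real.rpow_mul hx0.le]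
          norm_num
        rw [e1, ← e2, hy]
        ring
    _ ≤ _ := by
        rw [← Real.rpow_add hx0]
        exact mul_le_mul_of_nonneg_left (hle _ _ (by norm_num)) (by positivity)

theorem bilinear_le_uniform (K : ℕ) {ε : ℝ} (hε : 0 < ε) : ∃ C : ℝ, 1 ≤ C ∧
    ∀ k : ℕ, k ≠ 0 → k ≤ K →
    ∀ M Q : ℝ, 0 ≤ M → 1 ≤ Q → M ^ 12 ≤ Q ^ k → ∀ A B : Finset O, PrimeNorms M A →
    (∀ γ ∈ B, Red γ ∧ (N γ : ℝ) ≤ Q) → ∀ b : O → ℂ, (∀ γ, ‖b γ‖ ≤ 1) →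
    (∑ ρ ∈ A, ‖∑ γ ∈ B, b γ * twist ρ γ‖) ^ k ≤
      C * (Q * Q ^ ε) ^ k * ((A.card : ℝ) ^ (k - 1) * √A.card) := by
  choose C hC h using fun (k : ℕ) (hk : k ≠ 0) => bilinear_le hk hε
  let D : ℕ → ℝ := fun k => if hk : k ≠ 0 then C k hk else 0
  have hD : ∀ k, 0 ≤ D k := by
    intro k
    simp only [D]
    split_ifs with hk
    · exact (hC k hk).le
    · exact le_rfl
  refine ⟨1 + ∑ k ∈ Finset.range (K + 1), D k,
    le_add_of_nonneg_right (Finset.sum_nonneg fun k _ => hD k), ?_⟩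
  intro k hk hkK M Q hM hQ hMQ A B hA hB b hb
  refine (h k hk M Q hM hQ hMQ A B hA hB b hb).trans ?_
  have h1 : C k hk ≤ 1 + ∑ k ∈ Finset.range (K + 1), D k := by
    have := Finset.single_le_sum (fun k _ => hD k) (Finset.mem_range.2 (by omega : k < K + 1))
    simp only [D, dif_pos hk] at this
    linarith
  have : 0 ≤ (Q * Q ^ ε) ^ k := by positivity
  gcongr

theorem exists_exponent {a θ : ℝ} (h1 : 0.005 ≤ a) (h2 : a ≤ 0.985) (h3 : 0 ≤ θ)
    (h4 : θ ≤ 0.001) :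
    ∃ k : ℕ, k ≠ 0 ∧ k ≤ 800 ∧ 12 * (a + θ) ≤ k * (1 - a) ∧ 0.001 * k ≤ a - 0.0006 := by
  have h5 : 0 < 1 - a := by linarith
  have h6 : 0 < 12 * (a + θ) / (1 - a) := by positivity
  refine ⟨⌈12 * (a + θ) / (1 - a)⌉₊, (Nat.ceil_pos.2 h6).ne', ?_, ?_, ?_⟩
  · refine Nat.ceil_le.2 ?_
    rw [div_le_iff₀ h5]
    push_cast
    linarith
  · exact (div_le_iff₀ h5).1 (Nat.le_ceil _)
  · have h7 := (Nat.ceil_lt_add_one h6.le).le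
    have h8 : 12 * (a + θ) / (1 - a) + 1 ≤ (a - 0.0006) / 0.001 := by
      rw [div_add_one h5.ne', div_le_div_iff₀ h5 (by norm_num)]
      nlinarith [mul_nonneg (sub_nonneg.2 h1) (sub_nonneg.2 h2)]
    have h9 := h7.trans h8
    rw [le_div_iff₀ (by norm_num)] at h9
    linarith

theorem RN_disjoint {m n : ℕ} (h : m ≠ n) : Disjoint (RN m) (RN n) := by
  refine Finset.disjoint_left.2 fun α h1 h2 => h ?_
  have := (mem_RN.1 h1).2.symm.trans (mem_RN.1 h2).2
  exact_mod_cast this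

theorem sum_bilT_eq (U : ℝ) (S T : Finset ℕ) :
    ∑ q ∈ S, ∑ m ∈ T, bilT U q m = ∑ ρ ∈ S.biUnion RN, ((Real.log (N ρ) : ℝ) : ℂ) * fC ρ *
      ∑ γ ∈ T.biUnion RN, ((highM U (N γ).toNat : ℝ) : ℂ) * fC γ * twist ρ γ := by
  rw [Finset.sum_biUnion fun a _ b _ h => RN_disjoint h]
  refine Finset.sum_congr rfl fun q _ => ?_
  have h1 : ∀ ρ ∈ RN q, ((Real.log (N ρ) : ℝ) : ℂ) * fC ρ *
      ∑ γ ∈ T.biUnion RN, ((highM U (N γ).toNat : ℝ) : ℂ) * fC γ * twist ρ γ =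
      ∑ m ∈ T, ((Real.log q * highM U m : ℝ) : ℂ) *
        ∑ γ ∈ RN m, fC ρ * fC γ * twist ρ γ := by
    intro ρ hρ
    rw [Finset.sum_biUnion fun a _ b _ h => RN_disjoint h, Finset.mul_sum, (mem_RN.1 hρ).2,
      Int.cast_natCast]
    refine Finset.sum_congr rfl fun m _ => ?_
    rw [Finset.mul_sum, Finset.mul_sum]
    refine Finset.sum_congr rfl fun γ hγ => ?_
    rw [(mem_RN.1 hγ).2, Int.toNat_natCast]
    push_cast
    ring
  rw [Finset.sum_congr rfl h1, Finset.sum_comm]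
  refine Finset.sum_congr rfl fun m _ => ?_
  rw [bilT, Finset.mul_sum]

theorem sum_bilT_block_le : ∃ C : ℝ, 0 < C ∧ ∀ (X M U : ℝ) (S : Finset ℕ), 1 < X →
    1000 * Real.log 2 ≤ Real.log X →
    X ^ (0.005 : ℝ) ≤ M → M ≤ X ^ (0.985 : ℝ) →
    (∀ q ∈ S, q.Prime ∧ (q : ℝ) ≤ 2 * M ∧ (q : ℝ) ≤ X) →
    (S.card : ℝ) ≤ 3 * (X ^ (-0.0006 : ℝ) * M) →
    ‖∑ q ∈ S, ∑ m ∈ Finset.Icc 1 ⌊X / M⌋₊, bilT U q m‖ ≤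
      C * (X ^ (-0.0006 : ℝ) * X ^ (0.99954 : ℝ)) := by
  obtain ⟨C₁, hC₁, h₁⟩ := bilinear_le_uniform 800 (ε := 0.00001) (by norm_num)
  obtain ⟨C₂, hC₂, h₂⟩ := exists_eps_bound (ε := 0.00001) (by norm_num)
  refine ⟨3 * C₁ * C₂ ^ 3, by positivity, fun X M U S hX1 hX hM1 hM2 hS hcard => ?_⟩
  have hX0 : 0 < X := by linarith
  have hle : ∀ a b : ℝ, a ≤ b → X ^ a ≤ X ^ b :=
    fun a b h => Real.rpow_le_rpow_of_exponent_le hX1.le h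
  have hM0 : 0 < M := lt_of_lt_of_le (by positivity) hM1
  have hlogX : 0 < Real.log X := Real.log_pos hX1
  have ha : M = X ^ (Real.log M / Real.log X) := by
    rw [Real.rpow_def_of_pos hX0, mul_div_cancel₀ _ hlogX.ne', Real.exp_log hM0]
  have hθ : (2 : ℝ) = X ^ (Real.log 2 / Real.log X) := by
    rw [Real.rpow_def_of_pos hX0, mul_div_cancel₀ _ hlogX.ne', Real.exp_log two_pos]
  set a := Real.log M / Real.log X with ha_def
  set θ := Real.log 2 / Real.log X with hθ_def
  have ha1 : 0.005 ≤ a := (Real.rpow_le_rpow_left_iff hX1).1 (ha ▸ hM1)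
  have ha2 : a ≤ 0.985 := (Real.rpow_le_rpow_left_iff hX1).1 (ha ▸ hM2)
  have hθ0 : 0 ≤ θ := div_nonneg (Real.log_nonneg (by norm_num)) hlogX.le
  have hθ1 : θ ≤ 0.001 := by
    rw [hθ_def, div_le_iff₀ hlogX]
    linarith
  obtain ⟨k, hk0, hk, hk1, hk2⟩ := exists_exponent ha1 ha2 hθ0 hθ1
  set Q := X / M with hQ
  have hQa : Q = X ^ (1 - a) := by rw [hQ, Real.rpow_sub hX0, Real.rpow_one, ← ha]
  have hQ1 : 1 ≤ Q := by
    rw [hQa]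
    exact Real.one_le_rpow hX1.le (by linarith)
  have hM1' : 1 ≤ M := (Real.one_le_rpow hX1.le (by norm_num)).trans hM1
  have hQX : Q ≤ X := div_le_self hX0.le hM1'
  have hMQ : (2 * M) ^ 12 ≤ Q ^ k := by
    rw [ha, hQa, ← Real.rpow_natCast (X ^ (1 - a)), ← Real.rpow_mul hX0.le]
    nth_rewrite 1 [hθ]
    rw [← Real.rpow_add hX0, ← Real.rpow_natCast, ← Real.rpow_mul hX0.le]
    refine hle _ _ ?_
    push_cast
    linarith
  set y := C₂ * X ^ (0.00001 : ℝ) with hy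
  have hy1 : 1 ≤ y := one_le_mul_of_one_le_of_one_le hC₂ (Real.one_le_rpow hX1.le (by norm_num))
  have hbd : ∀ n : ℕ, (n : ℝ) ≤ X → (n.divisors.card : ℝ) ≤ y ∧ ((RN n).card : ℝ) ≤ y ∧
      Real.log n ≤ y := fun n hn => h₂ n X hn
  set A := S.biUnion RN with hA
  set B := (Finset.Icc 1 ⌊Q⌋₊).biUnion RN with hB
  have hAp : PrimeNorms (2 * M) A := by
    intro ρ hρ
    obtain ⟨q, hq, hρq⟩ := Finset.mem_biUnion.1 hρ
    exact ⟨(mem_RN.1 hρq).1, q, (hS q hq).1, (mem_RN.1 hρq).2, (hS q hq).2.1⟩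
  have hBQ : ∀ γ ∈ B, Red γ ∧ (N γ : ℝ) ≤ Q := by
    intro γ hγ
    obtain ⟨m, hm, hγm⟩ := Finset.mem_biUnion.1 hγ
    refine ⟨(mem_RN.1 hγm).1, ?_⟩
    rw [(mem_RN.1 hγm).2, Int.cast_natCast]
    exact (Nat.le_floor_iff (by positivity)).1 (Finset.mem_Icc.1 hm).2
  classical
  let b : O → ℂ := fun γ => if γ ∈ B then
    ((highM U (N γ).toNat : ℝ) : ℂ) * fC γ / (y : ℂ) else 0
  have hy0 : (y : ℂ) ≠ 0 := by
    have : y ≠ 0 := by positivity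
    exact_mod_cast this
  have hb : ∀ γ, ‖b γ‖ ≤ 1 := by
    intro γ
    simp only [b]
    split_ifs with hγ
    · rw [norm_div, norm_mul, Complex.norm_real, Complex.norm_real, Real.norm_eq_abs,
        Real.norm_of_nonneg (by positivity : 0 ≤ y), div_le_one (by positivity)]
      have h1 : (((N γ).toNat : ℕ) : ℝ) ≤ X := by
        have h2 : (((N γ).toNat : ℤ) : ℝ) = (N γ : ℝ) := by rw [Int.toNat_of_nonneg (N_nonneg γ)]
        rw [Int.cast_natCast] at h2
        rw [h2]
        exact (hBQ γ hγ).2.trans hQX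
      calc _ ≤ y * 1 := by
            refine mul_le_mul ((abs_highM_le _ _).trans (hbd _ h1).1) (norm_fC_le γ)
              (norm_nonneg _) (by positivity)
        _ = y := mul_one y
    · simp
  have hmain := h₁ k hk0 hk (2 * M) Q (by positivity) hQ1 hMQ A B hAp hBQ b hb
  set s := ∑ ρ ∈ A, ‖∑ γ ∈ B, b γ * twist ρ γ‖ with hs
  have hs0 : 0 ≤ s := Finset.sum_nonneg fun _ _ => norm_nonneg _
  set W := y * (3 * (X ^ (-0.0006 : ℝ) * M)) with hW
  have hAW : (A.card : ℝ) ≤ W := by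
    have h1 : (A.card : ℝ) ≤ ∑ q ∈ S, ((RN q).card : ℝ) := by
      exact_mod_cast Finset.card_biUnion_le
    refine h1.trans ((Finset.sum_le_sum fun q hq => (hbd q (hS q hq).2.2).2.1).trans ?_)
    rw [Finset.sum_const, nsmul_eq_mul, mul_comm]
    exact mul_le_mul_of_nonneg_left hcard (by positivity)
  set F := X ^ (0.0005 : ℝ) with hF
  have hF0 : 0 < F := by positivity
  have hκ : X ^ (-0.0006 : ℝ) * M = X ^ (a - 0.0006) := by
    conv_lhs => rw [ha]
    rw [← Real.rpow_add hX0]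
    congr 1
    ring
  have hFW : F ^ k ≤ √W := by
    refine Real.le_sqrt_of_sq_le ?_
    calc (F ^ k) ^ 2 = X ^ (0.001 * k : ℝ) := by
          rw [hF, ← pow_mul, ← Real.rpow_natCast, ← Real.rpow_mul hX0.le]
          congr 1
          push_cast
          ring
      _ ≤ X ^ (a - 0.0006) := hle _ _ hk2
      _ ≤ W := by
          rw [hW, hκ]
          have : 0 < X ^ (a - 0.0006) := by positivity
          nlinarith
  have hW0 : 0 < W := by positivity
  have hA0 : (0 : ℝ) ≤ A.card := Nat.cast_nonneg _
  generalize (A.card : ℝ) = c at hmain hAW hA0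
  have hpow : c ^ (k - 1) * √c ≤ (W / F) ^ k := by
    calc c ^ (k - 1) * √c ≤ W ^ (k - 1) * √W := by gcongr
      _ = W ^ k / √W := by
        rw [eq_div_iff (by positivity), mul_assoc, Real.mul_self_sqrt hW0.le, pow_sub_one_mul hk0]
      _ ≤ W ^ k / F ^ k := by gcongr
      _ = _ := (div_pow _ _ _).symm
  have hsle : s ≤ C₁ * (Q * Q ^ (0.00001 : ℝ)) * (W / F) := by
    refine le_of_pow_le_pow_left₀ hk0 (by positivity) (hmain.trans ?_)
    calc _ ≤ C₁ ^ k * (Q * Q ^ (0.00001 : ℝ)) ^ k * (W / F) ^ k := by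
          gcongr
          exact le_self_pow₀ hC₁ hk0
      _ = _ := by rw [mul_pow (C₁ * (Q * Q ^ (0.00001 : ℝ))), mul_pow C₁]
  have hnorm : ‖∑ q ∈ S, ∑ m ∈ Finset.Icc 1 ⌊Q⌋₊, bilT U q m‖ ≤ y * (y * s) := by
    rw [sum_bilT_eq, hs, Finset.mul_sum, Finset.mul_sum]
    refine norm_sum_le_of_le _ fun ρ hρ => ?_
    obtain ⟨q, hq, hρq⟩ := Finset.mem_biUnion.1 hρ
    rw [norm_mul, norm_mul, Complex.norm_real, (mem_RN.1 hρq).2, Int.cast_natCast]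
    have e : ∑ γ ∈ B, ((highM U (N γ).toNat : ℝ) : ℂ) * fC γ * twist ρ γ =
        y * ∑ γ ∈ B, b γ * twist ρ γ := by
      rw [Finset.mul_sum]
      refine Finset.sum_congr rfl fun γ hγ => ?_
      simp only [b, if_pos hγ]
      field_simp
    rw [e, norm_mul, Complex.norm_real, Real.norm_of_nonneg (by positivity : 0 ≤ y),
      Real.norm_of_nonneg (Real.log_natCast_nonneg q)]
    refine mul_le_mul_of_nonneg_right ?_ (by positivity)
    calc _ ≤ y * 1 := mul_le_mul (hbd q (hS q hq).2.2).2.2 (norm_fC_le ρ) (norm_nonneg _)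
          (by positivity)
      _ = y := mul_one y
  refine hnorm.trans ?_
  have hQε : Q ^ (0.00001 : ℝ) ≤ X ^ (0.00001 : ℝ) :=
    Real.rpow_le_rpow (by positivity) hQX (by norm_num)
  calc y * (y * s) ≤ y * (y * (C₁ * (Q * X ^ (0.00001 : ℝ)) * (W / F))) := by
        gcongr
        exact hsle.trans (by gcongr)
    _ = 3 * C₁ * C₂ ^ 3 * (X ^ (-0.0006 : ℝ) * (X / F * (X ^ (0.00001 : ℝ)) ^ 4)) := by
        rw [hW, hy, hQ]
        field_simp
    _ = _ := by
        have e1 : X / F = X ^ (1 - 0.0005 : ℝ) := by rw [Real.rpow_sub hX0, Real.rpow_one]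
        have e2 : (X ^ (0.00001 : ℝ)) ^ 4 = X ^ (0.00004 : ℝ) := by
          rw [← Real.rpow_natCast, ← Real.rpow_mul hX0.le]
          norm_num
        rw [e1, e2, ← Real.rpow_add hX0 (1 - 0.0005)]
        norm_num

theorem mem_primesAbove_factorial {V : ℝ} {x q : ℕ} :
    q ∈ primesAbove V x.factorial ↔ q.Prime ∧ V < q ∧ q ≤ x := by
  rw [primesAbove, Finset.mem_filter, Nat.mem_divisors]
  constructor
  · rintro ⟨⟨h1, _⟩, h2⟩
    exact ⟨h2.1, h2.2, (h2.1.dvd_factorial).1 h1⟩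
  · rintro ⟨h1, h2, h3⟩
    exact ⟨⟨h1.dvd_factorial.2 h3, Nat.factorial_ne_zero x⟩, h1, h2⟩

theorem sum_primesAbove_eq (V : ℝ) (x : ℕ) (f : ℕ → ℕ → ℂ) :
    ∑ n ∈ Finset.Icc 1 x, ∑ q ∈ primesAbove V n, f q (n / q) =
      ∑ q ∈ primesAbove V x.factorial, ∑ m ∈ Finset.Icc 1 (x / q), f q m := by
  rw [Finset.sum_sigma', Finset.sum_sigma']
  refine Finset.sum_nbij' (fun z => ⟨z.2, z.1 / z.2⟩) (fun z => ⟨z.1 * z.2, z.1⟩) ?_ ?_ ?_ ?_ ?_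
  · rintro ⟨n, q⟩ hz
    simp only [Finset.mem_sigma, Finset.mem_Icc, mem_primesAbove_factorial] at hz ⊢
    obtain ⟨⟨h1, h2⟩, hq⟩ := hz
    obtain ⟨h3, h4⟩ := Finset.mem_filter.1 hq
    have h5 := Nat.dvd_of_mem_divisors h3
    have h6 := Nat.le_of_dvd (by omega) h5
    exact ⟨⟨h4.1, h4.2, h6.trans h2⟩, Nat.div_pos h6 h4.1.pos, Nat.div_le_div_right h2⟩
  · rintro ⟨q, m⟩ hz
    simp only [Finset.mem_sigma, Finset.mem_Icc, mem_primesAbove_factorial] at hz ⊢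
    obtain ⟨⟨h1, h1', h2⟩, h3, h4⟩ := hz
    have h5 : q * m ≤ x := by
      rw [mul_comm]
      exact (Nat.le_div_iff_mul_le h1.pos).1 h4
    have h6 : 0 < q * m := Nat.mul_pos h1.pos h3
    refine ⟨⟨h6, h5⟩, Finset.mem_filter.2 ⟨Nat.mem_divisors.2 ⟨dvd_mul_right _ _, h6.ne'⟩, h1, h1'⟩⟩
  · rintro ⟨n, q⟩ hz
    simp only [Finset.mem_sigma] at hz
    have h5 := Nat.dvd_of_mem_divisors (Finset.mem_filter.1 hz.2).1
    simp [Nat.mul_div_cancel' h5]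
  · rintro ⟨q, m⟩ hz
    simp only [Finset.mem_sigma, mem_primesAbove_factorial] at hz
    simp [Nat.mul_div_cancel_left m hz.1.1.pos]
  · intros
    rfl

theorem sum_card_Ioc_le (S : Finset ℕ) (x Y : ℕ) (g : ℕ → ℕ) (hS : ∀ q ∈ S, 0 < q ∧ q * g q ≤ Y) :
    ∑ q ∈ S, (Finset.Ioc (x / q) (g q)).card ≤ ∑ n ∈ Finset.Ioc x Y, n.divisors.card := by
  have h1 : ∀ q ∈ S, (Finset.Ioc (x / q) (g q)).card ≤
      ((Finset.Ioc x Y).filter (q ∣ ·)).card := by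
    intro q hq
    obtain ⟨hq0, hqY⟩ := hS q hq
    refine Finset.card_le_card_of_injOn (fun m => q * m) ?_ ?_
    · intro m hm
      simp only [Finset.coe_Ioc, Set.mem_Ioc, Finset.coe_filter, Finset.mem_Ioc,
        Set.mem_ofPred_eq] at hm ⊢
      refine ⟨⟨?_, (Nat.mul_le_mul_left q hm.2).trans hqY⟩, dvd_mul_right q m⟩
      rw [mul_comm]
      exact (Nat.div_lt_iff_lt_mul hq0).1 hm.1
    · intro a _ b _ hab
      exact Nat.eq_of_mul_eq_mul_left hq0 hab
  refine (Finset.sum_le_sum h1).trans ?_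
  simp only [Finset.card_filter]
  rw [Finset.sum_comm]
  refine Finset.sum_le_sum fun n hn => ?_
  rw [← Finset.card_filter]
  refine Finset.card_le_card fun q hq => ?_
  have := (Finset.mem_filter.1 hq).2
  exact Nat.mem_divisors.2 ⟨this, by have := (Finset.mem_Ioc.1 hn).1; omega⟩

theorem card_le_of_mem_Icc {S : Finset ℕ} {a b : ℝ} (ha : 0 ≤ a) (hab : a ≤ b)
    (h : ∀ q ∈ S, a ≤ (q : ℝ) ∧ (q : ℝ) ≤ b) : (S.card : ℝ) ≤ b - a + 1 := by
  have hsub : S ⊆ Finset.Icc ⌈a⌉₊ ⌊b⌋₊ := fun q hq =>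
    Finset.mem_Icc.2 ⟨Nat.ceil_le.2 (h q hq).1, Nat.le_floor (h q hq).2⟩
  have h1 := Finset.card_le_card hsub
  rw [Nat.card_Icc] at h1
  have h2 : (⌊b⌋₊ : ℝ) ≤ b := Nat.floor_le (ha.trans hab)
  have h3 : a ≤ ⌈a⌉₊ := Nat.le_ceil a
  rcases le_total ⌈a⌉₊ (⌊b⌋₊ + 1) with h4 | h4
  · have h5 : (S.card : ℝ) ≤ ((⌊b⌋₊ + 1 - ⌈a⌉₊ : ℕ) : ℝ) := by exact_mod_cast h1
    rw [Nat.cast_sub h4] at h5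
    push_cast at h5
    linarith
  · have : S.card = 0 := by omega
    rw [this]
    push_cast
    linarith

theorem sum_bilT_le : ∃ C : ℝ, 0 < C ∧ ∀ x : ℕ, 10000 ≤ Real.log x →
    ‖∑ n ∈ Finset.Icc 1 x, ∑ q ∈ primesAbove ((x : ℝ) ^ (0.005 : ℝ)) n,
      bilT ((x : ℝ) ^ (0.015 : ℝ)) q (n / q)‖ ≤ C * (x : ℝ) ^ (0.9996 : ℝ) := by
  obtain ⟨C₁, hC₁, h₁⟩ := sum_bilT_block_le
  obtain ⟨C₂, hC₂, h₂⟩ := exists_eps_bound (ε := 0.00001) (by norm_num)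
  refine ⟨2 * (C₁ * (1 / 0.00001)) + 2 * (3 * C₂) ^ 5, by positivity, fun x hx => ?_⟩
  obtain ⟨X, hX⟩ : ∃ X : ℝ, X = x := ⟨x, rfl⟩
  simp only [← hX] at hx ⊢
  have hX1 : 1 < X := by
    by_contra! h
    have : Real.log X ≤ 0 := Real.log_nonpos (by rw [hX]; positivity) h
    linarith
  have hX0 : 0 < X := by linarith
  have hle : ∀ a b : ℝ, a ≤ b → X ^ a ≤ X ^ b :=
    fun a b h => Real.rpow_le_rpow_of_exponent_le hX1.le h
  have hadd : ∀ a b : ℝ, X ^ a * X ^ b = X ^ (a + b) := fun a b => (Real.rpow_add hX0 a b).symm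
  set U := X ^ (0.015 : ℝ) with hU
  set V := X ^ (0.005 : ℝ) with hV
  have hV1 : 1 ≤ V := Real.one_le_rpow hX1.le (by norm_num)
  set κ := X ^ (-0.0006 : ℝ) with hκ
  have hκ0 : 0 < κ := by positivity
  have hκ2 : κ ≤ 1 / 2 := by
    have h3 : κ = (Real.exp (Real.log X * 0.0006))⁻¹ := by
      rw [hκ, Real.rpow_def_of_pos hX0, ← Real.exp_neg]
      congr 1
      ring
    have h4 : 2 ≤ Real.exp (Real.log X * 0.0006) := by
      have := Real.add_one_le_exp (Real.log X * 0.0006)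
      linarith
    rw [h3, one_div]
    exact inv_anti₀ two_pos h4
  have hexp : Real.exp κ - 1 ≤ 2 * κ := by
    have := Real.abs_exp_sub_one_le (x := κ) (by rw [abs_of_pos hκ0]; linarith)
    rw [abs_of_pos hκ0] at this
    exact (le_abs_self _).trans this
  let M : ℕ → ℝ := fun j => V * Real.exp (κ * j)
  let J : ℕ → ℕ := fun q => ⌊Real.log (q / V) / κ⌋₊
  have hMV : ∀ j, V ≤ M j := fun j =>
    le_mul_of_one_le_right (by positivity) (Real.one_le_exp (by positivity))
  have hM0 : ∀ j, 0 < M j := fun j => by positivity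
  have hJ : ∀ q : ℕ, V < q → M (J q) ≤ q ∧ (q : ℝ) ≤ M (J q) * Real.exp κ := by
    intro q hq
    have hq0 : (0 : ℝ) < q := by linarith
    have hl : 0 ≤ Real.log (q / V) :=
      Real.log_nonneg ((one_le_div (by positivity)).2 hq.le)
    have e : (q : ℝ) = V * Real.exp (Real.log (q / V)) := by
      rw [Real.exp_log (by positivity)]
      field_simp
    constructor
    · conv_rhs => rw [e]
      refine mul_le_mul_of_nonneg_left (Real.exp_le_exp.2 ?_) (by positivity)
      have := Nat.floor_le (div_nonneg hl hκ0.le)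
      rw [le_div_iff₀ hκ0] at this
      linarith
    · conv_lhs => rw [e]
      rw [mul_assoc, ← Real.exp_add]
      refine mul_le_mul_of_nonneg_left (Real.exp_le_exp.2 ?_) (by positivity)
      have := (Nat.lt_floor_add_one (Real.log (q / V) / κ)).le
      rw [div_le_iff₀ hκ0] at this
      linarith
  set S := primesAbove V x.factorial with hS
  have hSmem : ∀ q ∈ S, q.Prime ∧ V < q ∧ q ≤ x := fun q hq => mem_primesAbove_factorial.1 hq
  let g : ℕ → ℕ := fun q => ⌊X / M (J q)⌋₊
  have hg : ∀ q ∈ S, x / q ≤ g q := by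
    intro q hq
    refine Nat.le_floor ((Nat.cast_div_le).trans ?_)
    rw [← hX]
    exact div_le_div_of_nonneg_left hX0.le (hM0 _) (hJ q (hSmem q hq).2.1).1
  rw [sum_primesAbove_eq]
  have hsplit : ∑ q ∈ S, ∑ m ∈ Finset.Icc 1 (x / q), bilT U q m =
      ∑ q ∈ S, ∑ m ∈ Finset.Icc 1 (g q), bilT U q m -
        ∑ q ∈ S, ∑ m ∈ Finset.Ioc (x / q) (g q), bilT U q m := by
    rw [← Finset.sum_sub_distrib]
    refine Finset.sum_congr rfl fun q hq => ?_
    have h3 := hg q hq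
    generalize x / q = r at h3 ⊢
    rw [eq_sub_iff_add_eq, ← Finset.sum_union]
    · refine Finset.sum_congr ?_ fun _ _ => rfl
      ext m
      simp only [Finset.mem_union, Finset.mem_Icc, Finset.mem_Ioc]
      omega
    · refine Finset.disjoint_left.2 fun m h4 h5 => ?_
      simp only [Finset.mem_Icc, Finset.mem_Ioc] at h4 h5
      omega
  rw [hsplit]
  refine (norm_sub_le _ _).trans ?_
  rw [add_mul]
  refine add_le_add ?_ ?_
  · have hJle : ∀ q ∈ S, J q ∈ Finset.range (⌊Real.log X / κ⌋₊ + 1) := by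
      intro q hq
      obtain ⟨h3, h4, h5⟩ := hSmem q hq
      refine Finset.mem_range.2 (Nat.lt_succ_of_le (Nat.floor_le_floor ?_))
      have h6 : (0 : ℝ) < q := by exact_mod_cast h3.pos
      have h7 : (q : ℝ) ≤ X := by rw [hX]; exact_mod_cast h5
      refine div_le_div_of_nonneg_right (Real.log_le_log (by positivity) ?_) hκ0.le
      exact (div_le_self h6.le hV1).trans h7
    rw [← Finset.sum_fiberwise_of_maps_to hJle]
    have hblock : ∀ j ∈ Finset.range (⌊Real.log X / κ⌋₊ + 1),
        ‖∑ q ∈ S.filter (fun q => J q = j), ∑ m ∈ Finset.Icc 1 (g q), bilT U q m‖ ≤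
          C₁ * (κ * X ^ (0.99954 : ℝ)) := by
      intro j _
      have e : ∑ q ∈ S.filter (fun q => J q = j), ∑ m ∈ Finset.Icc 1 (g q), bilT U q m =
          ∑ q ∈ S.filter (fun q => J q = j), ∑ m ∈ Finset.Icc 1 ⌊X / M j⌋₊, bilT U q m := by
        refine Finset.sum_congr rfl fun q hq => ?_
        rw [← (Finset.mem_filter.1 hq).2]
      rw [e]
      have hq : ∀ q ∈ S.filter (fun q => J q = j), q.Prime ∧ M j ≤ q ∧
          (q : ℝ) ≤ M j * Real.exp κ ∧ (q : ℝ) ≤ X := by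
        intro q hq
        obtain ⟨h3, h4⟩ := Finset.mem_filter.1 hq
        obtain ⟨h5, h6, h7⟩ := hSmem q h3
        have h8 := hJ q h6
        rw [h4] at h8
        exact ⟨h5, h8.1, h8.2, by rw [hX]; exact_mod_cast h7⟩
      by_cases hMj : M j ≤ X ^ (0.985 : ℝ)
      · refine h₁ X (M j) U _ hX1 ?_ (hMV j) hMj (fun q h => ?_) ?_
        · have := Real.log_two_lt_d9
          linarith
        · obtain ⟨h5, h6, h7, h8⟩ := hq q h
          refine ⟨h5, h7.trans ?_, h8⟩
          rw [mul_comm]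
          have := hM0 j
          gcongr
          linarith
        · refine (card_le_of_mem_Icc (hM0 j).le ?_ fun q h => ⟨(hq q h).2.1, (hq q h).2.2.1⟩).trans ?_
          · exact le_mul_of_one_le_right (hM0 j).le (Real.one_le_exp hκ0.le)
          · have h9 : 1 ≤ κ * M j := by
              calc 1 ≤ X ^ (0.0044 : ℝ) := Real.one_le_rpow hX1.le (by norm_num)
                _ = κ * V := by rw [hκ, hV, hadd]; norm_num
                _ ≤ _ := mul_le_mul_of_nonneg_left (hMV j) hκ0.le
            have h10 := mul_le_mul_of_nonneg_left hexp (hM0 j).le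
            rw [← hκ]
            linarith
      · push Not at hMj
        rw [Finset.sum_eq_zero, _root_.norm_zero]
        · positivity
        · intro q _
          refine Finset.sum_eq_zero fun m hm => ?_
          have h5 : (m : ℝ) ≤ U := by
            have h6 := (Nat.le_floor_iff (by have := hM0 j; positivity)).1 (Finset.mem_Icc.1 hm).2
            refine h6.trans ?_
            rw [div_le_iff₀ (hM0 j)]
            calc X = U * X ^ (0.985 : ℝ) := by rw [hU, hadd]; norm_num
              _ ≤ _ := by gcongr
          rw [bilT, highM_eq_zero h5]
          simp
    refine (norm_sum_le_of_le _ hblock).trans ?_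
    rw [Finset.sum_const, nsmul_eq_mul, Finset.card_range]
    have h3 : ((⌊Real.log X / κ⌋₊ + 1 : ℕ) : ℝ) * κ ≤ 2 * Real.log X := by
      have h4 := Nat.floor_le (div_nonneg (by linarith : 0 ≤ Real.log X) hκ0.le)
      rw [le_div_iff₀ hκ0] at h4
      push_cast
      linarith
    calc _ = C₁ * X ^ (0.99954 : ℝ) * (((⌊Real.log X / κ⌋₊ + 1 : ℕ) : ℝ) * κ) := by ring
      _ ≤ C₁ * X ^ (0.99954 : ℝ) * (2 * (1 / 0.00001 * X ^ (0.00001 : ℝ))) := by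
        refine mul_le_mul_of_nonneg_left ?_ (by positivity)
        exact h3.trans (mul_le_mul_of_nonneg_left (log_le_rpow (ε := 0.00001) (by norm_num) hX0.le) two_pos.le)
      _ = 2 * (C₁ * (1 / 0.00001)) * (X ^ (0.99954 : ℝ) * X ^ (0.00001 : ℝ)) := by ring
      _ ≤ _ := by
        rw [hadd]
        exact mul_le_mul_of_nonneg_left (hle _ _ (by norm_num)) (by positivity)
  · set Y := ⌊X * Real.exp κ⌋₊ with hY
    have hY0 : 0 ≤ X * Real.exp κ := by positivity
    have hYle : (Y : ℝ) ≤ X * Real.exp κ := Nat.floor_le hY0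
    have hY2 : X * Real.exp κ ≤ 2 * X := by nlinarith
    set y := 3 * C₂ * X ^ (0.00001 : ℝ) with hy
    have hbd : ∀ n : ℕ, (n : ℝ) ≤ 2 * X → (n.divisors.card : ℝ) ≤ y ∧ ((RN n).card : ℝ) ≤ y ∧
        Real.log n ≤ y := by
      intro n hn
      have h3 : C₂ * (2 * X) ^ (0.00001 : ℝ) ≤ y := by
        rw [hy, Real.mul_rpow two_pos.le hX0.le]
        have h4 : (2 : ℝ) ^ (0.00001 : ℝ) ≤ 2 ^ (1 : ℝ) :=
          Real.rpow_le_rpow_of_exponent_le (by norm_num) (by norm_num)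
        rw [Real.rpow_one] at h4
        have h5 : 0 < X ^ (0.00001 : ℝ) := by positivity
        have h6 : (2 : ℝ) ^ (0.00001 : ℝ) ≤ 3 := by linarith
        calc _ ≤ C₂ * (3 * X ^ (0.00001 : ℝ)) := by gcongr
          _ = _ := by ring
      obtain ⟨h4, h5, h6⟩ := h₂ n (2 * X) hn
      exact ⟨h4.trans h3, h5.trans h3, h6.trans h3⟩
    have hterm : ∀ q ∈ S, ‖∑ m ∈ Finset.Ioc (x / q) (g q), bilT U q m‖ ≤
        ((Finset.Ioc (x / q) (g q)).card : ℝ) * y ^ 4 := by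
      intro q hq
      obtain ⟨h3, h4, h5⟩ := hSmem q hq
      have h6 : (q : ℝ) ≤ 2 * X := by
        have : (q : ℝ) ≤ X := by rw [hX]; exact_mod_cast h5
        linarith
      refine (norm_sum_le_of_le _ (f := fun m => bilT U q m) (n := fun _ => y ^ 4) fun m hm => ?_).trans ?_
      · have h7 : (m : ℝ) ≤ 2 * X := by
          have h8 := (Nat.le_floor_iff (by have := hM0 (J q); positivity)).1 (Finset.mem_Ioc.1 hm).2
          have h9 : X / M (J q) ≤ X := div_le_self hX0.le (hV1.trans (hMV _))
          linarith
        exact norm_bilT_le (hbd q h6).2.2 (hbd m h7).1 (hbd q h6).2.1 (hbd m h7).2.1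
      · rw [Finset.sum_const, nsmul_eq_mul]
    refine (norm_sum_le_of_le _ hterm).trans ?_
    rw [← Finset.sum_mul]
    have hcount : ∑ q ∈ S, ((Finset.Ioc (x / q) (g q)).card : ℝ) ≤ 2 * κ * X * y := by
      have h3 := sum_card_Ioc_le S x Y g fun q hq => by
        obtain ⟨h3, h4, h5⟩ := hSmem q hq
        refine ⟨h3.pos, Nat.le_floor ?_⟩
        push_cast
        have h6 : (g q : ℝ) ≤ X / M (J q) := Nat.floor_le (by have := hM0 (J q); positivity)
        have h7 := (hJ q h4).2
        have h8 := hM0 (J q)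
        calc (q : ℝ) * g q ≤ M (J q) * Real.exp κ * (X / M (J q)) := by gcongr
          _ = X * Real.exp κ := by field_simp
      calc _ ≤ ((∑ n ∈ Finset.Ioc x Y, n.divisors.card : ℕ) : ℝ) := by
            rw [← Nat.cast_sum]
            exact_mod_cast h3
        _ ≤ ∑ n ∈ Finset.Ioc x Y, y := by
            rw [Nat.cast_sum]
            refine Finset.sum_le_sum fun n hn => (hbd n ?_).1
            have : (n : ℝ) ≤ Y := by exact_mod_cast (Finset.mem_Ioc.1 hn).2
            linarith
        _ ≤ _ := by
            rw [Finset.sum_const, nsmul_eq_mul, Nat.card_Ioc]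
            have hxY : x ≤ Y := Nat.le_floor (by
              rw [← hX]
              exact le_mul_of_one_le_right hX0.le (Real.one_le_exp hκ0.le))
            rw [Nat.cast_sub hxY, ← hX]
            have : 0 < y := by positivity
            refine mul_le_mul_of_nonneg_right ?_ this.le
            nlinarith
    calc _ ≤ 2 * κ * X * y * y ^ 4 := by gcongr
      _ = 2 * (3 * C₂) ^ 5 * (κ * X ^ (1 : ℝ) * (X ^ (0.00001 : ℝ)) ^ 5) := by
        rw [hy, Real.rpow_one]
        ring
      _ ≤ _ := by
        rw [← Real.rpow_natCast (X ^ (0.00001 : ℝ)), ← Real.rpow_mul hX0.le, hκ, hadd, hadd]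
        exact mul_le_mul_of_nonneg_left (hle _ _ (by norm_num)) (by positivity)

theorem norm_SF_vonMangoldt_le : ∃ C : ℝ, 0 < C ∧ ∀ x : ℕ, 1 ≤ x →
    ‖SF x vonMangoldt‖ ≤ C * (x : ℝ) ^ (0.9996 : ℝ) := by
  obtain ⟨C₁, hC₁, h₁⟩ := SF_vonMangoldt_sub_le
  obtain ⟨C₂, hC₂, h₂⟩ := SF_sub_bilT_le
  obtain ⟨C₃, hC₃, h₃⟩ := sum_bilT_le
  obtain ⟨N, hN⟩ := exists_nat_gt (Real.exp 10000)
  have hK : 0 ≤ ∑ y ∈ Finset.range N, ‖SF y vonMangoldt‖ :=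
    Finset.sum_nonneg fun _ _ => norm_nonneg _
  refine ⟨C₁ + C₂ + C₃ + ∑ y ∈ Finset.range N, ‖SF y vonMangoldt‖, by positivity, fun x hx => ?_⟩
  have hx1 : (1 : ℝ) ≤ x := by exact_mod_cast hx
  have hle : ∀ a : ℝ, a ≤ 0.9996 → (x : ℝ) ^ a ≤ (x : ℝ) ^ (0.9996 : ℝ) := fun a h =>
    Real.rpow_le_rpow_of_exponent_le hx1 h
  have hone : 1 ≤ (x : ℝ) ^ (0.9996 : ℝ) := Real.one_le_rpow hx1 (by norm_num)
  rcases lt_or_ge x N with h | h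
  · calc _ ≤ ∑ y ∈ Finset.range N, ‖SF y vonMangoldt‖ :=
          Finset.single_le_sum (f := fun y => ‖SF y vonMangoldt‖) (fun _ _ => norm_nonneg _)
            (Finset.mem_range.2 h)
      _ ≤ (∑ y ∈ Finset.range N, ‖SF y vonMangoldt‖) * (x : ℝ) ^ (0.9996 : ℝ) :=
        le_mul_of_one_le_right hK hone
      _ ≤ _ := by
        refine mul_le_mul_of_nonneg_right ?_ (by positivity)
        linarith
  · have hlog : 10000 ≤ Real.log x := by
      rw [Real.le_log_iff_exp_le (by positivity)]
      have : (N : ℝ) ≤ x := by exact_mod_cast h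
      linarith
    have b₁ := h₁ x hx
    have b₂ := h₂ x ((x : ℝ) ^ (0.015 : ℝ)) hx
    have b₃ := h₃ x hlog
    generalize (∑ n ∈ Finset.Icc 1 x, ∑ q ∈ primesAbove ((x : ℝ) ^ (0.005 : ℝ)) n,
      bilT ((x : ℝ) ^ (0.015 : ℝ)) q (n / q)) = s₃ at b₂ b₃
    generalize SF x ((vonMangoldt - low ((x : ℝ) ^ (0.005 : ℝ)) vonMangoldt) *
      highM ((x : ℝ) ^ (0.015 : ℝ)) : ArithmeticFunction ℝ) = s₂ at b₁ b₂
    generalize SF x vonMangoldt = s₁ at b₁ ⊢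
    have e : s₁ = (s₁ - s₂) + (s₂ - s₃) + s₃ := by ring
    rw [e]
    refine norm_add₃_le.trans ?_
    have c₁ := mul_le_mul_of_nonneg_left (hle 0.995 (by norm_num)) hC₁.le
    have c₂ := mul_le_mul_of_nonneg_left (hle 0.9985 (by norm_num)) hC₂.le
    have c₃ := mul_nonneg hK (zero_le_one.trans hone)
    linarith

theorem norm_sum_log_mul_FC_prime_le : ∃ C : ℝ, 0 < C ∧ ∀ x : ℕ,
    ‖∑ n ∈ Finset.Icc 1 x, (if n.Prime then (Real.log n : ℂ) * FC n else 0)‖ ≤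
      C * (x : ℝ) ^ (0.9996 : ℝ) := by
  obtain ⟨C₁, hC₁, h₁⟩ := norm_SF_vonMangoldt_le
  obtain ⟨C₂, hC₂, h₂⟩ := exists_eps_bound (ε := 0.1) (by norm_num)
  refine ⟨C₁ + C₂ * (2 * (1 / 0.1)), by positivity, fun x => ?_⟩
  rcases Nat.eq_zero_or_pos x with rfl | hx
  · rw [Finset.Icc_eq_empty (by norm_num), Finset.sum_empty, _root_.norm_zero]
    positivity
  have hx1 : (1 : ℝ) ≤ x := by exact_mod_cast hx
  have hx0 : (0 : ℝ) < x := by linarith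
  have e : ∑ n ∈ Finset.Icc 1 x, (if n.Prime then (Real.log n : ℂ) * FC n else 0) =
      SF x vonMangoldt -
        ∑ n ∈ (Finset.Icc 1 x).filter (fun n => ¬ n.Prime), (vonMangoldt n : ℂ) * FC n := by
    rw [SF, eq_sub_iff_add_eq, Finset.sum_filter, ← Finset.sum_add_distrib]
    refine Finset.sum_congr rfl fun n _ => ?_
    by_cases hn : n.Prime
    · simp [hn, ArithmeticFunction.vonMangoldt_apply_prime hn]
    · simp [hn]
  have h3 : ‖∑ n ∈ (Finset.Icc 1 x).filter (fun n => ¬ n.Prime), (vonMangoldt n : ℂ) * FC n‖ ≤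
      C₂ * (x : ℝ) ^ (0.1 : ℝ) * (2 * √x * Real.log x) := by
    refine (norm_sum_le_of_le _ (n := fun n => C₂ * (x : ℝ) ^ (0.1 : ℝ) * vonMangoldt n)
      fun n hn => ?_).trans ?_
    · have h4 : (n : ℝ) ≤ x := by
        exact_mod_cast (Finset.mem_Icc.1 (Finset.mem_filter.1 hn).1).2
      have h5 := (norm_FC_le n).trans (h₂ n x h4).2.1
      have h6 := ArithmeticFunction.vonMangoldt_nonneg (n := n)
      rw [norm_mul, Complex.norm_real, Real.norm_of_nonneg h6, mul_comm]
      exact mul_le_mul_of_nonneg_right h5 h6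
    · rw [← Finset.mul_sum]
      refine mul_le_mul_of_nonneg_left ?_ (by positivity)
      have h4 := Chebyshev.psi_sub_theta_le hx1
      rw [Chebyshev.psi_sub_theta_eq_sum_not_prime, Nat.floor_natCast] at h4
      exact h4
  have hadd : ∀ a b : ℝ, (x : ℝ) ^ a * (x : ℝ) ^ b = (x : ℝ) ^ (a + b) := fun a b =>
    (Real.rpow_add hx0 a b).symm
  rw [e]
  refine (norm_sub_le _ _).trans ?_
  rw [add_mul]
  refine add_le_add (h₁ x hx) (h3.trans ?_)
  calc _ ≤ C₂ * (x : ℝ) ^ (0.1 : ℝ) *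
        (2 * (x : ℝ) ^ (1 / 2 : ℝ) * (1 / 0.1 * (x : ℝ) ^ (0.1 : ℝ))) := by
        rw [Real.sqrt_eq_rpow]
        have := log_le_rpow (ε := 0.1) (by norm_num) hx0.le
        gcongr
    _ = C₂ * (2 * (1 / 0.1)) *
        ((x : ℝ) ^ (0.1 : ℝ) * (x : ℝ) ^ (1 / 2 : ℝ) * (x : ℝ) ^ (0.1 : ℝ)) := by ring
    _ ≤ _ := by
      rw [hadd, hadd]
      exact mul_le_mul_of_nonneg_left
        (Real.rpow_le_rpow_of_exponent_le hx1 (by norm_num)) (by positivity)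

theorem abel_antitone_le (x : ℕ) (h : ℕ → ℝ) (c : ℕ → ℂ) (hh : Antitone h) (h0 : ∀ n, 0 ≤ h n)
    (B : ℝ) (hB : ∀ y ≤ x, ‖∑ n ∈ Finset.Icc 1 y, c n‖ ≤ B) :
    ‖∑ n ∈ Finset.Icc 1 x, (h n : ℂ) * c n‖ ≤ 3 * h 0 * B := by
  have hB0 : 0 ≤ B := (norm_nonneg _).trans (hB x le_rfl)
  have h1 := abel_le x (fun n => h 0 - h n) c (fun a b hab => by
    have := hh hab
    simp only
    linarith) (by simp) B hB
  have e : ∑ n ∈ Finset.Icc 1 x, (h n : ℂ) * c n = h 0 * ∑ n ∈ Finset.Icc 1 x, c n -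
      ∑ n ∈ Finset.Icc 1 x, ((h 0 - h n : ℝ) : ℂ) * c n := by
    rw [Finset.mul_sum, ← Finset.sum_sub_distrib]
    refine Finset.sum_congr rfl fun n _ => ?_
    push_cast
    ring
  rw [e]
  refine (norm_sub_le _ _).trans ?_
  rw [norm_mul, Complex.norm_real, Real.norm_of_nonneg (h0 0)]
  have h2 := mul_le_mul_of_nonneg_left (hB x le_rfl) (h0 0)
  have h3 := mul_nonneg (h0 x) hB0
  nlinarith

theorem norm_sum_FC_prime_le : ∃ C : ℝ, 0 < C ∧ ∀ x : ℕ,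
    ‖∑ p ∈ (Finset.Icc 1 x).filter Nat.Prime, FC p‖ ≤ C * (x : ℝ) ^ (0.9996 : ℝ) := by
  obtain ⟨C, hC, h⟩ := norm_sum_log_mul_FC_prime_le
  have hl2 : 0 < Real.log 2 := Real.log_pos (by norm_num)
  refine ⟨3 * (1 / Real.log 2) * C, by positivity, fun x => ?_⟩
  let w : ℕ → ℝ := fun n => 1 / Real.log (max 2 n : ℕ)
  have hw : ∀ n : ℕ, 0 < Real.log (max 2 n : ℕ) := fun n =>
    Real.log_pos (by exact_mod_cast lt_of_lt_of_le one_lt_two (le_max_left 2 n))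
  have h1 := abel_antitone_le x w (fun n => if n.Prime then (Real.log n : ℂ) * FC n else 0)
    (fun a b hab => by
      refine one_div_le_one_div_of_le (hw a) (Real.log_le_log ?_ ?_)
      · exact_mod_cast lt_of_lt_of_le two_pos (le_max_left 2 a)
      · exact_mod_cast max_le_max le_rfl hab)
    (fun n => by have := hw n; positivity) (C * (x : ℝ) ^ (0.9996 : ℝ)) (fun y hy => by
      refine (h y).trans ?_
      gcongr)
  have e : ∑ p ∈ (Finset.Icc 1 x).filter Nat.Prime, FC p = ∑ n ∈ Finset.Icc 1 x,
      (w n : ℂ) * (if n.Prime then (Real.log n : ℂ) * FC n else 0) := by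
    rw [Finset.sum_filter]
    refine Finset.sum_congr rfl fun n _ => ?_
    split_ifs with hn
    · have h2 : max 2 n = n := max_eq_right hn.two_le
      have h3 := hw n
      have h4 : (Real.log n : ℂ) ≠ 0 := by
        rw [h2] at h3
        exact_mod_cast h3.ne'
      simp only [w, h2]
      rw [Complex.ofReal_div, Complex.ofReal_one, ← mul_assoc, one_div, inv_mul_cancel₀ h4, one_mul]
    · simp
  rw [e]
  refine h1.trans (le_of_eq ?_)
  simp only [w]
  norm_num
  ring

end CubicTrace

namespace CubicTrace

open ArithmeticFunction (vonMangoldt)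

section

variable {χ g : ℕ → ℝ} {B : ℝ}

theorem abs_sum_Ioc_mul_le {a : ℕ} (hB : ∀ b, a ≤ b → |∑ n ∈ Finset.Ioc a b, χ n| ≤ B)
    (hg : ∀ m n, a < m → m ≤ n → g n ≤ g m) (hg0 : ∀ n, a < n → 0 ≤ g n) (b : ℕ) (hab : a ≤ b) :
    |∑ n ∈ Finset.Ioc a b, χ n * g n| ≤ B * g (a + 1) := by
  have key : ∀ b, a ≤ b →
      |∑ n ∈ Finset.Ioc a b, χ n * g n - (∑ n ∈ Finset.Ioc a b, χ n) * g (b + 1)| ≤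
        B * (g (a + 1) - g (b + 1)) := by
    intro b hab
    induction b, hab using Nat.le_induction with
    | base => simp
    | succ b hab ih =>
      rw [Finset.sum_Ioc_succ_top hab, Finset.sum_Ioc_succ_top hab]
      have h1 := hB (b + 1) (by omega)
      rw [Finset.sum_Ioc_succ_top hab] at h1
      have h2 := hg (b + 1) (b + 1 + 1) (by omega) (by omega)
      set s := ∑ n ∈ Finset.Ioc a b, χ n
      set t := ∑ n ∈ Finset.Ioc a b, χ n * g n
      have e : t + χ (b + 1) * g (b + 1) - (s + χ (b + 1)) * g (b + 1 + 1) =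
          (t - s * g (b + 1)) + (s + χ (b + 1)) * (g (b + 1) - g (b + 1 + 1)) := by ring
      rw [e]
      refine (abs_add_le _ _).trans ?_
      rw [abs_mul, abs_of_nonneg (sub_nonneg.2 h2)]
      have h3 := mul_le_mul_of_nonneg_right h1 (sub_nonneg.2 h2)
      linarith
  have h1 := key b hab
  have h2 := mul_le_mul_of_nonneg_right (hB b hab) (hg0 (b + 1) (by omega))
  have h3 : |(∑ n ∈ Finset.Ioc a b, χ n) * g (b + 1)| ≤ B * g (b + 1) := by
    rwa [abs_mul, abs_of_nonneg (hg0 (b + 1) (by omega))]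
  calc _ = |(∑ n ∈ Finset.Ioc a b, χ n * g n - (∑ n ∈ Finset.Ioc a b, χ n) * g (b + 1)) +
        (∑ n ∈ Finset.Ioc a b, χ n) * g (b + 1)| := by ring_nf
    _ ≤ _ := abs_add_le _ _
    _ ≤ _ := by linarith

theorem Icc_one_eq_union {a b : ℕ} (hab : a ≤ b) :
    ∑ n ∈ Finset.Icc 1 b, χ n = ∑ n ∈ Finset.Icc 1 a, χ n + ∑ n ∈ Finset.Ioc a b, χ n := by
  rw [← Finset.sum_union]
  · refine Finset.sum_congr ?_ fun _ _ => rfl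
    ext n
    simp only [Finset.mem_union, Finset.mem_Icc, Finset.mem_Ioc]
    omega
  · refine Finset.disjoint_left.2 fun n h1 h2 => ?_
    simp only [Finset.mem_Icc, Finset.mem_Ioc] at h1 h2
    omega

theorem abs_sum_Ioc_le (hB : ∀ m, |∑ n ∈ Finset.Icc 1 m, χ n| ≤ B) (a b : ℕ) (hab : a ≤ b) :
    |∑ n ∈ Finset.Ioc a b, χ n| ≤ 2 * B := by
  have h := Icc_one_eq_union (χ := χ) hab
  have e : ∑ n ∈ Finset.Ioc a b, χ n =
      ∑ n ∈ Finset.Icc 1 b, χ n - ∑ n ∈ Finset.Icc 1 a, χ n := by linarith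
  rw [e]
  refine (abs_sub _ _).trans ?_
  linarith [hB a, hB b]

theorem exists_limit_sum_div (hB : ∀ m, |∑ n ∈ Finset.Icc 1 m, χ n| ≤ B) :
    ∃ L : ℝ, ∀ a : ℕ, |∑ n ∈ Finset.Icc 1 a, χ n / n - L| ≤ 2 * B / (a + 1) := by
  have hB0 : 0 ≤ B := (abs_nonneg _).trans (hB 0)
  have h1 : ∀ a b : ℕ, a ≤ b →
      |∑ n ∈ Finset.Icc 1 b, χ n / n - ∑ n ∈ Finset.Icc 1 a, χ n / n| ≤ 2 * B / (a + 1) := by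
    intro a b hab
    rw [Icc_one_eq_union hab, add_sub_cancel_left]
    have h2 := abs_sum_Ioc_mul_le (χ := χ) (g := fun n => 1 / (n : ℝ)) (a := a)
      (fun b hb => abs_sum_Ioc_le hB a b hb)
      (fun m n hm hn => one_div_le_one_div_of_le (by exact_mod_cast (by omega : 0 < m))
        (by exact_mod_cast hn)) (fun n _ => by positivity) b hab
    simp only [mul_one_div] at h2
    exact_mod_cast h2
  have hlim : Filter.Tendsto (fun a : ℕ => 2 * B / ((a : ℝ) + 1)) Filter.atTop (nhds 0) := by
    have := (tendsto_one_div_add_atTop_nhds_zero_nat (𝕜 := ℝ)).const_mul (2 * B)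
    simpa only [mul_one_div, mul_zero] using this
  have hc : CauchySeq fun a : ℕ => ∑ n ∈ Finset.Icc 1 a, χ n / n := by
    refine cauchySeq_of_le_tendsto_0' (fun a : ℕ => 2 * B / ((a : ℝ) + 1)) (fun a b hab => ?_) hlim
    rw [dist_comm, Real.dist_eq]
    exact h1 a b hab
  obtain ⟨L, hL⟩ := cauchySeq_tendsto_of_complete hc
  refine ⟨L, fun a => ?_⟩
  have h2 : Filter.Tendsto (fun b : ℕ => |∑ n ∈ Finset.Icc 1 b, χ n / n -
      ∑ n ∈ Finset.Icc 1 a, χ n / n|) Filter.atTop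
      (nhds |L - ∑ n ∈ Finset.Icc 1 a, χ n / n|) := (hL.sub_const _).abs
  rw [abs_sub_comm]
  exact le_of_tendsto h2 (Filter.eventually_atTop.2 ⟨a, fun b hb => h1 a b hb⟩)

theorem log_div_self_antitone {m n : ℕ} (hm : 3 ≤ m) (hmn : m ≤ n) :
    Real.log n / n ≤ Real.log m / m := by
  have he := Real.exp_one_lt_d9
  have h3 : (3 : ℝ) ≤ m := by exact_mod_cast hm
  have h4 : (m : ℝ) ≤ n := by exact_mod_cast hmn
  exact Real.log_div_self_antitoneOn (show Real.exp 1 ≤ (m : ℝ) by linarith)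
    (show Real.exp 1 ≤ (n : ℝ) by linarith) h4

theorem exists_sum_log_div_le (hB : ∀ m, |∑ n ∈ Finset.Icc 1 m, χ n| ≤ B) :
    ∃ K : ℝ, ∀ x : ℕ, |∑ n ∈ Finset.Icc 1 x, χ n * (Real.log n / n)| ≤ K := by
  have hB0 : 0 ≤ B := (abs_nonneg _).trans (hB 0)
  have hpos : 0 ≤ Real.log 3 / 3 := by
    have := Real.log_nonneg (show (1 : ℝ) ≤ 3 by norm_num)
    positivity
  refine ⟨|∑ n ∈ Finset.Icc 1 0, χ n * (Real.log n / n)| +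
    |∑ n ∈ Finset.Icc 1 1, χ n * (Real.log n / n)| +
    |∑ n ∈ Finset.Icc 1 2, χ n * (Real.log n / n)| + 2 * B * (Real.log 3 / 3), fun x => ?_⟩
  have h0 := abs_nonneg (∑ n ∈ Finset.Icc 1 0, χ n * (Real.log n / n))
  have h1 := abs_nonneg (∑ n ∈ Finset.Icc 1 1, χ n * (Real.log n / n))
  have h2 := abs_nonneg (∑ n ∈ Finset.Icc 1 2, χ n * (Real.log n / n))
  have h3 : 0 ≤ 2 * B * (Real.log 3 / 3) := by positivity
  rcases (by omega : x = 0 ∨ x = 1 ∨ 2 ≤ x) with rfl | rfl | hx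
  · linarith
  · linarith
  · rw [Icc_one_eq_union hx]
    refine (abs_add_le _ _).trans ?_
    have h4 := abs_sum_Ioc_mul_le (χ := χ) (g := fun n => Real.log n / n) (a := 2)
      (fun b hb => abs_sum_Ioc_le hB 2 b hb)
      (fun m n hm hn => log_div_self_antitone hm hn)
      (fun n _ => div_nonneg (Real.log_natCast_nonneg n) (Nat.cast_nonneg n)) x hx
    norm_num at h4 ⊢
    linarith

theorem exists_sum_vonMangoldt_div_le (hmul : ∀ m n, χ (m * n) = χ m * χ n) (h1 : ∀ n, |χ n| ≤ 1)
    (hB : ∀ m, |∑ n ∈ Finset.Icc 1 m, χ n| ≤ 2)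
    (hpos : 4 / 13 < ∑ n ∈ Finset.Icc 1 12, χ n / n) :
    ∃ K : ℝ, ∀ x : ℕ, |∑ n ∈ Finset.Icc 1 x, χ n * (vonMangoldt n / n)| ≤ K := by
  obtain ⟨L, hL⟩ := exists_limit_sum_div hB
  obtain ⟨K, hK⟩ := exists_sum_log_div_le hB
  have hL0 : 0 < L := by
    have := (abs_le.1 (hL 12)).2
    norm_num at this
    linarith
  refine ⟨(K + 4 * (Real.log 4 + 4)) / L, fun x => ?_⟩
  rw [le_div_iff₀ hL0]
  have e1 : ∑ n ∈ Finset.Icc 1 x, χ n * (Real.log n / n) =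
      ∑ d ∈ Finset.Icc 1 x, χ d * (vonMangoldt d / d) *
        ∑ m ∈ Finset.Icc 1 (x / d), χ m / m := by
    have h2 : ∀ n ∈ Finset.Icc 1 x, χ n * (Real.log n / n) = ∑ d ∈ n.divisors,
        χ d * (vonMangoldt d / d) * (χ (n / d) / (n / d : ℕ)) := by
      intro n hn
      have hn1 := (Finset.mem_Icc.1 hn).1
      rw [← ArithmeticFunction.vonMangoldt_sum, Finset.sum_div, Finset.mul_sum]
      refine Finset.sum_congr rfl fun d hd => ?_
      obtain ⟨k, rfl⟩ := Nat.dvd_of_mem_divisors hd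
      have hd0 : 0 < d := Nat.pos_of_mem_divisors hd
      rw [Nat.mul_div_cancel_left k hd0, hmul]
      push_cast
      field_simp
    rw [Finset.sum_congr rfl h2]
    simp only [Finset.mul_sum]
    rw [Finset.sum_sigma', Finset.sum_sigma']
    refine Finset.sum_nbij' (fun z => ⟨z.2, z.1 / z.2⟩) (fun z => ⟨z.1 * z.2, z.1⟩) ?_ ?_ ?_ ?_ ?_
    · rintro ⟨n, q⟩ hz
      simp only [Finset.mem_sigma, Finset.mem_Icc, Nat.mem_divisors] at hz ⊢
      obtain ⟨⟨h3, h4⟩, h5, h6⟩ := hz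
      have h7 := Nat.le_of_dvd h3 h5
      have h8 := Nat.pos_of_dvd_of_pos h5 h3
      exact ⟨⟨h8, h7.trans h4⟩, Nat.div_pos h7 h8, Nat.div_le_div_right h4⟩
    · rintro ⟨q, m⟩ hz
      simp only [Finset.mem_sigma, Finset.mem_Icc, Nat.mem_divisors] at hz ⊢
      obtain ⟨⟨h3, h4⟩, h5, h6⟩ := hz
      have h7 : q * m ≤ x := by
        rw [mul_comm]
        exact (Nat.le_div_iff_mul_le h3).1 h6
      have h8 : 0 < q * m := Nat.mul_pos h3 h5
      exact ⟨⟨h8, h7⟩, dvd_mul_right _ _, h8.ne'⟩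
    · rintro ⟨n, q⟩ hz
      simp only [Finset.mem_sigma] at hz
      simp [Nat.mul_div_cancel' (Nat.dvd_of_mem_divisors hz.2)]
    · rintro ⟨q, m⟩ hz
      simp only [Finset.mem_sigma, Finset.mem_Icc] at hz
      simp [Nat.mul_div_cancel_left m hz.1.1]
    · intros
      rfl
  have e2 : (∑ n ∈ Finset.Icc 1 x, χ n * (vonMangoldt n / n)) * L =
      ∑ n ∈ Finset.Icc 1 x, χ n * (Real.log n / n) -
        ∑ d ∈ Finset.Icc 1 x, χ d * (vonMangoldt d / d) *
          (∑ m ∈ Finset.Icc 1 (x / d), χ m / m - L) := by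
    rw [e1, Finset.sum_mul, ← Finset.sum_sub_distrib]
    exact Finset.sum_congr rfl fun _ _ => by ring
  have e3 : |∑ n ∈ Finset.Icc 1 x, χ n * (vonMangoldt n / n)| * L =
      |(∑ n ∈ Finset.Icc 1 x, χ n * (vonMangoldt n / n)) * L| := by
    rw [abs_mul, abs_of_pos hL0]
  rw [e3, e2]
  refine (abs_sub _ _).trans (add_le_add (hK x) ?_)
  refine (Finset.abs_sum_le_sum_abs _ _).trans ?_
  rcases Nat.eq_zero_or_pos x with rfl | hx
  · rw [Finset.Icc_eq_empty (by norm_num), Finset.sum_empty]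
    have := Real.log_nonneg (show (1 : ℝ) ≤ 4 by norm_num)
    positivity
  have hx0 : (0 : ℝ) < x := by exact_mod_cast hx
  calc _ ≤ ∑ d ∈ Finset.Icc 1 x, 4 / (x : ℝ) * vonMangoldt d := by
        refine Finset.sum_le_sum fun d hd => ?_
        have hd0 : (0 : ℝ) < d := by exact_mod_cast (Finset.mem_Icc.1 hd).1
        have hv := ArithmeticFunction.vonMangoldt_nonneg (n := d)
        rw [abs_mul, abs_mul, abs_of_nonneg (div_nonneg hv hd0.le)]
        have h3 : (x : ℝ) / d ≤ (x / d : ℕ) + 1 := by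
          have := (Nat.lt_floor_add_one ((x : ℝ) / d)).le
          rwa [Nat.floor_div_eq_div] at this
        have h4 : 2 * 2 / (((x / d : ℕ) : ℝ) + 1) ≤ 4 / ((x : ℝ) / d) := by
          norm_num
          exact div_le_div_of_nonneg_left (by norm_num) (by positivity) h3
        calc _ ≤ 1 * (vonMangoldt d / d) * (4 / ((x : ℝ) / d)) := by
              gcongr
              · exact h1 d
              · exact (hL _).trans h4
          _ = _ := by field_simp
    _ = 4 / (x : ℝ) * Chebyshev.psi x := by
      rw [← Finset.mul_sum, Chebyshev.psi, Nat.floor_natCast]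
      rfl
    _ ≤ 4 / (x : ℝ) * ((Real.log 4 + 4) * x) :=
      mul_le_mul_of_nonneg_left (Chebyshev.psi_le_const_mul_self hx0.le) (by positivity)
    _ = _ := by field_simp

end

theorem sum_log_eq_sum_vonMangoldt (x : ℕ) :
    ∑ n ∈ Finset.Icc 1 x, Real.log n = ∑ d ∈ Finset.Icc 1 x, vonMangoldt d * (x / d : ℕ) := by
  have h1 : ∀ d ∈ Finset.Icc 1 x, vonMangoldt d * (x / d : ℕ) =
      ∑ n ∈ Finset.Icc 1 x, if d ∣ n then vonMangoldt d else 0 := by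
    intro d hd
    rw [← Finset.sum_filter, Finset.sum_const, nsmul_eq_mul, mul_comm]
    congr 2
    exact (Nat.Ioc_filter_dvd_card_eq_div x d).symm
  rw [Finset.sum_congr rfl h1, Finset.sum_comm]
  refine Finset.sum_congr rfl fun n hn => ?_
  obtain ⟨h2, h3⟩ := Finset.mem_Icc.1 hn
  rw [← ArithmeticFunction.vonMangoldt_sum, ← Finset.sum_filter]
  refine Finset.sum_congr ?_ fun _ _ => rfl
  ext d
  simp only [Nat.mem_divisors, Finset.mem_filter, Finset.mem_Icc]
  constructor
  · rintro ⟨h4, _⟩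
    exact ⟨⟨Nat.pos_of_dvd_of_pos h4 h2, (Nat.le_of_dvd h2 h4).trans h3⟩, h4⟩
  · rintro ⟨_, h4⟩
    exact ⟨h4, by omega⟩

theorem sum_log_Icc_le (x : ℕ) : ∑ n ∈ Finset.Icc 1 x, Real.log n ≤ x * Real.log x := by
  calc _ ≤ ∑ n ∈ Finset.Icc 1 x, Real.log x := by
        refine Finset.sum_le_sum fun n hn => ?_
        obtain ⟨h1, h2⟩ := Finset.mem_Icc.1 hn
        exact Real.log_le_log (by exact_mod_cast h1) (by exact_mod_cast h2)
    _ = _ := by simp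

theorem le_sum_log_Icc (x : ℕ) : x * Real.log x - x ≤ ∑ n ∈ Finset.Icc 1 x, Real.log n := by
  induction x with
  | zero => simp
  | succ k ih =>
    rw [Finset.sum_Icc_succ_top (by omega)]
    rcases Nat.eq_zero_or_pos k with rfl | hk
    · simp
    have hk0 : (0 : ℝ) < k := by exact_mod_cast hk
    have h1 : Real.log ((k + 1 : ℕ) : ℝ) - Real.log k ≤ 1 / k := by
      rw [← Real.log_div (by positivity) hk0.ne']
      have := Real.log_le_sub_one_of_pos (show 0 < ((k + 1 : ℕ) : ℝ) / k by positivity)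
      refine this.trans (le_of_eq ?_)
      push_cast
      field_simp
      ring
    have h2 := mul_le_mul_of_nonneg_left h1 hk0.le
    rw [mul_one_div_cancel hk0.ne'] at h2
    push_cast at h2 ⊢
    linarith

theorem log_sub_one_le_sum (x : ℕ) (hx : 1 ≤ x) :
    Real.log x - 1 ≤ ∑ n ∈ Finset.Icc 1 x, vonMangoldt n / n := by
  have hx0 : (0 : ℝ) < x := by exact_mod_cast hx
  have h1 := le_sum_log_Icc x
  rw [sum_log_eq_sum_vonMangoldt] at h1
  have h2 : ∑ d ∈ Finset.Icc 1 x, vonMangoldt d * ((x / d : ℕ) : ℝ) ≤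
      x * ∑ n ∈ Finset.Icc 1 x, vonMangoldt n / n := by
    rw [Finset.mul_sum]
    refine Finset.sum_le_sum fun d _ => ?_
    calc _ ≤ vonMangoldt d * ((x : ℝ) / d) :=
          mul_le_mul_of_nonneg_left Nat.cast_div_le ArithmeticFunction.vonMangoldt_nonneg
      _ = _ := by ring
  nlinarith

theorem sum_vonMangoldt_div_le_log (x : ℕ) (hx : 1 ≤ x) :
    ∑ n ∈ Finset.Icc 1 x, vonMangoldt n / n ≤ Real.log x + (Real.log 4 + 4) := by
  have hx0 : (0 : ℝ) < x := by exact_mod_cast hx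
  have h1 := sum_log_Icc_le x
  rw [sum_log_eq_sum_vonMangoldt] at h1
  have h2 : x * ∑ n ∈ Finset.Icc 1 x, vonMangoldt n / n ≤
      ∑ d ∈ Finset.Icc 1 x, vonMangoldt d * ((x / d : ℕ) : ℝ) + Chebyshev.psi x := by
    have e : Chebyshev.psi x = ∑ d ∈ Finset.Icc 1 x, vonMangoldt d := by
      rw [Chebyshev.psi, Nat.floor_natCast]
      rfl
    rw [Finset.mul_sum, e, ← Finset.sum_add_distrib]
    refine Finset.sum_le_sum fun d _ => ?_
    have h3 : (x : ℝ) / d ≤ (x / d : ℕ) + 1 := by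
      have := (Nat.lt_floor_add_one ((x : ℝ) / d)).le
      rwa [Nat.floor_div_eq_div] at this
    calc _ = vonMangoldt d * ((x : ℝ) / d) := by ring
      _ ≤ vonMangoldt d * ((x / d : ℕ) + 1) :=
        mul_le_mul_of_nonneg_left h3 ArithmeticFunction.vonMangoldt_nonneg
      _ = _ := by ring
  have h3 := Chebyshev.psi_le_const_mul_self hx0.le
  nlinarith

theorem sum_dvd_vonMangoldt_div_le {p : ℕ} (hp : p.Prime) (x : ℕ) :
    ∑ n ∈ (Finset.Icc 1 x).filter (p ∣ ·), vonMangoldt n / n ≤ 2 * Real.log p := by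
  classical
  have hp2 : (2 : ℝ) ≤ p := by exact_mod_cast hp.two_le
  have hlp : 0 ≤ Real.log p := Real.log_natCast_nonneg p
  have h1 : ∀ n ∈ (Finset.Icc 1 x).filter (p ∣ ·), vonMangoldt n / n ≤
      if n ∈ (Finset.range (x + 1)).image (p ^ ·) then Real.log p * (1 / (n : ℝ)) else 0 := by
    intro n hn
    obtain ⟨h2, h3⟩ := Finset.mem_filter.1 hn
    obtain ⟨h4, h5⟩ := Finset.mem_Icc.1 h2
    by_cases h6 : IsPrimePow n
    · obtain ⟨q, k, hq, hk, rfl⟩ := h6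
      have hq' := hq.nat_prime
      have h7 : p = q := (Nat.prime_dvd_prime_iff_eq hp hq').1 (hp.dvd_of_dvd_pow h3)
      subst h7
      have h8 : p ^ k ∈ (Finset.range (x + 1)).image (p ^ ·) := by
        refine Finset.mem_image.2 ⟨k, Finset.mem_range.2 ?_, rfl⟩
        have := Nat.lt_pow_self (n := k) hp.one_lt
        omega
      rw [if_pos h8, ArithmeticFunction.vonMangoldt_apply_pow hk.ne',
        ArithmeticFunction.vonMangoldt_apply_prime hp, mul_one_div]
    · rw [ArithmeticFunction.vonMangoldt_eq_zero_iff.2 h6, zero_div]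
      split_ifs <;> positivity
  refine (Finset.sum_le_sum h1).trans ?_
  rw [← Finset.sum_filter, ← Finset.mul_sum, mul_comm 2]
  refine mul_le_mul_of_nonneg_left ?_ hlp
  calc _ ≤ ∑ n ∈ (Finset.range (x + 1)).image (p ^ ·), 1 / (n : ℝ) := by
        refine Finset.sum_le_sum_of_subset_of_nonneg (fun n hn => (Finset.mem_filter.1 hn).2)
          fun _ _ _ => by positivity
    _ = ∑ k ∈ Finset.range (x + 1), 1 / ((p ^ k : ℕ) : ℝ) :=
      Finset.sum_image fun a _ b _ h => Nat.pow_right_injective hp.two_le h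
    _ ≤ ∑ k ∈ Finset.range (x + 1), (1 / 2 : ℝ) ^ k := by
      refine Finset.sum_le_sum fun k _ => ?_
      push_cast
      rw [one_div_pow]
      gcongr
    _ ≤ 2 := by
      have h := mul_geom_sum (1 / 2 : ℝ) (x + 1)
      have : 0 < (1 / 2 : ℝ) ^ (x + 1) := by positivity
      linarith

/-- The function on `ℕ`, periodic mod `12`, with values `1, a, b, c` on the residue classes of
`1, 5, 7, 11` and supported on these classes. -/
def twelve (a b c : ℤ) (n : ℕ) : ℤ :=
  if n % 12 = 1 then 1 else if n % 12 = 5 then a else if n % 12 = 7 then b else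
    if n % 12 = 11 then c else 0

theorem twelve_mod (a b c : ℤ) (n : ℕ) : twelve a b c (n % 12) = twelve a b c n := by
  simp only [twelve, Nat.mod_mod]

theorem twelve_mul {a b c : ℤ} (h : ∀ r < 12, ∀ s < 12, twelve a b c (r * s) = twelve a b c r * twelve a b c s)
    (m n : ℕ) : twelve a b c (m * n) = twelve a b c m * twelve a b c n := by
  rw [← twelve_mod, Nat.mul_mod, twelve_mod, h _ (Nat.mod_lt _ (by norm_num)) _ (Nat.mod_lt _ (by norm_num)),
    twelve_mod, twelve_mod]

theorem abs_twelve_le {a b c : ℤ} (h : ∀ r < 12, |twelve a b c r| ≤ 1) (n : ℕ) : |twelve a b c n| ≤ 1 := by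
  rw [← twelve_mod]
  exact h _ (Nat.mod_lt _ (by norm_num))

theorem abs_sum_twelve_le {a b c : ℤ} {B : ℤ} (h : ∀ r < 12, |∑ n ∈ Finset.range (r + 1), twelve a b c n| ≤ B)
    (h0 : ∑ n ∈ Finset.range 12, twelve a b c n = 0) (m : ℕ) :
    |∑ n ∈ Finset.Icc 1 m, twelve a b c n| ≤ B := by
  have h1 : ∀ k, ∑ n ∈ Finset.range (12 * k), twelve a b c n = 0 := by
    intro k
    induction k with
    | zero => simp
    | succ k ih =>
      rw [Nat.mul_succ, Finset.sum_range_add, ih, zero_add, ← h0]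
      refine Finset.sum_congr rfl fun n _ => ?_
      rw [← twelve_mod, Nat.mul_add_mod, twelve_mod]
  have h2 : ∑ n ∈ Finset.Icc 1 m, twelve a b c n = ∑ n ∈ Finset.range (m + 1), twelve a b c n := by
    induction m with
    | zero => simp [twelve]
    | succ k ih => rw [Finset.sum_Icc_succ_top (by omega), ih, ← Finset.sum_range_succ]
  rw [h2]
  have h3 : m + 1 = 12 * (m / 12) + (m % 12 + 1) := by omega
  rw [h3, Finset.sum_range_add, h1, zero_add]
  have h4 : ∑ n ∈ Finset.range (m % 12 + 1), twelve a b c (12 * (m / 12) + n) =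
      ∑ n ∈ Finset.range (m % 12 + 1), twelve a b c n := by
    refine Finset.sum_congr rfl fun n _ => ?_
    rw [← twelve_mod, Nat.mul_add_mod, twelve_mod]
  rw [h4]
  exact h _ (Nat.mod_lt _ (by norm_num))

theorem exists_sum_twelve_vonMangoldt_le {a b c : ℤ}
    (hmul : ∀ r < 12, ∀ s < 12, twelve a b c (r * s) = twelve a b c r * twelve a b c s)
    (h1 : ∀ r < 12, |twelve a b c r| ≤ 1)
    (hB : ∀ r < 12, |∑ n ∈ Finset.range (r + 1), twelve a b c n| ≤ 2)
    (h0 : ∑ n ∈ Finset.range 12, twelve a b c n = 0)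
    (hpos : (4 / 13 : ℝ) < 1 + a / 5 + b / 7 + c / 11) :
    ∃ K : ℝ, ∀ x : ℕ, |∑ n ∈ Finset.Icc 1 x, (twelve a b c n : ℝ) * (vonMangoldt n / n)| ≤ K := by
  refine exists_sum_vonMangoldt_div_le (χ := fun n => (twelve a b c n : ℝ)) (fun m n => ?_) (fun n => ?_)
    (fun m => ?_) ?_
  · exact_mod_cast twelve_mul hmul m n
  · exact_mod_cast abs_twelve_le h1 n
  · exact_mod_cast abs_sum_twelve_le hB h0 m
  · simp only [twelve]
    norm_num [Finset.sum_Icc_succ_top]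
    linarith

theorem four_mul_ite_mod_twelve (n : ℕ) :
    (4 * (if n % 12 = 1 then 1 else 0) : ℝ) = (if 2 ∣ n ∨ 3 ∣ n then 0 else 1) +
      twelve 1 (-1) (-1) n + twelve (-1) 1 (-1) n + twelve (-1) (-1) 1 n := by
  have h : ∀ r < 12, (4 * (if r = 1 then 1 else 0) : ℤ) = (if 2 ∣ r ∨ 3 ∣ r then 0 else 1) +
      twelve 1 (-1) (-1) r + twelve (-1) 1 (-1) r + twelve (-1) (-1) 1 r := by decide
  have h1 := h (n % 12) (Nat.mod_lt _ (by norm_num))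
  have h2 : (2 ∣ n % 12 ∨ 3 ∣ n % 12) ↔ (2 ∣ n ∨ 3 ∣ n) := by omega
  simp only [twelve_mod, h2] at h1
  exact_mod_cast h1

theorem exists_abs_sum_one_mod_twelve_sub_le : ∃ K : ℝ, 0 ≤ K ∧ ∀ x : ℕ, 1 ≤ x →
    |∑ n ∈ (Finset.Icc 1 x).filter (· % 12 = 1), vonMangoldt n / n - 1 / 4 * Real.log x| ≤ K := by
  obtain ⟨K₁, h₁⟩ := exists_sum_twelve_vonMangoldt_le (a := 1) (b := -1) (c := -1)
    (by decide) (by decide) (by decide) (by decide) (by norm_num)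
  obtain ⟨K₂, h₂⟩ := exists_sum_twelve_vonMangoldt_le (a := -1) (b := 1) (c := -1)
    (by decide) (by decide) (by decide) (by decide) (by norm_num)
  obtain ⟨K₃, h₃⟩ := exists_sum_twelve_vonMangoldt_le (a := -1) (b := -1) (c := 1)
    (by decide) (by decide) (by decide) (by decide) (by norm_num)
  have hl2 := Real.log_nonneg (show (1 : ℝ) ≤ 2 by norm_num)
  have hl3 := Real.log_nonneg (show (1 : ℝ) ≤ 3 by norm_num)
  have hl4 := Real.log_nonneg (show (1 : ℝ) ≤ 4 by norm_num)
  have k₁ := (abs_nonneg _).trans (h₁ 0)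
  have k₂ := (abs_nonneg _).trans (h₂ 0)
  have k₃ := (abs_nonneg _).trans (h₃ 0)
  refine ⟨K₁ + K₂ + K₃ + 2 * Real.log 2 + 2 * Real.log 3 + 1 + (Real.log 4 + 4), by positivity,
    fun x hx => ?_⟩
  have e : 4 * ∑ n ∈ (Finset.Icc 1 x).filter (· % 12 = 1), vonMangoldt n / n =
      ∑ n ∈ Finset.Icc 1 x, (if 2 ∣ n ∨ 3 ∣ n then 0 else vonMangoldt n / n) +
      ∑ n ∈ Finset.Icc 1 x, (twelve 1 (-1) (-1) n : ℝ) * (vonMangoldt n / n) +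
      ∑ n ∈ Finset.Icc 1 x, (twelve (-1) 1 (-1) n : ℝ) * (vonMangoldt n / n) +
      ∑ n ∈ Finset.Icc 1 x, (twelve (-1) (-1) 1 n : ℝ) * (vonMangoldt n / n) := by
    rw [Finset.sum_filter, Finset.mul_sum, ← Finset.sum_add_distrib, ← Finset.sum_add_distrib,
      ← Finset.sum_add_distrib]
    refine Finset.sum_congr rfl fun n _ => ?_
    have h4 := congrArg (· * (vonMangoldt n / n)) (four_mul_ite_mod_twelve n)
    simp only [add_mul, mul_assoc, ite_mul, one_mul, zero_mul] at h4
    exact h4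
  have hv : ∀ n : ℕ, 0 ≤ vonMangoldt n / n := fun n =>
    div_nonneg ArithmeticFunction.vonMangoldt_nonneg (Nat.cast_nonneg n)
  have h5 : ∑ n ∈ Finset.Icc 1 x, (if 2 ∣ n ∨ 3 ∣ n then 0 else vonMangoldt n / n) ≤
      ∑ n ∈ Finset.Icc 1 x, vonMangoldt n / n := by
    refine Finset.sum_le_sum fun n _ => ?_
    have := hv n
    split_ifs <;> linarith
  have h6 : ∑ n ∈ Finset.Icc 1 x, vonMangoldt n / n ≤
      ∑ n ∈ Finset.Icc 1 x, (if 2 ∣ n ∨ 3 ∣ n then 0 else vonMangoldt n / n) +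
      ∑ n ∈ (Finset.Icc 1 x).filter (2 ∣ ·), vonMangoldt n / n +
      ∑ n ∈ (Finset.Icc 1 x).filter (3 ∣ ·), vonMangoldt n / n := by
    rw [Finset.sum_filter, Finset.sum_filter, ← Finset.sum_add_distrib, ← Finset.sum_add_distrib]
    refine Finset.sum_le_sum fun n _ => ?_
    have := hv n
    by_cases a2 : 2 ∣ n <;> by_cases a3 : 3 ∣ n <;> (simp [a2, a3] <;> linarith)
  have h7 := sum_dvd_vonMangoldt_div_le Nat.prime_two x
  have h8 := sum_dvd_vonMangoldt_div_le Nat.prime_three x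
  push_cast at h7 h8
  have h9 := log_sub_one_le_sum x hx
  have h10 := sum_vonMangoldt_div_le_log x hx
  have g₁ := abs_le.1 (h₁ x)
  have g₂ := abs_le.1 (h₂ x)
  have g₃ := abs_le.1 (h₃ x)
  rw [abs_le]
  constructor <;> linarith

theorem exists_le_card_prime_one_mod_twelve : ∃ c : ℝ, 0 < c ∧ ∀ x : ℕ, 13 ≤ x →
    c * (x : ℝ) ^ (0.99999 : ℝ) ≤
      ((Finset.Icc 1 x).filter (fun p => p.Prime ∧ p % 12 = 1)).card := by
  obtain ⟨K, hK, h⟩ := exists_abs_sum_one_mod_twelve_sub_le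
  obtain ⟨D, hD⟩ := exists_nat_gt (Real.exp (4 * (2 * K + 1)))
  have hD1 : (1 : ℝ) ≤ D := (Real.one_le_exp (by positivity)).trans hD.le
  have hlD : 4 * (2 * K + 1) ≤ Real.log D := by
    rw [Real.le_log_iff_exp_le (by positivity)]
    exact hD.le
  refine ⟨min (1 / (2 * 100000 * D)) (1 / (16 * D) ^ 4), by positivity, fun x hx => ?_⟩
  have hx1 : (1 : ℝ) ≤ x := by exact_mod_cast (by omega : 1 ≤ x)
  have hx0 : (0 : ℝ) < x := by linarith
  set P := (Finset.Icc 1 x).filter (fun p => p.Prime ∧ p % 12 = 1) with hP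
  rcases lt_or_ge (x : ℝ) ((16 * D) ^ 4) with hlt | hge
  · have h13 : 13 ∈ P := Finset.mem_filter.2 ⟨Finset.mem_Icc.2 ⟨by norm_num, hx⟩, by norm_num,
      by norm_num⟩
    have h1 : (1 : ℝ) ≤ P.card := by exact_mod_cast Finset.card_pos.2 ⟨13, h13⟩
    refine le_trans ?_ h1
    calc _ ≤ 1 / (16 * (D : ℝ)) ^ 4 * (x : ℝ) ^ (1 : ℝ) := by
          gcongr
          · exact min_le_right _ _
          · norm_num
      _ ≤ 1 / (16 * (D : ℝ)) ^ 4 * (16 * (D : ℝ)) ^ 4 := by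
        rw [Real.rpow_one]
        gcongr
      _ = 1 := one_div_mul_cancel (by positivity)
  · have hDx : D ≤ x := by
      have h1 : (D : ℝ) ≤ (16 * D) ^ 4 := by
        calc (D : ℝ) ≤ 16 * D := by linarith
          _ ≤ _ := le_self_pow₀ (by linarith) (by norm_num)
      exact_mod_cast h1.trans hge
    have hD0 : 0 < D := by exact_mod_cast (by linarith : (0 : ℝ) < D)
    set y := x / D with hy
    have hy1 : 1 ≤ y := Nat.div_pos hDx hD0
    have hyx : y ≤ x := Nat.div_le_self x D
    have hyle : (y : ℝ) ≤ x / D := Nat.cast_div_le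
    have hylt : (x : ℝ) / D ≤ y + 1 := by
      have := (Nat.lt_floor_add_one ((x : ℝ) / D)).le
      rwa [Nat.floor_div_eq_div] at this
    have hlog : Real.log y ≤ Real.log x - Real.log D := by
      rw [← Real.log_div hx0.ne' (by positivity)]
      exact Real.log_le_log (by exact_mod_cast hy1) hyle
    have h1 := (abs_le.1 (h x (by omega))).1
    have h2 := (abs_le.1 (h y hy1)).2
    have hsplit : ∑ n ∈ (Finset.Icc 1 x).filter (· % 12 = 1), vonMangoldt n / n =
        ∑ n ∈ (Finset.Icc 1 y).filter (· % 12 = 1), vonMangoldt n / n +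
          ∑ n ∈ (Finset.Ioc y x).filter (· % 12 = 1), vonMangoldt n / n := by
      rw [Finset.sum_filter, Finset.sum_filter, Finset.sum_filter]
      exact Icc_one_eq_union (χ := fun n => if n % 12 = 1 then vonMangoldt n / n else 0) hyx
    have h3 : 1 ≤ ∑ n ∈ (Finset.Ioc y x).filter (· % 12 = 1), vonMangoldt n / n := by linarith
    have h4 : ∑ n ∈ (Finset.Ioc y x).filter (· % 12 = 1), vonMangoldt n / n ≤
        (D : ℝ) / x * ∑ n ∈ (Finset.Icc 1 x).filter (· % 12 = 1), vonMangoldt n := by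
      rw [Finset.mul_sum]
      calc _ ≤ ∑ n ∈ (Finset.Ioc y x).filter (· % 12 = 1), (D : ℝ) / x * vonMangoldt n := by
            refine Finset.sum_le_sum fun n hn => ?_
            have h5 := (Finset.mem_Ioc.1 (Finset.mem_filter.1 hn).1).1
            have h6 : (y : ℝ) + 1 ≤ n := by exact_mod_cast h5
            have h7 : vonMangoldt n / n ≤ vonMangoldt n / ((x : ℝ) / D) :=
              div_le_div_of_nonneg_left ArithmeticFunction.vonMangoldt_nonneg (by positivity)
                (hylt.trans h6)
            refine h7.trans (le_of_eq ?_)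
            field_simp
        _ ≤ _ := by
            refine Finset.sum_le_sum_of_subset_of_nonneg (fun n hn => ?_) fun n _ _ =>
              mul_nonneg (by positivity) ArithmeticFunction.vonMangoldt_nonneg
            simp only [Finset.mem_filter, Finset.mem_Ioc, Finset.mem_Icc] at hn ⊢
            omega
    have h5 : (x : ℝ) / D ≤ ∑ n ∈ (Finset.Icc 1 x).filter (· % 12 = 1), vonMangoldt n := by
      have h6 := mul_le_mul_of_nonneg_left (h3.trans h4) (by positivity : 0 ≤ (x : ℝ) / D)
      refine le_trans (le_of_eq (mul_one _).symm) (h6.trans (le_of_eq ?_))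
      field_simp
    have h6 : ∑ n ∈ (Finset.Icc 1 x).filter (· % 12 = 1), vonMangoldt n ≤
        P.card * Real.log x + 2 * √x * Real.log x := by
      have h7 : ∑ n ∈ (Finset.Icc 1 x).filter (· % 12 = 1), vonMangoldt n ≤
          ∑ p ∈ P, vonMangoldt p +
            ∑ n ∈ (Finset.Icc 1 x).filter (fun n => ¬ n.Prime), vonMangoldt n := by
        rw [hP, Finset.sum_filter, Finset.sum_filter, Finset.sum_filter, ← Finset.sum_add_distrib]
        refine Finset.sum_le_sum fun n _ => ?_
        have := ArithmeticFunction.vonMangoldt_nonneg (n := n)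
        by_cases a1 : n.Prime <;> by_cases a2 : n % 12 = 1 <;> simp [a1, a2, this]
      have h8 := Chebyshev.psi_sub_theta_le hx1
      rw [Chebyshev.psi_sub_theta_eq_sum_not_prime, Nat.floor_natCast] at h8
      refine h7.trans (add_le_add ?_ h8)
      rw [← nsmul_eq_mul]
      refine Finset.sum_le_card_nsmul _ _ _ fun p hp => ?_
      obtain ⟨h9, h10, h11⟩ := Finset.mem_filter.1 hp
      obtain ⟨h12, h13⟩ := Finset.mem_Icc.1 h9
      rw [ArithmeticFunction.vonMangoldt_apply_prime h10]
      exact Real.log_le_log (by exact_mod_cast h12) (by exact_mod_cast h13)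
    have hadd : ∀ a b : ℝ, (x : ℝ) ^ a * (x : ℝ) ^ b = (x : ℝ) ^ (a + b) := fun a b =>
      (Real.rpow_add hx0 a b).symm
    have h7 : 2 * √x * Real.log x ≤ x / D / 2 := by
      have h8 : 16 * (D : ℝ) ≤ (x : ℝ) ^ (1 / 4 : ℝ) := by
        calc 16 * (D : ℝ) = ((16 * (D : ℝ)) ^ 4) ^ (1 / 4 : ℝ) := by
              rw [← Real.rpow_natCast, ← Real.rpow_mul (by positivity)]
              norm_num
          _ ≤ _ := Real.rpow_le_rpow (by positivity) hge (by norm_num)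
      have h9 := log_le_rpow (ε := 1 / 4) (by norm_num) hx0.le
      have e : (x : ℝ) = (x : ℝ) ^ (1 / 2 : ℝ) * (x : ℝ) ^ (1 / 4 : ℝ) * (x : ℝ) ^ (1 / 4 : ℝ) := by
        rw [hadd, hadd]
        norm_num
      rw [div_div, le_div_iff₀ (by positivity), Real.sqrt_eq_rpow]
      calc 2 * (x : ℝ) ^ (1 / 2 : ℝ) * Real.log x * (D * 2) ≤
            2 * (x : ℝ) ^ (1 / 2 : ℝ) * (1 / (1 / 4) * (x : ℝ) ^ (1 / 4 : ℝ)) * (D * 2) := by gcongr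
        _ = (x : ℝ) ^ (1 / 2 : ℝ) * (x : ℝ) ^ (1 / 4 : ℝ) * (16 * D) := by ring
        _ ≤ (x : ℝ) ^ (1 / 2 : ℝ) * (x : ℝ) ^ (1 / 4 : ℝ) * (x : ℝ) ^ (1 / 4 : ℝ) := by gcongr
        _ = x := e.symm
    have h8 : (x : ℝ) / D / 2 ≤ P.card * Real.log x := by linarith
    have h9 : (x : ℝ) / D / 2 ≤ P.card * (100000 * (x : ℝ) ^ (0.00001 : ℝ)) := by
      refine h8.trans (mul_le_mul_of_nonneg_left ?_ (Nat.cast_nonneg _))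
      refine (log_le_rpow (ε := 0.00001) (by norm_num) hx0.le).trans (le_of_eq ?_)
      norm_num
    have e : (x : ℝ) = (x : ℝ) ^ (0.99999 : ℝ) * (x : ℝ) ^ (0.00001 : ℝ) := by
      rw [hadd]
      norm_num
    have hp1 : 0 < (x : ℝ) ^ (0.00001 : ℝ) := by positivity
    have hp2 : 0 < (x : ℝ) ^ (0.99999 : ℝ) := by positivity
    refine le_trans (mul_le_mul_of_nonneg_right (min_le_left _ _) hp2.le) ?_
    refine le_of_mul_le_mul_right ?_ (by positivity : 0 < 100000 * (x : ℝ) ^ (0.00001 : ℝ))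
    refine le_trans (le_of_eq ?_) h9
    conv_rhs => rw [e]
    field_simp

end CubicTrace

namespace CubicTrace

theorem exists_card_cube_sub_le : ∃ C : ℝ, 0 < C ∧ ∀ x : ℕ, 13 ≤ x → ∀ A : Finset ℕ,
    (∀ p, p ∈ A ↔ (p.Prime ∧ p ≤ x ∧ p % 12 = 1 ∧ ∃ b : ZMod p, b ^ 3 = ((apE p : ℤ) : ZMod p))) →
    |(A.card : ℝ) / ((Finset.Icc 1 x).filter (fun p => p.Prime ∧ p % 12 = 1)).card - 1 / 3| ≤
      C * (x : ℝ) ^ (-(1 / 3200) : ℝ) := by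
  classical
  obtain ⟨C, hC, h₁⟩ := norm_sum_FC_prime_le
  obtain ⟨c, hc, h₂⟩ := exists_le_card_prime_one_mod_twelve
  refine ⟨C / (6 * c), by positivity, fun x hx A hA => ?_⟩
  have hx1 : (1 : ℝ) ≤ x := by exact_mod_cast (by omega : 1 ≤ x)
  have hx0 : (0 : ℝ) < x := by linarith
  have h3 := h₁ x
  have h4 := h₂ x hx
  set P := (Finset.Icc 1 x).filter (fun p => p.Prime ∧ p % 12 = 1) with hP
  have e : ∑ p ∈ (Finset.Icc 1 x).filter Nat.Prime, FC p = ((6 * A.card - 2 * P.card : ℝ) : ℂ) := by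
    have e1 : A = P.filter fun p => ∃ b : ZMod p, b ^ 3 = ((apE p : ℤ) : ZMod p) := by
      ext p
      rw [hA, hP, Finset.mem_filter, Finset.mem_filter, Finset.mem_Icc]
      constructor
      · rintro ⟨a1, a2, a3, a4⟩
        exact ⟨⟨⟨a1.one_le, a2⟩, a1, a3⟩, a4⟩
      · rintro ⟨⟨⟨_, a2⟩, a1, a3⟩, a4⟩
        exact ⟨a1, a2, a3, a4⟩
    have e2 : ∑ p ∈ (Finset.Icc 1 x).filter Nat.Prime, FC p =
        ∑ p ∈ P, ((if ∃ b : ZMod p, b ^ 3 = ((apE p : ℤ) : ZMod p) then 6 else 0) - 2) := by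
      rw [hP, ← Finset.filter_filter, Finset.sum_filter (fun p => p % 12 = 1)]
      refine Finset.sum_congr rfl fun p hp => ?_
      rw [FC_prime (Finset.mem_filter.1 hp).2]
      split_ifs <;> norm_num
    rw [e2, Finset.sum_sub_distrib, ← Finset.sum_filter, ← e1]
    simp only [Finset.sum_const, nsmul_eq_mul]
    push_cast
    ring
  rw [e, Complex.norm_real, Real.norm_eq_abs] at h3
  have hp1 : 0 < (x : ℝ) ^ (0.99999 : ℝ) := by positivity
  have hP0 : (0 : ℝ) < P.card := lt_of_lt_of_le (by positivity) h4
  have e3 : (A.card : ℝ) / P.card - 1 / 3 = (6 * A.card - 2 * P.card) / (6 * P.card) := by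
    field_simp
    ring
  rw [e3, abs_div, abs_of_pos (by positivity : (0 : ℝ) < 6 * P.card)]
  calc _ ≤ C * (x : ℝ) ^ (0.9996 : ℝ) / (6 * (c * (x : ℝ) ^ (0.99999 : ℝ))) := by gcongr
    _ = C / (6 * c) * ((x : ℝ) ^ (0.9996 : ℝ) / (x : ℝ) ^ (0.99999 : ℝ)) := by field_simp
    _ ≤ _ := by
      rw [← Real.rpow_sub hx0]
      exact mul_le_mul_of_nonneg_left
        (Real.rpow_le_rpow_of_exponent_le hx1 (by norm_num)) (by positivity)

end CubicTrace

/-- There is a constant `C > 0` such that for all `X ≥ 100`, the proportion, among primes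
`p ≤ X` with `p ≡ 1 (mod 12)`, of those for which `a_p` is a cube modulo `p`, is within
`C·X^(-1/3200)` of `1/3`. -/
theorem stmt_0 :
    ∃ C : ℝ, 0 < C ∧ ∀ X : ℝ, 100 ≤ X →
      |({p : ℕ | p.Prime ∧ (p : ℝ) ≤ X ∧ p % 12 = 1 ∧
            ∃ b : ZMod p, b ^ 3 = ((apE p : ℤ) : ZMod p)}.ncard : ℝ) /
          ({p : ℕ | p.Prime ∧ (p : ℝ) ≤ X ∧ p % 12 = 1}.ncard : ℝ) - 1 / 3|
        ≤ C * X ^ (-(1 / 3200) : ℝ) := by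
  obtain ⟨C, hC, h⟩ := CubicTrace.exists_card_cube_sub_le
  refine ⟨C * 2, by positivity, fun X hX => ?_⟩
  have hX0 : 0 < X := by linarith
  have hx : 13 ≤ ⌊X⌋₊ := Nat.le_floor (by norm_num; linarith)
  have hfin : {p : ℕ | p.Prime ∧ (p : ℝ) ≤ X ∧ p % 12 = 1 ∧
      ∃ b : ZMod p, b ^ 3 = ((apE p : ℤ) : ZMod p)}.Finite :=
    (Set.finite_Iic ⌊X⌋₊).subset fun p hp => Nat.le_floor hp.2.1
  have h1 := h ⌊X⌋₊ hx hfin.toFinset fun p => by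
    rw [Set.Finite.mem_toFinset, Nat.le_floor_iff hX0.le]
    rfl
  rw [← Set.ncard_eq_toFinset_card _ hfin] at h1
  have e : {p : ℕ | p.Prime ∧ (p : ℝ) ≤ X ∧ p % 12 = 1} =
      (((Finset.Icc 1 ⌊X⌋₊).filter (fun p => p.Prime ∧ p % 12 = 1) : Finset ℕ) : Set ℕ) := by
    ext p
    rw [Finset.mem_coe, Finset.mem_filter, Finset.mem_Icc, Nat.le_floor_iff hX0.le]
    constructor
    · rintro ⟨a1, a2, a3⟩
      exact ⟨⟨a1.one_le, a2⟩, a1, a3⟩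
    · rintro ⟨⟨_, a2⟩, a1, a3⟩
      exact ⟨a1, a2, a3⟩
  rw [e, Set.ncard_coe_finset]
  refine h1.trans ?_
  rw [mul_assoc]
  refine mul_le_mul_of_nonneg_left ?_ hC.le
  have h2 : X / 2 ≤ ⌊X⌋₊ := by
    have := (Nat.lt_floor_add_one X).le
    linarith
  calc ((⌊X⌋₊ : ℕ) : ℝ) ^ (-(1 / 3200) : ℝ) ≤ (X / 2) ^ (-(1 / 3200) : ℝ) :=
        Real.rpow_le_rpow_of_nonpos (by positivity) h2 (by norm_num)
    _ = (2 : ℝ) ^ (1 / 3200 : ℝ) * X ^ (-(1 / 3200) : ℝ) := by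
      rw [Real.div_rpow hX0.le two_pos.le, Real.rpow_neg two_pos.le, div_inv_eq_mul, mul_comm]
    _ ≤ 2 * X ^ (-(1 / 3200) : ℝ) := by
      refine mul_le_mul_of_nonneg_right ?_ (by positivity)
      calc (2 : ℝ) ^ (1 / 3200 : ℝ) ≤ 2 ^ (1 : ℝ) :=
            Real.rpow_le_rpow_of_exponent_le (by norm_num) (by norm_num)
        _ = 2 := Real.rpow_one 2
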